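/- Suppose f : 𝕋 → ℂ is a topological embedding of the unit circle into the plane such that ℓ·|a−b| ≤ |f(a)−f(b)| ≤ L·|a−b| for all a, b ∈ 𝕋, where ℓ ∈ [0,∞) and L ∈ (0,∞]. Then f extends to a homeomorphism F : ℂ → ℂ satisfying 10^{−14}·ℓ·|a−b| ≤ |F(a)−F(b)| ≤ 2·10^{14}·L·|a−b| for all a, b in the closed unit disk, and also 10^{−25}·(ℓ²/L)·|a−b| ≤ |F(a)−F(b)| ≤ 10^{28}·L·|a−b| for all a, b ∈ ℂ. -/

import Mathlib

open Complex Metric Set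

namespace CircleEmbedding

open Filter Topology MeasureTheory

/-- A continuous logarithm of `h` on `S`. -/
def HasLogOn {X : Type*} [TopologicalSpace X] (S : Set X) (h : X → ℂ) : Prop :=
  ∃ g : X → ℂ, ContinuousOn g S ∧ ∀ z ∈ S, exp (g z) = h z

theorem HasLogOn.mono {X : Type*} [TopologicalSpace X] {S T : Set X} {h : X → ℂ}
    (hh : HasLogOn S h) (hT : T ⊆ S) : HasLogOn T h := by
  obtain ⟨g, hg, he⟩ := hh
  exact ⟨g, hg.mono hT, fun z hz => he z (hT hz)⟩

theorem HasLogOn.congr {X : Type*} [TopologicalSpace X] {S : Set X} {h h' : X → ℂ}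
    (hh : HasLogOn S h) (e : EqOn h' h S) : HasLogOn S h' := by
  obtain ⟨g, hg, he⟩ := hh
  exact ⟨g, hg, fun z hz => by rw [he z hz, e hz]⟩

theorem HasLogOn.mul {X : Type*} [TopologicalSpace X] {S : Set X} {h h' : X → ℂ}
    (hh : HasLogOn S h) (hh' : HasLogOn S h') : HasLogOn S (fun z => h z * h' z) := by
  obtain ⟨g, hg, he⟩ := hh
  obtain ⟨g', hg', he'⟩ := hh'
  exact ⟨fun z => g z + g' z, hg.add hg', fun z hz => by rw [Complex.exp_add, he z hz, he' z hz]⟩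

theorem HasLogOn.inv {X : Type*} [TopologicalSpace X] {S : Set X} {h : X → ℂ}
    (hh : HasLogOn S h) : HasLogOn S (fun z => (h z)⁻¹) := by
  obtain ⟨g, hg, he⟩ := hh
  exact ⟨fun z => - g z, hg.neg, fun z hz => by rw [Complex.exp_neg, he z hz]⟩

theorem sub_eq_sub_of_exp_eq {X : Type*} [TopologicalSpace X] {S : Set X} (hS : IsPreconnected S)
    {g₁ g₂ : X → ℂ} (h₁ : ContinuousOn g₁ S) (h₂ : ContinuousOn g₂ S)
    (he : ∀ z ∈ S, exp (g₁ z) = exp (g₂ z)) {x y : X} (hx : x ∈ S) (hy : y ∈ S) :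
    g₁ x - g₂ x = g₁ y - g₂ y := by
  have key := Complex.isCoveringMap_exp.eqOn_of_comp_eqOn hS
    (g₁ := fun z => g₁ z - g₂ z) (g₂ := fun _ => g₁ x - g₂ x) (h₁.sub h₂) continuousOn_const
    (fun z hz => by
      apply Subtype.ext
      simp only [Function.comp, Complex.exp_sub, he z hz, he x hx]
      rw [div_self (exp_ne_zero _), div_self (exp_ne_zero _)]) hx rfl
  exact (key hy).symm

theorem not_hasLogOn_sphere (c : ℂ) {r : ℝ} (hr : 0 < r) :
    ¬ HasLogOn (sphere c r) (fun z => z - c) := by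
  rintro ⟨g, hg, he⟩
  have hm : ∀ t : ℝ, c + r * exp (t * I) ∈ sphere c r := fun t => by
    simp [mem_sphere_iff_norm, Complex.norm_exp_ofReal_mul_I, abs_of_pos hr]
  have hc : Continuous fun t : ℝ => g (c + r * exp (t * I)) :=
    hg.comp_continuous (by fun_prop) hm
  have := sub_eq_sub_of_exp_eq (S := (univ : Set ℝ)) isPreconnected_univ hc.continuousOn
    (g₂ := fun t : ℝ => Complex.log r + t * I)
    (by fun_prop) (fun t _ => by
      rw [he _ (hm t), Complex.exp_add, Complex.exp_log (by exact_mod_cast hr.ne')]; ring)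
    (mem_univ 0) (mem_univ (2 * Real.pi))
  simp [Complex.exp_two_pi_mul_I] at this

theorem HasLogOn.of_homotopy {X : Type*} [TopologicalSpace X] {S : Set X} {H : ℝ → X → ℂ}
    (hc : ContinuousOn (fun p : ℝ × X => H p.1 p.2) (Icc 0 1 ×ˢ S))
    (hne : ∀ t ∈ Icc (0:ℝ) 1, ∀ z ∈ S, H t z ≠ 0) (h0 : HasLogOn S (H 0)) :
    HasLogOn S (H 1) := by
  obtain ⟨g, hg, he⟩ := h0
  let G : C(unitInterval × S, {z : ℂ // z ≠ 0}) :=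
    ⟨fun p => ⟨H p.1 p.2, hne _ p.1.2 _ p.2.2⟩, by
      refine Continuous.subtype_mk ?_ _
      exact hc.comp_continuous (f := fun p : unitInterval × S => ((p.1 : ℝ), (p.2 : X)))
        (by fun_prop) (fun p => ⟨p.1.2, p.2.2⟩)⟩
  let g0 : C(S, ℂ) := ⟨fun z => g z, hg.domRestrict⟩
  have h0 : ∀ a, G (0, a) = (⟨_, (g0 a).exp_ne_zero⟩ : {z : ℂ // z ≠ 0}) := fun a => by
    apply Subtype.ext
    exact (by simpa using (he a a.2).symm : H (0 : unitInterval) a = exp (g a))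
  let Λ := Complex.isCoveringMap_exp.liftHomotopy G g0 h0
  have hΛ := Complex.isCoveringMap_exp.liftHomotopy_lifts G g0 h0
  classical
  refine ⟨fun z => if hz : z ∈ S then Λ (1, ⟨z, hz⟩) else 0, ?_, ?_⟩
  · rw [continuousOn_iff_continuous_domRestrict]
    have : Continuous fun z : S => Λ (1, z) := by fun_prop
    convert this using 1
    ext z
    simp
  · intro z hz
    have := congrArg Subtype.val (congrFun hΛ (1, ⟨z, hz⟩))
    have h2 : exp (Λ (1, ⟨z, hz⟩)) = H ((1 : unitInterval) : ℝ) z := this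
    simpa [hz] using h2

theorem HasLogOn.of_starConvex {S : Set ℂ} {x : ℂ} (hS : StarConvex ℝ x S) (hx : x ∈ S) {h : ℂ → ℂ}
    (hc : ContinuousOn h S) (hne : ∀ z ∈ S, h z ≠ 0) : HasLogOn S h := by
  have hm : ∀ t ∈ Icc (0:ℝ) 1, ∀ z ∈ S, x + t * (z - x) ∈ S := fun t ht z hz => by
    have := hS hz (a := 1 - t) (b := t) (by linarith [ht.2]) ht.1 (by ring)
    convert this using 1
    simp only [real_smul]; push_cast; ring
  have := HasLogOn.of_homotopy (S := S) (H := fun t z => h (x + t * (z - x)))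
    (hc.comp (by fun_prop) (fun p hp => hm _ hp.1 _ hp.2)) (fun t ht z hz => hne _ (hm t ht z hz))
    ⟨fun _ => Complex.log (h x), continuousOn_const, fun z _ => by
      simp [Complex.exp_log (hne x hx)]⟩
  exact this.congr (fun z _ => by simp)

theorem hasLogOn_Icc {a b : ℝ} {h : ℝ → ℂ} (hab : a ≤ b)
    (hc : ContinuousOn h (Icc a b)) (hne : ∀ z ∈ Icc a b, h z ≠ 0) : HasLogOn (Icc a b) h := by
  have hm : ∀ t ∈ Icc (0:ℝ) 1, ∀ z ∈ Icc a b, a + t * (z - a) ∈ Icc a b := fun t ht z hz => by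
    constructor
    · nlinarith [ht.1, ht.2, hz.1, hz.2]
    · nlinarith [ht.1, ht.2, hz.1, hz.2]
  have ha : a ∈ Icc a b := ⟨le_rfl, hab⟩
  have := HasLogOn.of_homotopy (S := Icc a b) (H := fun t z => h (a + t * (z - a)))
    (hc.comp (by fun_prop) (fun p hp => hm _ hp.1 _ hp.2)) (fun t ht z hz => hne _ (hm t ht z hz))
    ⟨fun _ => Complex.log (h a), continuousOn_const, fun z _ => by
      simp [Complex.exp_log (hne a ha)]⟩
  exact this.congr (fun z _ => by simp)

theorem continuousOn_invFunOn {X : Type*} [TopologicalSpace X] [Nonempty X] {S : Set X}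
    (hS : IsCompact S) {γ : X → ℂ} (hc : ContinuousOn γ S) (hi : InjOn γ S) :
    ContinuousOn (Function.invFunOn γ S) (γ '' S) := by
  rw [continuousOn_iff_isClosed]
  intro t ht
  refine ⟨γ '' (S ∩ t), ((hS.inter_right ht).image_of_continuousOn
    (hc.mono inter_subset_left)).isClosed, ?_⟩
  ext z
  constructor
  · rintro ⟨h1, x, hx, rfl⟩
    refine ⟨⟨x, ⟨hx, ?_⟩, rfl⟩, ⟨x, hx, rfl⟩⟩
    have : Function.invFunOn γ S (γ x) = x := hi.leftInvOn_invFunOn hx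
    rwa [mem_preimage, this] at h1
  · rintro ⟨⟨x, ⟨hx, hxt⟩, rfl⟩, _⟩
    refine ⟨?_, x, hx, rfl⟩
    have : Function.invFunOn γ S (γ x) = x := hi.leftInvOn_invFunOn hx
    rwa [mem_preimage, this]

theorem HasLogOn.image {X : Type*} [TopologicalSpace X] [Nonempty X] {S : Set X}
    (hS : IsCompact S) {γ : X → ℂ} (hc : ContinuousOn γ S) (hi : InjOn γ S) {h : ℂ → ℂ}
    (hh : HasLogOn S (fun x => h (γ x))) : HasLogOn (γ '' S) h := by
  obtain ⟨g, hg, he⟩ := hh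
  refine ⟨fun z => g (Function.invFunOn γ S z),
    hg.comp (continuousOn_invFunOn hS hc hi) (fun z hz => Function.invFunOn_mem hz), ?_⟩
  rintro _ ⟨x, hx, rfl⟩
  have : Function.invFunOn γ S (γ x) = x := hi.leftInvOn_invFunOn hx
  simp only [this]
  exact he x hx

/-- Borsuk's obstruction: if `K` contains the frontier of a bounded open set `V ∋ v`, then `z - v`
is not of the form `h₀ e^g` on `K` with `h₀` nonvanishing on the closure of `V`. -/
theorem borsuk_obstruction {K V : Set ℂ} (hK : IsClosed K) (hV : Bornology.IsBounded V)
    (hfr : frontier V ⊆ K) {v : ℂ} (hv : v ∈ interior V) {h₀ g : ℂ → ℂ} (hh₀ : Continuous h₀)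
    (hne : ∀ z ∈ closure V, h₀ z ≠ 0) (hg : ContinuousOn g K)
    (he : ∀ z ∈ K, z - v = h₀ z * exp (g z)) : False := by
  obtain ⟨G, hG⟩ := ContinuousMap.exists_restrict_eq hK (⟨K.domRestrict g, hg.domRestrict⟩ :
      C(K, ℂ))
  have hG' : ∀ z ∈ K, G z = g z := fun z hz => by
    have := congrArg (fun φ : C(K, ℂ) => φ ⟨z, hz⟩) hG
    exact this
  classical
  let H : ℂ → ℂ := V.piecewise (fun z => h₀ z * exp (G z)) (fun z => z - v)
  have hHc : Continuous H := by
    refine continuous_piecewise (fun z hz => ?_) (by fun_prop) (by fun_prop)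
    rw [he z (hfr hz), hG' z (hfr hz)]
  have hH0 : ∀ z, H z ≠ 0 := fun z => by
    by_cases hz : z ∈ V
    · simp [H, hz, hne z (subset_closure hz), exp_ne_zero]
    · simp only [H, hz, not_false_eq_true, piecewise_eq_of_notMem]
      intro h
      exact hz (by rw [sub_eq_zero.1 h]; exact interior_subset hv)
  obtain ⟨R, hR⟩ := hV.subset_ball v
  have hR0 : 0 < R := by
    have := hR (interior_subset hv)
    simpa using this
  have := HasLogOn.of_starConvex (S := univ) (x := 0) (convex_univ.starConvex trivial) trivial
    hHc.continuousOn (fun z _ => hH0 z)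
  refine not_hasLogOn_sphere v hR0 ((this.mono (subset_univ _)).congr fun z hz => ?_)
  have : z ∉ V := fun h => by
    have h1 := hR h
    rw [mem_sphere] at hz
    rw [mem_ball, hz] at h1
    exact lt_irrefl _ h1
  simp [H, this]

theorem frontier_connectedComponentIn_subset {K : Set ℂ} (hK : IsClosed K) (v : ℂ) :
    frontier (connectedComponentIn Kᶜ v) ⊆ K := by
  intro z hz
  by_contra hzK
  have ho : IsOpen (connectedComponentIn Kᶜ v) := hK.isOpen_compl.connectedComponentIn
  have ho' : IsOpen (connectedComponentIn Kᶜ z) := hK.isOpen_compl.connectedComponentIn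
  have hz' : z ∈ connectedComponentIn Kᶜ z := mem_connectedComponentIn hzK
  rw [frontier_eq_closure_inter_closure, ho.isClosed_compl.closure_eq] at hz
  obtain ⟨x, hx1, hx2⟩ := mem_closure_iff.1 hz.1 _ ho' hz'
  exact hz.2 (by rw [connectedComponentIn_eq hx2, ← connectedComponentIn_eq hx1]; exact hz')

theorem isPreconnected_compl_closedBall {R : ℝ} (hR : 0 < R) :
    IsPreconnected (closedBall (0:ℂ) R)ᶜ := by
  have : (closedBall (0:ℂ) R)ᶜ = exp '' {w : ℂ | Real.log R < w.re} := by
    ext z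
    simp only [mem_compl_iff, mem_closedBall, dist_zero_right, not_le, mem_image, mem_ofPred_eq]
    constructor
    · intro h
      have h0 : z ≠ 0 := norm_pos_iff.1 (hR.trans h)
      exact ⟨Complex.log z, by rw [Complex.log_re]; exact Real.log_lt_log hR h, Complex.exp_log h0⟩
    · rintro ⟨w, hw, rfl⟩
      rw [Complex.norm_exp]
      exact (Real.log_lt_iff_lt_exp hR).1 hw
  rw [this]
  exact ((convex_halfSpace_re_gt _).isPreconnected).image _ Complex.continuous_exp.continuousOn

theorem mem_component_of_unbounded {K : Set ℂ} (hK : IsCompact K) {v w : ℂ} (hw : w ∉ K)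
    (h1 : ¬ Bornology.IsBounded (connectedComponentIn Kᶜ v))
    (h2 : ¬ Bornology.IsBounded (connectedComponentIn Kᶜ w)) :
    w ∈ connectedComponentIn Kᶜ v := by
  obtain ⟨R, hR0, hR⟩ := hK.isBounded.subset_closedBall_lt 0 0
  have hsub : (closedBall (0:ℂ) R)ᶜ ⊆ Kᶜ := compl_subset_compl.2 hR
  have key : ∀ u, ¬ Bornology.IsBounded (connectedComponentIn Kᶜ u) →
      ∃ x ∈ connectedComponentIn Kᶜ u, x ∈ (closedBall (0:ℂ) R)ᶜ := fun u hu => by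
    by_contra! hcon
    exact hu ((isBounded_closedBall (x := (0:ℂ)) (r :=
        R)).subset fun x hx => by simpa using hcon x hx)
  obtain ⟨x, hx, hxR⟩ := key v h1
  obtain ⟨y, hy, hyR⟩ := key w h2
  have : y ∈ connectedComponentIn Kᶜ x :=
    (isPreconnected_compl_closedBall hR0).subset_connectedComponentIn hxR hsub hyR
  rw [connectedComponentIn_eq hx, connectedComponentIn_eq this, ← connectedComponentIn_eq hy]
  exact mem_connectedComponentIn hw

theorem hasLogOn_of_mem_component {K : Set ℂ} (hK : IsClosed K) {v w : ℂ}
    (hw : w ∈ connectedComponentIn Kᶜ v) : HasLogOn K (fun z => (z - w) / (z - v)) := by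
  have hv : v ∈ Kᶜ := by
    by_contra h
    rw [connectedComponentIn_eq_empty h] at hw
    exact hw
  have hpc : IsPathConnected (connectedComponentIn Kᶜ v) :=
    (hK.isOpen_compl.connectedComponentIn).isConnected_iff_isPathConnected.1
      ⟨⟨v, mem_connectedComponentIn hv⟩, isPreconnected_connectedComponentIn⟩
  obtain ⟨γ, hγ⟩ := hpc.joinedIn v (mem_connectedComponentIn hv) w hw
  have hγ' : ∀ t, γ.extend t ∈ Kᶜ := fun t => by
    have : γ.extend t ∈ range γ := by rw [← γ.extend_range]; exact ⟨t, rfl⟩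
    obtain ⟨s, hs⟩ := this
    rw [← hs]
    exact connectedComponentIn_subset _ _ (hγ s)
  have hz : ∀ z ∈ K, ∀ t, z - γ.extend t ≠ 0 := fun z hz t h => hγ' t (by
    rw [← sub_eq_zero.1 h]; exact hz)
  have := HasLogOn.of_homotopy (S := K) (H := fun t z => (z - γ.extend t) / (z - γ.extend 0))
    (ContinuousOn.div (by fun_prop) (by fun_prop) (fun p hp => hz _ hp.2 _))
    (fun t _ z h => div_ne_zero (hz z h t) (hz z h 0))
    ⟨fun _ => 0, continuousOn_const, fun z h => by
      simp only [div_self (hz z h 0), Complex.exp_zero]⟩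
  exact this.congr fun z _ => by simp

theorem mem_component_of_hasLogOn {K : Set ℂ} (hK : IsCompact K) {v w : ℂ} (hv : v ∉ K)
    (hw : w ∉ K) (h : HasLogOn K (fun z => (z - w) / (z - v))) :
    w ∈ connectedComponentIn Kᶜ v := by
  have key : ∀ a b : ℂ, a ∉ K → b ∉ K → b ∉ connectedComponentIn Kᶜ a →
      HasLogOn K (fun z => (z - a) / (z - b)) →
      ¬ Bornology.IsBounded (connectedComponentIn Kᶜ a) := by
    rintro a b ha hb hba ⟨g, hg, he⟩ hbd
    have ho : IsOpen (connectedComponentIn Kᶜ a) := hK.isClosed.isOpen_compl.connectedComponentIn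
    have hfr := frontier_connectedComponentIn_subset hK.isClosed a
    refine borsuk_obstruction hK.isClosed hbd hfr
      (by rw [ho.interior_eq]; exact mem_connectedComponentIn ha) (h₀ := fun z => z - b)
      (by fun_prop) (fun z hz hzb => ?_) hg (fun z hz => ?_)
    · rw [sub_eq_zero] at hzb
      subst hzb
      rw [closure_eq_self_union_frontier] at hz
      exact hz.elim hba (fun h => hb (hfr h))
    · have : z - b ≠ 0 := fun h => hb (by rw [← sub_eq_zero.1 h]; exact hz)
      rw [he z hz]; field_simp
  by_contra hcon
  have hcon' : v ∉ connectedComponentIn Kᶜ w := fun h' => hcon (by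
    rw [← connectedComponentIn_eq h']; exact mem_connectedComponentIn hw)
  refine hcon (mem_component_of_unbounded hK hw (key v w hv hw hcon ?_) (key w v hw hv hcon' h))
  exact h.inv.congr fun z _ => by simp

/-- Janiszewski's theorem. -/
theorem janiszewski {K₁ K₂ : Set ℂ} (h₁ : IsCompact K₁) (h₂ : IsCompact K₂)
    (hc : IsPreconnected (K₁ ∩ K₂)) {v w : ℂ} (hw₁ : w ∈ connectedComponentIn K₁ᶜ v)
    (hw₂ : w ∈ connectedComponentIn K₂ᶜ v) : w ∈ connectedComponentIn (K₁ ∪ K₂)ᶜ v := by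
  have hv : ∀ K : Set ℂ, w ∈ connectedComponentIn Kᶜ v → v ∉ K := fun K hw hvK => by
    rw [connectedComponentIn_eq_empty (by simpa using hvK)] at hw
    exact hw
  obtain ⟨g₁, hg₁, he₁⟩ := hasLogOn_of_mem_component h₁.isClosed hw₁
  obtain ⟨g₂, hg₂, he₂⟩ := hasLogOn_of_mem_component h₂.isClosed hw₂
  refine mem_component_of_hasLogOn (h₁.union h₂)
    (fun h => h.elim (hv _ hw₁) (hv _ hw₂)) (fun h => h.elim
      (connectedComponentIn_subset _ _ hw₁) (connectedComponentIn_subset _ _ hw₂)) ?_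
  obtain ⟨c, hc1, hcc⟩ : ∃ c, exp c = 1 ∧ ∀ z ∈ K₁ ∩ K₂, g₁ z = g₂ z + c := by
    by_cases hne : (K₁ ∩ K₂).Nonempty
    · obtain ⟨x, hx⟩ := hne
      refine ⟨g₁ x - g₂ x, ?_, fun z hz => ?_⟩
      · rw [Complex.exp_sub, he₁ x hx.1, he₂ x hx.2, div_self]
        rw [← he₁ x hx.1]; exact exp_ne_zero _
      · have := sub_eq_sub_of_exp_eq hc (hg₁.mono inter_subset_left) (hg₂.mono inter_subset_right)
          (fun z hz => by rw [he₁ z hz.1, he₂ z hz.2]) hx hz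
        rw [this]; ring
    · exact ⟨0, Complex.exp_zero, fun z hz => absurd ⟨z, hz⟩ hne⟩
  classical
  have e1 : EqOn (K₁.piecewise g₁ (fun z => g₂ z + c)) g₁ K₁ := piecewise_eqOn _ _ _
  have e2 : EqOn (K₁.piecewise g₁ (fun z => g₂ z + c)) (fun z => g₂ z + c) K₂ := fun z hz => by
    by_cases h : z ∈ K₁
    · simp [h, hcc z ⟨h, hz⟩]
    · simp [h]
  refine ⟨K₁.piecewise g₁ (fun z => g₂ z + c), ?_, ?_⟩
  · exact (hg₁.congr e1).union_of_isClosed ((hg₂.add continuousOn_const).congr e2)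
      h₁.isClosed h₂.isClosed
  · rintro z (hz | hz)
    · rw [e1 hz, he₁ z hz]
    · rw [e2 hz, Complex.exp_add, hc1, he₂ z hz, mul_one]

theorem exp_mul_I_mem_sphere (t : ℝ) : exp (t * I) ∈ sphere (0:ℂ) 1 := by
  simp [Complex.norm_exp_ofReal_mul_I]

theorem exists_exp_mul_I_eq {u : ℂ} (hu : u ∈ sphere (0:ℂ) 1) (a : ℝ) :
    ∃ t ∈ Ico a (a + 2 * Real.pi), exp (t * I) = u := by
  have hu1 : ‖u‖ = 1 := by simpa using hu
  refine ⟨toIcoMod Real.two_pi_pos a (arg u), toIcoMod_mem_Ico _ _ _, ?_⟩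
  have h1 : (toIcoMod Real.two_pi_pos a (arg u) : ℝ) = arg u -
      toIcoDiv Real.two_pi_pos a (arg u) • (2 * Real.pi) := rfl
  rw [h1]
  have : ((arg u - toIcoDiv Real.two_pi_pos a (arg u) • (2 * Real.pi) : ℝ) : ℂ) * I
      = arg u * I - (toIcoDiv Real.two_pi_pos a (arg u) : ℤ) * (2 * Real.pi * I) := by
    push_cast [zsmul_eq_mul]; ring
  rw [this, Complex.exp_sub, Complex.exp_int_mul_two_pi_mul_I, div_one]
  have := Complex.norm_mul_exp_arg_mul_I u
  rwa [hu1, ofReal_one, one_mul] at this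

theorem exp_mul_I_injOn (a : ℝ) : InjOn (fun t : ℝ => exp (t * I)) (Ico a (a + 2 * Real.pi)) := by
  intro s hs t ht h
  obtain ⟨n, hn⟩ := Complex.exp_eq_exp_iff_exists_int.1 h
  have h1 : s = t + n * (2 * Real.pi) := by
    have : (s : ℂ) * I = (t + n * (2 * Real.pi)) * I := by rw [hn]; ring
    have := mul_right_cancel₀ I_ne_zero this
    exact_mod_cast this
  have hp := Real.pi_pos
  have h2 : (n : ℝ) < 1 := by
    by_contra! hcon
    nlinarith [hs.2, ht.1]
  have h3 : (-1 : ℝ) < n := by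
    by_contra! hcon
    nlinarith [hs.1, ht.2]
  have h4 : n = 0 := by
    have : n < 1 := by exact_mod_cast h2
    have : -1 < n := by exact_mod_cast h3
    omega
  rw [h1, h4]; simp

section Jordan

variable {f : ℂ → ℂ} (hf : ContinuousOn f (sphere (0:ℂ) 1)) (hi : InjOn f (sphere (0:ℂ) 1))

theorem continuous_loop (hf : ContinuousOn f (sphere (0:ℂ) 1)) :
    Continuous fun t : ℝ => f (exp (t * I)) :=
  hf.comp_continuous (by fun_prop) exp_mul_I_mem_sphere

theorem injOn_loop (hi : InjOn f (sphere (0:ℂ) 1)) (a : ℝ) :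
    InjOn (fun t : ℝ => f (exp (t * I))) (Ico a (a + 2 * Real.pi)) := fun _ hs _ ht h =>
  exp_mul_I_injOn a hs ht (hi (exp_mul_I_mem_sphere _) (exp_mul_I_mem_sphere _) h)

theorem isCompact_curve (hf : ContinuousOn f (sphere (0:ℂ) 1)) : IsCompact (f '' sphere (0:ℂ) 1) :=
  (isCompact_sphere 0 1).image_of_continuousOn hf

theorem isPreconnected_curve (hf : ContinuousOn f (sphere (0:ℂ) 1)) :
    IsPreconnected (f '' sphere (0:ℂ) 1) := by
  have : f '' sphere (0:ℂ) 1 = range fun t : ℝ => f (exp (t * I)) := by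
    ext z
    constructor
    · rintro ⟨u, hu, rfl⟩
      obtain ⟨t, -, rfl⟩ := exists_exp_mul_I_eq hu 0
      exact ⟨t, rfl⟩
    · rintro ⟨t, rfl⟩
      exact ⟨_, exp_mul_I_mem_sphere t, rfl⟩
  rw [this]
  exact isPreconnected_range (continuous_loop hf)

theorem hasLogOn_compl_arc {γ : ℝ → ℂ} (hγ : Continuous γ) (a b : ℝ) :
    HasLogOn (γ '' uIcc a b)ᶜ (fun z => (z - γ b) / (z - γ a)) := by
  have hm : ∀ t ∈ Icc (0:ℝ) 1, a + t * (b - a) ∈ uIcc a b := fun t ht => by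
    rcases le_total a b with h | h
    · rw [uIcc_of_le h]; constructor <;> nlinarith [ht.1, ht.2]
    · rw [uIcc_of_ge h]; constructor <;> nlinarith [ht.1, ht.2]
  have hz : ∀ z ∈ (γ '' uIcc a b)ᶜ, ∀ t ∈ Icc (0:ℝ) 1, z - γ (a + t * (b - a)) ≠ 0 :=
    fun z hz t ht h => hz ⟨_, hm t ht, (sub_eq_zero.1 h).symm⟩
  have hza : ∀ z ∈ (γ '' uIcc a b)ᶜ, z - γ a ≠ 0 := fun z h => by
    simpa using hz z h 0 (by simp)
  have := HasLogOn.of_homotopy (S := (γ '' uIcc a b)ᶜ)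
    (H := fun t z => (z - γ (a + t * (b - a))) / (z - γ a))
    (ContinuousOn.div (by fun_prop) (by fun_prop) (fun p hp => hza _ hp.2))
    (fun t ht z h => div_ne_zero (hz z h t ht) (hza z h))
    ⟨fun _ => 0, continuousOn_const, fun z h => by
      simp [div_self (hza z h)]⟩
  exact this.congr fun z _ => by simp

theorem not_isPreconnected_compl_curve (hf : ContinuousOn f (sphere (0:ℂ) 1))
    (hi : InjOn f (sphere (0:ℂ) 1)) : ¬ IsPreconnected (f '' sphere (0:ℂ) 1)ᶜ := by
  intro hpre
  set γ : ℝ → ℂ := fun t : ℝ => f (exp (t * I)) with hγdef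
  have hγ : Continuous γ := continuous_loop hf
  have hpi := Real.pi_pos
  have hper : γ (2 * Real.pi) = γ 0 := by
    simp [hγdef, Complex.exp_two_pi_mul_I]
  have hA := hasLogOn_compl_arc hγ 0 Real.pi
  have hB := hasLogOn_compl_arc hγ (2 * Real.pi) Real.pi
  rw [uIcc_of_le hpi.le] at hA
  rw [uIcc_of_ge (by linarith), hper] at hB
  set A := γ '' Icc 0 Real.pi
  set B := γ '' Icc Real.pi (2 * Real.pi)
  have hAc : IsCompact A := isCompact_Icc.image hγ
  have hBc : IsCompact B := isCompact_Icc.image hγ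
  have hAB : (f '' sphere (0:ℂ) 1)ᶜ = Aᶜ ∩ Bᶜ := by
    rw [← compl_union, ← image_union, Icc_union_Icc_eq_Icc hpi.le (by linarith)]
    congr 1
    ext z
    constructor
    · rintro ⟨u, hu, rfl⟩
      obtain ⟨t, ht, rfl⟩ := exists_exp_mul_I_eq hu 0
      exact ⟨t, ⟨ht.1, by linarith [ht.2]⟩, rfl⟩
    · rintro ⟨t, _, rfl⟩
      exact ⟨_, exp_mul_I_mem_sphere t, rfl⟩
  have hintg : ∀ z, z ∈ A → z ∈ B → z = γ 0 ∨ z = γ Real.pi := by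
    rintro z ⟨s, hs, rfl⟩ ⟨t, ht, h⟩
    rcases eq_or_lt_of_le ht.2 with h2 | h2
    · left; rw [← h, h2, hper]
    · right
      have : t = s := injOn_loop hi 0 ⟨by linarith [ht.1], by linarith⟩
        ⟨hs.1, by linarith [hs.2]⟩ h
      rw [← h, show t = Real.pi by linarith [ht.1, hs.2]]
  have hpq : γ Real.pi ≠ γ 0 := fun h => hpi.ne'
    (injOn_loop hi 0 ⟨hpi.le, by linarith⟩ ⟨le_rfl, by linarith⟩ h)
  rw [hAB] at hpre
  obtain ⟨g₁, hg₁, he₁⟩ := hA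
  obtain ⟨g₂, hg₂, he₂⟩ := hB
  obtain ⟨x, hx⟩ : (Aᶜ ∩ Bᶜ).Nonempty := by
    rw [← compl_union]
    by_contra hcon
    rw [not_nonempty_iff_eq_empty, compl_empty_iff] at hcon
    exact (hcon ▸ hAc.union hBc).ne_univ rfl
  have hcc : ∀ z ∈ Aᶜ ∩ Bᶜ, g₁ z = g₂ z + (g₁ x - g₂ x) := fun z hz => by
    rw [sub_eq_sub_of_exp_eq hpre (hg₁.mono inter_subset_left) (hg₂.mono inter_subset_right)
          (fun z hz => by rw [he₁ z hz.1, he₂ z hz.2]) hx hz]; ring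
  have hc1 : exp (g₁ x - g₂ x) = 1 := by
    rw [Complex.exp_sub, he₁ x hx.1, he₂ x hx.2, div_self]
    rw [← he₁ x hx.1]; exact exp_ne_zero _
  set c := g₁ x - g₂ x
  classical
  have e1 : EqOn (Aᶜ.piecewise g₁ (fun z => g₂ z + c)) g₁ Aᶜ := piecewise_eqOn _ _ _
  have e2 : EqOn (Aᶜ.piecewise g₁ (fun z => g₂ z + c)) (fun z => g₂ z + c) Bᶜ := fun z hz => by
    by_cases h : z ∈ Aᶜ
    · rw [piecewise_eq_of_mem _ _ _ h, hcc z ⟨h, hz⟩]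
    · rw [piecewise_eq_of_notMem _ _ _ h]
  have hlog : HasLogOn (Aᶜ ∪ Bᶜ) (fun z => (z - γ Real.pi) / (z - γ 0)) := by
    refine ⟨Aᶜ.piecewise g₁ (fun z => g₂ z + c), ?_, ?_⟩
    · exact (hg₁.congr e1).union_of_isOpen ((hg₂.add continuousOn_const).congr e2)
        hAc.isClosed.isOpen_compl hBc.isClosed.isOpen_compl
    · rintro z (hz | hz)
      · rw [e1 hz, he₁ z hz]
      · rw [e2 hz, Complex.exp_add, hc1, he₂ z hz, mul_one]
  set r := dist (γ Real.pi) (γ 0) / 2 with hr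
  have hr0 : 0 < r := by have := dist_pos.2 hpq; positivity
  have hs : ∀ z ∈ closedBall (γ 0) r, z - γ Real.pi ≠ 0 := fun z hz h => by
    rw [sub_eq_zero] at h
    subst h
    rw [mem_closedBall] at hz
    linarith
  have h1 : HasLogOn (sphere (γ 0) r) (fun z => (z - γ Real.pi) / (z - γ 0)) := by
    refine hlog.mono fun z hz => ?_
    rw [← compl_inter]
    rintro ⟨hzA, hzB⟩
    rcases hintg z hzA hzB with h | h
    · rw [h, mem_sphere, dist_self] at hz
      exact hr0.ne hz
    · exact hs z (sphere_subset_closedBall hz) (by rw [h, sub_self])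
  have h2 : HasLogOn (sphere (γ 0) r) (fun z => (z - γ Real.pi)) :=
    (HasLogOn.of_starConvex ((convex_closedBall (γ 0) r).starConvex (mem_closedBall_self hr0.le))
      (mem_closedBall_self hr0.le) (by fun_prop) hs).mono sphere_subset_closedBall
  refine not_hasLogOn_sphere (γ 0) hr0 ((h1.inv.mul h2).congr fun z hz => ?_)
  have := hs z (sphere_subset_closedBall hz)
  simp only [inv_div]
  field_simp

theorem exists_bounded_component (hf : ContinuousOn f (sphere (0:ℂ) 1))
    (hi : InjOn f (sphere (0:ℂ) 1)) : ∃ p, p ∉ f '' sphere (0:ℂ) 1 ∧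
      Bornology.IsBounded (connectedComponentIn (f '' sphere (0:ℂ) 1)ᶜ p) := by
  by_contra! hcon
  refine not_isPreconnected_compl_curve hf hi (isPreconnected_of_forall_pair fun x hx y hy => ?_)
  refine ⟨connectedComponentIn (f '' sphere (0:ℂ) 1)ᶜ x, connectedComponentIn_subset _ _,
    mem_connectedComponentIn hx, ?_, isPreconnected_connectedComponentIn⟩
  exact mem_component_of_unbounded (isCompact_curve hf) hy (hcon x hx) (hcon y hy)

theorem frontier_bounded_component (hf : ContinuousOn f (sphere (0:ℂ) 1))
    (hi : InjOn f (sphere (0:ℂ) 1)) {p : ℂ} (hp : p ∉ f '' sphere (0:ℂ) 1)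
    (hb : Bornology.IsBounded (connectedComponentIn (f '' sphere (0:ℂ) 1)ᶜ p)) :
    frontier (connectedComponentIn (f '' sphere (0:ℂ) 1)ᶜ p) = f '' sphere (0:ℂ) 1 := by
  set V := connectedComponentIn (f '' sphere (0:ℂ) 1)ᶜ p
  have hfr : frontier V ⊆ _ :=
    frontier_connectedComponentIn_subset (isCompact_curve hf).isClosed p
  refine hfr.antisymm ?_
  rintro _ ⟨u, hu, rfl⟩
  by_contra hcon
  obtain ⟨a, -, rfl⟩ := exists_exp_mul_I_eq hu 0
  set γ : ℝ → ℂ := fun t : ℝ => f (exp (t * I)) with hγdef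
  have hγ : Continuous γ := continuous_loop hf
  have hpi := Real.pi_pos
  have hev : ∀ᶠ t in 𝓝 a, γ t ∉ frontier V :=
    hγ.continuousAt.eventually (isClosed_frontier.isOpen_compl.mem_nhds hcon)
  obtain ⟨ε, hε, hεV⟩ := Metric.eventually_nhds_iff.1 hev
  set δ := min (ε / 2) 1
  have hδ : 0 < δ := lt_min (by linarith) one_pos
  have hδε : δ < ε := (min_le_left _ _).trans_lt (by linarith)
  have hδ1 : δ ≤ 1 := min_le_right _ _
  have hpi3 := Real.pi_gt_three
  have harc : frontier V ⊆ γ '' Icc (a + δ) (a + 2 * Real.pi - δ) := by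
    intro z hz
    obtain ⟨u, hu, rfl⟩ := hfr hz
    obtain ⟨t, ht, rfl⟩ := exists_exp_mul_I_eq hu a
    refine ⟨t, ⟨?_, ?_⟩, rfl⟩
    · by_contra! h
      exact hεV (by rw [Real.dist_eq, abs_lt]; constructor <;> linarith [ht.1]) hz
    · by_contra! h
      refine hεV (y := t - 2 * Real.pi)
        (by rw [Real.dist_eq, abs_lt]; constructor <;> linarith [ht.2]) ?_
      have : γ (t - 2 * Real.pi) = f (exp (t * I)) := by
        simp only [hγdef]
        congr 1
        push_cast
        rw [sub_mul, Complex.exp_sub, Complex.exp_two_pi_mul_I, div_one]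
      rwa [this]
  have hsub : Icc (a + δ) (a + 2 * Real.pi - δ) ⊆ Ico a (a + 2 * Real.pi) := fun t ht =>
    ⟨by linarith [ht.1], by linarith [ht.2]⟩
  have hlog : HasLogOn (γ '' Icc (a + δ) (a + 2 * Real.pi - δ)) (fun z => z - p) := by
    refine HasLogOn.image isCompact_Icc hγ.continuousOn ((injOn_loop hi a).mono hsub) ?_
    refine hasLogOn_Icc (by linarith) (by fun_prop) fun t _ h => hp ?_
    exact ⟨_, exp_mul_I_mem_sphere t, sub_eq_zero.1 h⟩
  obtain ⟨g, hg, he⟩ := hlog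
  have ho : IsOpen V := (isCompact_curve hf).isClosed.isOpen_compl.connectedComponentIn
  refine borsuk_obstruction (isCompact_Icc.image hγ).isClosed hb harc (v := p)
    (by rw [ho.interior_eq]; exact mem_connectedComponentIn hp) (h₀ := fun _ => 1)
    continuous_const (by simp) hg (fun z hz => by rw [he z hz, one_mul])

end Jordan

/-- Differentiation of an integral depending holomorphically on a locally bounded parameter. -/
theorem differentiableOn_intervalIntegral {U : Set ℂ} (hU : IsOpen U) {k : ℂ → ℝ → ℂ}
    (hd : ∀ t ∈ Icc (0:ℝ) 1, DifferentiableOn ℂ (fun z => k z t) U)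
    (hc : ∀ z ∈ U, ContinuousOn (k z) (Icc 0 1))
    (hb : ∀ z ∈ U, ∃ r > 0, ∃ C, ball z r ⊆ U ∧
      ∀ z' ∈ ball z r, ∀ t ∈ Icc (0:ℝ) 1, ‖k z' t‖ ≤ C) :
    DifferentiableOn ℂ (fun z => ∫ t in (0:ℝ)..1, k z t) U := by
  intro z hz
  obtain ⟨r, hr, C, hrU, hC⟩ := hb z hz
  have hsub : ∀ t, t ∈ uIoc (0:ℝ) 1 → t ∈ Icc (0:ℝ) 1 := fun t ht => by
    rw [uIoc_of_le zero_le_one] at ht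
    exact Ioc_subset_Icc_self ht
  have hmeas : ∀ x ∈ U, AEStronglyMeasurable (k x) (volume.restrict (uIoc (0:ℝ) 1)) := fun x hx =>
    ((hc x hx).mono hsub).aestronglyMeasurable measurableSet_uIoc
  have hderiv : ∀ t ∈ Icc (0:ℝ) 1, ∀ x ∈ U, HasDerivAt (fun z => k z t)
      (deriv (fun z => k z t) x) x := fun t ht x hx =>
    ((hd t ht).differentiableAt (hU.mem_nhds hx)).hasDerivAt
  have key := intervalIntegral.hasDerivAt_integral_of_dominated_loc_of_deriv_le (μ := volume)
    (a := 0) (b := 1) (F := k) (F' := fun x t => deriv (fun z => k z t) x) (x₀ := z)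
    (s := ball z (r / 2)) (bound := fun _ => C / (r / 2)) (ball_mem_nhds z (by linarith))
    (eventually_of_mem (hU.mem_nhds hz) hmeas)
    ((hc z hz).intervalIntegrable_of_Icc zero_le_one) ?_ ?_ (by simp) ?_
  · exact key.2.differentiableAt.differentiableWithinAt
  · have hseq : Tendsto (fun n : ℕ => z + (((r / 2) / (n + 1) : ℝ) : ℂ)) atTop (𝓝[≠] z) := by
      refine tendsto_nhdsWithin_iff.2 ⟨?_, Eventually.of_forall fun n => ?_⟩
      · have : Tendsto (fun n : ℕ => (r / 2) / ((n : ℝ) + 1)) atTop (𝓝 0) :=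
          tendsto_const_div_atTop_nhds_zero_nat (r / 2) |>.comp (tendsto_add_atTop_nat 1) |>.congr
            fun n => by simp
        have := (continuous_ofReal.tendsto 0).comp this
        simpa using this.const_add z
      · have : (0:ℝ) < (r / 2) / (n + 1) := by positivity
        simpa using (Complex.ofReal_ne_zero.2 this.ne')
    have hm : ∀ n : ℕ, z + (((r / 2) / (n + 1) : ℝ) : ℂ) ∈ U := fun n => by
      apply hrU
      rw [mem_ball, dist_eq_norm, add_sub_cancel_left, Complex.norm_real, Real.norm_of_nonneg
        (by positivity)]
      have : (r / 2) / ((n : ℝ) + 1) ≤ r / 2 := div_le_self (by linarith)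
          (by linarith [n.cast_nonneg (α := ℝ)])
      linarith
    refine aestronglyMeasurable_of_tendsto_ae atTop
      (f := fun (n : ℕ) t => slope (fun x => k x t) z (z + (((r / 2) / (n + 1) : ℝ) : ℂ)))
      (fun n => ?_) ?_
    · simp only [slope_def_field]
      simp only [div_eq_mul_inv]
      exact ((hmeas _ (hm n)).sub (hmeas z hz)).mul_const _
    · filter_upwards [ae_restrict_mem measurableSet_uIoc] with t ht
      exact (hasDerivAt_iff_tendsto_slope.1 (hderiv t (hsub t ht) z hz)).comp hseq
  · refine Eventually.of_forall fun t ht x hx => ?_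
    have hx' : closedBall x (r / 2) ⊆ ball z r := fun y hy => by
      rw [mem_ball] at hx ⊢
      rw [mem_closedBall] at hy
      linarith [dist_triangle y x z]
    refine Complex.norm_deriv_le_of_forall_mem_sphere_norm_le (by linarith) ?_
      (fun y hy => hC y (hx' (sphere_subset_closedBall hy)) t (hsub t ht))
    exact ((hd t (hsub t ht)).mono (hx'.trans hrU)).diffContOnCl_ball subset_rfl
  · refine Eventually.of_forall fun t ht x hx => hderiv t (hsub t ht) x (hrU ?_)
    exact ball_subset_ball (by linarith) hx

/-- The point at time `t` on the oriented segment `s`. -/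
def segPt (s : ℂ × ℂ) (t : ℝ) : ℂ := s.1 + t * (s.2 - s.1)

@[fun_prop]
theorem continuous_segPt (s : ℂ × ℂ) : Continuous (segPt s) := by unfold segPt; fun_prop

/-- Integral of `k` over a chain of oriented segments. -/
noncomputable def chainIntegral (l : List (ℂ × ℂ)) (k : ℂ → ℂ) : ℂ :=
  (l.map fun s => ∫ t in (0:ℝ)..1, k (segPt s t) * (s.2 - s.1)).sum

/-- A chain whose segments are contained in `Ω`. -/
def ChainIn (Ω : Set ℂ) (l : List (ℂ × ℂ)) : Prop := ∀ s ∈ l, ∀ t ∈ Icc (0:ℝ) 1, segPt s t ∈ Ω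

/-- Evaluation of the boundary of a chain on a function. -/
def chainBoundary (l : List (ℂ × ℂ)) (F : ℂ → ℂ) : ℂ := (l.map fun s => F s.2 - F s.1).sum

/-- The support of a chain. -/
def chainSupport (l : List (ℂ × ℂ)) : Set ℂ := {z | ∃ s ∈ l, z ∈ segPt s '' Icc 0 1}

theorem isCompact_chainSupport (l : List (ℂ × ℂ)) : IsCompact (chainSupport l) := by
  have : chainSupport l = ⋃ s ∈ l.toFinset, segPt s '' Icc 0 1 := by
    ext z; simp [chainSupport]
  rw [this]
  exact l.toFinset.isCompact_biUnion fun s _ => isCompact_Icc.image (continuous_segPt s)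

theorem mem_chainSupport {l : List (ℂ × ℂ)} {s : ℂ × ℂ} (hs : s ∈ l) {t : ℝ} (ht : t ∈ Icc
    (0:ℝ) 1) :
    segPt s t ∈ chainSupport l := ⟨s, hs, t, ht, rfl⟩

theorem chainSupport_subset {Ω : Set ℂ} {l : List (ℂ × ℂ)} (hl : ChainIn Ω l) :
    chainSupport l ⊆ Ω := by
  rintro _ ⟨s, hs, t, ht, rfl⟩
  exact hl s hs t ht

theorem differentiableOn_list_sum {ι : Type*} {U : Set ℂ} (l : List ι) {k : ι → ℂ → ℂ}
    (h : ∀ s ∈ l, DifferentiableOn ℂ (k s) U) :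
    DifferentiableOn ℂ (fun z => (l.map fun s => k s z).sum) U := by
  induction l with
  | nil => simp
  | cons a l ih =>
    simp only [List.map_cons, List.sum_cons]
    exact (h a (by simp)).add (ih fun s hs => h s (by simp [hs]))

theorem tendsto_list_sum {ι : Type*} (l : List ι) {k : ι → ℂ → ℂ} {F : Filter ℂ}
    (h : ∀ s ∈ l, Tendsto (k s) F (𝓝 0)) :
    Tendsto (fun z => (l.map fun s => k s z).sum) F (𝓝 0) := by
  induction l with
  | nil => simpa using tendsto_const_nhds
  | cons a l ih =>
    simp only [List.map_cons, List.sum_cons]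
    simpa using (h a (by simp)).add (ih fun s hs => h s (by simp [hs]))

section Cauchy

variable {l : List (ℂ × ℂ)} {h : ℂ → ℂ}

theorem differentiableOn_cauchyTransform (hh : ContinuousOn h (chainSupport l)) :
    DifferentiableOn ℂ (fun z => chainIntegral l fun w => h w / (w - z)) (chainSupport l)ᶜ := by
  refine differentiableOn_list_sum l fun s hs => ?_
  have hne : ∀ z ∈ (chainSupport l)ᶜ, ∀ t ∈ Icc (0:ℝ) 1, segPt s t - z ≠ 0 := fun z hz t ht h0 =>
    hz (by rw [← sub_eq_zero.1 h0]; exact mem_chainSupport hs ht)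
  have hcomp : ContinuousOn (fun t => h (segPt s t)) (Icc 0 1) :=
    hh.comp (by fun_prop) fun t ht => mem_chainSupport hs ht
  refine differentiableOn_intervalIntegral (isCompact_chainSupport l).isClosed.isOpen_compl
    (fun t ht => ?_) (fun z hz => ?_) (fun z hz => ?_)
  · refine DifferentiableOn.mul_const (DifferentiableOn.div (by fun_prop) (by fun_prop) ?_) _
    exact fun z hz => hne z hz t ht
  · exact ContinuousOn.mul (hcomp.div (by fun_prop) (hne z hz)) (by fun_prop)
  · obtain ⟨M, hM⟩ := isCompact_Icc.exists_bound_of_continuousOn hcomp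
    obtain ⟨r, hr, hrU⟩ := Metric.isOpen_iff.1
      (isCompact_chainSupport l).isClosed.isOpen_compl z hz
    refine ⟨r / 2, by linarith, M / (r / 2) * ‖s.2 - s.1‖,
      (ball_subset_ball (by linarith)).trans hrU, fun z' hz' t ht => ?_⟩
    have hd : r / 2 ≤ ‖segPt s t - z'‖ := by
      by_contra! hcon
      refine hrU ?_ (mem_chainSupport hs ht)
      rw [mem_ball] at hz' ⊢
      rw [← dist_eq_norm] at hcon
      linarith [dist_triangle (segPt s t) z' z]
    rw [norm_mul, norm_div]
    have hM0 : 0 ≤ M := (norm_nonneg _).trans (hM t ht)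
    gcongr
    exact hM t ht

theorem tendsto_cauchyTransform (hh : ContinuousOn h (chainSupport l)) :
    Tendsto (fun z => chainIntegral l fun w => h w / (w - z)) (cocompact ℂ) (𝓝 0) := by
  refine tendsto_list_sum l fun s hs => ?_
  have hcomp : ContinuousOn (fun t => h (segPt s t)) (Icc 0 1) :=
    hh.comp (by fun_prop) fun t ht => mem_chainSupport hs ht
  obtain ⟨M, hM⟩ := isCompact_Icc.exists_bound_of_continuousOn hcomp
  obtain ⟨R, hR⟩ := isCompact_Icc.exists_bound_of_continuousOn
    ((continuous_segPt s).continuousOn (s := Icc 0 1))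
  have hM0 : 0 ≤ M := (norm_nonneg _).trans (hM 0 (by simp))
  have h1 : Tendsto (fun z : ℂ => M / (‖z‖ - R) * ‖s.2 - s.1‖) (cocompact ℂ) (𝓝 0) := by
    have : Tendsto (fun z : ℂ => ‖z‖ - R) (cocompact ℂ) atTop :=
      tendsto_atTop_add_const_right _ _ (tendsto_norm_cocompact_atTop (E := ℂ))
    simpa using (this.const_div_atTop M).mul_const ‖s.2 - s.1‖
  refine squeeze_zero_norm' ?_ h1
  filter_upwards [(tendsto_norm_cocompact_atTop (E := ℂ)).eventually_gt_atTop R] with z hz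
  have := intervalIntegral.norm_integral_le_of_norm_le_const (a := 0) (b := 1)
    (f := fun t => h (segPt s t) / (segPt s t - z) * (s.2 - s.1))
    (C := M / (‖z‖ - R) * ‖s.2 - s.1‖) (fun t ht => ?_)
  · simpa using this
  · rw [uIoc_of_le zero_le_one] at ht
    have ht' := Ioc_subset_Icc_self ht
    have h2 : ‖z‖ - R ≤ ‖segPt s t - z‖ := by
      have := norm_sub_norm_le z (segPt s t)
      rw [norm_sub_rev] at this
      linarith [hR t ht']
    have h3 : 0 < ‖z‖ - R := by linarith
    rw [norm_mul, norm_div]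
    gcongr
    exact hM t ht'

theorem chainIntegral_of_hasDerivAt {Ω : Set ℂ} (hl : ChainIn Ω l) {F : ℂ → ℂ}
    (hF : ∀ z ∈ Ω, HasDerivAt F (h z) z) (hh : ContinuousOn h Ω) :
    chainIntegral l h = chainBoundary l F := by
  unfold chainIntegral chainBoundary
  congr 1
  refine List.map_congr_left fun s hs => ?_
  have hseg : ∀ t : ℝ, HasDerivAt (segPt s) (s.2 - s.1) t := fun t => by
    have := ((hasDerivAt_id (t : ℂ)).comp_ofReal.mul_const (s.2 - s.1)).const_add s.1
    rw [one_mul] at this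
    exact this
  have hin : ∀ t ∈ uIcc (0:ℝ) 1, segPt s t ∈ Ω := fun t ht => hl s hs t (by
    rwa [uIcc_of_le zero_le_one] at ht)
  rw [intervalIntegral.integral_eq_sub_of_hasDerivAt
    (f := fun t => F (segPt s t)) (fun t ht => (hF _ (hin t ht)).comp t (hseg t))]
  · simp [segPt]
  · refine ContinuousOn.intervalIntegrable (ContinuousOn.mul ?_ continuousOn_const)
    exact hh.comp (by fun_prop) hin

/-- The index of a cycle is integral. -/
theorem exp_chainIntegral_inv (hl : ∀ F, chainBoundary l F = 0) {z : ℂ}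
    (hz : z ∉ chainSupport l) : exp (chainIntegral l fun w => 1 / (w - z)) = 1 := by
  have key : ∀ s ∈ l, exp (∫ t in (0:ℝ)..1, 1 / (segPt s t - z) * (s.2 - s.1))
      = (s.2 - z) / (s.1 - z) := fun s hs => by
    have hne : ∀ t ∈ Icc (0:ℝ) 1, segPt s t - z ≠ 0 := fun t ht h0 =>
      hz (by rw [← sub_eq_zero.1 h0]; exact mem_chainSupport hs ht)
    have h1 : s.1 - z ≠ 0 := by simpa [segPt] using hne 0 (by simp)
    have hsl : ∀ t ∈ Icc (0:ℝ) 1, (segPt s t - z) / (s.1 - z) ∈ slitPlane := by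
      intro t ht
      set β := (s.2 - s.1) / (s.1 - z) with hβ
      have hu : ∀ t : ℝ, segPt s t - z = (1 + t * β) * (s.1 - z) := fun t => by
        rw [hβ, segPt]; field_simp; ring
      rw [hu, mul_div_cancel_right₀ _ h1]
      by_contra hcon
      rw [mem_slitPlane_iff, not_or] at hcon
      simp only [add_re, one_re, mul_re, ofReal_re, ofReal_im, zero_mul, sub_zero, not_lt,
        add_im, one_im, mul_im, zero_add, not_not, add_zero, mul_eq_zero] at hcon
      obtain ⟨h4, h5⟩ := hcon
      have ht0 : t ≠ 0 := by rintro rfl; norm_num at h4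
      have htpos : 0 < t := lt_of_le_of_ne ht.1 ht0.symm
      have hβi : β.im = 0 := h5.resolve_left ht0
      have hβr : β.re < 0 := by by_contra! h; nlinarith
      have hm : -1 / β.re ∈ Icc (0:ℝ) 1 := by
        constructor
        · exact div_nonneg_of_nonpos (by norm_num) hβr.le
        · rw [div_le_one_of_neg hβr]; nlinarith [ht.2]
      apply hne _ hm
      rw [hu, show (1 + ((-1 / β.re : ℝ) : ℂ) * β) = 0 from ?_, zero_mul]
      apply Complex.ext
      · simp only [add_re, one_re, mul_re, ofReal_re, ofReal_im, zero_mul, sub_zero, zero_re]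
        rw [div_mul_cancel₀ _ hβr.ne]; norm_num
      · simp [hβi]
    have := chainIntegral_of_hasDerivAt (l := [s]) (h := fun w => 1 / (w - z))
      (Ω := {w | (w - z) / (s.1 - z) ∈ slitPlane}) (fun s' hs' t ht => by
        rw [List.mem_singleton] at hs'
        subst hs'
        exact hsl t ht) (F := fun w => Complex.log ((w - z) / (s.1 - z))) (fun w hw => ?_) ?_
    · simp only [chainIntegral, chainBoundary, List.map_cons, List.map_nil, List.sum_cons,
        List.sum_nil, add_zero, div_self h1, Complex.log_one, sub_zero] at this
      rw [this, Complex.exp_log]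
      have := hne 1 (by simp)
      simp only [segPt] at this
      refine div_ne_zero (by simpa using this) h1
    · have h6 := ((hasDerivAt_id w).sub_const z).div_const (s.1 - z)
      have h7 := h6.clog hw
      have h8 : w - z ≠ 0 := fun h0 => slitPlane_ne_zero hw (by simp [h0])
      have h9 : 1 / (w - z) = 1 / (s.1 - z) / ((id w - z) / (s.1 - z)) := by
        rw [div_div_div_cancel_right₀ h1]
        rfl
      rw [h9]
      exact h7
    · refine ContinuousOn.div (by fun_prop) (by fun_prop) fun w hw h0 => ?_
      exact slitPlane_ne_zero hw (by simp [h0])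
  have h2 : ∀ l' : List (ℂ × ℂ), (∀ s ∈ l', s ∈ l) → exp (chainIntegral l' fun w => 1 / (w - z))
      = exp (chainBoundary l' fun w => Complex.log (w - z)) := by
    intro l'
    induction l' with
    | nil => simp [chainIntegral, chainBoundary]
    | cons a l' ih =>
      intro h'
      have ha := h' a (by simp)
      have ih' := ih fun s hs => h' s (by simp [hs])
      have h1 : a.1 - z ≠ 0 := fun h0 => hz (by
        have := mem_chainSupport ha (t := 0) (by simp)
        rw [sub_eq_zero] at h0
        simpa [segPt, h0] using this)
      have h2 : a.2 - z ≠ 0 := fun h0 => hz (by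
        have := mem_chainSupport ha (t := 1) (by simp)
        rw [sub_eq_zero] at h0
        simpa [segPt, h0] using this)
      simp only [chainIntegral, chainBoundary, List.map_cons, List.sum_cons,
          Complex.exp_add] at ih' ⊢
      rw [ih', key a ha, Complex.exp_sub, Complex.exp_log h1, Complex.exp_log h2]
  rw [h2 l fun s hs => hs, hl, Complex.exp_zero]

theorem eq_zero_of_exp_eq_one {x : ℂ} (hx : exp x = 1) (h1 : ‖x‖ < 1) : x = 0 := by
  obtain ⟨n, hn⟩ := Complex.exp_eq_one_iff.1 hx
  have : n = 0 := by
    by_contra h0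
    have h2 : (1:ℝ) ≤ |(n:ℝ)| := by exact_mod_cast Int.one_le_abs h0
    rw [hn, norm_mul] at h1
    simp only [norm_intCast, Complex.norm_mul, Complex.norm_ofNat, norm_real, norm_I, mul_one,
      Real.norm_of_nonneg Real.pi_pos.le] at h1
    nlinarith [Real.pi_gt_three]
  rw [hn, this]; simp

theorem dslope_comm (h : ℂ → ℂ) (z w : ℂ) : dslope h z w = dslope h w z := by
  by_cases e : z = w
  · rw [e]
  · rw [dslope_of_ne _ (Ne.symm e), dslope_of_ne _ e, slope_comm]

theorem exists_bound_dslope {Ω W : Set ℂ} (hΩ : IsOpen Ω) (hh : DifferentiableOn ℂ h Ω)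
    (hW : IsCompact W) (hWΩ : W ⊆ Ω) {z₀ : ℂ} (hz₀ : z₀ ∈ Ω) :
    ∃ r > 0, ∃ C, ball z₀ r ⊆ Ω ∧ ∀ z ∈ ball z₀ r, ∀ w ∈ W, ‖dslope h z w‖ ≤ C := by
  obtain ⟨ε, hε, hεΩ⟩ := Metric.isOpen_iff.1 hΩ z₀ hz₀
  set r := ε / 4 with hr
  have hr0 : 0 < r := by positivity
  have hball : closedBall z₀ (3 * r) ⊆ Ω := fun x hx => hεΩ (by
    rw [mem_closedBall] at hx; rw [mem_ball]; linarith)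
  obtain ⟨M, hM⟩ := (hW.union (isCompact_closedBall z₀ (3 * r))).exists_bound_of_continuousOn
    (hh.continuousOn.mono (union_subset hWΩ hball))
  have hM0 : 0 ≤ M := (norm_nonneg _).trans (hM z₀ (Or.inr (mem_closedBall_self (by linarith))))
  have hfar : ∀ z ∈ closedBall z₀ (3 * r), ∀ w ∈ W, r ≤ ‖w - z‖ →
      ‖dslope h z w‖ ≤ (M + M) / r := fun z hz w hw hd => by
    have hne : w ≠ z := by rintro rfl; simp at hd; linarith
    rw [dslope_of_ne _ hne, slope_def_field, norm_div]
    gcongr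
    exact (norm_sub_le _ _).trans (add_le_add (hM w (Or.inl hw)) (hM z (Or.inr hz)))
  refine ⟨r, hr0, (M + M) / r,
    (ball_subset_closedBall.trans (closedBall_subset_closedBall (by linarith))).trans hball,
    fun z hz w hw => ?_⟩
  rw [mem_ball, dist_eq_norm] at hz
  by_cases hw2 : ‖w - z₀‖ < 2 * r
  · rw [dslope_comm]
    refine Complex.norm_le_of_forall_mem_frontier_norm_le (U := ball z₀ (3 * r)) isBounded_ball
      (f := dslope h w) ?_ (fun x hx => ?_) (subset_closure ?_)
    · refine DifferentiableOn.diffContOnCl_ball (U := Ω) ?_ hball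
      exact (Complex.differentiableOn_dslope (hΩ.mem_nhds (hWΩ hw))).2 hh
    · rw [frontier_ball _ (by positivity), mem_sphere, dist_eq_norm] at hx
      rw [dslope_comm]
      refine hfar x (by rw [mem_closedBall, dist_eq_norm]; exact hx.le) w hw ?_
      have := norm_sub_norm_le (x - z₀) (w - z₀)
      rw [sub_sub_sub_cancel_right, norm_sub_rev x w] at this
      linarith
    · rw [mem_ball, dist_eq_norm]; linarith
  · refine hfar z (by rw [mem_closedBall, dist_eq_norm]; linarith) w hw ?_
    have := norm_sub_norm_le (w - z₀) (z - z₀)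
    rw [sub_sub_sub_cancel_right] at this
    linarith

theorem chainIntegral_sub {k₁ k₂ : ℂ → ℂ} (h₁ : ContinuousOn k₁ (chainSupport l))
    (h₂ : ContinuousOn k₂ (chainSupport l)) :
    chainIntegral l (fun w => k₁ w - k₂ w) = chainIntegral l k₁ - chainIntegral l k₂ := by
  have key : ∀ l' : List (ℂ × ℂ), (∀ s ∈ l', s ∈ l) →
      chainIntegral l' (fun w => k₁ w - k₂ w) = chainIntegral l' k₁ - chainIntegral l' k₂ := by
    intro l'
    induction l' with
    | nil => simp [chainIntegral]
    | cons a l' ih =>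
      intro h'
      have ih' := ih fun s hs => h' s (by simp [hs])
      simp only [chainIntegral, List.map_cons, List.sum_cons] at ih' ⊢
      rw [ih']
      have hintg : ∀ k : ℂ → ℂ, ContinuousOn k (chainSupport l) → IntervalIntegrable
          (fun t => k (segPt a t) * (a.2 - a.1)) volume 0 1 := fun k hk => by
        refine ContinuousOn.intervalIntegrable_of_Icc zero_le_one
          (ContinuousOn.mul (hk.comp (by fun_prop) fun t ht => ?_) continuousOn_const)
        exact mem_chainSupport (h' a (by simp)) ht
      simp only [sub_mul]
      rw [intervalIntegral.integral_sub (hintg _ h₁) (hintg _ h₂)]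
      ring
  exact key l fun s hs => hs

theorem chainIntegral_mul_const {k : ℂ → ℂ} (c : ℂ) :
    chainIntegral l (fun w => c * k w) = c * chainIntegral l k := by
  simp only [chainIntegral, mul_assoc, intervalIntegral.integral_const_mul]
  rw [List.sum_map_mul_left]

theorem chainIntegral_congr {k₁ k₂ : ℂ → ℂ} (h : EqOn k₁ k₂ (chainSupport l)) :
    chainIntegral l k₁ = chainIntegral l k₂ := by
  unfold chainIntegral
  congr 1
  refine List.map_congr_left fun s hs => intervalIntegral.integral_congr fun t ht => ?_
  rw [uIcc_of_le zero_le_one] at ht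
  simp only [h (mem_chainSupport hs ht)]

/-- Dixon's proof of Cauchy's theorem for a bounded open set with connected complement. -/
theorem chainIntegral_eq_zero {Ω : Set ℂ} (hΩ : IsOpen Ω) (hb : Bornology.IsBounded Ω)
    (hpre : IsPreconnected Ωᶜ) (hne : Ω.Nonempty) (hh : DifferentiableOn ℂ h Ω)
    (hlΩ : ChainIn Ω l) (hl : ∀ F, chainBoundary l F = 0) : chainIntegral l h = 0 := by
  have hsub := chainSupport_subset hlΩ
  have hclosed := (isCompact_chainSupport l).isClosed
  set ind : ℂ → ℂ := fun z => chainIntegral l fun w => 1 / (w - z) with hind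
  have hindd : DifferentiableOn ℂ ind (chainSupport l)ᶜ :=
    differentiableOn_cauchyTransform (h := fun _ => 1) continuousOn_const
  have hind0 : ∀ z ∈ Ωᶜ, ind z = 0 := by
    intro z hz
    have hconst : ∀ w ∈ Ωᶜ, ind w = ind z := fun w hw => by
      have := sub_eq_sub_of_exp_eq hpre (g₁ := ind) (g₂ := fun _ => 0)
        (hindd.continuousOn.mono (compl_subset_compl.2 hsub)) continuousOn_const
        (fun x hx => by
          rw [Complex.exp_zero]; exact exp_chainIntegral_inv hl fun h => hx (hsub h)) hw hz
      simpa using this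
    have ht : Tendsto ind (cocompact ℂ) (𝓝 0) :=
      tendsto_cauchyTransform (h := fun _ => 1) continuousOn_const
    have hev : ind =ᶠ[cocompact ℂ] fun _ => ind z := by
      filter_upwards [hb.isCompact_closure.compl_mem_cocompact] with w hw
      exact hconst w fun h => hw (subset_closure h)
    exact tendsto_nhds_unique (tendsto_const_nhds.congr' hev.symm) ht
  set Z : Set ℂ := {z | z ∉ chainSupport l ∧ ind z = 0} with hZ
  have hZo : IsOpen Z := by
    rw [isOpen_iff_mem_nhds]
    rintro z ⟨hz, hz0⟩
    have hc : ContinuousAt ind z :=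
      (hindd.differentiableAt (hclosed.isOpen_compl.mem_nhds hz)).continuousAt
    have h1 : ∀ᶠ w in 𝓝 z, ‖ind w‖ < 1 := by
      have := hc.norm
      rw [ContinuousAt, hz0, norm_zero] at this
      exact this.eventually_lt_const one_pos
    filter_upwards [h1, hclosed.isOpen_compl.mem_nhds hz] with w hw hw'
    exact ⟨hw', eq_zero_of_exp_eq_one (exp_chainIntegral_inv hl hw') hw⟩
  obtain ⟨z₀, hz₀⟩ := hne
  set h₁ : ℂ → ℂ := fun w => h w * (w - z₀) with hh₁def
  have hh₁ : DifferentiableOn ℂ h₁ Ω := hh.mul (by fun_prop)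
  have hh₁c : ContinuousOn h₁ (chainSupport l) := hh₁.continuousOn.mono hsub
  set D : ℂ → ℂ := fun z => chainIntegral l fun w => dslope h₁ z w with hD
  set E : ℂ → ℂ := fun z => chainIntegral l fun w => h₁ w / (w - z) with hE
  have hDd : DifferentiableOn ℂ D Ω := by
    refine differentiableOn_list_sum l fun s hs => ?_
    refine differentiableOn_intervalIntegral hΩ (fun t ht => ?_) (fun z hz => ?_) (fun z hz => ?_)
    · refine DifferentiableOn.mul_const ?_ _
      simp only [dslope_comm h₁ _ (segPt s t)]
      exact (Complex.differentiableOn_dslope (hΩ.mem_nhds (hlΩ s hs t ht))).2 hh₁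
    · refine ContinuousOn.mul ?_ continuousOn_const
      exact ((continuousOn_dslope (hΩ.mem_nhds hz)).2 ⟨hh₁.continuousOn,
        hh₁.differentiableAt (hΩ.mem_nhds hz)⟩).comp (by fun_prop) (fun t ht => hlΩ s hs t ht)
    · obtain ⟨r, hr, C, hrΩ, hC⟩ := exists_bound_dslope hΩ hh₁ (isCompact_chainSupport l) hsub hz
      refine ⟨r, hr, C * ‖s.2 - s.1‖, hrΩ, fun z' hz' t ht => ?_⟩
      rw [norm_mul]
      gcongr
      exact hC z' hz' _ (mem_chainSupport hs ht)
  have hEd : DifferentiableOn ℂ E (chainSupport l)ᶜ := differentiableOn_cauchyTransform hh₁c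
  have hDE : ∀ z ∈ Z, D z = E z := by
    rintro z ⟨hz, hz0⟩
    have hne : ∀ w ∈ chainSupport l, w - z ≠ 0 := fun w hw h0 => hz (by
      rwa [← sub_eq_zero.1 h0])
    have h1 : D z = chainIntegral l fun w => h₁ w / (w - z) - h₁ z * (1 / (w - z)) := by
      refine chainIntegral_congr fun w hw => ?_
      have : w ≠ z := sub_ne_zero.1 (hne w hw)
      simp only [dslope_of_ne _ this, slope_def_field]
      ring
    rw [h1, chainIntegral_sub (k₁ := fun w => h₁ w / (w - z)) (k₂ := fun w => h₁ z * (1 / (w - z)))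
      (hh₁c.div (by fun_prop) hne)
      (continuousOn_const.mul (continuousOn_const.div (by fun_prop) hne)), chainIntegral_mul_const]
    change E z - h₁ z * ind z = E z
    rw [hz0]; ring
  classical
  set G : ℂ → ℂ := fun z => if z ∈ Ω then D z else E z with hG
  have hGE : EqOn G E Z := fun z hz => by
    by_cases h : z ∈ Ω
    · simp [hG, h, hDE z hz]
    · simp [hG, h]
  have hGd : Differentiable ℂ G := by
    intro z
    by_cases h : z ∈ Ω
    · refine (hDd.differentiableAt (hΩ.mem_nhds h)).congr_of_eventuallyEq ?_
      filter_upwards [hΩ.mem_nhds h] with w hw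
      simp [hG, hw]
    · have hzZ : z ∈ Z := ⟨fun h' => h (hsub h'), hind0 z h⟩
      refine (hEd.differentiableAt (hclosed.isOpen_compl.mem_nhds hzZ.1)).congr_of_eventuallyEq ?_
      filter_upwards [hZo.mem_nhds hzZ] with w hw using hGE hw
  have hGt : Tendsto G (cocompact ℂ) (𝓝 0) := by
    refine (tendsto_cauchyTransform hh₁c).congr' ?_
    filter_upwards [hb.isCompact_closure.compl_mem_cocompact] with w hw
    have : w ∉ Ω := fun h => hw (subset_closure h)
    simp [hG, this]; rfl
  have h0 := hGd.apply_eq_of_tendsto_cocompact z₀ hGt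
  simp only [hG, hz₀, if_true, hD] at h0
  rw [← h0]
  refine chainIntegral_congr fun w hw => ?_
  by_cases hw0 : w = z₀
  · rw [hw0, dslope_same]
    have h1 := (hh.differentiableAt (hΩ.mem_nhds hz₀)).hasDerivAt.mul
      ((hasDerivAt_id z₀).sub_const z₀)
    have := h1.deriv
    simp only [id, sub_self, mul_zero, mul_one, zero_add] at this
    exact this.symm
  · rw [dslope_of_ne _ hw0, slope_def_field]
    have : w - z₀ ≠ 0 := sub_ne_zero.2 hw0
    simp [hh₁def]; field_simp

theorem chainIntegral_append (l₁ l₂ : List (ℂ × ℂ)) (k : ℂ → ℂ) :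
    chainIntegral (l₁ ++ l₂) k = chainIntegral l₁ k + chainIntegral l₂ k := by
  simp [chainIntegral]

theorem chainBoundary_append (l₁ l₂ : List (ℂ × ℂ)) (F : ℂ → ℂ) :
    chainBoundary (l₁ ++ l₂) F = chainBoundary l₁ F + chainBoundary l₂ F := by
  simp [chainBoundary]

theorem segPt_swap (s : ℂ × ℂ) (t : ℝ) : segPt s.swap t = segPt s (1 - t) := by
  simp [segPt]; ring

theorem chainIntegral_swap (l : List (ℂ × ℂ)) (k : ℂ → ℂ) :
    chainIntegral (l.map Prod.swap) k = - chainIntegral l k := by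
  induction l with
  | nil => simp [chainIntegral]
  | cons a l ih =>
    simp only [chainIntegral, List.map_cons, List.sum_cons, segPt_swap] at ih ⊢
    rw [ih, neg_add]
    congr 1
    have := intervalIntegral.integral_comp_sub_left (a := 0) (b := 1)
      (fun t => k (segPt a t) * (a.swap.2 - a.swap.1)) 1
    simp only [sub_self, sub_zero] at this
    rw [this, ← intervalIntegral.integral_neg]
    simp only [Prod.fst_swap, Prod.snd_swap]
    congr 1
    ext t
    ring

theorem chainBoundary_swap (l : List (ℂ × ℂ)) (F : ℂ → ℂ) :
    chainBoundary (l.map Prod.swap) F = - chainBoundary l F := by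
  induction l with
  | nil => simp [chainBoundary]
  | cons a l ih =>
    simp only [chainBoundary, List.map_cons, List.sum_cons] at ih ⊢
    rw [ih]
    simp [add_comm]

/-- Every holomorphic function on `Ω` has a primitive. -/
def HasPrimitivesOn (Ω : Set ℂ) : Prop :=
  ∀ h : ℂ → ℂ, DifferentiableOn ℂ h Ω → ∃ P : ℂ → ℂ, ∀ z ∈ Ω, HasDerivAt P (h z) z

theorem hasPrimitivesOn_ball (c : ℂ) (r : ℝ) : HasPrimitivesOn (ball c r) :=
  fun _ hh => hh.isExactOn_ball

theorem segPt_mem_ball {c a b : ℂ} {r : ℝ} (ha : a ∈ ball c r) (hb : b ∈ ball c r) {t : ℝ}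
    (ht : t ∈ Icc (0:ℝ) 1) : segPt (a, b) t ∈ ball c r := by
  have := (convex_ball c r) ha hb (a := 1 - t) (b := t) (by linarith [ht.2]) ht.1 (by ring)
  convert this using 1
  simp [segPt]; ring

theorem exists_chain {Ω : Set ℂ} (hΩ : IsOpen Ω) (hpre : IsPreconnected Ω) {p : ℂ} (hp : p ∈ Ω)
    {z : ℂ} (hz : z ∈ Ω) : ∃ l, ChainIn Ω l ∧ ∀ F, chainBoundary l F = F z - F p := by
  set S : Set ℂ := {z | ∃ l, ChainIn Ω l ∧ ∀ F, chainBoundary l F = F z - F p} with hS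
  have step : ∀ c r, ball c r ⊆ Ω → ∀ a ∈ ball c r, ∀ b ∈ ball c r, a ∈ S → b ∈ S := by
    rintro c r hr a ha b hb ⟨l, hl, hlF⟩
    refine ⟨l ++ [(a, b)], fun s hs t ht => ?_, fun F => ?_⟩
    · rcases List.mem_append.1 hs with h | h
      · exact hl s h t ht
      · rw [List.mem_singleton] at h
        subst h
        exact hr (segPt_mem_ball ha hb ht)
    · rw [chainBoundary_append, hlF]; simp [chainBoundary]
  have hball : ∀ z ∈ Ω, ∃ r > 0, ball z r ⊆ Ω := Metric.isOpen_iff.1 hΩ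
  have h1 : IsOpen (Ω ∩ S) := by
    rw [Metric.isOpen_iff]
    rintro x ⟨hx, hxS⟩
    obtain ⟨r, hr, hrΩ⟩ := hball x hx
    exact ⟨r, hr, fun y hy => ⟨hrΩ hy, step x r hrΩ x (mem_ball_self hr) y hy hxS⟩⟩
  have h2 : IsOpen (Ω ∩ Sᶜ) := by
    rw [Metric.isOpen_iff]
    rintro x ⟨hx, hxS⟩
    obtain ⟨r, hr, hrΩ⟩ := hball x hx
    exact ⟨r, hr, fun y hy => ⟨hrΩ hy, fun h => hxS (step x r hrΩ y hy x (mem_ball_self hr) h)⟩⟩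
  have hpS : p ∈ S := ⟨[], by simp [ChainIn], by simp [chainBoundary]⟩
  exact (hpre.subset_left_of_subset_union h1 h2
    (Set.disjoint_left.2 fun x hx hx' => hx'.2 hx.2)
    (fun x hx => by
      by_cases h : x ∈ S
      · exact Or.inl ⟨hx, h⟩
      · exact Or.inr ⟨hx, h⟩) ⟨p, hp, hp, hpS⟩ hz).2

theorem hasPrimitivesOn_of_isPreconnected_compl {Ω : Set ℂ} (hΩ : IsOpen Ω)
    (hb : Bornology.IsBounded Ω) (hΩc : IsPreconnected Ω) (hpre : IsPreconnected Ωᶜ) :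
    HasPrimitivesOn Ω := by
  intro h hh
  rcases Ω.eq_empty_or_nonempty with rfl | ⟨p, hp⟩
  · exact ⟨h, by simp⟩
  choose! l hl using fun z (hz : z ∈ Ω) => exists_chain hΩ hΩc hp hz
  refine ⟨fun z => chainIntegral (l z) h, fun z hz => ?_⟩
  obtain ⟨r, hr, hrΩ⟩ := Metric.isOpen_iff.1 hΩ z hz
  obtain ⟨Q, hQ⟩ := hasPrimitivesOn_ball z r h (hh.mono hrΩ)
  have hzr := mem_ball_self (x := z) hr
  have key : ∀ w ∈ ball z r, chainIntegral (l w) h = chainIntegral (l z) h + (Q w - Q z) := by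
    intro w hw
    have hzw : ChainIn (ball z r) [(z, w)] := fun s hs t ht => by
      rw [List.mem_singleton] at hs
      subst hs
      exact segPt_mem_ball hzr hw ht
    have h0 := chainIntegral_eq_zero (l := l z ++ ([(z, w)] ++ (l w).map Prod.swap))
      hΩ hb hpre ⟨p, hp⟩ hh ?_ ?_
    · rw [chainIntegral_append, chainIntegral_append, chainIntegral_swap,
        chainIntegral_of_hasDerivAt hzw hQ (hh.continuousOn.mono hrΩ)] at h0
      simp only [chainBoundary, List.map_cons, List.map_nil, List.sum_cons, List.sum_nil,
        add_zero] at h0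
      linear_combination -h0
    · intro s hs t ht
      rcases List.mem_append.1 hs with h | h
      · exact (hl z hz).1 s h t ht
      rcases List.mem_append.1 h with h | h
      · exact hrΩ (hzw s h t ht)
      · obtain ⟨s', hs', rfl⟩ := List.mem_map.1 h
        rw [segPt_swap]
        exact (hl w (hrΩ hw)).1 s' hs' _ ⟨by linarith [ht.2], by linarith [ht.1]⟩
    · intro F
      rw [chainBoundary_append, chainBoundary_append, chainBoundary_swap, (hl z hz).2,
        (hl w (hrΩ hw)).2]
      simp [chainBoundary]
  have h1 : HasDerivAt (fun w => chainIntegral (l z) h + (Q w - Q z)) (h z) z :=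
    ((hQ z hzr).sub_const _).const_add _
  exact h1.congr_of_eventuallyEq (eventually_of_mem (ball_mem_nhds z hr) key)

theorem HasPrimitivesOn.exists_log {Ω : Set ℂ} (hP : HasPrimitivesOn Ω) (hΩ : IsOpen Ω)
    (hΩc : IsPreconnected Ω) {h : ℂ → ℂ} (hh : DifferentiableOn ℂ h Ω) (hne : ∀ z ∈ Ω, h z ≠ 0) :
    ∃ g, DifferentiableOn ℂ g Ω ∧ ∀ z ∈ Ω, exp (g z) = h z := by
  rcases Ω.eq_empty_or_nonempty with rfl | ⟨p, hp⟩
  · exact ⟨h, hh, by simp⟩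
  obtain ⟨P, hP⟩ := hP (fun z => deriv h z / h z) ((hh.deriv hΩ).div hh hne)
  have hd : ∀ z ∈ Ω, HasDerivAt (fun z => exp (-P z) * h z) 0 z := fun z hz => by
    have h1 := ((hP z hz).neg.cexp).mul ((hh.differentiableAt (hΩ.mem_nhds hz)).hasDerivAt)
    refine h1.congr_deriv ?_
    have h2 := div_mul_cancel₀ (deriv h z) (hne z hz)
    simp only [Pi.neg_apply]
    linear_combination -exp (-P z) * h2
  have hconst : ∀ z ∈ Ω, exp (-P z) * h z = exp (-P p) * h p := fun z hz =>
    hΩ.is_const_of_deriv_eq_zero hΩc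
      (fun z hz => (hd z hz).differentiableAt.differentiableWithinAt)
      (fun z hz => (hd z hz).deriv) hz hp
  refine ⟨fun z => P z + Complex.log (exp (-P p) * h p),
    fun z hz => ((hP z hz).differentiableAt.add_const _).differentiableWithinAt, fun z hz => ?_⟩
  rw [Complex.exp_add, Complex.exp_log (mul_ne_zero (exp_ne_zero _) (hne p hp)), ← hconst z hz,
    ← mul_assoc, ← Complex.exp_add]
  simp

theorem isPreconnected_compl_of_frontier {Ω : Set ℂ} (hΩ : IsOpen Ω)
    (hfr : IsPreconnected (frontier Ω)) (hne : (frontier Ω).Nonempty) :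
    IsPreconnected Ωᶜ := by
  have hsub : frontier Ω ⊆ Ωᶜ := fun z hz h => by
    rw [hΩ.frontier_eq] at hz; exact hz.2 h
  have key : ∀ t t' : Set ℂ, IsClosed t → IsClosed t' → Ωᶜ ⊆ t ∪ t' → frontier Ω ⊆ t →
      (Ωᶜ ∩ t').Nonempty → (Ωᶜ ∩ (t ∩ t')).Nonempty := by
    intro t t' ht ht' hcov hft hn
    by_contra hcon
    have hclopen : IsClopen (Ωᶜ ∩ t') := by
      refine ⟨hΩ.isClosed_compl.inter ht', ?_⟩
      have : Ωᶜ ∩ t' = (closure Ω ∪ t)ᶜ := by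
        ext z
        constructor
        · rintro ⟨h1, h2⟩ (h3 | h3)
          · rw [closure_eq_self_union_frontier] at h3
            rcases h3 with h3 | h3
            · exact h1 h3
            · exact hcon ⟨z, h1, hft h3, h2⟩
          · exact hcon ⟨z, h1, h3, h2⟩
        · intro hz
          rw [mem_compl_iff, mem_union, not_or] at hz
          have h1 : z ∈ Ωᶜ := fun h => hz.1 (subset_closure h)
          exact ⟨h1, (hcov h1).resolve_left hz.2⟩
      rw [this]
      exact (isClosed_closure.union ht).isOpen_compl
    have := hclopen.eq_univ hn
    obtain ⟨x, hx⟩ := hne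
    exact hcon ⟨x, hsub hx, hft hx, (this.symm ▸ mem_univ x : x ∈ Ωᶜ ∩ t').2⟩
  rw [isPreconnected_closed_iff]
  intro t t' ht ht' hcov hn hn'
  rw [isPreconnected_closed_iff] at hfr
  by_cases h1 : frontier Ω ⊆ t
  · exact key t t' ht ht' hcov h1 hn'
  by_cases h2 : frontier Ω ⊆ t'
  · rw [inter_comm t t']
    exact key t' t ht' ht (by rwa [union_comm]) h2 hn
  obtain ⟨x, hx, hxt⟩ := not_subset.1 h1
  obtain ⟨y, hy, hyt⟩ := not_subset.1 h2
  obtain ⟨z, hz, hz'⟩ := hfr t t' ht ht' (hsub.trans hcov)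
    ⟨y, hy, (hcov (hsub hy)).resolve_right hyt⟩ ⟨x, hx, (hcov (hsub hx)).resolve_left hxt⟩
  exact ⟨z, hsub hz, hz'⟩

end Cauchy

theorem eventually_ne_of_injOn {Ω : Set ℂ} (hΩ : IsOpen Ω) {φ : ℂ → ℂ} (hi : InjOn φ Ω) {z : ℂ}
    (hz : z ∈ Ω) : ∃ᶠ w in 𝓝 z, φ w ≠ φ z := by
  have h1 : ∀ᶠ w in 𝓝[≠] z, φ w ≠ φ z := by
    filter_upwards [self_mem_nhdsWithin, mem_nhdsWithin_of_mem_nhds (hΩ.mem_nhds hz)] with w hw hw'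
    exact fun h => hw (hi hw' hz h)
  exact h1.frequently.filter_mono nhdsWithin_le_nhds

theorem nhds_le_map_of_injOn {Ω : Set ℂ} (hΩ : IsOpen Ω) {φ : ℂ → ℂ}
    (hd : DifferentiableOn ℂ φ Ω) (hi : InjOn φ Ω) {z : ℂ}
    (hz : z ∈ Ω) : 𝓝 (φ z) ≤ map φ (𝓝 z) :=
  ((hd.analyticAt (hΩ.mem_nhds hz)).eventually_constant_or_nhds_le_map_nhds).resolve_left
    fun h => (eventually_ne_of_injOn hΩ hi hz) (h.mono fun _ h => not_not.2 h)

theorem isOpen_image_of_injOn {Ω : Set ℂ} (hΩ : IsOpen Ω) {φ : ℂ → ℂ}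
    (hd : DifferentiableOn ℂ φ Ω) (hi : InjOn φ Ω) : IsOpen (φ '' Ω) := by
  rw [isOpen_iff_mem_nhds]
  rintro _ ⟨z, hz, rfl⟩
  exact nhds_le_map_of_injOn hΩ hd hi hz (image_mem_map (hΩ.mem_nhds hz))

theorem invFunOn_apply {Ω : Set ℂ} {φ : ℂ → ℂ} (hi : InjOn φ Ω) {z : ℂ} (hz : z ∈ Ω) :
    Function.invFunOn φ Ω (φ z) = z := hi.leftInvOn_invFunOn hz

theorem continuousAt_invFunOn {Ω : Set ℂ} (hΩ : IsOpen Ω) {φ : ℂ → ℂ}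
    (hd : DifferentiableOn ℂ φ Ω) (hi : InjOn φ Ω) {z : ℂ} (hz : z ∈ Ω) :
    ContinuousAt (Function.invFunOn φ Ω) (φ z) := by
  rw [ContinuousAt, invFunOn_apply hi hz]
  refine (tendsto_map'_iff.2 ?_).mono_left (nhds_le_map_of_injOn hΩ hd hi hz)
  refine tendsto_id.congr' ?_
  filter_upwards [hΩ.mem_nhds hz] with w hw
  exact (invFunOn_apply hi hw).symm

/-- The inverse of an injective holomorphic function is holomorphic. -/
theorem differentiableOn_invFunOn {Ω : Set ℂ} (hΩ : IsOpen Ω) {φ : ℂ → ℂ}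
    (hd : DifferentiableOn ℂ φ Ω) (hi : InjOn φ Ω) :
    DifferentiableOn ℂ (Function.invFunOn φ Ω) (φ '' Ω) := by
  have hO := isOpen_image_of_injOn hΩ hd hi
  have reg : ∀ z ∈ Ω, deriv φ z ≠ 0 → DifferentiableAt ℂ (Function.invFunOn φ Ω) (φ z) := by
    intro z hz hne
    refine (HasDerivAt.of_local_left_inverse (f := φ) (f' := deriv φ z)
      (continuousAt_invFunOn hΩ hd hi hz) ?_ hne ?_).differentiableAt
    · rw [invFunOn_apply hi hz]
      exact (hd.differentiableAt (hΩ.mem_nhds hz)).hasDerivAt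
    · filter_upwards [hO.mem_nhds (mem_image_of_mem φ hz)] with w hw
      exact Function.invFunOn_eq hw
  rintro _ ⟨z, hz, rfl⟩
  have han : AnalyticAt ℂ (deriv φ) z := (hd.analyticAt (hΩ.mem_nhds hz)).deriv
  rcases han.eventually_eq_zero_or_eventually_ne_zero with h | h
  · exfalso
    have h2 : ∀ᶠ w in 𝓝 z, φ w = φ z := by
      obtain ⟨r, hr, hr'⟩ := Metric.eventually_nhds_iff_ball.1 (h.and (hΩ.mem_nhds hz))
      refine Metric.eventually_nhds_iff_ball.2 ⟨r, hr, fun w hw => ?_⟩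
      exact isOpen_ball.is_const_of_deriv_eq_zero (convex_ball z r).isPreconnected
        (hd.mono fun w hw => (hr' w hw).2) (fun w hw => (hr' w hw).1) hw (mem_ball_self hr)
    exact (eventually_ne_of_injOn hΩ hi hz) (h2.mono fun _ h => not_not.2 h)
  · rw [eventually_nhdsWithin_iff] at h
    have h1 := (h.and (hΩ.mem_nhds hz))
    have h2 : φ '' {w | (w ∈ ({z}ᶜ : Set ℂ) → deriv φ w ≠ 0) ∧ w ∈ Ω} ∈ 𝓝 (φ z) :=
      nhds_le_map_of_injOn hΩ hd hi hz (image_mem_map h1)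
    refine (((differentiableOn_compl_singleton_and_continuousAt_iff h2).1
      ⟨?_, continuousAt_invFunOn hΩ hd hi hz⟩).differentiableAt h2).differentiableWithinAt
    rintro _ ⟨⟨w, ⟨hw, hw'⟩, rfl⟩, hne⟩
    refine (reg w hw' (hw fun h => hne ?_)).differentiableWithinAt
    rw [mem_singleton_iff] at h ⊢
    rw [h]

theorem deriv_mul_deriv_invFunOn {Ω : Set ℂ} (hΩ : IsOpen Ω) {φ : ℂ → ℂ}
    (hd : DifferentiableOn ℂ φ Ω) (hi : InjOn φ Ω) {z : ℂ} (hz : z ∈ Ω) :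
    deriv (Function.invFunOn φ Ω) (φ z) * deriv φ z = 1 := by
  have h1 := ((differentiableOn_invFunOn hΩ hd hi).differentiableAt
    ((isOpen_image_of_injOn hΩ hd hi).mem_nhds (mem_image_of_mem φ hz))).hasDerivAt
  have h2 := h1.comp z (hd.differentiableAt (hΩ.mem_nhds hz)).hasDerivAt
  have h3 : HasDerivAt (Function.invFunOn φ Ω ∘ φ) 1 z := by
    refine (hasDerivAt_id z).congr_of_eventuallyEq ?_
    filter_upwards [hΩ.mem_nhds hz] with w hw
    exact invFunOn_apply hi hw
  exact h2.unique h3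

theorem deriv_ne_zero_of_injOn {Ω : Set ℂ} (hΩ : IsOpen Ω) {φ : ℂ → ℂ}
    (hd : DifferentiableOn ℂ φ Ω) (hi : InjOn φ Ω) {z : ℂ} (hz : z ∈ Ω) : deriv φ z ≠ 0 :=
  fun h => by simpa [h] using deriv_mul_deriv_invFunOn hΩ hd hi hz

/-- Montel's theorem. -/
theorem exists_tendstoLocallyUniformlyOn {Ω : Set ℂ} (hΩ : IsOpen Ω) {φ : ℕ → ℂ → ℂ}
    (hd : ∀ n, DifferentiableOn ℂ (φ n) Ω) (hm : ∀ n, MapsTo (φ n) Ω (closedBall 0 1)) :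
    ∃ (U : Ultrafilter ℕ) (g : ℂ → ℂ), ↑U ≤ (atTop : Filter ℕ) ∧
      TendstoLocallyUniformlyOn φ g U Ω ∧ MapsTo g Ω (closedBall 0 1) := by
  obtain ⟨U, hU⟩ := Ultrafilter.exists_le (atTop : Filter ℕ)
  have hlim : ∀ z ∈ Ω, ∃ g ∈ closedBall (0:ℂ) 1, Tendsto (fun n => φ n z) U (𝓝 g) := by
    intro z hz
    obtain ⟨g, hg, hg'⟩ := (isCompact_closedBall (0:ℂ) 1).ultrafilter_le_nhds
      (U.map fun n => φ n z) (by
        rw [le_principal_iff]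
        exact Eventually.of_forall (f := (U : Filter ℕ)) fun n => hm n hz)
    exact ⟨g, hg, hg'⟩
  choose! g hg hg' using hlim
  refine ⟨U, g, hU, ?_, hg⟩
  rw [Metric.tendstoLocallyUniformlyOn_iff]
  intro ε hε z hz
  obtain ⟨r, hr, hrΩ⟩ := Metric.isOpen_iff.1 hΩ z hz
  have hlip : ∀ n, ∀ w ∈ ball z r, dist (φ n w) (φ n z) ≤ 2 / r * dist w z := by
    intro n w hw
    refine dist_le_div_mul_dist_of_mapsTo_ball ((hd n).mono hrΩ) (fun v hv => ?_) hw
    have h1 := hm n (hrΩ hv)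
    have h2 := hm n hz
    rw [mem_closedBall] at h1 h2 ⊢
    linarith [dist_triangle_right (φ n v) (φ n z) 0]
  set δ := min r (r * ε / 8)
  have hδ : 0 < δ := by positivity
  refine ⟨ball z δ, mem_nhdsWithin_of_mem_nhds (ball_mem_nhds z hδ), ?_⟩
  have h3 : ∀ w ∈ ball z δ, ∀ n, dist (φ n w) (φ n z) ≤ ε / 4 := by
    intro w hw n
    have hw' : dist w z < δ := hw
    refine (hlip n w (ball_subset_ball (min_le_left _ _) hw)).trans ?_
    have : dist w z ≤ r * ε / 8 := hw'.le.trans (min_le_right _ _)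
    calc 2 / r * dist w z ≤ 2 / r * (r * ε / 8) := by gcongr
      _ = ε / 4 := by field_simp; norm_num
  filter_upwards [(Metric.tendsto_nhds.1 (hg' z hz)) (ε / 4) (by positivity)] with n hn w hw
  have h4 : dist (g w) (g z) ≤ ε / 4 :=
    le_of_tendsto ((hg' w (hrΩ (ball_subset_ball (min_le_left _ _) hw))).dist (hg' z hz))
      (Eventually.of_forall (h3 w hw))
  have h5 := h3 w hw n
  have := dist_triangle4 (g w) (g z) (φ n z) (φ n w)
  rw [dist_comm (g z), dist_comm (φ n z) (φ n w)] at this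
  linarith

/-- Hurwitz's theorem. -/
theorem injOn_of_tendstoLocallyUniformlyOn {Ω : Set ℂ} (hΩ : IsOpen Ω) (hΩc : IsPreconnected Ω)
    {ι : Type*} {l : Filter ι} [l.NeBot] {φ : ι → ℂ → ℂ} {g : ℂ → ℂ}
    (hd : ∀ n, DifferentiableOn ℂ (φ n) Ω) (hi : ∀ n, InjOn (φ n) Ω)
    (hl : TendstoLocallyUniformlyOn φ g l Ω) (hg : ∃ z ∈ Ω, deriv g z ≠ 0) : InjOn g Ω := by
  have hgd : DifferentiableOn ℂ g Ω := hl.differentiableOn (Eventually.of_forall hd) hΩ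
  have hgan : AnalyticOnNhd ℂ g Ω := hgd.analyticOnNhd hΩ
  intro a ha b hb hab
  by_contra hne
  have hev : ∀ᶠ z in 𝓝[≠] b, g z ≠ g b := by
    rcases (hgan b hb).eventually_eq_or_eventually_ne analyticAt_const (g :=
        fun _ => g b) with h | h
    · exfalso
      obtain ⟨z, hz, hz'⟩ := hg
      have := hgan.eqOn_of_preconnected_of_eventuallyEq (g := fun _ => g b)
        (fun _ _ => analyticAt_const) hΩc hb h
      apply hz'
      rw [(this.eventuallyEq_of_mem (hΩ.mem_nhds hz)).deriv_eq]
      simp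
    · exact h
  rw [eventually_nhdsWithin_iff] at hev
  obtain ⟨r, hr, hr'⟩ := Metric.eventually_nhds_iff_ball.1
    ((hev.and (hΩ.mem_nhds hb)).and (isOpen_ne.mem_nhds (Ne.symm hne : b ≠ a)))
  set s := r / 2
  have hs : 0 < s := by positivity
  have hsub : closedBall b s ⊆ ball b r := closedBall_subset_ball (by simp only [s]; linarith)
  have hcont : ContinuousOn (fun z => ‖g z - g b‖) (sphere b s) := by
    refine ContinuousOn.norm (ContinuousOn.sub (hgd.continuousOn.mono fun z hz =>
      (hr' z (hsub (sphere_subset_closedBall hz))).1.2) continuousOn_const)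
  obtain ⟨z₀, hz₀, hmin⟩ := (isCompact_sphere b s).exists_isMinOn
    (NormedSpace.sphere_nonempty.2 hs.le) hcont
  set m := ‖g z₀ - g b‖
  have hm : 0 < m := norm_pos_iff.2 (sub_ne_zero.2
    ((hr' z₀ (hsub (sphere_subset_closedBall hz₀))).1.1 (ne_of_mem_sphere hz₀ hs.ne')))
  have hunif := (tendstoLocallyUniformlyOn_iff_forall_isCompact hΩ).1 hl (closedBall b s)
    (fun z hz => (hr' z (hsub hz)).1.2) (isCompact_closedBall b s)
  have h1 := (Metric.tendstoUniformlyOn_iff.1 hunif) (m / 8) (by positivity)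
  have h2 := (Metric.tendsto_nhds.1 (hl.tendsto_at ha)) (m / 8) (by positivity)
  obtain ⟨n, hn1, hn2⟩ := (h1.and h2).exists
  have hΩs : closedBall b s ⊆ Ω := fun z hz => (hr' z (hsub hz)).1.2
  have h3 : ∀ z ∈ sphere b s, m / 2 ≤ ‖φ n z - φ n b‖ := by
    intro z hz
    have h4 := hn1 z (sphere_subset_closedBall hz)
    have h5 := hn1 b (mem_closedBall_self hs.le)
    have h6 : m ≤ ‖g z - g b‖ := hmin hz
    rw [dist_eq_norm] at h4 h5
    have h7 := norm_add₃_le (a := g z - φ n z) (b := φ n z - φ n b) (c := φ n b - g b)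
    rw [show g z - φ n z + (φ n z - φ n b) + (φ n b - g b) = g z - g b by ring,
      norm_sub_rev (φ n b) (g b)] at h7
    linarith
  have h8 := DiffContOnCl.ball_subset_image_closedBall (f := φ n) (z₀ := b) (r := s) (ε := m / 2)
    (DifferentiableOn.diffContOnCl (by
      rw [closure_ball b hs.ne']; exact (hd n).mono hΩs)) hs h3
    (eventually_ne_of_injOn hΩ (hi n) hb)
  have h9 : φ n a ∈ ball (φ n b) (m / 2 / 2) := by
    have h5 := hn1 b (mem_closedBall_self hs.le)
    rw [mem_ball]
    have := dist_triangle (φ n a) (g a) (φ n b)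
    rw [hab] at this hn2
    linarith
  obtain ⟨c, hc, hc'⟩ := h8 h9
  have := hi n (hΩs hc) ha hc'
  exact (hr' c (hsub hc)).2 this


/-- The disk automorphism exchanging `a` and `0`. -/
noncomputable def diskMap (a z : ℂ) : ℂ := (a - z) / (1 - (starRingEnd ℂ) a * z)

theorem diskMap_denom_ne_zero {a z : ℂ} (ha : a ∈ ball (0:ℂ) 1) (hz : z ∈ closedBall (0:ℂ) 1) :
    1 - (starRingEnd ℂ) a * z ≠ 0 := by
  rw [mem_ball_zero_iff] at ha
  rw [mem_closedBall_zero_iff] at hz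
  intro h
  have h1 : ‖(starRingEnd ℂ) a * z‖ = 1 := by rw [← sub_eq_zero.1 h]; simp
  rw [norm_mul, RCLike.norm_conj] at h1
  nlinarith [norm_nonneg a, norm_nonneg z]

theorem normSq_one_sub_conj_mul (a z : ℂ) :
    ‖1 - (starRingEnd ℂ) a * z‖ ^ 2 - ‖a - z‖ ^ 2 = (1 - ‖a‖ ^ 2) * (1 - ‖z‖ ^ 2) := by
  simp only [← normSq_eq_norm_sq, normSq_apply, sub_re, sub_im, one_re, one_im, mul_re, mul_im,
    conj_re, conj_im]
  ring

theorem diskMap_mem_ball {a z : ℂ} (ha : a ∈ ball (0:ℂ) 1) (hz : z ∈ ball (0:ℂ) 1) :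
    diskMap a z ∈ ball (0:ℂ) 1 := by
  have h0 := diskMap_denom_ne_zero ha (ball_subset_closedBall hz)
  have h1 := normSq_one_sub_conj_mul a z
  rw [mem_ball_zero_iff] at *
  rw [diskMap, norm_div, div_lt_one (norm_pos_iff.2 h0)]
  have h2 : 0 < (1 - ‖a‖ ^ 2) * (1 - ‖z‖ ^ 2) := by
    apply mul_pos <;> nlinarith [norm_nonneg a, norm_nonneg z]
  exact lt_of_pow_lt_pow_left₀ 2 (norm_nonneg _) (by linarith)

theorem diskMap_diskMap {a z : ℂ} (ha : a ∈ ball (0:ℂ) 1) (hz : z ∈ closedBall (0:ℂ) 1) :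
    diskMap a (diskMap a z) = z := by
  have h0 := diskMap_denom_ne_zero ha hz
  have h1 := diskMap_denom_ne_zero ha (ball_subset_closedBall ha)
  have h2 : 1 - (starRingEnd ℂ) a * ((a - z) / (1 - (starRingEnd ℂ) a * z)) =
      (1 - (starRingEnd ℂ) a * a) / (1 - (starRingEnd ℂ) a * z) := by
    rw [eq_div_iff h0, sub_mul, mul_assoc, div_mul_cancel₀ _ h0]; ring
  rw [diskMap, diskMap, h2, div_eq_iff (div_ne_zero h1 h0)]
  rw [sub_eq_iff_eq_add, ← mul_div_assoc, ← add_div, eq_div_iff h0]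
  ring

theorem diskMap_injOn {a : ℂ} (ha : a ∈ ball (0:ℂ) 1) : InjOn (diskMap a) (closedBall 0 1) :=
  fun z hz w hw h => by rw [← diskMap_diskMap ha hz, h, diskMap_diskMap ha hw]

@[simp] theorem diskMap_self (a : ℂ) : diskMap a a = 0 := by simp [diskMap]

@[simp] theorem diskMap_zero (a : ℂ) : diskMap a 0 = a := by simp [diskMap]

theorem hasDerivAt_diskMap {a z : ℂ} (ha : a ∈ ball (0:ℂ) 1) (hz : z ∈ closedBall (0:ℂ) 1) :
    HasDerivAt (diskMap a) (-(1 - ‖a‖ ^ 2) / (1 - (starRingEnd ℂ) a * z) ^ 2) z := by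
  have h0 := diskMap_denom_ne_zero ha hz
  have h1 := ((hasDerivAt_id z).const_sub a).div
    (((hasDerivAt_id z).const_mul ((starRingEnd ℂ) a)).const_sub 1) h0
  refine h1.congr_deriv ?_
  congr 1
  rw [← conj_mul' a]
  simp only [id]
  ring

theorem differentiableOn_diskMap {a : ℂ} (ha : a ∈ ball (0:ℂ) 1) :
    DifferentiableOn ℂ (diskMap a) (closedBall 0 1) :=
  fun _ hz => (hasDerivAt_diskMap ha hz).differentiableAt.differentiableWithinAt

/-- The square root step: a holomorphic injection into the disk which is not onto can be
improved. -/
theorem exists_larger_deriv {Ω : Set ℂ} (hΩ : IsOpen Ω) (hΩc : IsPreconnected Ω)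
    (hP : HasPrimitivesOn Ω) {p : ℂ} (hp : p ∈ Ω) {φ : ℂ → ℂ} (hd : DifferentiableOn ℂ φ Ω)
    (hi : InjOn φ Ω) (hm : MapsTo φ Ω (ball 0 1)) (hφp : φ p = 0) {a : ℂ} (ha : a ∈ ball (0:ℂ) 1)
    (hna : a ∉ φ '' Ω) :
    ∃ ψ : ℂ → ℂ, DifferentiableOn ℂ ψ Ω ∧ InjOn ψ Ω ∧ MapsTo ψ Ω (ball 0 1) ∧ ψ p = 0 ∧
      ‖deriv φ p‖ < ‖deriv ψ p‖ := by
  have hm' : MapsTo φ Ω (closedBall 0 1) := fun z hz => ball_subset_closedBall (hm hz)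
  have hcd : DifferentiableOn ℂ (fun z => diskMap a (φ z)) Ω :=
    (differentiableOn_diskMap ha).comp hd hm'
  obtain ⟨g, hg, hge⟩ := hP.exists_log hΩ hΩc hcd (fun z hz h => hna ⟨z, hz, by
    refine diskMap_injOn ha (hm' hz) (ball_subset_closedBall ha) ?_
    rw [h, diskMap_self]⟩)
  set s : ℂ → ℂ := fun z => exp (g z / 2) with hs
  have hs2 : ∀ z ∈ Ω, s z ^ 2 = diskMap a (φ z) := fun z hz => by
    rw [hs, ← hge z hz, ← exp_nat_mul]
    congr 1
    push_cast
    ring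
  have hsm : ∀ z ∈ Ω, s z ∈ ball (0:ℂ) 1 := fun z hz => by
    have := diskMap_mem_ball ha (hm hz)
    rw [← hs2 z hz, mem_ball_zero_iff, norm_pow] at this
    rw [mem_ball_zero_iff]
    exact lt_of_pow_lt_pow_left₀ 2 zero_le_one (by simpa using this)
  have hsm' : ∀ z ∈ Ω, s z ∈ closedBall (0:ℂ) 1 := fun z hz => ball_subset_closedBall (hsm z hz)
  have hsd : DifferentiableOn ℂ s Ω := (hg.div_const 2).cexp
  set b := s p with hb
  have hb1 := hsm p hp
  have hb0 : b ≠ 0 := exp_ne_zero _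
  refine ⟨fun z => diskMap b (s z), (differentiableOn_diskMap hb1).comp hsd hsm', ?_,
    fun z hz => diskMap_mem_ball hb1 (hsm z hz), diskMap_self b, ?_⟩
  · intro z hz w hw h
    have h1 : s z = s w := diskMap_injOn hb1 (hsm' z hz) (hsm' w hw) h
    exact hi hz hw (diskMap_injOn ha (hm' hz) (hm' hw) (by rw [← hs2 z hz, ← hs2 w hw, h1]))
  have hpn := hΩ.mem_nhds hp
  have hφd := (hd.differentiableAt hpn).hasDerivAt
  have hsd' := (hsd.differentiableAt hpn).hasDerivAt
  have hab : b ^ 2 = a := by rw [hs2 p hp, hφp, diskMap_zero]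
  have e1 : HasDerivAt (fun z => s z ^ 2) (-(1 - ‖a‖ ^ 2) * deriv φ p) p := by
    have h1 := (hasDerivAt_diskMap ha (hm' hp)).comp p hφd
    refine (h1.congr_of_eventuallyEq ?_).congr_deriv ?_
    · filter_upwards [hpn] with z hz using hs2 z hz
    · simp [hφp]
  have e2 := e1.unique (hsd'.pow 2)
  have e3 := ((hasDerivAt_diskMap hb1 (hsm' p hp)).comp p hsd').deriv
  rw [Function.comp_def] at e3
  rw [e3]
  have hbn : 0 < ‖b‖ := norm_pos_iff.2 hb0
  have hbn1 : ‖b‖ < 1 := by simpa using hb1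
  have hφ0 : 0 < ‖deriv φ p‖ := norm_pos_iff.2 (deriv_ne_zero_of_injOn hΩ hd hi hp)
  have e4 : (1 - ‖b‖ ^ 4) * ‖deriv φ p‖ = 2 * ‖b‖ * ‖deriv s p‖ := by
    have := congrArg norm e2
    rw [← hab] at this
    simp only [norm_mul, norm_neg, norm_pow] at this
    have h5 : ‖(1:ℂ) - ((‖b‖ ^ 2 : ℝ) : ℂ) ^ 2‖ = 1 - ‖b‖ ^ 4 := by
      rw [← ofReal_pow, ← ofReal_one, ← ofReal_sub, norm_real, Real.norm_of_nonneg]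
      · ring
      · have : ‖b‖ ^ 2 < 1 := by nlinarith
        nlinarith
    rw [h5] at this
    simpa using this
  have e5 : ‖-(1 - (‖b‖:ℂ) ^ 2) / (1 - (starRingEnd ℂ) b * s p) ^ 2‖ = 1 / (1 - ‖b‖ ^ 2) := by
    rw [← hb, conj_mul', norm_div, norm_neg, norm_pow]
    have : ‖(1:ℂ) - (‖b‖:ℂ) ^ 2‖ = 1 - ‖b‖ ^ 2 := by
      rw [← ofReal_pow, ← ofReal_one, ← ofReal_sub, norm_real, Real.norm_of_nonneg]
      nlinarith
    have h8 : 1 - ‖b‖ ^ 2 ≠ 0 := by nlinarith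
    rw [this]
    field_simp
  rw [norm_mul, e5, one_div, inv_mul_eq_div, lt_div_iff₀ (by nlinarith)]
  have h6 : 0 < 1 - ‖b‖ := by linarith
  have : 2 * ‖b‖ * (‖deriv φ p‖ * (1 - ‖b‖ ^ 2)) < 2 * ‖b‖ * ‖deriv s p‖ := by
    rw [← e4]
    have h7 : 0 < (1 - ‖b‖) ^ 2 * ((1 - ‖b‖ ^ 2) * ‖deriv φ p‖) := by
      have : 0 < 1 - ‖b‖ ^ 2 := by nlinarith
      positivity
    nlinarith
  exact lt_of_mul_lt_mul_left this (by positivity)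

/-- The Riemann mapping theorem for bounded domains on which holomorphic functions have
primitives. -/
theorem exists_riemann_map {Ω : Set ℂ} (hΩ : IsOpen Ω) (hΩc : IsPreconnected Ω)
    (hb : Bornology.IsBounded Ω) (hP : HasPrimitivesOn Ω) {p : ℂ} (hp : p ∈ Ω) :
    ∃ Φ : ℂ → ℂ, DifferentiableOn ℂ Φ (ball 0 1) ∧ InjOn Φ (ball 0 1) ∧ Φ '' ball 0 1 = Ω ∧
      Φ 0 = p := by
  set 𝓕 : Set (ℂ → ℂ) := {φ | DifferentiableOn ℂ φ Ω ∧ InjOn φ Ω ∧ MapsTo φ Ω (ball 0 1) ∧ φ p = 0}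
    with h𝓕
  obtain ⟨R, hR, hR'⟩ := hb.subset_ball_lt 0 p
  have hne : (fun z => (z - p) / R) ∈ 𝓕 := by
    refine ⟨by fun_prop, fun z hz w hw h => ?_, fun z hz => ?_, by simp⟩
    · have : (R:ℂ) ≠ 0 := by exact_mod_cast hR.ne'
      simpa [div_left_inj' this] using h
    · have := hR' hz
      rw [mem_ball_iff_norm] at this
      rw [mem_ball_zero_iff, norm_div, norm_real, Real.norm_of_nonneg hR.le, div_lt_one hR]
      exact this
  obtain ⟨r, hr, hrΩ⟩ := Metric.isOpen_iff.1 hΩ p hp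
  have hbd : BddAbove ((fun φ : ℂ → ℂ => ‖deriv φ p‖) '' 𝓕) := by
    refine ⟨1 / r, ?_⟩
    rintro _ ⟨φ, ⟨h1, h2, h3, h4⟩, rfl⟩
    refine norm_deriv_le_div_of_mapsTo_ball (h1.mono hrΩ) (fun z hz => ?_) hr
    rw [h4]
    exact ball_subset_closedBall (h3 (hrΩ hz))
  set M := sSup ((fun φ : ℂ → ℂ => ‖deriv φ p‖) '' 𝓕)
  have hM : 0 < M := lt_of_lt_of_le (norm_pos_iff.2
    (deriv_ne_zero_of_injOn hΩ hne.1 hne.2.1 hp)) (le_csSup hbd (mem_image_of_mem _ hne))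
  obtain ⟨u, -, hu, hu'⟩ := exists_seq_tendsto_sSup (⟨_, mem_image_of_mem _ hne⟩ :
    ((fun φ : ℂ → ℂ => ‖deriv φ p‖) '' 𝓕).Nonempty) hbd
  choose φ hφ hφu using hu'
  obtain ⟨U, g, hU, hlim, hgm⟩ := exists_tendstoLocallyUniformlyOn hΩ (fun n => (hφ n).1)
    (fun n z hz => ball_subset_closedBall ((hφ n).2.2.1 hz))
  have hgd : DifferentiableOn ℂ g Ω := hlim.differentiableOn (Eventually.of_forall fun n =>
      (hφ n).1) hΩ
  have hgM : ‖deriv g p‖ = M := by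
    have h1 := (hlim.deriv (Eventually.of_forall fun n => (hφ n).1) hΩ).tendsto_at hp
    refine tendsto_nhds_unique h1.norm ?_
    refine (hu.mono_left hU).congr fun n => ?_
    exact (hφu n).symm
  have hg0 : deriv g p ≠ 0 := norm_pos_iff.1 (hgM ▸ hM)
  have hgi : InjOn g Ω := injOn_of_tendstoLocallyUniformlyOn hΩ hΩc (fun n => (hφ n).1)
    (fun n => (hφ n).2.1) hlim ⟨p, hp, hg0⟩
  have hgp : g p = 0 := by
    refine tendsto_nhds_unique (hlim.tendsto_at hp) ?_
    exact tendsto_const_nhds.congr fun n => ((hφ n).2.2.2).symm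
  have hO := isOpen_image_of_injOn hΩ hgd hgi
  have hgm' : g '' Ω ⊆ ball 0 1 := by
    rw [← interior_closedBall (0:ℂ) one_ne_zero]
    exact interior_maximal hgm.image_subset hO
  have hsurj : g '' Ω = ball 0 1 := by
    refine hgm'.antisymm fun a ha => ?_
    by_contra hna
    obtain ⟨ψ, h1, h2, h3, h4, h5⟩ := exists_larger_deriv hΩ hΩc hP hp hgd hgi
      (mapsTo_iff_image_subset.2 hgm') hgp ha hna
    rw [hgM] at h5
    exact absurd (le_csSup hbd (mem_image_of_mem (fun φ : ℂ → ℂ => ‖deriv φ p‖)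
      (show ψ ∈ 𝓕 from ⟨h1, h2, h3, h4⟩))) (not_le.2 h5)
  refine ⟨Function.invFunOn g Ω, ?_, ?_, ?_, ?_⟩
  · rw [← hsurj]; exact differentiableOn_invFunOn hΩ hgd hgi
  · rw [← hsurj]; exact Function.invFunOn_injOn_image g Ω
  · rw [← hsurj, image_image]
    exact (image_congr fun z hz => invFunOn_apply hgi hz).trans (image_id' Ω)
  · rw [← hgp]; exact invFunOn_apply hgi hp

theorem ofReal_norm_sub_le_lintegral {E : Type*} [NormedAddCommGroup E] [NormedSpace ℝ E]
    [CompleteSpace E] {u : ℝ → E} {s t c : ℝ} (hst : s ≤ t) (hc : 0 < c)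
    (hu : ContinuousOn u (Icc s t)) (hd : DifferentiableOn ℝ u (Ioo s t)) :
    ENNReal.ofReal ‖u t - u s‖ ≤ ENNReal.ofReal (c / 2) *
      (∫⁻ τ in Ioo s t, ENNReal.ofReal (‖deriv u τ‖ ^ 2)) + ENNReal.ofReal ((t - s) / (2 * c)) := by
  set G : ℝ → ENNReal := fun τ => ENNReal.ofReal (‖deriv u τ‖ ^ 2)
  rcases eq_or_ne (∫⁻ τ in Ioo s t, G τ) ⊤ with hG | hG
  · rw [hG, ENNReal.mul_top (by simpa using hc), top_add]
    exact le_top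
  have hintg : Integrable (fun τ => ‖deriv u τ‖ ^ 2) (volume.restrict (Ioo s t)) := by
    refine ⟨((stronglyMeasurable_deriv u).norm.pow 2).aestronglyMeasurable, ?_⟩
    rw [hasFiniteIntegral_iff_ofReal (Eventually.of_forall fun τ => by positivity)]
    exact lt_top_iff_ne_top.2 hG
  have hintg' : IntervalIntegrable (fun τ => ‖deriv u τ‖ ^ 2) volume s t := by
    rw [intervalIntegrable_iff_integrableOn_Ioo_of_le hst]; exact hintg
  have h1 := norm_sub_le_integral_of_norm_deriv_le_of_le
    (B := fun τ => c / 2 * ‖deriv u τ‖ ^ 2 + 1 / (2 * c)) hst hu hd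
    (Eventually.of_forall fun τ _ => by
      have : 0 ≤ (c * ‖deriv u τ‖ - 1) ^ 2 / (2 * c) := by positivity
      have h2 : (c * ‖deriv u τ‖ - 1) ^ 2 / (2 * c) =
        c / 2 * ‖deriv u τ‖ ^ 2 + 1 / (2 * c) - ‖deriv u τ‖ := by field_simp; ring
      linarith)
    ((hintg'.const_mul _).add intervalIntegrable_const)
  rw [intervalIntegral.integral_add (hintg'.const_mul _) intervalIntegrable_const,
    intervalIntegral.integral_const_mul, intervalIntegral.integral_const,
    intervalIntegral.integral_of_le hst, integral_Ioc_eq_integral_Ioo] at h1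
  have h3 : ∫⁻ τ in Ioo s t, G τ = ENNReal.ofReal (∫ τ in Ioo s t, ‖deriv u τ‖ ^ 2) :=
    (ofReal_integral_eq_lintegral_ofReal hintg (Eventually.of_forall fun τ => by positivity)).symm
  rw [h3, ← ENNReal.ofReal_mul (by positivity), ← ENNReal.ofReal_add]
  · refine ENNReal.ofReal_le_ofReal (h1.trans (le_of_eq ?_))
    rw [smul_eq_mul, mul_one_div]
  · refine mul_nonneg (by positivity) (integral_nonneg fun τ => by positivity)
  · exact div_nonneg (by linarith) (by positivity)

theorem lintegral_norm_deriv_sq_mul {S : Set ℂ} (hS : IsOpen S) {Ψ : ℂ → ℂ}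
    (hd : DifferentiableOn ℂ Ψ S) (hi : InjOn Ψ S) (w : ℂ → ENNReal) :
    ∫⁻ z in S, ENNReal.ofReal (‖deriv Ψ z‖ ^ 2) * w (Ψ z) = ∫⁻ z in Ψ '' S, w z := by
  rw [lintegral_image_eq_lintegral_abs_det_fderiv_mul volume hS.measurableSet
    (f' := fun z => (ContinuousLinearMap.toSpanSingleton ℂ (deriv Ψ z)).restrictScalars ℝ)
    (fun z hz => ?_) hi]
  · congr 1
    ext z
    congr 2
    simp [ContinuousLinearMap.det, LinearMap.det_restrictScalars, Algebra.norm_complex_eq,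
      normSq_eq_norm_sq]
  · exact ((hd.differentiableAt (hS.mem_nhds hz)).hasDerivAt.hasFDerivAt.restrictScalars
      ℝ).hasFDerivWithinAt

theorem lintegral_reProdIm {s t : Set ℝ} {G : ℂ → ENNReal}
    (hG : AEMeasurable G (volume.restrict (s ×ℂ t))) :
    ∫⁻ z in s ×ℂ t, G z = ∫⁻ x in s, ∫⁻ y in t, G (x + y * I) := by
  have h1 : s ×ℂ t = measurableEquivRealProd ⁻¹' (s ×ˢ t) := by
    ext z; simp [mem_reProdIm, measurableEquivRealProd]
  have hmp := volume_preserving_equiv_real_prod.restrict_preimage_emb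
    measurableEquivRealProd.measurableEmbedding (s ×ˢ t)
  have hG' : AEMeasurable (G ∘ measurableEquivRealProd.symm)
      (volume.restrict (s ×ˢ t)) := by
    rw [← h1] at hmp
    refine AEMeasurable.comp_measurable ?_ measurableEquivRealProd.symm.measurable
    have := (MeasurePreserving.symm measurableEquivRealProd hmp).map_eq
    rwa [this]
  rw [h1]
  have := hmp.lintegral_comp_emb measurableEquivRealProd.measurableEmbedding
    (G ∘ measurableEquivRealProd.symm)
  simp only [Function.comp_apply, MeasurableEquiv.symm_apply_apply] at this
  rw [this, Measure.volume_eq_prod]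
  refine (setLIntegral_prod _ hG').trans ?_
  congr! with x y
  simp [measurableEquivRealProd_symm_apply, mk_eq_add_mul_I]

theorem lintegral_annulus_le (q : ℂ) {ρ R : ℝ} (hρ : 0 < ρ) (hR : ρ ≤ R) :
    ∫⁻ w, (ball q R \ closedBall q ρ).indicator (fun w => ENNReal.ofReal ((‖w - q‖ ^ 2)⁻¹)) w
      ≤ ENNReal.ofReal (2 * Real.pi * Real.log (R / ρ)) := by
  rw [← lintegral_add_right_eq_self _ q, ← Complex.lintegral_comp_polarCoord_symm]
  have h1 : ∀ p ∈ _root_.polarCoord.target, ENNReal.ofReal p.1 •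
      (ball q R \ closedBall q ρ).indicator (fun w => ENNReal.ofReal ((‖w - q‖ ^ 2)⁻¹))
        (Complex.polarCoord.symm p + q) =
      (Ioo ρ R).indicator (fun r => ENNReal.ofReal r⁻¹) p.1 := by
    rintro ⟨r, θ⟩ ⟨hr, hθ⟩
    have hr : 0 < r := hr
    have hn : ‖Complex.polarCoord.symm (r, θ)‖ = r := by
      rw [norm_polarCoord_symm, abs_of_pos hr]
    have hiff : Complex.polarCoord.symm (r, θ) + q ∈ ball q R \ closedBall q ρ ↔ r ∈ Ioo ρ R := by
      rw [Set.mem_sdiff, mem_ball_iff_norm, mem_closedBall_iff_norm, add_sub_cancel_right, hn,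
          not_le,
        mem_Ioo, and_comm]
    by_cases h : r ∈ Ioo ρ R
    · rw [indicator_of_mem (hiff.2 h), indicator_of_mem h, add_sub_cancel_right, hn, smul_eq_mul,
        ← ENNReal.ofReal_mul hr.le]
      congr 1
      field_simp
    · rw [indicator_of_notMem (mt hiff.1 h), indicator_of_notMem h, smul_zero]
  rw [setLIntegral_congr_fun _root_.polarCoord.open_target.measurableSet h1, polarCoord_target,
    Measure.volume_eq_prod, setLIntegral_prod]
  · simp only [lintegral_const, Measure.restrict_apply_univ, Real.volume_Ioo]
    rw [lintegral_mul_const' _ _ ENNReal.ofReal_ne_top, mul_comm,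
      show 2 * Real.pi * Real.log (R / ρ) = (Real.pi - -Real.pi) * Real.log (R / ρ) by ring,
      ENNReal.ofReal_mul (by linarith [Real.pi_pos])]
    gcongr
    refine (setLIntegral_le_lintegral _ _).trans ?_
    rw [lintegral_indicator measurableSet_Ioo, ← integral_inv_of_pos hρ (hρ.trans_le hR),
      intervalIntegral.integral_of_le hR, integral_Ioc_eq_integral_Ioo,
      ofReal_integral_eq_lintegral_ofReal]
    · have : IntervalIntegrable (fun x : ℝ => x⁻¹) volume ρ R := by
        refine ContinuousOn.intervalIntegrable (continuousOn_inv₀.mono fun x hx => ?_)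
        rw [uIcc_of_le hR] at hx
        exact (hρ.trans_le hx.1).ne'
      rwa [intervalIntegrable_iff_integrableOn_Ioo_of_le hR] at this
    · exact (ae_restrict_iff' measurableSet_Ioo).2
        (Eventually.of_forall fun x hx => inv_nonneg.2 (hρ.trans hx.1).le)
  · exact (((measurable_inv.ennreal_ofReal).indicator measurableSet_Ioo).comp
      measurable_fst).aemeasurable

theorem exists_crossing {v : ℝ → ℝ} {a b A B : ℝ} (hv : ContinuousOn v (Icc a b)) (hAB : A < B)
    (h : ∃ s ∈ Icc a b, ∃ t ∈ Icc a b, v s ≤ A ∧ B ≤ v t) :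
    ∃ s t, a ≤ s ∧ s < t ∧ t ≤ b ∧ B - A ≤ |v t - v s| ∧
      (∀ τ ∈ Ioo s t, A < v τ ∧ v τ < B) ∧ ∀ τ ∈ Icc s t, A ≤ v τ ∧ v τ ≤ B := by
  obtain ⟨s, hs, t, ht, h1, h2⟩ := h
  wlog hst : s ≤ t generalizing v A B s t
  · obtain ⟨s', t', h1, h2, h3, h4, h5, h6⟩ := this (v := fun τ => -v τ) (A := -B) (B := -A) hv.neg
      (by linarith) t ht s hs (by linarith) (by linarith) (by linarith)
    refine ⟨s', t', h1, h2, h3, ?_, fun τ hτ => ?_, fun τ hτ => ?_⟩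
    · rw [show -v t' - -v s' = -(v t' - v s') by ring, abs_neg] at h4; linarith
    · constructor <;> linarith [(h5 τ hτ).1, (h5 τ hτ).2]
    · constructor <;> linarith [(h6 τ hτ).1, (h6 τ hτ).2]
  have hsub : Icc s t ⊆ Icc a b := Icc_subset_Icc hs.1 ht.2
  have hc1 : IsCompact {τ | τ ∈ Icc s t ∧ B ≤ v τ} :=
    isCompact_Icc.of_isClosed_subset
      ((hv.mono hsub).preimage_isClosed_of_isClosed isClosed_Icc isClosed_Ici) fun τ hτ => hτ.1
  obtain ⟨t', ⟨ht', hBt⟩, hmin⟩ := hc1.exists_isLeast ⟨t, ⟨hst, le_rfl⟩, h2⟩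
  have hsub' : Icc s t' ⊆ Icc a b := Icc_subset_Icc hs.1 (ht'.2.trans ht.2)
  have hc2 : IsCompact {τ | τ ∈ Icc s t' ∧ v τ ≤ A} :=
    isCompact_Icc.of_isClosed_subset
      ((hv.mono hsub').preimage_isClosed_of_isClosed isClosed_Icc isClosed_Iic) fun τ hτ => hτ.1
  obtain ⟨s', ⟨hs', hAs⟩, hmax⟩ := hc2.exists_isGreatest ⟨s, ⟨le_rfl, ht'.1⟩, h1⟩
  have hlt : s' < t' := lt_of_le_of_ne hs'.2 fun h => by rw [h] at hAs; linarith
  have hoo : ∀ τ ∈ Ioo s' t', A < v τ ∧ v τ < B := fun τ hτ => by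
    constructor
    · by_contra hcon
      exact absurd (hmax ⟨⟨hs'.1.trans hτ.1.le, hτ.2.le⟩, not_lt.1 hcon⟩) (not_le.2 hτ.1)
    · by_contra hcon
      exact absurd (hmin ⟨⟨hs'.1.trans hτ.1.le, hτ.2.le.trans ht'.2⟩, not_lt.1 hcon⟩)
        (not_le.2 hτ.2)
  refine ⟨s', t', hs.1.trans hs'.1, hlt, ht'.2.trans ht.2, ?_, hoo, fun τ hτ => ?_⟩
  · exact (by linarith : B - A ≤ v t' - v s').trans (le_abs_self _)
  · rw [← closure_Ioo hlt.ne] at hτ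
    have hc : ContinuousOn v (closure (Ioo s' t')) := by
      rw [closure_Ioo hlt.ne]
      exact hv.mono (Icc_subset_Icc (hs.1.trans hs'.1) (ht'.2.trans ht.2))
    exact ⟨le_on_closure (fun τ hτ => (hoo τ hτ).1.le) continuousOn_const hc hτ,
      le_on_closure (fun τ hτ => (hoo τ hτ).2.le) hc continuousOn_const hτ⟩

theorem hasDerivAt_log_norm {v : ℝ → ℂ} {v' : ℂ} {t : ℝ} (hv : HasDerivAt v v' t) (h0 : v t ≠ 0) :
    ∃ d, HasDerivAt (fun τ => Real.log ‖v τ‖) d t ∧ |d| ≤ ‖v'‖ / ‖v t‖ := by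
  have h1 := (hv.norm_sq.log (by simpa using h0)).div_const 2
  refine ⟨_, h1.congr_of_eventuallyEq (Eventually.of_forall fun τ => ?_), ?_⟩
  · simp only [Real.log_pow]; push_cast; ring
  · have h2 := abs_real_inner_le_norm (v t) v'
    have h3 : 0 < ‖v t‖ := norm_pos_iff.2 h0
    rw [mul_div_assoc, mul_div_cancel_left₀ _ two_ne_zero, abs_div, abs_of_pos (by positivity :
        0 < ‖v t‖ ^ 2),
      div_le_div_iff₀ (by positivity) h3]
    nlinarith [mul_le_mul_of_nonneg_left h2 h3.le]

theorem hasDerivAt_vertical {Ψ : ℂ → ℂ} {x t : ℝ} (hd : DifferentiableAt ℂ Ψ (x + t * I)) :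
    HasDerivAt (fun τ : ℝ => Ψ (x + τ * I)) (deriv Ψ (x + t * I) * I) t := by
  have h1 : HasDerivAt (fun τ : ℝ => (x : ℂ) + τ * I) I t := by
    simpa using ((ofRealCLM.hasDerivAt (x := t)).mul_const I).const_add (x : ℂ)
  exact hd.hasDerivAt.comp t h1

theorem mem_reProdIm_vertical {s t : Set ℝ} {x y : ℝ} :
    (x : ℂ) + y * I ∈ s ×ℂ t ↔ x ∈ s ∧ y ∈ t := by simp [mem_reProdIm]

theorem isOpen_rect {a b c d : ℝ} : IsOpen (Ioo a b ×ℂ Ioo c d) := isOpen_Ioo.reProdIm isOpen_Ioo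

theorem aemeasurable_norm_deriv_sq {S : Set ℂ} (hS : IsOpen S) {Ψ : ℂ → ℂ}
    (hd : DifferentiableOn ℂ Ψ S) :
    AEMeasurable (fun z => ENNReal.ofReal (‖deriv Ψ z‖ ^ 2)) (volume.restrict S) :=
  ((((hd.deriv hS).continuousOn.norm.pow 2).aemeasurable hS.measurableSet)).ennreal_ofReal

/-- The length-area estimate for the family of vertical segments of a rectangle. -/
theorem rectangle_estimate {x₁ x₂ a ρ R : ℝ} (hx : x₁ < x₂) (ha : 0 < a) (hρ : 0 < ρ) (hR : ρ < R)
    {Ψ : ℂ → ℂ} (hc : ContinuousOn Ψ (Ioo x₁ x₂ ×ℂ Icc 0 a))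
    (hd : DifferentiableOn ℂ Ψ (Ioo x₁ x₂ ×ℂ Ioo 0 a)) (hi : InjOn Ψ (Ioo x₁ x₂ ×ℂ Ioo 0 a)) (q : ℂ)
    (hcross : ∀ x ∈ Ioo x₁ x₂, ∃ s ∈ Icc 0 a, ∃ t ∈ Icc 0 a,
      ‖Ψ (x + s * I) - q‖ ≤ ρ ∧ R ≤ ‖Ψ (x + t * I) - q‖) :
    (x₂ - x₁) * Real.log (R / ρ) ≤ 2 * Real.pi * a := by
  set b := x₂ - x₁ with hb
  have hb0 : 0 < b := sub_pos.2 hx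
  set Λ := Real.log (R / ρ) with hΛ
  have hΛ0 : 0 < Λ := Real.log_pos ((one_lt_div hρ).2 hR)
  set c := b / (2 * Real.pi) with hcdef
  have hc0 : 0 < c := by positivity
  set w : ℂ → ENNReal := (ball q R \ closedBall q ρ).indicator
    (fun w => ENNReal.ofReal ((‖w - q‖ ^ 2)⁻¹)) with hw
  have hwm : Measurable w := by
    refine Measurable.indicator (by fun_prop) (measurableSet_ball.diff measurableSet_closedBall)
  set G : ℂ → ENNReal := fun z => ENNReal.ofReal (‖deriv Ψ z‖ ^ 2) * w (Ψ z) with hG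
  have hGm : AEMeasurable G (volume.restrict (Ioo x₁ x₂ ×ℂ Ioo 0 a)) :=
    (aemeasurable_norm_deriv_sq isOpen_rect hd).mul
      (hwm.comp_aemeasurable (hd.continuousOn.aemeasurable isOpen_rect.measurableSet))
  have hslice : ∀ x ∈ Ioo x₁ x₂, ENNReal.ofReal Λ ≤
      ENNReal.ofReal (c / 2) * (∫⁻ y in Ioo 0 a, G (x + y * I)) + ENNReal.ofReal (a / (2 * c)) := by
    intro x hx
    have hcv : ContinuousOn (fun τ : ℝ => Ψ (x + τ * I) - q) (Icc 0 a) := by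
      refine ContinuousOn.sub (hc.comp (by fun_prop) fun τ hτ => ?_) continuousOn_const
      exact mem_reProdIm_vertical.2 ⟨hx, hτ⟩
    obtain ⟨s, t, has, hst, hta, hdiff, hoo, hcc⟩ := exists_crossing hcv.norm hR (hcross x hx)
    have hsub : Icc s t ⊆ Icc 0 a := Icc_subset_Icc has hta
    have hsuboo : Ioo s t ⊆ Ioo 0 a := Ioo_subset_Ioo has hta
    have hpos : ∀ τ ∈ Icc s t, 0 < ‖Ψ (x + τ * I) - q‖ := fun τ hτ => hρ.trans_le (hcc τ hτ).1
    have hder : ∀ τ ∈ Ioo s t, ∃ d, HasDerivAt (fun τ : ℝ => Real.log ‖Ψ (x + τ * I) - q‖) d τ ∧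
        |d| ≤ ‖deriv Ψ (x + τ * I)‖ / ‖Ψ (x + τ * I) - q‖ := by
      intro τ hτ
      have h1 := (hasDerivAt_vertical (hd.differentiableAt (isOpen_rect.mem_nhds
        (mem_reProdIm_vertical.2 ⟨hx, hsuboo hτ⟩)))).sub_const q
      obtain ⟨d, hd1, hd2⟩ := hasDerivAt_log_norm h1
        (norm_pos_iff.1 (hpos τ (Ioo_subset_Icc_self hτ)))
      exact ⟨d, hd1, by simpa using hd2⟩
    have h2 := ofReal_norm_sub_le_lintegral (u := fun τ : ℝ => Real.log ‖Ψ (x + τ * I) - q‖)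
      hst.le hc0 ((hcv.mono hsub).norm.log fun τ hτ => (hpos τ hτ).ne') fun τ hτ => by
        obtain ⟨d, hd, -⟩ := hder τ hτ
        exact hd.differentiableAt.differentiableWithinAt
    have h3 : Λ ≤ ‖Real.log ‖Ψ (x + t * I) - q‖ - Real.log ‖Ψ (x + s * I) - q‖‖ := by
      have hs := hcc s ⟨le_rfl, hst.le⟩
      have ht := hcc t ⟨hst.le, le_rfl⟩
      rw [Real.norm_eq_abs, hΛ, Real.log_div (hρ.trans hR).ne' hρ.ne']
      rcases abs_cases (‖Ψ (x + t * I) - q‖ - ‖Ψ (x + s * I) - q‖) with h | h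
      · rw [show ‖Ψ (x + t * I) - q‖ = R by linarith [h.1], show ‖Ψ (x + s * I) - q‖ =
          ρ by linarith [h.1]]
        exact le_abs_self _
      · rw [show ‖Ψ (x + t * I) - q‖ = ρ by linarith [h.1], show ‖Ψ (x + s * I) - q‖ =
          R by linarith [h.1],
          abs_sub_comm]
        exact le_abs_self _
    refine (ENNReal.ofReal_le_ofReal h3).trans (h2.trans ?_)
    gcongr ENNReal.ofReal (c / 2) * ?_ + ENNReal.ofReal ?_
    · refine (setLIntegral_mono' measurableSet_Ioo fun τ hτ => ?_).trans (lintegral_mono_set hsuboo)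
      obtain ⟨d, hd1, hd2⟩ := hder τ hτ
      have hmem : Ψ (x + τ * I) ∈ ball q R \ closedBall q ρ := by
        rw [Set.mem_sdiff, mem_ball_iff_norm, mem_closedBall_iff_norm, not_le]
        exact (hoo τ hτ).symm
      rw [hd1.deriv, hG, hw]
      simp only
      rw [indicator_of_mem hmem, ← ENNReal.ofReal_mul (by positivity), Real.norm_eq_abs,
        ← div_eq_mul_inv, ← div_pow]
      gcongr
    · gcongr
      linarith
  have h4 : ENNReal.ofReal Λ * ENNReal.ofReal b ≤ ENNReal.ofReal (c / 2) *
      ENNReal.ofReal (2 * Real.pi * Λ) + ENNReal.ofReal (a / (2 * c)) * ENNReal.ofReal b := by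
    have hvol : volume (Ioo x₁ x₂) = ENNReal.ofReal b := Real.volume_Ioo
    calc ENNReal.ofReal Λ * ENNReal.ofReal b = ∫⁻ x in Ioo x₁ x₂, ENNReal.ofReal Λ := by
          rw [setLIntegral_const, hvol]
      _ ≤ ∫⁻ x in Ioo x₁ x₂, (ENNReal.ofReal (c / 2) * (∫⁻ y in Ioo 0 a, G (x + y * I)) +
            ENNReal.ofReal (a / (2 * c))) := setLIntegral_mono' measurableSet_Ioo hslice
      _ = ENNReal.ofReal (c / 2) * (∫⁻ x in Ioo x₁ x₂, ∫⁻ y in Ioo 0 a, G (x + y * I)) +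
            ENNReal.ofReal (a / (2 * c)) * ENNReal.ofReal b := by
          rw [lintegral_add_right _ measurable_const,
              lintegral_const_mul' _ _ ENNReal.ofReal_ne_top,
            setLIntegral_const, hvol]
      _ ≤ _ := by
          gcongr
          rw [← lintegral_reProdIm hGm, hG, lintegral_norm_deriv_sq_mul isOpen_rect hd hi]
          exact (setLIntegral_le_lintegral _ _).trans (lintegral_annulus_le q hρ hR.le)
  rw [← ENNReal.ofReal_mul hΛ0.le, ← ENNReal.ofReal_mul (by positivity),
    ← ENNReal.ofReal_mul (by positivity), ← ENNReal.ofReal_add (by positivity) (by positivity),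
    ENNReal.ofReal_le_ofReal_iff (by positivity)] at h4
  have h5 : c / 2 * (2 * Real.pi * Λ) + a / (2 * c) * b = b * Λ / 2 + Real.pi * a := by
    rw [hcdef]; field_simp
  linarith

/-- On some vertical segment, a holomorphic injection with image of finite area is Hölder
continuous. -/
theorem exists_holder_segment {x₁ x₂ a : ℝ} (hx : x₁ < x₂) {Ψ : ℂ → ℂ}
    (hd : DifferentiableOn ℂ Ψ (Ioo x₁ x₂ ×ℂ Ioo 0 a)) (hi : InjOn Ψ (Ioo x₁ x₂ ×ℂ Ioo 0 a))
    {A : ℝ} (hA0 : 0 < A)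
    (hA : volume (Ψ '' (Ioo x₁ x₂ ×ℂ Ioo 0 a)) ≤ ENNReal.ofReal A) :
    ∃ x ∈ Ioo x₁ x₂, ∀ s ∈ Ioo 0 a, ∀ t ∈ Ioo 0 a,
      ‖Ψ (x + t * I) - Ψ (x + s * I)‖ ^ 2 ≤ 2 * A / (x₂ - x₁) * |t - s| := by
  set E := 2 * A / (x₂ - x₁) with hE
  have hb : 0 < x₂ - x₁ := sub_pos.2 hx
  have hE0 : 0 < E := by positivity
  set G : ℂ → ENNReal := fun z => ENNReal.ofReal (‖deriv Ψ z‖ ^ 2) with hG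
  have hGm : AEMeasurable G (volume.restrict (Ioo x₁ x₂ ×ℂ Ioo 0 a)) :=
    aemeasurable_norm_deriv_sq isOpen_rect hd
  have hex : ∃ x ∈ Ioo x₁ x₂, (∫⁻ y in Ioo 0 a, G (x + y * I)) ≤ ENNReal.ofReal E := by
    by_contra! hcon
    have h1 : ∫⁻ x in Ioo x₁ x₂, ∫⁻ y in Ioo 0 a, G (x + y * I) ≤ ENNReal.ofReal A := by
      rw [← lintegral_reProdIm hGm]
      have := lintegral_norm_deriv_sq_mul isOpen_rect hd hi fun _ => 1
      simp only [mul_one, setLIntegral_one] at this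
      rw [this]
      exact hA
    have h2 : ENNReal.ofReal (2 * A) = ∫⁻ x in Ioo x₁ x₂, ENNReal.ofReal E := by
      rw [setLIntegral_const, Real.volume_Ioo, ← ENNReal.ofReal_mul hE0.le, hE,
        div_mul_cancel₀ _ hb.ne']
    have h3 := h2.le.trans ((setLIntegral_mono' measurableSet_Ioo fun x hx =>
        (hcon x hx).le).trans h1)
    rw [ENNReal.ofReal_le_ofReal_iff hA0.le] at h3
    linarith
  obtain ⟨x, hx', hxE⟩ := hex
  refine ⟨x, hx', fun s hs t ht => ?_⟩
  wlog hst : s ≤ t generalizing s t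
  · rw [norm_sub_rev, abs_sub_comm]; exact this t ht s hs (by linarith)
  rcases hst.eq_or_lt with rfl | hst'
  · simp
  rw [abs_of_pos (sub_pos.2 hst')]
  have hsub : Icc s t ⊆ Ioo 0 a := Icc_subset_Ioo hs.1 ht.2
  have hder : ∀ τ ∈ Icc s t, HasDerivAt (fun τ : ℝ => Ψ (x + τ * I)) (deriv Ψ (x + τ * I) * I) τ :=
    fun τ hτ => hasDerivAt_vertical (hd.differentiableAt (isOpen_rect.mem_nhds
        (mem_reProdIm_vertical.2 ⟨hx', hsub hτ⟩)))
  have key : ∀ c : ℝ, 0 < c → ‖Ψ (x + t * I) - Ψ (x + s * I)‖ ≤ c / 2 * E + (t - s) / (2 * c) := by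
    intro c hc
    have h1 := ofReal_norm_sub_le_lintegral (u := fun τ : ℝ => Ψ (x + τ * I)) hst'.le hc
      (fun τ hτ => (hder τ hτ).continuousAt.continuousWithinAt)
      (fun τ hτ => (hder τ (Ioo_subset_Icc_self hτ)).differentiableAt.differentiableWithinAt)
    have h2 : ∫⁻ τ in Ioo s t, ENNReal.ofReal (‖deriv (fun τ : ℝ => Ψ (x + τ * I)) τ‖ ^ 2) ≤
        ENNReal.ofReal E := by
      refine ((setLIntegral_mono' measurableSet_Ioo fun τ hτ => ?_).trans
        (lintegral_mono_set (Ioo_subset_Icc_self.trans hsub))).trans hxE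
      rw [(hder τ (Ioo_subset_Icc_self hτ)).deriv]
      simp [hG]
    have h0 : 0 < t - s := sub_pos.2 hst'
    have h3 : ENNReal.ofReal ‖Ψ (x + t * I) - Ψ (x + s * I)‖ ≤
        ENNReal.ofReal (c / 2) * ENNReal.ofReal E + ENNReal.ofReal ((t - s) / (2 * c)) :=
      h1.trans (by gcongr)
    rwa [← ENNReal.ofReal_mul (by positivity), ← ENNReal.ofReal_add (by positivity) (by positivity),
      ENNReal.ofReal_le_ofReal_iff (by positivity)] at h3
  have h0 : 0 < t - s := sub_pos.2 hst'
  rcases (norm_nonneg (Ψ (x + t * I) - Ψ (x + s * I))).eq_or_lt with hN | hN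
  · rw [← hN, zero_pow two_ne_zero]; positivity
  have := key (‖Ψ (x + t * I) - Ψ (x + s * I)‖ / E) (by positivity)
  set N := ‖Ψ (x + t * I) - Ψ (x + s * I)‖
  have h5 : N / E / 2 * E + (t - s) / (2 * (N / E)) = (N ^ 2 + E * (t - s)) / (2 * N) := by
    field_simp
  rw [h5, le_div_iff₀ (by positivity)] at this
  nlinarith

theorem norm_exp_mul_I (z : ℂ) : ‖exp (z * I)‖ = Real.exp (-z.im) := by
  simp [Complex.norm_exp]

theorem exp_mul_I_mem_ball {z : ℂ} (hz : 0 < z.im) : exp (z * I) ∈ ball (0:ℂ) 1 := by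
  rw [mem_ball_zero_iff, norm_exp_mul_I, Real.exp_lt_one_iff]
  linarith

theorem exp_mul_I_mem_closedBall {z : ℂ} (hz : 0 ≤ z.im) : exp (z * I) ∈ closedBall (0:ℂ) 1 := by
  rw [mem_closedBall_zero_iff, norm_exp_mul_I, Real.exp_le_one_iff]
  linarith

theorem exp_mul_I_inj {z w : ℂ} (h : exp (z * I) = exp (w * I))
    (hre : |z.re - w.re| < 2 * Real.pi) : z = w := by
  obtain ⟨n, hn⟩ := Complex.exp_eq_exp_iff_exists_int.1 h
  have h1 : z = w + n * (2 * Real.pi) :=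
    mul_right_cancel₀ I_ne_zero (by rw [hn]; ring)
  have h2 : z.re - w.re = n * (2 * Real.pi) := by
    rw [h1]; simp
  have hp := Real.pi_pos
  rw [h2, abs_mul, abs_of_pos (by positivity : (0:ℝ) < 2 * Real.pi)] at hre
  have h3 : |(n:ℝ)| < 1 := by nlinarith
  have h4 : n = 0 := by
    rw [← Int.cast_abs] at h3
    exact Int.abs_lt_one_iff.1 (by exact_mod_cast h3)
  rw [h1, h4]; simp

theorem exists_exp_mul_I_eq_of_ne_zero {u : ℂ} (hu : u ≠ 0) (a : ℝ) :
    ∃ z : ℂ, z.re ∈ Ico a (a + 2 * Real.pi) ∧ z.im = -Real.log ‖u‖ ∧ exp (z * I) = u := by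
  obtain ⟨t, ht, hte⟩ := exists_exp_mul_I_eq (u := u / ‖u‖) (by simp [hu]) a
  refine ⟨t - Real.log ‖u‖ * I, by simpa using ht, by simp, ?_⟩
  rw [sub_mul, mul_assoc, I_mul_I, mul_neg_one, sub_neg_eq_add, Complex.exp_add, hte, ← ofReal_exp,
    Real.exp_log (by simpa using hu)]
  have : (‖u‖ : ℂ) ≠ 0 := by simpa using hu
  field_simp

theorem norm_exp_mul_I_sub (s t : ℝ) :
    ‖exp (s * I) - exp (t * I)‖ = 2 * |Real.sin ((s - t) / 2)| := by
  have : exp (s * I) - exp (t * I) = exp (t * I) * (exp (I * ((s - t : ℝ) : ℂ)) - 1) := by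
    rw [mul_sub, ← Complex.exp_add, mul_one]; congr 2; push_cast; ring
  rw [this, norm_mul, norm_exp_ofReal_mul_I, one_mul, norm_exp_I_mul_ofReal_sub_one]
  simp

theorem norm_exp_mul_I_sub_le (s t : ℝ) : ‖exp (s * I) - exp (t * I)‖ ≤ |s - t| := by
  rw [norm_exp_mul_I_sub]
  have : |Real.sin ((s - t) / 2)| ≤ |(s - t) / 2| := by
    exact Real.abs_sin_le_abs
  rw [abs_div, abs_two] at this
  linarith

theorem le_norm_exp_mul_I_sub {s t : ℝ} (h : |s - t| ≤ Real.pi) :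
    2 / Real.pi * |s - t| ≤ ‖exp (s * I) - exp (t * I)‖ := by
  rw [norm_exp_mul_I_sub]
  have h1 := Real.mul_le_sin (x := |s - t| / 2) (by positivity) (by linarith)
  have h2 : |Real.sin ((s - t) / 2)| = Real.sin (|s - t| / 2) := by
    have h0 : 0 ≤ Real.sin (|s - t| / 2) := Real.sin_nonneg_of_nonneg_of_le_pi (by positivity)
      (by linarith [Real.pi_pos])
    rcases abs_cases (s - t) with ⟨h, -⟩ | ⟨h, -⟩ <;> rw [h] at h0 ⊢
    · exact abs_of_nonneg h0
    · rw [← abs_of_nonneg h0, neg_div, Real.sin_neg, abs_neg]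
  rw [h2]
  have : 2 / Real.pi * |s - t| = 2 * (2 / Real.pi * (|s - t| / 2)) := by ring
  rw [this]
  linarith

theorem isPreconnected_compl_closedBall_center (c : ℂ) {R : ℝ} (hR : 0 < R) :
    IsPreconnected (closedBall c R)ᶜ := by
  have := (isPreconnected_compl_closedBall hR).image (fun z => z + c) (by fun_prop)
  convert this using 1
  ext z
  simp only [mem_compl_iff, mem_closedBall, mem_image]
  constructor
  · intro h
    exact ⟨z - c, by simpa [dist_eq_norm] using h, by ring⟩
  · rintro ⟨x, hx, rfl⟩
    simpa [dist_eq_norm] using hx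

theorem exists_small_subarc {f : ℂ → ℂ} (hf : ContinuousOn f (sphere (0:ℂ) 1))
    (hi : InjOn f (sphere (0:ℂ) 1)) {ε : ℝ} (hε : 0 < ε) :
    ∃ δ > 0, ∀ a ∈ f '' sphere (0:ℂ) 1, ∀ b ∈ f '' sphere (0:ℂ) 1, dist a b < δ →
      ∃ A ⊆ f '' sphere (0:ℂ) 1, IsCompact A ∧ IsPreconnected A ∧ a ∈ A ∧ b ∈ A ∧
        A ⊆ closedBall a ε := by
  have hp := Real.pi_pos
  obtain ⟨δ₁, hδ₁, h₁⟩ := Metric.uniformContinuousOn_iff.1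
    ((isCompact_sphere (0:ℂ) 1).uniformContinuousOn_of_continuous hf) ε hε
  obtain ⟨δ, hδ, h₂⟩ := Metric.uniformContinuousOn_iff.1
    ((isCompact_curve hf).uniformContinuousOn_of_continuous
      (continuousOn_invFunOn (isCompact_sphere (0:ℂ) 1) hf hi)) (2 / Real.pi * δ₁) (by positivity)
  refine ⟨δ, hδ, ?_⟩
  rintro _ ⟨u, hu, rfl⟩ _ ⟨v, hv, rfl⟩ hab
  have h₃ := h₂ _ (mem_image_of_mem f hu) _ (mem_image_of_mem f hv) hab
  rw [invFunOn_apply hi hu, invFunOn_apply hi hv] at h₃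
  obtain ⟨s, -, rfl⟩ := exists_exp_mul_I_eq hu 0
  obtain ⟨t, ht, rfl⟩ := exists_exp_mul_I_eq hv (s - Real.pi)
  have hst : |s - t| ≤ Real.pi := abs_le.2 ⟨by linarith [ht.2], by linarith [ht.1]⟩
  rw [dist_eq_norm] at h₃
  have h₄ : |s - t| < δ₁ := by
    have := (le_norm_exp_mul_I_sub hst).trans_lt h₃
    exact lt_of_mul_lt_mul_left this (by positivity)
  refine ⟨(fun τ : ℝ => f (exp (τ * I))) '' uIcc s t, ?_,
    isCompact_uIcc.image (continuous_loop hf),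
    isPreconnected_uIcc.image _ (continuous_loop hf).continuousOn,
    ⟨s, left_mem_uIcc, rfl⟩, ⟨t, right_mem_uIcc, rfl⟩, ?_⟩
  · rintro _ ⟨τ, -, rfl⟩
    exact mem_image_of_mem f (exp_mul_I_mem_sphere τ)
  · rintro _ ⟨τ, hτ, rfl⟩
    rw [mem_closedBall]
    refine (h₁ _ (exp_mul_I_mem_sphere τ) _ (exp_mul_I_mem_sphere s) ?_).le
    rw [dist_eq_norm]
    refine (norm_exp_mul_I_sub_le τ s).trans_lt (lt_of_le_of_lt ?_ h₄)
    rw [abs_sub_comm s t]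
    exact abs_sub_left_of_mem_uIcc hτ

/-- A conformal map `Φ` from the unit disk onto the bounded complementary component of a Jordan
curve `f` that contains `p = Φ 0`. -/
structure JordanMap (f : ℂ → ℂ) (p : ℂ) (Φ : ℂ → ℂ) : Prop where
  cont : ContinuousOn f (sphere (0:ℂ) 1)
  inj : InjOn f (sphere (0:ℂ) 1)
  notMem : p ∉ f '' sphere (0:ℂ) 1
  bdd : Bornology.IsBounded (connectedComponentIn (f '' sphere (0:ℂ) 1)ᶜ p)
  diff : DifferentiableOn ℂ Φ (ball 0 1)
  injOn : InjOn Φ (ball 0 1)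
  image : Φ '' ball 0 1 = connectedComponentIn (f '' sphere (0:ℂ) 1)ᶜ p
  zero : Φ 0 = p

namespace JordanMap

variable {f Φ : ℂ → ℂ} {p : ℂ}

theorem mem_component (h : JordanMap f p Φ) {w : ℂ} (hw : w ∈ ball (0:ℂ) 1) :
    Φ w ∈ connectedComponentIn (f '' sphere (0:ℂ) 1)ᶜ p := by
  rw [← h.image]; exact mem_image_of_mem Φ hw

theorem notMem_curve (h : JordanMap f p Φ) {w : ℂ} (hw : w ∈ ball (0:ℂ) 1) :
    Φ w ∉ f '' sphere (0:ℂ) 1 :=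
  connectedComponentIn_subset _ _ (h.mem_component hw)

theorem mem_curve_of_tendsto (h : JordanMap f p Φ) {α : Type*} {l : Filter α} [l.NeBot]
    {g : α → ℂ} {ζ a : ℂ} (hg : ∀ᶠ x in l, g x ∈ ball (0:ℂ) 1) (hζ : ζ ∈ sphere (0:ℂ) 1)
    (ht : Tendsto g l (𝓝 ζ)) (ha : Tendsto (fun x => Φ (g x)) l (𝓝 a)) :
    a ∈ f '' sphere (0:ℂ) 1 := by
  rw [← frontier_bounded_component h.cont h.inj h.notMem h.bdd]
  have ho : IsOpen (connectedComponentIn (f '' sphere (0:ℂ) 1)ᶜ p) :=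
    (isCompact_curve h.cont).isClosed.isOpen_compl.connectedComponentIn
  rw [ho.frontier_eq]
  refine ⟨mem_closure_of_tendsto ha (hg.mono fun x hx => h.mem_component hx), fun hcon => ?_⟩
  rw [← h.image] at hcon
  obtain ⟨w, hw, rfl⟩ := hcon
  have h1 := (continuousAt_invFunOn isOpen_ball h.diff h.injOn hw).tendsto.comp ha
  have h2 : Tendsto g l (𝓝 (Function.invFunOn Φ (ball 0 1) (Φ w))) :=
    h1.congr' (hg.mono fun x hx => invFunOn_apply h.injOn hx)
  have h3 := tendsto_nhds_unique h2 ht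
  have h4 := Function.invFunOn_mem (mem_image_of_mem Φ hw)
  rw [h3] at h4
  simp only [mem_ball, mem_sphere] at h4 hζ
  linarith

/-- A connected set in the complement of the curve pulls back to a connected subset of the disk. -/
theorem pullback (h : JordanMap f p Φ) {K : Set ℂ} {w₁ w₂ : ℂ} (hw₁ : w₁ ∈ ball (0:ℂ) 1)
    (hw₂ : w₂ ∈ ball (0:ℂ) 1)
    (hK : Φ w₂ ∈ connectedComponentIn (f '' sphere (0:ℂ) 1 ∪ K)ᶜ (Φ w₁)) :
    ∃ N ⊆ ball (0:ℂ) 1, IsPreconnected N ∧ w₁ ∈ N ∧ w₂ ∈ N ∧ ∀ w ∈ N, Φ w ∉ K := by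
  set V := connectedComponentIn (f '' sphere (0:ℂ) 1 ∪ K)ᶜ (Φ w₁) with hV
  have hsub : V ⊆ (f '' sphere (0:ℂ) 1 ∪ K)ᶜ := connectedComponentIn_subset _ _
  have h1 : Φ w₁ ∈ V := mem_connectedComponentIn (by
    by_contra hcon
    rw [hV, connectedComponentIn_eq_empty hcon] at hK
    exact hK)
  have hVΩ : V ⊆ Φ '' ball 0 1 := by
    rw [h.image, connectedComponentIn_eq (h.mem_component hw₁)]
    exact isPreconnected_connectedComponentIn.subset_connectedComponentIn h1
      (hsub.trans (compl_subset_compl.2 subset_union_left))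
  refine ⟨Function.invFunOn Φ (ball 0 1) '' V, ?_, ?_, ⟨_, h1, invFunOn_apply h.injOn hw₁⟩,
    ⟨_, hK, invFunOn_apply h.injOn hw₂⟩, ?_⟩
  · rintro _ ⟨x, hx, rfl⟩
    exact Function.invFunOn_mem (hVΩ hx)
  · refine isPreconnected_connectedComponentIn.image _ fun x hx => ?_
    obtain ⟨w, hw, rfl⟩ := hVΩ hx
    exact (continuousAt_invFunOn isOpen_ball h.diff h.injOn hw).continuousWithinAt
  · rintro _ ⟨x, hx, rfl⟩ hcon
    rw [Function.invFunOn_eq (hVΩ hx)] at hcon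
    exact hsub hx (Or.inr hcon)

end JordanMap

theorem exists_tendsto_of_holder {u : ℝ → ℂ} {S : Set ℝ} {c : ℝ} (hc : 0 ≤ c)
    (h : ∀ s ∈ S, ∀ t ∈ S, ‖u t - u s‖ ^ 2 ≤ c * |t - s|) {x : ℝ} (hx : x ∈ closure S) :
    ∃ a, Tendsto u (𝓝[S] x) (𝓝 a) := by
  have := mem_closure_iff_nhdsWithin_neBot.mp hx
  apply cauchy_map_iff_exists_tendsto.1
  rw [Metric.cauchy_iff]
  refine ⟨inferInstance, fun ε hε => ?_⟩
  set δ := ε ^ 2 / (2 * (c + 1)) with hδ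
  have hδ0 : 0 < δ := by positivity
  refine ⟨u '' (S ∩ ball x δ), image_mem_map ?_, ?_⟩
  · exact inter_mem_nhdsWithin _ (ball_mem_nhds x hδ0)
  · rintro _ ⟨s, hs, rfl⟩ _ ⟨t, ht, rfl⟩
    have h1 := h t ht.1 s hs.1
    have h2 : |s - t| < 2 * δ := by
      have := dist_triangle_right s t x
      have h3 := hs.2
      have h4 := ht.2
      rw [mem_ball] at h3 h4
      rw [Real.dist_eq s t] at this
      linarith
    rw [dist_eq_norm]
    refine lt_of_pow_lt_pow_left₀ 2 hε.le (h1.trans_lt ?_)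
    calc c * |s - t| ≤ c * (2 * δ) := by gcongr
      _ < (c + 1) * (2 * δ) := by nlinarith
      _ = ε ^ 2 := by rw [hδ]; field_simp

theorem exp_im_pos {ω : ℂ} (h : ω.im ∈ Ioo 0 Real.pi) : 0 < (exp ω).im := by
  rw [Complex.exp_im]
  exact mul_pos (Real.exp_pos _) (Real.sin_pos_of_mem_Ioo h)

theorem isOpenMap_exp_mul_I : IsOpenMap fun z : ℂ => exp (z * I) :=
  Complex.isOpenMap_exp.comp (Homeomorph.mulRight₀ I I_ne_zero).isOpenMap

namespace JordanMap

variable {f Φ : ℂ → ℂ} {p : ℂ}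

theorem exists_crosscut (h : JordanMap f p Φ) (x₀ : ℝ) {η : ℝ} (hη : 0 < η) :
    ∃ r : ℝ, 0 < r ∧ r < 1 ∧ ∃ u : ℝ → ℂ, ContinuousOn u (Icc 0 Real.pi) ∧
      (∀ θ ∈ Ioo 0 Real.pi, u θ = Φ (exp ((x₀ + r * exp (θ * I)) * I))) ∧
      u 0 ∈ f '' sphere (0:ℂ) 1 ∧ u Real.pi ∈ f '' sphere (0:ℂ) 1 ∧
      ∀ θ ∈ Icc 0 Real.pi, dist (u θ) (u 0) < η := by
  have hp := Real.pi_pos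
  obtain ⟨R, hR⟩ := h.bdd.subset_closedBall p
  set A := (volume (closedBall p R)).toReal + 1 with hA
  have hA0 : 0 < A := by positivity
  set N := 2 * A * Real.pi / η ^ 2 + 1 with hN
  have hN0 : 0 < N := by positivity
  set Ψ : ℂ → ℂ := fun ω => Φ (exp ((x₀ + exp ω) * I)) with hΨ
  have him : ∀ ω : ℂ, ω.im ∈ Ioo 0 Real.pi → 0 < ((x₀ : ℂ) + exp ω).im := fun ω hω => by
    simpa using exp_im_pos hω
  have hball : ∀ ω : ℂ, ω.im ∈ Ioo 0 Real.pi → exp ((x₀ + exp ω) * I) ∈ ball (0:ℂ) 1 :=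
    fun ω hω => exp_mul_I_mem_ball (him ω hω)
  obtain ⟨x, hx, hH⟩ := exists_holder_segment (x₁ := -1 - N) (x₂ := -1) (a := Real.pi) (Ψ := Ψ)
    (by linarith) (fun ω hω => by
      have h1 := (h.diff.differentiableAt (isOpen_ball.mem_nhds (hball ω hω.2)))
      exact (h1.comp ω (by fun_prop : DifferentiableAt ℂ (fun ω => exp ((x₀ + exp ω) * I)) ω)
        ).differentiableWithinAt)
    (fun ω hω ω' hω' he => by
      have h1 := h.injOn (hball ω hω.2) (hball ω' hω'.2) he
      have hn : ∀ ω : ℂ, ω ∈ Ioo (-1 - N) (-1) ×ℂ Ioo 0 Real.pi → |(exp ω).re| ≤ 1 := fun ω hω => by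
        refine (abs_re_le_norm _).trans ?_
        rw [Complex.norm_exp, Real.exp_le_one_iff]
        have := hω.1.2
        linarith
      have h2 := exp_mul_I_inj h1 (by
        simp only [add_re, ofReal_re, add_sub_add_left_eq_sub]
        refine (abs_sub _ _).trans_lt ?_
        linarith [hn ω hω, hn ω' hω', Real.pi_gt_three])
      exact Complex.exp_inj_of_neg_pi_lt_of_le_pi (by linarith [hω.2.1]) hω.2.2.le
        (by linarith [hω'.2.1]) hω'.2.2.le (add_left_cancel h2))
    hA0 (by
      have h1 : Ψ '' (Ioo (-1 - N) (-1) ×ℂ Ioo 0 Real.pi) ⊆ closedBall p R := by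
        rintro _ ⟨ω, hω, rfl⟩
        exact hR (h.mem_component (hball ω hω.2))
      refine (measure_mono h1).trans ?_
      rw [← ENNReal.ofReal_toReal (measure_closedBall_lt_top (x := p) (r := R)).ne]
      exact ENNReal.ofReal_le_ofReal (by linarith))
  set v : ℝ → ℂ := fun θ => Ψ (x + θ * I) with hv
  set c := 2 * A / N with hc
  have hc0 : 0 < c := by positivity
  have hcN : c * Real.pi < η ^ 2 := by
    have h1 : η ^ 2 * N = 2 * A * Real.pi + η ^ 2 := by rw [hN]; field_simp
    rw [hc, div_mul_eq_mul_div, div_lt_iff₀ hN0, h1]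
    linarith [sq_pos_of_pos hη]
  have hH' : ∀ s ∈ Ioo 0 Real.pi, ∀ t ∈ Ioo 0 Real.pi, ‖v t - v s‖ ^ 2 ≤ c * |t - s| := by
    intro s hs t ht
    have := hH s hs t ht
    rwa [show (-1 : ℝ) - (-1 - N) = N by ring] at this
  have hcl : closure (Ioo 0 Real.pi) = Icc 0 Real.pi := closure_Ioo hp.ne
  have hlim : ∀ θ ∈ Icc 0 Real.pi, ∃ a, Tendsto v (𝓝[Ioo 0 Real.pi] θ) (𝓝 a) := fun θ hθ =>
    exists_tendsto_of_holder hc0.le hH' (hcl ▸ hθ)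
  set u := extendFrom (Ioo 0 Real.pi) v with hu
  have huc : ContinuousOn u (Icc 0 Real.pi) := continuousOn_extendFrom hcl.ge hlim
  have huv : ∀ θ ∈ Ioo 0 Real.pi, u θ = v θ := fun θ hθ => by
    refine extendFrom_extends (fun θ hθ => ?_) θ hθ
    have h1 := h.diff.continuousOn.continuousAt (isOpen_ball.mem_nhds
      (hball (x + θ * I) (by simpa using hθ)))
    exact (ContinuousAt.comp (f := fun θ : ℝ => exp ((x₀ + exp (x + θ * I)) * I)) h1
      (by fun_prop)).continuousWithinAt
  have hend : ∀ θ ∈ Icc 0 Real.pi, Real.sin θ = 0 → u θ ∈ f '' sphere (0:ℂ) 1 := fun θ hθ hs => by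
    have := mem_closure_iff_nhdsWithin_neBot.mp (hcl.ge hθ)
    have hu1 : Tendsto v (𝓝[Ioo 0 Real.pi] θ) (𝓝 (u θ)) := tendsto_extendFrom (hlim θ hθ)
    refine h.mem_curve_of_tendsto (l := 𝓝[Ioo 0 Real.pi] θ)
      (g := fun θ : ℝ => exp ((x₀ + exp (x + θ * I)) * I))
      (ζ := exp ((x₀ + exp (x + θ * I)) * I)) ?_ ?_ ?_ hu1
    · filter_upwards [self_mem_nhdsWithin] with t ht
      exact hball (x + t * I) (by simpa using ht)
    · rw [mem_sphere_zero_iff_norm, norm_exp_mul_I, Real.exp_eq_one_iff]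
      simp [Complex.exp_im, hs]
    · refine Continuous.tendsto' ?_ _ _ rfl |>.mono_left nhdsWithin_le_nhds
      fun_prop
  have hb1 : ∀ s ∈ Ioo 0 Real.pi, ∀ t ∈ Icc 0 Real.pi, ‖u t - u s‖ ^ 2 ≤ c * Real.pi := by
    intro s hs t ht
    refine ContinuousWithinAt.closure_le (s := Ioo 0 Real.pi) (f := fun t => ‖u t - u s‖ ^ 2)
      (hcl.ge ht) ?_ continuousWithinAt_const fun t ht => ?_
    · exact ((((huc t ht).mono Ioo_subset_Icc_self).sub continuousWithinAt_const).norm).pow 2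
    · rw [huv t ht, huv s hs]
      refine (hH' s hs t ht).trans ?_
      gcongr
      exact abs_le.2 ⟨by linarith [hs.2, ht.1], by linarith [hs.1, ht.2]⟩
  have h0 : (0:ℝ) ∈ Icc 0 Real.pi := left_mem_Icc.2 hp.le
  have hb2 : ∀ t ∈ Icc 0 Real.pi, ‖u t - u 0‖ ^ 2 ≤ c * Real.pi := by
    intro t ht
    refine ContinuousWithinAt.closure_le (s := Ioo 0 Real.pi) (f := fun s => ‖u t - u s‖ ^ 2)
      (hcl.ge h0) ?_ continuousWithinAt_const fun s hs => hb1 s hs t ht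
    exact ((continuousWithinAt_const.sub ((huc 0 h0).mono Ioo_subset_Icc_self)).norm).pow 2
  refine ⟨Real.exp x, Real.exp_pos x, ?_, u, huc, fun θ hθ => ?_, hend 0 h0 Real.sin_zero,
    hend _ (right_mem_Icc.2 hp.le) Real.sin_pi, fun θ hθ => ?_⟩
  · rw [Real.exp_lt_one_iff]
    linarith [hx.2]
  · rw [huv θ hθ]
    simp only [hv, hΨ, Complex.exp_add, ofReal_exp]
  · rw [dist_eq_norm]
    exact lt_of_pow_lt_pow_left₀ 2 hη.le ((hb2 θ hθ).trans_lt hcN)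

theorem exists_image_subset_closedBall (h : JordanMap f p Φ) (x₀ : ℝ) {ε : ℝ} (hε : 0 < ε) :
    ∃ a : ℂ, ∃ r > 0, ∀ z : ℂ, 0 < z.im → dist z x₀ < r → Φ (exp (z * I)) ∈ closedBall a ε := by
  have hp := Real.pi_pos
  have hΓ := isCompact_curve h.cont
  obtain ⟨ε', hε', hle, hpε⟩ : ∃ ε' > 0, ε' ≤ ε ∧ ∀ a ∈ f '' sphere (0:ℂ) 1, ε' < dist p a := by
    obtain ⟨d, hd, hd'⟩ := Metric.mem_nhds_iff.1 (hΓ.isClosed.isOpen_compl.mem_nhds h.notMem)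
    refine ⟨min ε (d / 2), by positivity, min_le_left _ _, fun a ha => ?_⟩
    by_contra! hcon
    refine hd' (a := a) ?_ ha
    rw [mem_ball, dist_comm]
    linarith [min_le_right ε (d / 2)]
  obtain ⟨δ, hδ, hsub⟩ := exists_small_subarc h.cont h.inj hε'
  obtain ⟨r, hr, hr1, u, huc, hu, hu0, huπ, hd⟩ := h.exists_crosscut x₀ (lt_min hδ hε')
  have hb1 := (hd _ (right_mem_Icc.2 hp.le)).trans_le (min_le_left _ _)
  rw [dist_comm] at hb1
  obtain ⟨A, hAΓ, hAc, hAp, haA, hbA, hAb⟩ := hsub _ hu0 _ huπ hb1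
  refine ⟨u 0, r, hr, fun z hz hzr => closedBall_subset_closedBall hle ?_⟩
  by_contra hcon
  set K := u '' Icc 0 Real.pi ∪ A with hK
  have hKb : K ⊆ closedBall (u 0) ε' := by
    rintro _ (⟨θ, hθ, rfl⟩ | hx)
    · exact ((hd θ hθ).trans_le (min_le_right _ _)).le
    · exact hAb hx
  have hDim : ∀ θ ∈ Ioo 0 Real.pi, exp ((x₀ + r * exp (θ * I)) * I) ∈ ball (0:ℂ) 1 := fun θ hθ => by
    refine exp_mul_I_mem_ball ?_
    have : 0 < (exp (θ * I)).im := exp_im_pos (by simpa using hθ)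
    simpa using mul_pos hr this
  have hintg : f '' sphere (0:ℂ) 1 ∩ K = A := by
    refine Subset.antisymm ?_ (subset_inter hAΓ subset_union_right)
    rintro _ ⟨hx, (⟨θ, hθ, rfl⟩ | hA)⟩
    · rcases eq_or_lt_of_le hθ.1 with rfl | h1
      · exact haA
      rcases eq_or_lt_of_le hθ.2 with rfl | h2
      · exact hbA
      rw [hu θ ⟨h1, h2⟩] at hx
      exact absurd hx (h.notMem_curve (hDim θ ⟨h1, h2⟩))
    · exact hA
  have hw := exp_mul_I_mem_ball hz
  have h0 : (0:ℂ) ∈ ball (0:ℂ) 1 := mem_ball_self one_pos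
  have hJ := janiszewski (v := Φ 0) (w := Φ (exp (z * I))) hΓ
    ((isCompact_Icc.image_of_continuousOn huc).union hAc)
    (by rw [← hK, hintg]; exact hAp) (by rw [h.zero]; exact h.mem_component hw)
    ((isPreconnected_compl_closedBall_center (u 0) hε').subset_connectedComponentIn
      (by rw [h.zero, mem_compl_iff, mem_closedBall, not_le]; exact hpε _ hu0)
      (compl_subset_compl.2 hKb) hcon)
  obtain ⟨N, hNb, hNp, h0N, hwN, hNK⟩ := h.pullback h0 hw hJ
  have hsep := hNp ((fun z => exp (z * I)) '' ball (x₀:ℂ) r)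
    ((fun z => exp (z * I)) '' closedBall (x₀:ℂ) r)ᶜ ?_ ?_ ?_ ⟨_, hwN, z, hzr, rfl⟩
    ⟨0, h0N, ?_⟩
  · obtain ⟨w, -, ⟨y, hy, rfl⟩, h2⟩ := hsep
    exact h2 ⟨y, ball_subset_closedBall hy, rfl⟩
  · exact isOpenMap_exp_mul_I _ isOpen_ball
  · exact ((isCompact_closedBall _ _).image (by fun_prop)).isClosed.isOpen_compl
  · intro w hw
    by_cases hc : w ∈ (fun z => exp (z * I)) '' closedBall (x₀:ℂ) r
    · left
      obtain ⟨y, hy, rfl⟩ := hc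
      rcases (mem_closedBall.1 hy).lt_or_eq with h1 | h1
      · exact ⟨y, h1, rfl⟩
      · exfalso
        have hyim : 0 < y.im := by
          have := hNb hw
          rw [mem_ball_zero_iff, norm_exp_mul_I, Real.exp_lt_one_iff] at this
          linarith
        rw [dist_eq_norm] at h1
        have h2 : (x₀ : ℂ) + r * exp (arg (y - x₀) * I) = y := by
          rw [← h1, Complex.norm_mul_exp_arg_mul_I]; ring
        have h3 : arg (y - x₀) ∈ Ioo 0 Real.pi := by
          have h4 : 0 < (y - x₀).im := by simpa using hyim
          refine ⟨lt_of_le_of_ne (arg_nonneg_iff.2 h4.le) fun h5 => h4.ne' ?_,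
            arg_lt_pi_iff.2 (Or.inr h4.ne')⟩
          exact (arg_eq_zero_iff.1 h5.symm).2
        refine hNK _ hw (Or.inl ⟨arg (y - x₀), Ioo_subset_Icc_self h3, ?_⟩)
        rw [hu _ h3, h2]
    · exact Or.inr hc
  · rintro ⟨y, -, hy⟩
    exact exp_ne_zero _ hy

theorem exists_tendsto (h : JordanMap f p Φ) {ζ : ℂ} (hζ : ζ ∈ closedBall (0:ℂ) 1) :
    ∃ a, Tendsto Φ (𝓝[ball 0 1] ζ) (𝓝 a) := by
  rw [mem_closedBall_zero_iff] at hζ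
  rcases hζ.lt_or_eq with h1 | h1
  · exact ⟨Φ ζ, h.diff.continuousOn ζ (mem_ball_zero_iff.2 h1)⟩
  have hcl : ζ ∈ closure (ball (0:ℂ) 1) := by
    rw [closure_ball _ one_ne_zero, mem_closedBall_zero_iff]; exact hζ
  have := mem_closure_iff_nhdsWithin_neBot.mp hcl
  apply cauchy_map_iff_exists_tendsto.1
  rw [Metric.cauchy_iff]
  refine ⟨inferInstance, fun ε hε => ?_⟩
  obtain ⟨x₀, -, rfl⟩ := exists_exp_mul_I_eq (mem_sphere_zero_iff_norm.2 h1) 0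
  obtain ⟨a, r, hr, ha⟩ := h.exists_image_subset_closedBall x₀ (by positivity : 0 < ε / 3)
  refine ⟨Φ '' (ball 0 1 ∩ (fun z => exp (z * I)) '' ball (x₀:ℂ) r), image_mem_map ?_, ?_⟩
  · exact inter_mem_nhdsWithin _ ((isOpenMap_exp_mul_I _ isOpen_ball).mem_nhds
      ⟨x₀, mem_ball_self hr, rfl⟩)
  · have key : ∀ w ∈ ball 0 1 ∩ (fun z => exp (z * I)) '' ball (x₀:ℂ) r,
        Φ w ∈ closedBall a (ε / 3) := by
      rintro _ ⟨hw, z, hz, rfl⟩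
      refine ha z ?_ hz
      rw [mem_ball_zero_iff, norm_exp_mul_I, Real.exp_lt_one_iff] at hw
      linarith
    rintro _ ⟨w, hw, rfl⟩ _ ⟨w', hw', rfl⟩
    have h2 := key w hw
    have h3 := key w' hw'
    have := dist_triangle_right (Φ w) (Φ w') a
    rw [mem_closedBall] at h2 h3
    linarith

theorem exists_extension (h : JordanMap f p Φ) :
    ∃ Φ' : ℂ → ℂ, ContinuousOn Φ' (closedBall 0 1) ∧ EqOn Φ' Φ (ball 0 1) ∧
      Φ' '' sphere 0 1 = f '' sphere (0:ℂ) 1 := by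
  have hcl : closure (ball (0:ℂ) 1) = closedBall 0 1 := closure_ball _ one_ne_zero
  have hc : ContinuousOn (extendFrom (ball 0 1) Φ) (closedBall 0 1) :=
    continuousOn_extendFrom hcl.ge fun ζ hζ => h.exists_tendsto hζ
  have he : EqOn (extendFrom (ball 0 1) Φ) Φ (ball 0 1) :=
    extendFrom_extends h.diff.continuousOn
  have hsub : extendFrom (ball 0 1) Φ '' sphere 0 1 ⊆ f '' sphere (0:ℂ) 1 := by
    rintro _ ⟨ζ, hζ, rfl⟩
    have hζ' := sphere_subset_closedBall hζ
    have := mem_closure_iff_nhdsWithin_neBot.mp (hcl.ge hζ')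
    exact h.mem_curve_of_tendsto (l := 𝓝[ball 0 1] ζ) (g := id) self_mem_nhdsWithin hζ
      nhdsWithin_le_nhds (tendsto_extendFrom (h.exists_tendsto hζ'))
  refine ⟨extendFrom (ball 0 1) Φ, hc, he, hsub.antisymm fun a ha => ?_⟩
  have hK := ((isCompact_closedBall (0:ℂ) 1).image_of_continuousOn hc).isClosed
  have h1 : a ∈ extendFrom (ball 0 1) Φ '' closedBall 0 1 := by
    have h2 : closure (connectedComponentIn (f '' sphere (0:ℂ) 1)ᶜ p) ⊆
        extendFrom (ball 0 1) Φ '' closedBall 0 1 := by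
      refine closure_minimal ?_ hK
      rw [← h.image, ← image_congr he]
      exact image_mono ball_subset_closedBall
    rw [← frontier_bounded_component h.cont h.inj h.notMem h.bdd] at ha
    exact h2 (frontier_subset_closure ha)
  obtain ⟨w, hw, rfl⟩ := h1
  rcases (mem_closedBall_zero_iff.1 hw).lt_or_eq with h2 | h2
  · rw [he (mem_ball_zero_iff.2 h2)] at ha
    exact absurd ha (h.notMem_curve (mem_ball_zero_iff.2 h2))
  · exact ⟨w, mem_sphere_zero_iff_norm.2 h2, rfl⟩

end JordanMap

theorem isPreconnected_curve_diff_singleton {f : ℂ → ℂ} (hf : ContinuousOn f (sphere (0:ℂ) 1))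
    (hi : InjOn f (sphere (0:ℂ) 1)) {a : ℂ} (ha : a ∈ f '' sphere (0:ℂ) 1) :
    IsPreconnected (f '' sphere (0:ℂ) 1 \ {a}) := by
  obtain ⟨u, hu, rfl⟩ := ha
  obtain ⟨σ, -, rfl⟩ := exists_exp_mul_I_eq hu 0
  have hp := Real.pi_pos
  have : f '' sphere (0:ℂ) 1 \ {f (exp (σ * I))} =
      (fun t : ℝ => f (exp (t * I))) '' Ioo σ (σ + 2 * Real.pi) := by
    ext z
    constructor
    · rintro ⟨⟨v, hv, rfl⟩, hne⟩
      obtain ⟨t, ht, rfl⟩ := exists_exp_mul_I_eq hv σ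
      refine ⟨t, ⟨lt_of_le_of_ne ht.1 ?_, ht.2⟩, rfl⟩
      rintro rfl
      exact hne rfl
    · rintro ⟨t, ht, rfl⟩
      refine ⟨mem_image_of_mem f (exp_mul_I_mem_sphere t), fun h => ?_⟩
      exact ht.1.ne' (injOn_loop hi σ ⟨ht.1.le, ht.2⟩ ⟨le_rfl, by linarith⟩ h)
  rw [this]
  exact isPreconnected_Ioo.image _ (continuous_loop hf).continuousOn

theorem not_constant_on_arc {Φ : ℂ → ℂ} (hc : ContinuousOn Φ (closedBall 0 1))
    (hd : DifferentiableOn ℂ Φ (ball 0 1)) (hi : InjOn Φ (ball 0 1)) {α β : ℝ} (h1 : α < β)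
    (h2 : β ≤ α + 2 * Real.pi) {a : ℂ} (ha : a ∉ Φ '' ball 0 1) :
    ∃ x ∈ Ioo α β, Φ (exp (x * I)) ≠ a := by
  by_contra! hcon
  have hp := Real.pi_pos
  have he : Real.exp (-1) < 1 := by simp
  have hsub : sphere (0:ℂ) (Real.exp (-1)) ⊆ ball 0 1 := sphere_subset_ball he
  obtain ⟨w, hw, hmin⟩ := (isCompact_sphere (0:ℂ) (Real.exp (-1))).exists_isMinOn
    ((NormedSpace.sphere_nonempty).2 (Real.exp_pos _).le) (f := fun w => ‖Φ w - a‖)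
    ((hd.continuousOn.mono hsub).sub continuousOn_const).norm
  set R := ‖Φ w - a‖ with hR
  have hR0 : 0 < R := norm_pos_iff.2 (sub_ne_zero.2 fun h => ha ⟨w, hsub hw, h⟩)
  have him : ∀ z ∈ Ioo α β ×ℂ Ioo 0 1, exp (z * I) ∈ ball (0:ℂ) 1 := fun z hz =>
    exp_mul_I_mem_ball hz.2.1
  set N := 2 * Real.pi / (β - α) + 1 with hN
  have hβα : 0 < β - α := by linarith
  have hN0 : 0 < N := by positivity
  have := rectangle_estimate (Ψ := fun z => Φ (exp (z * I))) (ρ := R * Real.exp (-N)) (R := R) h1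
    one_pos (by positivity) (by
      have : Real.exp (-N) < 1 := by rw [Real.exp_lt_one_iff]; linarith
      nlinarith)
    (hc.comp (by fun_prop) fun z hz => exp_mul_I_mem_closedBall hz.2.1)
    (hd.comp (by fun_prop) him)
    (fun z hz z' hz' h => exp_mul_I_inj (hi (him z hz) (him z' hz') h) (by
      rw [abs_lt]
      constructor <;> linarith [hz.1.1, hz'.1.1, hz.1.2, hz'.1.2])) a
    (fun x hx => ⟨0, by simp, 1, by simp, by
      have := hcon x hx
      simp only [ofReal_zero, zero_mul, add_zero, this, sub_self, norm_zero]
      positivity, hmin (by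
        rw [mem_sphere_zero_iff_norm, norm_exp_mul_I]
        simp)⟩)
  rw [div_mul_eq_div_div, div_self hR0.ne', one_div, ← Real.exp_neg, neg_neg, Real.log_exp, hN,
    mul_add, mul_div_cancel₀ _ hβα.ne'] at this
  linarith

namespace JordanMap

variable {f Φ Φ' : ℂ → ℂ} {p : ℂ}

theorem injOn_sphere_aux (h : JordanMap f p Φ) (hc : ContinuousOn Φ' (closedBall 0 1))
    (he : EqOn Φ' Φ (ball 0 1)) (hs : Φ' '' sphere 0 1 = f '' sphere (0:ℂ) 1) {α β : ℝ}
    (h1 : α < β) (h2 : β < α + 2 * Real.pi) : Φ' (exp (α * I)) ≠ Φ' (exp (β * I)) := by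
  intro hab
  have hp := Real.pi_pos
  have hmem : ∀ t : ℝ, Φ' (exp (t * I)) ∈ f '' sphere (0:ℂ) 1 := fun t =>
    hs ▸ mem_image_of_mem Φ' (exp_mul_I_mem_sphere t)
  set a := Φ' (exp (α * I)) with ha
  have haΓ : a ∈ f '' sphere (0:ℂ) 1 := hmem α
  have haΩ : a ∉ Φ' '' ball 0 1 := by
    rw [image_congr he]
    rintro ⟨w, hw, hwa⟩
    exact h.notMem_curve hw (hwa ▸ haΓ)
  have hd' : DifferentiableOn ℂ Φ' (ball 0 1) := h.diff.congr he
  have hi' : InjOn Φ' (ball 0 1) := h.injOn.congr he.symm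
  obtain ⟨x₁, hx₁, hx₁a⟩ := not_constant_on_arc hc hd' hi' h1 h2.le haΩ
  obtain ⟨x₂, hx₂, hx₂a⟩ := not_constant_on_arc hc hd' hi' h2 (by linarith) haΩ
  set D : ℝ → Set ℂ := fun t => (fun s : ℝ => (s : ℂ) * exp (t * I)) '' Icc 0 1 with hD
  have hDc : ∀ t, IsCompact (D t) := fun t => isCompact_Icc.image (by fun_prop)
  have hDb : ∀ t, D t ⊆ closedBall 0 1 := by
    rintro t _ ⟨s, hs, rfl⟩
    simp only [mem_closedBall_zero_iff, norm_mul, norm_exp_ofReal_mul_I, norm_real, mul_one,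
      Real.norm_eq_abs]
    exact abs_le.2 ⟨by linarith [hs.1], hs.2⟩
  set K := Φ' '' (D α ∪ D β) with hK
  have hKc : IsCompact K := ((hDc α).union (hDc β)).image_of_continuousOn
    (hc.mono (union_subset (hDb α) (hDb β)))
  have hDs : ∀ t, ∀ w ∈ D t, ‖w‖ = 1 → w = exp (t * I) := by
    rintro t _ ⟨s, hs, rfl⟩ hw
    simp only [norm_mul, norm_exp_ofReal_mul_I, norm_real, mul_one, Real.norm_eq_abs,
      abs_of_nonneg hs.1] at hw
    simp [hw]
  have hintg : f '' sphere (0:ℂ) 1 ∩ K = {a} := by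
    refine Subset.antisymm ?_ (singleton_subset_iff.2 ⟨haΓ, _, Or.inl ⟨1, by simp, by simp⟩, rfl⟩)
    rintro _ ⟨hx, w, hw, rfl⟩
    have hwb := union_subset (hDb α) (hDb β) hw
    rcases (mem_closedBall_zero_iff.1 hwb).lt_or_eq with h3 | h3
    · rw [he (mem_ball_zero_iff.2 h3)] at hx
      exact absurd hx (h.notMem_curve (mem_ball_zero_iff.2 h3))
    · rcases hw with hw | hw
      · rw [hDs α w hw h3]; rfl
      · rw [hDs β w hw h3, ← hab]; rfl
  have hΓa : f '' sphere (0:ℂ) 1 \ {a} ⊆ Kᶜ := fun x hx hxK => hx.2 (hintg ▸ ⟨hx.1, hxK⟩)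
  set W := connectedComponentIn Kᶜ (Φ' (exp (x₁ * I))) with hW
  have hWo : IsOpen W := hKc.isClosed.isOpen_compl.connectedComponentIn
  have hW1 : ∀ t : ℝ, Φ' (exp (t * I)) ≠ a → Φ' (exp (t * I)) ∈ W := fun t ht =>
    (isPreconnected_curve_diff_singleton h.cont h.inj haΓ).subset_connectedComponentIn
      ⟨hmem x₁, hx₁a⟩ hΓa ⟨hmem t, ht⟩
  have key : ∀ t : ℝ, Φ' (exp (t * I)) ≠ a → ∀ U : Set ℂ, IsOpen U → exp (t * I) ∈ U →
      ∃ w ∈ ball (0:ℂ) 1, w ∈ U ∧ Φ w ∈ W := fun t ht U hU htU => by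
    have hcl : exp (t * I) ∈ closure (ball (0:ℂ) 1) := by
      rw [closure_ball _ one_ne_zero]; exact sphere_subset_closedBall (exp_mul_I_mem_sphere t)
    have := mem_closure_iff_nhdsWithin_neBot.mp hcl
    have h3 := (hc _ (sphere_subset_closedBall (exp_mul_I_mem_sphere t))).mono
      ball_subset_closedBall |>.eventually (hWo.mem_nhds (hW1 t ht))
    have h4 : ∀ᶠ w in 𝓝[ball 0 1] exp (t * I), w ∈ U := nhdsWithin_le_nhds (hU.mem_nhds htU)
    have h5 : ∀ᶠ w in 𝓝[ball 0 1] exp (t * I), w ∈ ball (0:ℂ) 1 := self_mem_nhdsWithin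
    obtain ⟨w, hw1, hw2, hw3⟩ := (h3.and (h4.and h5)).exists
    exact ⟨w, hw3, hw2, he hw3 ▸ hw1⟩
  set S : ℝ → ℝ → Set ℂ := fun s t => (fun z => exp (z * I)) '' (Complex.re ⁻¹' Ioo s t) with hS
  have hSo : ∀ s t, IsOpen (S s t) := fun s t =>
    isOpenMap_exp_mul_I _ (isOpen_Ioo.preimage continuous_re)
  obtain ⟨w₁, hw₁, hw₁U, hw₁W⟩ := key x₁ hx₁a (S α β) (hSo _ _) ⟨x₁, by simpa using hx₁, rfl⟩
  obtain ⟨w₂, hw₂, hw₂U, hw₂W⟩ := key x₂ hx₂a (S β (α + 2 * Real.pi)) (hSo _ _)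
    ⟨x₂, by simpa using hx₂, rfl⟩
  have hJ := janiszewski (v := Φ w₁) (w := Φ w₂) (isCompact_curve h.cont) hKc
    (hintg ▸ isPreconnected_singleton)
    (by rw [← connectedComponentIn_eq (h.mem_component hw₁)]; exact h.mem_component hw₂)
    (by rw [← connectedComponentIn_eq hw₁W]; exact hw₂W)
  obtain ⟨N, hNb, hNp, hN1, hN2, hNK⟩ := h.pullback hw₁ hw₂ hJ
  have hcov : N ⊆ S α β ∪ S β (α + 2 * Real.pi) := by
    intro w hw
    have hwb := hNb hw
    have hnot : ∀ w ∈ ball (0:ℂ) 1, w ∈ D α ∪ D β → Φ w ∈ K := fun w hw hwD =>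
      ⟨w, hwD, he hw⟩
    have hw0 : w ≠ 0 := by
      rintro rfl
      exact hNK _ hw (hnot _ hwb (Or.inl ⟨0, by simp, by simp⟩))
    obtain ⟨z, hz, -, rfl⟩ := exists_exp_mul_I_eq_of_ne_zero hw0 α
    have hrad : exp (z * I) ∈ D z.re := by
      rw [mem_ball_zero_iff, norm_exp_mul_I] at hwb
      refine ⟨Real.exp (-z.im), ⟨(Real.exp_pos _).le, hwb.le⟩, ?_⟩
      simp only [ofReal_exp, ← Complex.exp_add]
      congr 1
      apply Complex.ext <;> simp
    rcases eq_or_lt_of_le hz.1 with h3 | h3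
    · exact absurd (hnot _ hwb (Or.inl (h3 ▸ hrad))) (hNK _ hw)
    rcases lt_trichotomy z.re β with h4 | h4 | h4
    · exact Or.inl ⟨z, ⟨h3, h4⟩, rfl⟩
    · exact absurd (hnot _ hwb (Or.inr (h4 ▸ hrad))) (hNK _ hw)
    · exact Or.inr ⟨z, ⟨h4, hz.2⟩, rfl⟩
  obtain ⟨w, -, ⟨y, hy, rfl⟩, y', hy', hyy⟩ := hNp _ _ (hSo _ _) (hSo _ _) hcov ⟨w₁, hN1, hw₁U⟩
    ⟨w₂, hN2, hw₂U⟩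
  have h3 := exp_mul_I_inj hyy (by
    rw [abs_lt]
    constructor <;> linarith [hy.1, hy'.1, hy.2, hy'.2])
  rw [h3] at hy'
  linarith [hy.2, hy'.1]

/-- **Carathéodory's theorem**: a conformal map onto a Jordan domain extends to a homeomorphism
of the closures. -/
theorem caratheodory (h : JordanMap f p Φ) :
    ∃ Φ' : ℂ → ℂ, ContinuousOn Φ' (closedBall 0 1) ∧ EqOn Φ' Φ (ball 0 1) ∧
      Φ' '' sphere 0 1 = f '' sphere (0:ℂ) 1 ∧ InjOn Φ' (closedBall 0 1) := by
  obtain ⟨Φ', hc, he, hs⟩ := h.exists_extension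
  refine ⟨Φ', hc, he, hs, ?_⟩
  have hsep : ∀ u ∈ ball (0:ℂ) 1, ∀ v ∈ sphere (0:ℂ) 1, Φ' u ≠ Φ' v := fun u hu v hv huv => by
    rw [he hu] at huv
    exact h.notMem_curve hu (huv ▸ hs ▸ mem_image_of_mem Φ' hv)
  intro u hu v hv huv
  rw [← ball_union_sphere] at hu hv
  rcases hu with hu | hu <;> rcases hv with hv | hv
  · rw [he hu, he hv] at huv
    exact h.injOn hu hv huv
  · exact absurd huv (hsep u hu v hv)
  · exact absurd huv.symm (hsep v hv u hu)
  · obtain ⟨s, hs1, rfl⟩ := exists_exp_mul_I_eq hu 0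
    obtain ⟨t, ht1, rfl⟩ := exists_exp_mul_I_eq hv 0
    rcases lt_trichotomy s t with h1 | h1 | h1
    · exact absurd huv (h.injOn_sphere_aux hc he hs h1 (by linarith [hs1.1, ht1.2]))
    · rw [h1]
    · exact absurd huv.symm (h.injOn_sphere_aux hc he hs h1 (by linarith [ht1.1, hs1.2]))

end JordanMap

/-- The conformal map of a Jordan domain, extended to the closed disk. -/
theorem exists_closed_riemann_map {f : ℂ → ℂ} (hf : ContinuousOn f (sphere (0:ℂ) 1))
    (hi : InjOn f (sphere (0:ℂ) 1)) {p : ℂ} (hp : p ∉ f '' sphere (0:ℂ) 1)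
    (hb : Bornology.IsBounded (connectedComponentIn (f '' sphere (0:ℂ) 1)ᶜ p)) :
    ∃ Φ : ℂ → ℂ, JordanMap f p Φ ∧ ContinuousOn Φ (closedBall 0 1) ∧ InjOn Φ (closedBall 0 1) ∧
      Φ '' sphere 0 1 = f '' sphere (0:ℂ) 1 := by
  have hΓ := isCompact_curve hf
  have hpm : p ∈ connectedComponentIn (f '' sphere (0:ℂ) 1)ᶜ p := mem_connectedComponentIn hp
  have hΩ : IsOpen (connectedComponentIn (f '' sphere (0:ℂ) 1)ᶜ p) :=
    hΓ.isClosed.isOpen_compl.connectedComponentIn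
  have hpre : IsPreconnected (connectedComponentIn (f '' sphere (0:ℂ) 1)ᶜ p) :=
    isPreconnected_connectedComponentIn
  have hfr := frontier_bounded_component hf hi hp hb
  have hP := hasPrimitivesOn_of_isPreconnected_compl hΩ hb hpre
    (isPreconnected_compl_of_frontier hΩ (by rw [hfr]; exact isPreconnected_curve hf)
      (by rw [hfr]; exact (NormedSpace.sphere_nonempty.2 zero_le_one).image f))
  obtain ⟨Φ, hd, hinj, him, h0⟩ := exists_riemann_map hΩ hpre hb hP hpm
  have hJ : JordanMap f p Φ := ⟨hf, hi, hp, hb, hd, hinj, him, h0⟩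
  obtain ⟨Φ', hc, he, hs, hi'⟩ := hJ.caratheodory
  exact ⟨Φ', ⟨hf, hi, hp, hb, hd.congr he, hinj.congr he.symm, (image_congr he).trans him,
    (he (mem_ball_self one_pos)).trans h0⟩, hc, hi', hs⟩

theorem norm_sq_le_lintegral_circle {φ : ℂ → ℂ} (hφ : DifferentiableOn ℂ φ (ball 0 1)) {s : ℝ}
    (hs : s ∈ Ioo 0 1) : ENNReal.ofReal (2 * Real.pi * ‖φ 0‖ ^ 2) ≤
      ∫⁻ θ in Ioo (-Real.pi) Real.pi, ENNReal.ofReal (‖φ (circleMap 0 s θ)‖ ^ 2) := by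
  have hp := Real.pi_pos
  have hsub : closedBall (0:ℂ) |s| ⊆ ball 0 1 := closedBall_subset_ball (by
    rw [abs_of_pos hs.1]; exact hs.2)
  have h1 : DiffContOnCl ℂ (fun z => φ z ^ 2) (ball 0 |s|) :=
    (hφ.pow 2).diffContOnCl_ball hsub
  have h2 := h1.circleAverage
  have hper : Function.Periodic (fun θ => φ (circleMap 0 s θ) ^ 2) (2 * Real.pi) := fun θ => by
    simp only [periodic_circleMap 0 s θ]
  have h3 := hper.intervalIntegral_add_eq 0 (-Real.pi)
  rw [zero_add, show -Real.pi + 2 * Real.pi = Real.pi by ring] at h3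
  rw [Real.circleAverage_def, h3, intervalIntegral.integral_of_le (by linarith),
    integral_Ioc_eq_integral_Ioo] at h2
  have h4 : 2 * Real.pi * ‖φ 0‖ ^ 2 =
      ‖∫ θ in Ioo (-Real.pi) Real.pi, φ (circleMap 0 s θ) ^ 2‖ := by
    rw [← norm_pow, ← h2, norm_smul, norm_inv, Real.norm_of_nonneg (by positivity)]
    field_simp
  rw [h4, ofReal_norm]
  refine (enorm_integral_le_lintegral_enorm _).trans (le_of_eq ?_)
  refine lintegral_congr fun θ => ?_
  rw [← ofReal_norm, norm_pow]

theorem area_mean_value {φ : ℂ → ℂ} (hφ : DifferentiableOn ℂ φ (ball 0 1)) {r : ℝ} (hr : 0 ≤ r)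
    (hr1 : r ≤ 1) : ENNReal.ofReal (Real.pi * r ^ 2 * ‖φ 0‖ ^ 2) ≤
      ∫⁻ z in ball (0:ℂ) r, ENNReal.ofReal (‖φ z‖ ^ 2) := by
  have hp := Real.pi_pos
  rw [← lintegral_indicator isOpen_ball.measurableSet, ← Complex.lintegral_comp_polarCoord_symm]
  have hsub : Ioo 0 r ×ˢ Ioo (-Real.pi) Real.pi ⊆ _root_.polarCoord.target := by
    rw [polarCoord_target]
    exact prod_mono Ioo_subset_Ioi_self subset_rfl
  refine le_trans ?_ (lintegral_mono_set hsub)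
  have hmeas : MeasurableSet (Ioo 0 r ×ˢ Ioo (-Real.pi) Real.pi) :=
    measurableSet_Ioo.prod measurableSet_Ioo
  have h1 : ∀ p ∈ Ioo 0 r ×ˢ Ioo (-Real.pi) Real.pi, ENNReal.ofReal p.1 •
      (ball (0:ℂ) r).indicator (fun z => ENNReal.ofReal (‖φ z‖ ^ 2)) (Complex.polarCoord.symm p) =
      ENNReal.ofReal p.1 * ENNReal.ofReal (‖φ (circleMap 0 p.1 p.2)‖ ^ 2) := by
    rintro ⟨s, θ⟩ ⟨hs, -⟩
    have hs : s ∈ Ioo 0 r := hs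
    have h2 : Complex.polarCoord.symm (s, θ) = circleMap 0 s θ := by
      simp [Complex.polarCoord_symm_apply, circleMap, Complex.exp_mul_I]
    rw [h2, indicator_of_mem, smul_eq_mul]
    simp [abs_of_pos hs.1, hs.2]
  rw [setLIntegral_congr_fun hmeas h1, Measure.volume_eq_prod, setLIntegral_prod]
  · have h2 : ∀ s ∈ Ioo 0 r, ENNReal.ofReal (2 * Real.pi * ‖φ 0‖ ^ 2) * ENNReal.ofReal s ≤
        ∫⁻ θ in Ioo (-Real.pi) Real.pi, ENNReal.ofReal s *
          ENNReal.ofReal (‖φ (circleMap 0 s θ)‖ ^ 2) := fun s hs => by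
      rw [lintegral_const_mul' _ _ ENNReal.ofReal_ne_top, mul_comm]
      gcongr
      exact norm_sq_le_lintegral_circle hφ ⟨hs.1, hs.2.trans_le hr1⟩
    refine le_trans ?_ (setLIntegral_mono' measurableSet_Ioo h2)
    rw [lintegral_const_mul' _ _ ENNReal.ofReal_ne_top, ← ofReal_integral_eq_lintegral_ofReal,
      ← integral_Ioc_eq_integral_Ioo, ← intervalIntegral.integral_of_le hr, integral_id,
      ← ENNReal.ofReal_mul (by positivity)]
    · refine ENNReal.ofReal_le_ofReal (le_of_eq ?_)
      ring
    · exact (continuous_id.integrableOn_Icc).mono_set Ioo_subset_Icc_self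
    · exact (ae_restrict_iff' measurableSet_Ioo).2 (Eventually.of_forall fun x hx => hx.1.le)
  · refine (measurable_fst.ennreal_ofReal).aemeasurable.mul (ContinuousOn.aemeasurable ?_ hmeas)
    refine ENNReal.continuous_ofReal.comp_continuousOn (ContinuousOn.pow (ContinuousOn.norm ?_) 2)
    refine hφ.continuousOn.comp (by unfold circleMap; fun_prop) fun p hp => ?_
    have h3 : p.1 ∈ Ioo 0 r := hp.1
    simpa [abs_of_pos h3.1] using h3.2.trans_le hr1

/-- Growth of `log |k - q|` along radii, when its hyperbolic derivative is at most `M`. -/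
theorem abs_log_norm_sub_le {k : ℂ → ℂ} (hk : DifferentiableOn ℂ k (ball 0 1)) {q : ℂ}
    (hq : q ∉ k '' ball 0 1) {M : ℝ}
    (hM : ∀ z ∈ ball (0:ℂ) 1, (1 - ‖z‖ ^ 2) * ‖deriv k z‖ ≤ M * ‖k z - q‖) {z : ℂ}
    (hz : z ∈ ball (0:ℂ) 1) :
    |Real.log ‖k z - q‖ - Real.log ‖k 0 - q‖| ≤ M / 2 * Real.log ((1 + ‖z‖) / (1 - ‖z‖)) := by
  have hz1 : ‖z‖ < 1 := by simpa using hz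
  have hn := norm_nonneg z
  have htz : ∀ t ∈ Icc (0:ℝ) 1, t * ‖z‖ < 1 ∧ 0 ≤ t * ‖z‖ := fun t ht =>
    ⟨by nlinarith [ht.1, ht.2], mul_nonneg ht.1 hn⟩
  have hb : ∀ t ∈ Icc (0:ℝ) 1, (t:ℂ) * z ∈ ball (0:ℂ) 1 := fun t ht => by
    rw [mem_ball_zero_iff, norm_mul, norm_real, Real.norm_of_nonneg ht.1]
    exact (htz t ht).1
  have hne : ∀ t ∈ Icc (0:ℝ) 1, k (t * z) - q ≠ 0 := fun t ht h =>
    hq ⟨_, hb t ht, sub_eq_zero.1 h⟩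
  have hder : ∀ t ∈ Icc (0:ℝ) 1, ∃ d, HasDerivAt (fun τ : ℝ => Real.log ‖k (τ * z) - q‖) d t ∧
      |d| ≤ ‖deriv k (t * z) * z‖ / ‖k (t * z) - q‖ := fun t ht => by
    have h1 := (hk.differentiableAt (isOpen_ball.mem_nhds (hb t ht))).hasDerivAt
    have h2 : HasDerivAt (fun τ : ℝ => (τ : ℂ) * z) z t := by
      simpa using (hasDerivAt_id t).ofReal_comp.mul_const z
    exact hasDerivAt_log_norm ((h1.comp_of_eq t h2 rfl).sub_const q) (hne t ht)
  choose! d hd hd' using hder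
  have key := image_norm_le_of_norm_deriv_right_le_deriv_boundary' (a := 0) (b := 1)
    (f := fun t : ℝ => Real.log ‖k (t * z) - q‖ - Real.log ‖k 0 - q‖) (f' := d)
    (B := fun t => M / 2 * (Real.log (1 + t * ‖z‖) - Real.log (1 - t * ‖z‖)))
    (B' := fun t => M / 2 * (‖z‖ / (1 + t * ‖z‖) - -‖z‖ / (1 - t * ‖z‖)))
    (fun t ht => ((hd t ht).continuousAt.continuousWithinAt).sub continuousWithinAt_const)
    (fun t ht => ((hd t (Ico_subset_Icc_self ht)).sub_const _).hasDerivWithinAt) (by simp)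
    ?_ ?_ ?_ (right_mem_Icc.2 zero_le_one)
  · simp only [ofReal_one, one_mul, Real.norm_eq_abs] at key
    rwa [Real.log_div (by positivity) (by linarith)]
  · intro t ht
    have := htz t ht
    refine ContinuousAt.continuousWithinAt ?_
    have h1 : 1 + t * ‖z‖ ≠ 0 := by linarith
    have h2 : 1 - t * ‖z‖ ≠ 0 := by linarith
    fun_prop (disch := assumption)
  · intro t ht
    have := htz t (Ico_subset_Icc_self ht)
    have h0 : HasDerivAt (fun t : ℝ => t * ‖z‖) ‖z‖ t := by
      simpa using (hasDerivAt_id t).mul_const ‖z‖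
    exact (((h0.const_add 1).log (by linarith)).sub
      ((h0.const_sub 1).log (by linarith))).const_mul _ |>.hasDerivWithinAt
  · intro t ht
    have ht' := Ico_subset_Icc_self ht
    have := htz t ht'
    have h1 := hM _ (hb t ht')
    have h3 := norm_pos_iff.2 (hne t ht')
    rw [norm_mul, norm_real, Real.norm_of_nonneg ht'.1] at h1
    have h2 : (0:ℝ) < 1 - (t * ‖z‖) ^ 2 := by nlinarith
    have h4 : (0:ℝ) < 1 + t * ‖z‖ := by linarith
    have h5 : (0:ℝ) < 1 - t * ‖z‖ := by linarith
    refine (hd' t ht').trans ?_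
    have h6 : M / 2 * (‖z‖ / (1 + t * ‖z‖) - -‖z‖ / (1 - t * ‖z‖)) =
        M * ‖z‖ / (1 - (t * ‖z‖) ^ 2) := by
      rw [show 1 - (t * ‖z‖) ^ 2 = (1 + t * ‖z‖) * (1 - t * ‖z‖) by ring,
        div_sub_div _ _ h4.ne' h5.ne', ← mul_div_assoc]
      congr 1
      ring
    rw [h6, norm_mul, div_le_div_iff₀ h3 h2]
    nlinarith

theorem log_three_lt : Real.log 3 < 1.12 := by
  rw [Real.log_lt_iff_lt_exp (by norm_num)]
  have h1 := Real.exp_one_gt_d9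
  have h2 := Real.add_one_le_exp (0.12 : ℝ)
  rw [show (1.12 : ℝ) = 1 + 0.12 by norm_num, Real.exp_add]
  nlinarith

theorem norm_deriv_zero_sq_le {k : ℂ → ℂ} (hk : DifferentiableOn ℂ k (ball 0 1))
    (hi : InjOn k (ball 0 1)) {q : ℂ} (hq : q ∉ k '' ball 0 1) {M : ℝ} (hM0 : 0 < M)
    (hM : ∀ z ∈ ball (0:ℂ) 1, (1 - ‖z‖ ^ 2) * ‖deriv k z‖ ≤ M * ‖k z - q‖) :
    ‖deriv k 0‖ ^ 2 ≤ 7 * M * ‖k 0 - q‖ ^ 2 := by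
  have hp := Real.pi_pos
  have hne : ∀ z ∈ ball (0:ℂ) 1, k z - q ≠ 0 := fun z hz h => hq ⟨z, hz, sub_eq_zero.1 h⟩
  have h0 : (0:ℂ) ∈ ball (0:ℂ) 1 := mem_ball_self one_pos
  have hsub : ball (0:ℂ) 0.8 ⊆ ball 0 1 := ball_subset_ball (by norm_num)
  set P := ‖k 0 - q‖ with hP
  have hP0 : 0 < P := norm_pos_iff.2 (hne 0 h0)
  set T := M * Real.log 3 with hT
  have hlog3 : 0 < Real.log 3 := Real.log_pos (by norm_num)
  have hT0 : 0 < T := by positivity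
  have h1 := area_mean_value (φ := fun z => deriv k z / (k z - q))
    ((hk.deriv isOpen_ball).div (hk.sub_const q) hne) (r := 0.8) (by norm_num) (by norm_num)
  have h2 := lintegral_norm_deriv_sq_mul isOpen_ball (hk.mono hsub) (hi.mono hsub)
    ((ball q (P * Real.exp T) \ closedBall q (P * Real.exp (-T))).indicator
      (fun w => ENNReal.ofReal ((‖w - q‖ ^ 2)⁻¹)))
  have h3 : ∫⁻ z in ball (0:ℂ) 0.8, ENNReal.ofReal (‖deriv k z / (k z - q)‖ ^ 2) =
      ∫⁻ z in ball (0:ℂ) 0.8, ENNReal.ofReal (‖deriv k z‖ ^ 2) *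
        (ball q (P * Real.exp T) \ closedBall q (P * Real.exp (-T))).indicator
          (fun w => ENNReal.ofReal ((‖w - q‖ ^ 2)⁻¹)) (k z) := by
    refine setLIntegral_congr_fun isOpen_ball.measurableSet fun z hz => ?_
    have hz1 := hsub hz
    have hpos := norm_pos_iff.2 (hne z hz1)
    have hzn : ‖z‖ < 0.8 := by simpa using hz
    have h4 := abs_log_norm_sub_le hk hq hM hz1
    have h5 : M / 2 * Real.log ((1 + ‖z‖) / (1 - ‖z‖)) < T := by
      have : Real.log ((1 + ‖z‖) / (1 - ‖z‖)) < Real.log (3 ^ 2) := by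
        have hd : 0 < 1 - ‖z‖ := by linarith
        refine Real.log_lt_log (by positivity) ?_
        rw [div_lt_iff₀ hd]
        linarith
      rw [Real.log_pow] at this
      push_cast at this
      rw [hT]
      nlinarith
    have h6 := abs_lt.1 (h4.trans_lt h5)
    have e1 : P * Real.exp T = Real.exp (Real.log P + T) := by
      rw [Real.exp_add, Real.exp_log hP0]
    have e2 : P * Real.exp (-T) = Real.exp (Real.log P - T) := by
      rw [sub_eq_add_neg, Real.exp_add, Real.exp_log hP0]
    rw [indicator_of_mem, ← ENNReal.ofReal_mul (by positivity), norm_div, div_pow, div_eq_mul_inv]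
    rw [Set.mem_sdiff, mem_ball_iff_norm, mem_closedBall_iff_norm, not_le, e1, e2,
      ← Real.log_lt_iff_lt_exp hpos, ← Real.lt_log_iff_exp_lt hpos]
    exact ⟨by linarith [h6.2], by linarith [h6.1]⟩
  rw [h3, h2] at h1
  have h7 := h1.trans ((setLIntegral_le_lintegral _ _).trans (lintegral_annulus_le q
    (by positivity) (by gcongr; linarith)))
  rw [mul_div_mul_left _ _ hP0.ne', ← Real.exp_sub, Real.log_exp,
    ENNReal.ofReal_le_ofReal_iff (mul_nonneg (by positivity) (by linarith)), norm_div, ← hP,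
        div_pow] at h7
  have h8 : ‖deriv k 0‖ ^ 2 / P ^ 2 * 0.64 ≤ 4 * (M * Real.log 3) := by
    have : Real.pi * (‖deriv k 0‖ ^ 2 / P ^ 2 * 0.64) ≤ Real.pi * (4 * (M * Real.log 3)) := by
      rw [hT] at h7
      linarith
    exact le_of_mul_le_mul_left this hp
  have h9 : ‖deriv k 0‖ ^ 2 / P ^ 2 ≤ 7 * M := by
    nlinarith [log_three_lt]
  rwa [div_le_iff₀ (by positivity)] at h9

theorem one_sub_norm_diskMap_sq {a z : ℂ} (ha : a ∈ ball (0:ℂ) 1) (hz : z ∈ ball (0:ℂ) 1) :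
    1 - ‖diskMap a z‖ ^ 2 =
      (1 - ‖z‖ ^ 2) * ‖-(1 - (‖a‖ : ℂ) ^ 2) / (1 - (starRingEnd ℂ) a * z) ^ 2‖ := by
  have h0 := norm_pos_iff.2 (diskMap_denom_ne_zero ha (ball_subset_closedBall hz))
  have ha1 : ‖a‖ < 1 := by simpa using ha
  have h1 : ‖-(1 - (‖a‖ : ℂ) ^ 2)‖ = 1 - ‖a‖ ^ 2 := by
    rw [norm_neg, show 1 - (‖a‖ : ℂ) ^ 2 = ((1 - ‖a‖ ^ 2 : ℝ) : ℂ) by push_cast; ring, norm_real,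
      Real.norm_of_nonneg (by nlinarith [norm_nonneg a])]
  have h2 := normSq_one_sub_conj_mul a z
  rw [diskMap, norm_div, norm_div, norm_pow, h1, div_pow]
  generalize ‖1 - (starRingEnd ℂ) a * z‖ = D at h0 h2 ⊢
  field_simp
  linarith

theorem norm_deriv_sq_le {k : ℂ → ℂ} (hk : DifferentiableOn ℂ k (ball 0 1))
    (hi : InjOn k (ball 0 1)) {q : ℂ} (hq : q ∉ k '' ball 0 1) {M : ℝ} (hM0 : 0 < M)
    (hM : ∀ z ∈ ball (0:ℂ) 1, (1 - ‖z‖ ^ 2) * ‖deriv k z‖ ≤ M * ‖k z - q‖) {a : ℂ}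
    (ha : a ∈ ball (0:ℂ) 1) :
    ((1 - ‖a‖ ^ 2) * ‖deriv k a‖) ^ 2 ≤ 7 * M * ‖k a - q‖ ^ 2 := by
  have hmaps : MapsTo (diskMap a) (ball 0 1) (ball 0 1) := fun z hz => diskMap_mem_ball ha hz
  have hder : ∀ z ∈ ball (0:ℂ) 1, deriv (k ∘ diskMap a) z =
      deriv k (diskMap a z) * (-(1 - ‖a‖ ^ 2) / (1 - (starRingEnd ℂ) a * z) ^ 2) := fun z hz =>
    ((hk.differentiableAt (isOpen_ball.mem_nhds (hmaps hz))).hasDerivAt.comp z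
      (hasDerivAt_diskMap ha (ball_subset_closedBall hz))).deriv
  have h0 : (0:ℂ) ∈ ball (0:ℂ) 1 := mem_ball_self one_pos
  have := norm_deriv_zero_sq_le (k := k ∘ diskMap a) (q := q) (M := M)
    (hk.comp (fun z hz => (hasDerivAt_diskMap ha
      (ball_subset_closedBall hz)).differentiableAt.differentiableWithinAt) hmaps)
    (hi.comp ((diskMap_injOn ha).mono ball_subset_closedBall) hmaps)
    (by
      rintro ⟨z, hz, hzq⟩
      exact hq ⟨_, hmaps hz, hzq⟩) hM0
    (fun z hz => by
      rw [hder z hz, norm_mul, mul_comm ‖deriv k _‖, ← mul_assoc, ← one_sub_norm_diskMap_sq ha hz]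
      exact hM _ (hmaps hz))
  have h1 := one_sub_norm_diskMap_sq ha h0
  rw [hder 0 h0, norm_mul] at this
  simp only [diskMap_zero, norm_zero, Function.comp_apply] at this h1
  rw [mul_comm]
  convert this using 3
  rw [h1]
  ring

/-- A Koebe-type distortion estimate. -/
theorem koebe_distortion {k : ℂ → ℂ} (hk : DifferentiableOn ℂ k (ball 0 1))
    (hi : InjOn k (ball 0 1)) {q : ℂ} (hq : q ∉ k '' ball 0 1) {w : ℂ}
    (hw : w ∈ ball (0:ℂ) 1) : (1 - ‖w‖ ^ 2) * ‖deriv k w‖ ≤ 7 * ‖k w - q‖ := by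
  have hne : ∀ z ∈ ball (0:ℂ) 1, ‖k z - q‖ ≠ 0 := fun z hz h =>
    hq ⟨z, hz, sub_eq_zero.1 (norm_eq_zero.1 h)⟩
  have hdk := hk.deriv isOpen_ball
  have key : ∀ r ∈ Ioo (0:ℝ) 1, (1 - ‖w‖ ^ 2) * ‖r * deriv k (r * w)‖ ≤ 7 * ‖k (r * w) - q‖ := by
    intro r hr
    have hmc : MapsTo (fun z : ℂ => r * z) (closedBall 0 1) (ball 0 1) := fun z hz => by
      rw [mem_closedBall_zero_iff] at hz
      rw [mem_ball_zero_iff, norm_mul, norm_real, Real.norm_of_nonneg hr.1.le]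
      nlinarith [hr.1, hr.2, norm_nonneg z]
    have hmb := hmc.mono_left ball_subset_closedBall
    have hr0 : (r : ℂ) ≠ 0 := by exact_mod_cast hr.1.ne'
    have hder : ∀ z ∈ ball (0:ℂ) 1, deriv (fun z => k (r * z)) z = r * deriv k (r * z) :=
      fun z hz => by
        have h1 := (hk.differentiableAt (isOpen_ball.mem_nhds (hmb hz))).hasDerivAt
        have h2 : HasDerivAt (fun z : ℂ => r * z) r z := by
          simpa using (hasDerivAt_id z).const_mul (r:ℂ)
        have h3 : HasDerivAt (fun z => k (r * z)) (deriv k (r * z) * r) z := h1.comp z h2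
        rw [h3.deriv, mul_comm]
    obtain ⟨z₀, hz₀, hmax⟩ := (isCompact_closedBall (0:ℂ) 1).exists_isMaxOn ⟨0, by simp⟩
      (f := fun z => (1 - ‖z‖ ^ 2) * ‖r * deriv k (r * z)‖ / ‖k (r * z) - q‖) (by
        have h1 : ContinuousOn (fun z => deriv k (r * z)) (closedBall 0 1) :=
          hdk.continuousOn.comp (by fun_prop) hmc
        have h2 : ContinuousOn (fun z => k (r * z)) (closedBall 0 1) :=
          hk.continuousOn.comp (by fun_prop) hmc
        refine ContinuousOn.div ?_ (h2.sub continuousOn_const).norm fun z hz => hne _ (hmc hz)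
        exact ContinuousOn.mul (by fun_prop) (continuousOn_const.mul h1).norm)
    set M := (1 - ‖z₀‖ ^ 2) * ‖r * deriv k (r * z₀)‖ / ‖k (r * z₀) - q‖ with hM
    have hle : ∀ z ∈ ball (0:ℂ) 1, (1 - ‖z‖ ^ 2) * ‖r * deriv k (r * z)‖ ≤ M * ‖k (r * z) - q‖ :=
      fun z hz => by
        have := hmax (ball_subset_closedBall hz)
        exact (div_le_iff₀ (lt_of_le_of_ne (norm_nonneg _) (hne _ (hmb hz)).symm)).1 this
    refine (hle w hw).trans (mul_le_mul_of_nonneg_right ?_ (norm_nonneg _))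
    by_contra! hM7
    have hz₀b : z₀ ∈ ball (0:ℂ) 1 := by
      rw [mem_closedBall_zero_iff] at hz₀
      rcases hz₀.lt_or_eq with h1 | h1
      · exact mem_ball_zero_iff.2 h1
      · rw [h1] at hM
        norm_num at hM
        linarith
    have h3 := norm_deriv_sq_le (k := fun z => k (r * z)) (q := q) (M := M)
      (hk.comp (by fun_prop) hmb)
      (fun z hz z' hz' h => mul_left_cancel₀ hr0 (hi (hmb hz) (hmb hz') h))
      (by
        rintro ⟨z, hz, hzq⟩
        exact hq ⟨_, hmb hz, hzq⟩) (by linarith)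
      (fun z hz => by rw [hder z hz]; exact hle z hz) hz₀b
    rw [hder z₀ hz₀b] at h3
    have hpos : 0 < ‖k (r * z₀) - q‖ := lt_of_le_of_ne (norm_nonneg _) (hne _ (hmb hz₀b)).symm
    have h4 : (1 - ‖z₀‖ ^ 2) * ‖r * deriv k (r * z₀)‖ = M * ‖k (r * z₀) - q‖ := by
      rw [hM]; field_simp
    rw [h4, mul_pow] at h3
    have h5 := le_of_mul_le_mul_right h3 (by positivity)
    nlinarith
  have hlim : ∀ φ : ℂ → ℂ, DifferentiableOn ℂ φ (ball 0 1) →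
      Tendsto (fun r : ℝ => φ (r * w)) (𝓝[<] 1) (𝓝 (φ w)) := fun φ hφ => by
    have h1 : ContinuousAt φ (((1:ℝ) : ℂ) * w) :=
      hφ.continuousOn.continuousAt (isOpen_ball.mem_nhds (by simpa using hw))
    have h2 : ContinuousAt (fun r : ℝ => φ (r * w)) 1 :=
      ContinuousAt.comp (f := fun r : ℝ => (r : ℂ) * w) h1 (by fun_prop)
    have := h2.tendsto
    simp only [ofReal_one, one_mul] at this
    exact this.mono_left nhdsWithin_le_nhds
  have hr : Tendsto (fun r : ℝ => (r:ℂ)) (𝓝[<] 1) (𝓝 1) := by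
    have : Tendsto (fun r : ℝ => (r:ℂ)) (𝓝 1) (𝓝 ((1:ℝ):ℂ)) := (by fun_prop :
        Continuous _).tendsto 1
    simpa using this.mono_left nhdsWithin_le_nhds
  refine le_of_tendsto_of_tendsto (f := fun r : ℝ => (1 - ‖w‖ ^ 2) * ‖r * deriv k (r * w)‖)
    (g := fun r : ℝ => 7 * ‖k (r * w) - q‖) (b := 𝓝[<] (1:ℝ)) ?_
    (((hlim k hk).sub_const q).norm.const_mul 7) ?_
  · simpa using ((hr.mul (hlim _ hdk)).norm.const_mul (1 - ‖w‖ ^ 2))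
  · filter_upwards [Ioo_mem_nhdsLT zero_lt_one] with r hr using key r hr

/-- Schwarz–Pick: the inradius of a univalent image is at most the hyperbolic derivative. -/
theorem radius_le_of_ball_subset_image {k : ℂ → ℂ} (hk : DifferentiableOn ℂ k (ball 0 1))
    (hi : InjOn k (ball 0 1)) {w : ℂ} (hw : w ∈ ball (0:ℂ) 1) {d : ℝ} (hd : 0 < d)
    (hsub : ball (k w) d ⊆ k '' ball 0 1) : d ≤ (1 - ‖w‖ ^ 2) * ‖deriv k w‖ := by
  set g := Function.invFunOn k (ball 0 1) with hg
  have hgw : g (k w) = w := invFunOn_apply hi hw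
  have hgd : DifferentiableOn ℂ g (ball (k w) d) :=
    (differentiableOn_invFunOn isOpen_ball hk hi).mono hsub
  have hgm : MapsTo g (ball (k w) d) (ball 0 1) := fun z hz => Function.invFunOn_mem (hsub hz)
  have hkw : k w ∈ ball (k w) d := mem_ball_self hd
  have h1 : ‖deriv (diskMap w ∘ g) (k w)‖ ≤ 1 / d := by
    refine Complex.norm_deriv_le_div_of_mapsTo_ball (c := k w) (R₁ := d) (R₂ := 1)
      (fun z hz => ?_) ?_ hd
    · exact ((hasDerivAt_diskMap hw (ball_subset_closedBall (hgm hz))).differentiableAt.comp z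
        (hgd.differentiableAt (isOpen_ball.mem_nhds hz))).differentiableWithinAt
    · intro z hz
      simp only [Function.comp_apply, hgw, diskMap_self]
      first | exact diskMap_mem_ball hw (hgm hz) | exact ball_subset_closedBall (diskMap_mem_ball hw
          (hgm hz))
  have h2 : deriv (diskMap w ∘ g) (k w) =
      -(1 - ‖w‖ ^ 2) / (1 - (starRingEnd ℂ) w * w) ^ 2 * deriv g (k w) := by
    refine HasDerivAt.deriv (HasDerivAt.comp_of_eq _ ?_
      (hgd.differentiableAt (isOpen_ball.mem_nhds hkw)).hasDerivAt rfl)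
    rw [hgw]
    exact hasDerivAt_diskMap hw (ball_subset_closedBall hw)
  have h3 := deriv_mul_deriv_invFunOn isOpen_ball hk hi hw
  have hw1 : ‖w‖ < 1 := by simpa using hw
  have hpos : 0 < 1 - ‖w‖ ^ 2 := by nlinarith [norm_nonneg w]
  have h4 : -(1 - (‖w‖ : ℂ) ^ 2) / (1 - (starRingEnd ℂ) w * w) ^ 2 =
      ((-(1 - ‖w‖ ^ 2)⁻¹ : ℝ) : ℂ) := by
    rw [mul_comm, Complex.mul_conj, Complex.normSq_eq_norm_sq]
    push_cast
    have : (1 - (‖w‖ : ℂ) ^ 2) ≠ 0 := by exact_mod_cast hpos.ne'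
    field_simp
  rw [h2, h4, norm_mul, norm_real, norm_neg, Real.norm_of_nonneg (by positivity)] at h1
  have h5 : ‖deriv g (k w)‖ * ‖deriv k w‖ = 1 := by rw [← norm_mul, h3, norm_one]
  have h6 : 0 < ‖deriv k w‖ := norm_pos_iff.2 fun h => by simp [h] at h5
  have h7 : ‖deriv g (k w)‖ = ‖deriv k w‖⁻¹ := eq_inv_of_mul_eq_one_left h5
  rw [h7, ← mul_inv, one_div] at h1
  exact (inv_le_inv₀ (by positivity) hd).1 h1

/-- An increasing lift of an orientation-preserving circle homeomorphism. -/
structure CircleLift (η : ℝ → ℝ) : Prop where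
  cont : Continuous η
  mono : StrictMono η
  period : ∀ x, η (x + 2 * Real.pi) = η x + 2 * Real.pi

/-- The mean of `η` over the segment from `x` to `x + y`. -/
noncomputable def segMean (η : ℝ → ℝ) (x y : ℝ) : ℝ := ∫ t in (0:ℝ)..1, η (x + t * y)

/-- Truncation to `[-2π, 2π]`. -/
noncomputable def clamp (y : ℝ) : ℝ := max (-(2 * Real.pi)) (min y (2 * Real.pi))

/-- The segment mean, extended affinely past height `2π`. -/
noncomputable def clampMean (η : ℝ → ℝ) (x y : ℝ) : ℝ := segMean η x (clamp y) + (y - clamp y) / 2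

/-- The Beurling–Ahlfors extension of `η`, equal to a translation away from the strip
`|Im z| < 2π`. -/
noncomputable def beurlingAhlfors (η : ℝ → ℝ) (z : ℂ) : ℂ :=
  ⟨(clampMean η z.re z.im + clampMean η z.re (-z.im)) / 2,
    clampMean η z.re z.im - clampMean η z.re (-z.im)⟩

theorem clamp_neg (y : ℝ) : clamp (-y) = -clamp y := by
  have := Real.pi_pos
  simp only [clamp, max_def, min_def]
  split_ifs <;> linarith

theorem clamp_of_abs_le {y : ℝ} (hy : |y| ≤ 2 * Real.pi) : clamp y = y := by
  rw [abs_le] at hy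
  rw [clamp, min_eq_left hy.2, max_eq_right hy.1]

theorem clamp_of_le {y : ℝ} (hy : 2 * Real.pi ≤ y) : clamp y = 2 * Real.pi := by
  rw [clamp, min_eq_right hy, max_eq_right (by linarith [Real.pi_pos])]

theorem clamp_mono : Monotone clamp := fun _ _ h => max_le_max le_rfl (min_le_min h le_rfl)

theorem sub_clamp_mono : Monotone fun y => y - clamp y := fun a b h => by
  simp only [clamp, max_def, min_def]
  split_ifs <;> linarith

namespace CircleLift

variable {η : ℝ → ℝ} (h : CircleLift η)

include h

theorem continuous_segMean : Continuous fun p : ℝ × ℝ => segMean η p.1 p.2 := by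
  have := h.cont
  exact intervalIntegral.continuous_parametric_intervalIntegral_of_continuous' (by fun_prop) _ _

theorem integral_lt {x y x' y' : ℝ} (h0 : ∀ t ∈ Icc (0:ℝ) 1, x + t * y ≤ x' + t * y')
    (h1 : x + y < x' + y') : segMean η x y < segMean η x' y' := by
  have := h.cont
  refine intervalIntegral.integral_lt_integral_of_continuousOn_of_le_of_exists_lt one_pos
    (by fun_prop) (by fun_prop) (fun t ht => h.mono.monotone (h0 t (Ioc_subset_Icc_self ht)))
    ⟨1, by simp, h.mono (by linarith)⟩

theorem segMean_lt_left {x x' : ℝ} (hx : x < x') (y : ℝ) : segMean η x y < segMean η x' y :=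
  h.integral_lt (fun t _ => by linarith) (by linarith)

theorem segMean_lt_right (x : ℝ) {y y' : ℝ} (hy : y < y') : segMean η x y < segMean η x y' :=
  h.integral_lt (fun t ht => by nlinarith [ht.1]) (by linarith)

theorem clampMean_lt_left {x x' : ℝ} (hx : x < x') (y : ℝ) :
    clampMean η x y < clampMean η x' y := by
  have := h.segMean_lt_left hx (clamp y)
  unfold clampMean; linarith

theorem clampMean_lt_right (x : ℝ) {y y' : ℝ} (hy : y < y') :
    clampMean η x y < clampMean η x y' := by
  unfold clampMean
  rcases (clamp_mono hy.le).lt_or_eq with h1 | h1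
  · have := h.segMean_lt_right x h1
    have h2 := sub_clamp_mono hy.le
    simp only at h2
    linarith
  · rw [h1]; linarith

theorem segMean_period (x y : ℝ) :
    segMean η (x + 2 * Real.pi) y = segMean η x y + 2 * Real.pi := by
  have := h.cont
  have e : ∀ t : ℝ, η (x + 2 * Real.pi + t * y) = η (x + t * y) + 2 * Real.pi := fun t => by
    rw [← h.period]; congr 1; ring
  simp only [segMean, e]
  rw [intervalIntegral.integral_add (by apply Continuous.intervalIntegrable; fun_prop) (by simp)]
  simp

theorem beurlingAhlfors_period (z : ℂ) :
    beurlingAhlfors η (z + 2 * Real.pi) = beurlingAhlfors η z + 2 * Real.pi := by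
  have e : ((2 * Real.pi : ℝ) : ℂ) = 2 * Real.pi := by push_cast; ring
  rw [← e]
  apply Complex.ext <;>
  simp only [beurlingAhlfors, clampMean, add_re, add_im, ofReal_re, ofReal_im, add_zero,
    h.segMean_period] <;> ring

theorem exists_bound : ∃ C, ∀ x, |η x - x| ≤ C := by
  have hc := h.cont
  obtain ⟨C, hC⟩ := (isCompact_Icc (a := (0:ℝ)) (b := 2 * Real.pi)).exists_bound_of_continuousOn
    (f := fun x => η x - x) (by fun_prop)
  refine ⟨C, fun x => ?_⟩
  have hp : Function.Periodic (fun x => η x - x) (2 * Real.pi) := fun x => by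
    simp only [h.period]; ring
  obtain ⟨y, hy, e⟩ := hp.exists_mem_Ico₀ Real.two_pi_pos x
  rw [e]
  exact hC y (Ico_subset_Icc_self hy)

theorem exists_clampMean_bound : ∃ C, ∀ x y, |clampMean η x y - x - y / 2| ≤ C := by
  obtain ⟨C, hC⟩ := h.exists_bound
  have hc := h.cont
  refine ⟨C, fun x y => ?_⟩
  have e : clampMean η x y - x - y / 2 =
      ∫ t in (0:ℝ)..1, (η (x + t * clamp y) - (x + t * clamp y)) := by
    rw [intervalIntegral.integral_sub (by apply Continuous.intervalIntegrable; fun_prop)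
      (by apply Continuous.intervalIntegrable; fun_prop), intervalIntegral.integral_add (by simp)
      (by apply Continuous.intervalIntegrable; fun_prop), intervalIntegral.integral_mul_const]
    simp only [clampMean, segMean, integral_id, intervalIntegral.integral_const, smul_eq_mul]
    ring
  rw [e]
  have := intervalIntegral.norm_integral_le_of_norm_le_const (a := (0:ℝ)) (b := 1) (C := C)
    (f := fun t => η (x + t * clamp y) - (x + t * clamp y)) fun t _ => hC (x + t * clamp y)
  simpa using this

theorem continuous_beurlingAhlfors : Continuous (beurlingAhlfors η) := by
  have h1 := h.continuous_segMean
  have h2 : Continuous clamp := by unfold clamp; fun_prop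
  have h3 : Continuous fun p : ℝ × ℝ => clampMean η p.1 p.2 := by
    unfold clampMean
    exact (h1.comp (by fun_prop : Continuous fun p : ℝ × ℝ => (p.1, clamp p.2))).add (by fun_prop)
  have h4 : Continuous fun z : ℂ => clampMean η z.re z.im :=
    h3.comp (by fun_prop : Continuous fun z : ℂ => (z.re, z.im))
  have h5 : Continuous fun z : ℂ => clampMean η z.re (-z.im) :=
    h3.comp (by fun_prop : Continuous fun z : ℂ => (z.re, -z.im))
  have : beurlingAhlfors η = fun z => (((clampMean η z.re z.im + clampMean η z.re (-z.im)) / 2 : ℝ)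
      : ℂ) + ((clampMean η z.re z.im - clampMean η z.re (-z.im) : ℝ) : ℂ) * I := by
    ext z; rw [← mk_eq_add_mul_I]; rfl
  rw [this]
  fun_prop

theorem injective_beurlingAhlfors : Function.Injective (beurlingAhlfors η) := by
  have key : ∀ z w : ℂ, clampMean η z.re z.im = clampMean η w.re w.im →
      clampMean η z.re (-z.im) = clampMean η w.re (-w.im) → ¬ z.re < w.re := by
    intro z w h1 h2 hlt
    have h3 := h.clampMean_lt_left hlt w.im
    have h4 := h.clampMean_lt_left hlt (-w.im)
    rcases lt_trichotomy z.im w.im with h5 | h5 | h5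
    · have := h.clampMean_lt_right z.re h5
      linarith
    · rw [h5] at h1; linarith
    · have := h.clampMean_lt_right z.re (neg_lt_neg h5)
      linarith
  intro z w hzw
  have hr := congrArg re hzw
  have hi := congrArg im hzw
  simp only [beurlingAhlfors] at hr hi
  have h1 : clampMean η z.re z.im = clampMean η w.re w.im := by linarith
  have h2 : clampMean η z.re (-z.im) = clampMean η w.re (-w.im) := by linarith
  have h3 : z.re = w.re := le_antisymm (not_lt.1 (key w z h1.symm h2.symm)) (not_lt.1
      (key z w h1 h2))
  refine Complex.ext h3 ?_
  rw [h3] at h1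
  rcases lt_trichotomy z.im w.im with h5 | h5 | h5
  · have := h.clampMean_lt_right w.re h5; linarith
  · exact h5
  · have := h.clampMean_lt_right w.re h5; linarith

theorem exists_beurlingAhlfors_bound : ∃ C, ∀ z, ‖beurlingAhlfors η z - z‖ ≤ C := by
  obtain ⟨C, hC⟩ := h.exists_clampMean_bound
  refine ⟨3 * C, fun z => (norm_le_abs_re_add_abs_im _).trans ?_⟩
  have h1 := abs_le.1 (hC z.re z.im)
  have h2 := abs_le.1 (hC z.re (-z.im))
  simp only [beurlingAhlfors, sub_re, sub_im]
  have h3 : |(clampMean η z.re z.im + clampMean η z.re (-z.im)) / 2 - z.re| ≤ C :=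
    abs_le.2 ⟨by linarith, by linarith⟩
  have h4 : |clampMean η z.re z.im - clampMean η z.re (-z.im) - z.im| ≤ 2 * C :=
    abs_le.2 ⟨by linarith, by linarith⟩
  linarith

end CircleLift

theorem surjective_of_norm_sub_le {G : ℂ → ℂ} (hG : Continuous G) {C : ℝ}
    (hC : ∀ z, ‖G z - z‖ ≤ C) : Function.Surjective G := by
  intro p
  by_contra! hp
  obtain hlog := HasLogOn.of_starConvex (S := univ) (x := 0)
      (convex_univ.starConvex trivial) trivial
    (h := fun z => G z - p) (by fun_prop) fun z _ => sub_ne_zero.2 (hp z)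
  have hC0 : 0 ≤ C := (norm_nonneg _).trans (hC 0)
  have hR : 0 < C + 1 := by linarith
  refine not_hasLogOn_sphere p hR ?_
  have hn : ∀ z ∈ sphere p (C + 1), z - p ≠ 0 := fun z hz h0 => by
    rw [mem_sphere_iff_norm, h0, norm_zero] at hz; linarith
  have h1 : HasLogOn (sphere p (C + 1)) fun z => (G z - p) / (z - p) := by
    have hs : ∀ z ∈ sphere p (C + 1), (G z - p) / (z - p) ∈ slitPlane := fun z hz => by
      have e : (G z - p) / (z - p) = 1 + (G z - z) / (z - p) := by
        field_simp [hn z hz]; ring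
      rw [e]
      apply mem_slitPlane_of_norm_lt_one
      rw [norm_div, mem_sphere_iff_norm.1 hz, div_lt_one hR]
      linarith [hC z]
    refine ⟨fun z => log ((G z - p) / (z - p)), ?_, fun z hz => exp_log (slitPlane_ne_zero
        (hs z hz))⟩
    exact ContinuousOn.clog (ContinuousOn.div (by fun_prop) (by fun_prop) hn) hs
  refine ((hlog.mono (subset_univ _)).mul h1.inv).congr fun z hz => ?_
  have h2 := sub_ne_zero.2 (hp z)
  have h3 := hn z hz
  simp only
  field_simp

theorem exists_homeomorph_of_bijective {G : ℂ → ℂ} (hG : Continuous G) (hb : Function.Bijective G)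
    (hp : Tendsto G (cocompact ℂ) (cocompact ℂ)) : ∃ e : ℂ ≃ₜ ℂ, ∀ z, e z = G z := by
  have h1 : IsHomeomorph G := isHomeomorph_iff_continuous_isClosedMap_bijective.2
    ⟨hG, (isProperMap_iff_tendsto_cocompact.2 ⟨hG, hp⟩).isClosedMap, hb⟩
  exact ⟨h1.homeomorph, fun z => rfl⟩

namespace CircleLift

variable {η : ℝ → ℝ} (h : CircleLift η)

include h

theorem exists_homeomorph : ∃ G : ℂ ≃ₜ ℂ, ∀ z, G z = beurlingAhlfors η z := by
  obtain ⟨C, hC⟩ := h.exists_beurlingAhlfors_bound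
  refine exists_homeomorph_of_bijective h.continuous_beurlingAhlfors ⟨h.injective_beurlingAhlfors,
    surjective_of_norm_sub_le h.continuous_beurlingAhlfors hC⟩ ?_
  rw [← Metric.cobounded_eq_cocompact, ← tendsto_norm_atTop_iff_cobounded,
    Metric.cobounded_eq_cocompact]
  refine tendsto_atTop_mono (f := fun z : ℂ => ‖z‖ + -C) (fun z => ?_)
    (tendsto_atTop_add_const_right _ _ (tendsto_norm_cocompact_atTop (E := ℂ)))
  have h1 := norm_sub_norm_le z (z - beurlingAhlfors η z)
  rw [sub_sub_cancel, norm_sub_rev] at h1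
  linarith [hC z]

end CircleLift

theorem segMean_eq {η : ℝ → ℝ} (x : ℝ) {y : ℝ} (hy : y ≠ 0) :
    segMean η x y = y⁻¹ * ∫ s in x..(x + y), η s := by
  have := intervalIntegral.integral_comp_add_mul (a := 0) (b := 1) η hy x
  simp only [mul_zero, add_zero, mul_one, smul_eq_mul] at this
  rw [← this, segMean]
  simp only [mul_comm]

namespace CircleLift

variable {η : ℝ → ℝ} (h : CircleLift η)

include h

theorem exists_segMean_two_pi : ∃ c, ∀ x, segMean η x (2 * Real.pi) = x + Real.pi + c ∧
    segMean η x (-(2 * Real.pi)) = x - Real.pi + c := by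
  have hp := Real.two_pi_pos
  have hc := h.cont
  have hper : Function.Periodic (fun x => η x - x) (2 * Real.pi) := fun x => by
    simp only [h.period]; ring
  have e : ∀ x, ∫ s in x..(x + 2 * Real.pi), η s =
      (∫ s in (0:ℝ)..(0 + 2 * Real.pi), (η s - s)) + 2 * Real.pi * (x + Real.pi) := fun x => by
    rw [← hper.intervalIntegral_add_eq x 0, intervalIntegral.integral_sub
      (hc.intervalIntegrable _ _) (Continuous.intervalIntegrable (by fun_prop) _ _), integral_id]
    ring
  have e1 : ∀ x, segMean η x (2 * Real.pi) =
      x + Real.pi + (2 * Real.pi)⁻¹ * ∫ s in (0:ℝ)..(0 + 2 * Real.pi), (η s - s) := fun x => by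
    rw [segMean_eq x hp.ne', e]
    field_simp
    ring
  refine ⟨_, fun x => ⟨e1 x, ?_⟩⟩
  have e2 : segMean η x (-(2 * Real.pi)) = segMean η (x - 2 * Real.pi) (2 * Real.pi) := by
    rw [segMean_eq x (neg_ne_zero.2 hp.ne'), segMean_eq _ hp.ne', sub_add_cancel,
      ← sub_eq_add_neg, intervalIntegral.integral_symm]
    field_simp
  rw [e2, e1]
  ring

/-- Outside the strip, the Beurling–Ahlfors map is a translation. -/
theorem exists_translation : ∃ c : ℝ, ∀ z : ℂ, 2 * Real.pi ≤ |z.im| →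
    beurlingAhlfors η z = z + c := by
  obtain ⟨c, hc⟩ := h.exists_segMean_two_pi
  refine ⟨c, fun z hz => ?_⟩
  rcases le_abs'.1 hz with h1 | h1
  · have h2 : clamp (-z.im) = 2 * Real.pi := clamp_of_le (by linarith)
    have h3 : clamp z.im = -(2 * Real.pi) := by rw [← h2, clamp_neg, neg_neg]
    apply Complex.ext <;>
    simp only [beurlingAhlfors, clampMean, h2, h3, (hc _).1, (hc _).2, add_re, add_im, ofReal_re,
      ofReal_im] <;> ring
  · have h2 : clamp (z.im) = 2 * Real.pi := clamp_of_le (by linarith)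
    have h3 : clamp (-z.im) = -(2 * Real.pi) := by rw [← h2, clamp_neg]
    apply Complex.ext <;>
    simp only [beurlingAhlfors, clampMean, h2, h3, (hc _).1, (hc _).2, add_re, add_im, ofReal_re,
      ofReal_im] <;> ring

theorem beurlingAhlfors_im_pos {z : ℂ} (hz : 0 < z.im) : 0 < (beurlingAhlfors η z).im :=
  sub_pos.2 (h.clampMean_lt_right _ (by linarith))

theorem beurlingAhlfors_im_neg {z : ℂ} (hz : z.im < 0) : (beurlingAhlfors η z).im < 0 :=
  sub_neg.2 (h.clampMean_lt_right _ (by linarith))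

omit h in
theorem beurlingAhlfors_ofReal (x : ℝ) : beurlingAhlfors η x = η x := by
  have h0 : clamp 0 = 0 := clamp_of_abs_le (by simp [Real.pi_pos.le])
  apply Complex.ext <;> simp [beurlingAhlfors, clampMean, h0, segMean]

theorem beurlingAhlfors_im_le {z : ℂ} (hz : |z.im| ≤ 2 * Real.pi) :
    (beurlingAhlfors η z).im ≤ 2 * Real.pi := by
  obtain ⟨c, hc⟩ := h.exists_segMean_two_pi
  have h1 : segMean η z.re z.im ≤ segMean η z.re (2 * Real.pi) := by
    rcases (abs_le.1 hz).2.eq_or_lt with e | e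
    · rw [e]
    · exact (h.segMean_lt_right _ e).le
  have h2 : segMean η z.re (-(2 * Real.pi)) ≤ segMean η z.re (-z.im) := by
    rcases (abs_le.1 hz).2.eq_or_lt with e | e
    · rw [e]
    · exact (h.segMean_lt_right _ (by linarith)).le
  rw [(hc _).1] at h1
  rw [(hc _).2] at h2
  simp only [beurlingAhlfors, clampMean, clamp_neg, clamp_of_abs_le hz]
  linarith

theorem hasFDerivAt_segMean {z : ℂ} (hz : z.im ≠ 0) :
    HasFDerivAt (fun w : ℂ => segMean η w.re w.im)
      (z.im⁻¹ • ((η (z.re + z.im) - η z.re) • reCLM +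
        (η (z.re + z.im) - segMean η z.re z.im) • imCLM)) z := by
  have hc := h.cont
  set P : ℝ → ℝ := fun u => ∫ s in (0:ℝ)..u, η s with hP
  have hPd : ∀ u, HasDerivAt P (η u) u := fun u =>
    intervalIntegral.integral_hasDerivAt_right (hc.intervalIntegrable _ _)
      hc.stronglyMeasurable.stronglyMeasurableAtFilter hc.continuousAt
  have hre : HasFDerivAt (fun w : ℂ => w.re) reCLM z := reCLM.hasFDerivAt
  have him : HasFDerivAt (fun w : ℂ => w.im) imCLM z := imCLM.hasFDerivAt
  have h1 : HasFDerivAt (fun w : ℂ => P (w.re + w.im)) (η (z.re + z.im) • (reCLM + imCLM)) z :=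
    (hPd _).comp_hasFDerivAt z (hre.add him)
  have h2 : HasFDerivAt (fun w : ℂ => P w.re) (η z.re • reCLM) z :=
    (hPd _).comp_hasFDerivAt z hre
  have h3 : HasFDerivAt (fun w : ℂ => (w.im)⁻¹) ((-(z.im ^ 2)⁻¹) • imCLM) z :=
    (hasDerivAt_inv hz).comp_hasFDerivAt z him
  have e : ∀ w : ℂ, w.im ≠ 0 → segMean η w.re w.im = (w.im)⁻¹ * (P (w.re + w.im) - P w.re) :=
    fun w hw => by
      rw [segMean_eq _ hw, hP]
      simp only
      rw [intervalIntegral.integral_interval_sub_left (hc.intervalIntegrable _ _)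
        (hc.intervalIntegrable _ _)]
  have h4 : (fun w : ℂ => segMean η w.re w.im) =ᶠ[𝓝 z]
      fun w => (w.im)⁻¹ * (P (w.re + w.im) - P w.re) := by
    filter_upwards [(continuous_im.continuousAt (x := z)).eventually_ne hz] with w hw
    exact e w hw
  refine ((h3.mul (h1.sub h2)).congr_of_eventuallyEq h4).congr_fderiv ?_
  refine ContinuousLinearMap.ext fun v => ?_
  simp [e z hz]
  field_simp
  ring

end CircleLift

namespace CircleLift

variable {η : ℝ → ℝ} (h : CircleLift η)

include h

theorem segMean_le {x y : ℝ} (hy : 0 < y) :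
    segMean η x y ≤ η (x + y / 3) / 3 + 2 * η (x + y) / 3 := by
  have hc := h.cont
  have hi : ∀ a b, IntervalIntegrable (fun t => η (x + t * y)) volume a b := fun a b =>
    Continuous.intervalIntegrable (by fun_prop) _ _
  rw [segMean, ← intervalIntegral.integral_add_adjacent_intervals (hi 0 (1/3)) (hi (1/3) 1)]
  have h1 : ∫ t in (0:ℝ)..(1/3), η (x + t * y) ≤ ∫ t in (0:ℝ)..(1/3), η (x + y / 3) :=
    intervalIntegral.integral_mono_on (by norm_num) (hi _ _) (by simp) fun t ht =>
      h.mono.monotone (by nlinarith [ht.2])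
  have h2 : ∫ t in (1/3:ℝ)..1, η (x + t * y) ≤ ∫ t in (1/3:ℝ)..1, η (x + y) :=
    intervalIntegral.integral_mono_on (by norm_num) (hi _ _) (by simp) fun t ht =>
      h.mono.monotone (by nlinarith [ht.2])
  simp only [intervalIntegral.integral_const, smul_eq_mul] at h1 h2
  linarith

theorem le_segMean {x y : ℝ} (hy : 0 < y) : η x ≤ segMean η x y := by
  have hc := h.cont
  have h1 : ∫ t in (0:ℝ)..1, η x ≤ ∫ t in (0:ℝ)..1, η (x + t * y) :=
    intervalIntegral.integral_mono_on (by norm_num) (by simp)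
      (Continuous.intervalIntegrable (by fun_prop) _ _) fun t ht =>
      h.mono.monotone (by nlinarith [ht.1])
  rw [segMean]
  simpa using h1

theorem neg_comp_neg : CircleLift fun x => -η (-x) where
  cont := by have := h.cont; fun_prop
  mono := fun a b hab => neg_lt_neg (h.mono (neg_lt_neg hab))
  period := fun x => by
    have := h.period (-(x + 2 * Real.pi))
    rw [show -(x + 2 * Real.pi) + 2 * Real.pi = -x by ring] at this
    linarith

omit h in
theorem segMean_neg_comp_neg (x y : ℝ) :
    segMean (fun x => -η (-x)) x y = -segMean η (-x) (-y) := by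
  rw [segMean, segMean, ← intervalIntegral.integral_neg]
  congr 1; ext t; congr 2; ring

theorem hasFDerivAt_segMean_neg {z : ℂ} (hz : z.im ≠ 0) :
    HasFDerivAt (fun w : ℂ => segMean η w.re (-w.im))
      (z.im⁻¹ • ((η z.re - η (z.re - z.im)) • reCLM +
        (η (z.re - z.im) - segMean η z.re (-z.im)) • imCLM)) z := by
  have h1 : HasFDerivAt (fun w : ℂ => (starRingEnd ℂ) w) (conjCLE : ℂ →L[ℝ] ℂ) z :=
    conjCLE.hasFDerivAt
  have h2 := (h.hasFDerivAt_segMean (z := (starRingEnd ℂ) z) (by simpa using hz)).comp z h1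
  have e : (fun w : ℂ => segMean η w.re (-w.im)) =
    (fun w : ℂ => segMean η w.re w.im) ∘ fun w : ℂ => (starRingEnd ℂ) w := by
    ext w; simp
  rw [e]
  refine h2.congr_fderiv ?_
  refine ContinuousLinearMap.ext fun v => ?_
  simp [← sub_eq_add_neg]
  field_simp
  ring

omit h in
theorem norm_linear_bounds {a₁ a₂ b₁ b₂ m : ℝ} (hm : 0 ≤ m) (ha : m ≤ a₂) (ha' : a₂ ≤ a₁)
    (hb : m ≤ b₂) (hb' : b₂ ≤ b₁) (v : ℂ) :
    (4 / 5) * m * ‖v‖ ≤ ‖(⟨(a₁ * v.re + a₂ * v.im + (b₁ * v.re - b₂ * v.im)) / 2,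
      a₁ * v.re + a₂ * v.im - (b₁ * v.re - b₂ * v.im)⟩ : ℂ)‖ ∧
    ‖(⟨(a₁ * v.re + a₂ * v.im + (b₁ * v.re - b₂ * v.im)) / 2,
      a₁ * v.re + a₂ * v.im - (b₁ * v.re - b₂ * v.im)⟩ : ℂ)‖ ≤ 3 * (a₁ + b₁) * ‖v‖ := by
  have hv : ‖v‖ ^ 2 = v.re ^ 2 + v.im ^ 2 := by
    rw [← normSq_eq_norm_sq, normSq_apply]; ring
  constructor
  · refine le_of_sq_le_sq ?_ (norm_nonneg _)
    rw [mul_pow, hv, ← normSq_eq_norm_sq, normSq_apply]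
    simp only
    set A := a₁ * v.re + a₂ * v.im with hA
    set B := b₁ * v.re - b₂ * v.im with hB
    have h1 : (4 / 5) * A ^ 2 ≤ (A + B) / 2 * ((A + B) / 2) + (A - B) * (A - B) := by
      nlinarith [sq_nonneg (B - 3 / 5 * A)]
    have h2 : (4 / 5) * B ^ 2 ≤ (A + B) / 2 * ((A + B) / 2) + (A - B) * (A - B) := by
      nlinarith [sq_nonneg (A - 3 / 5 * B)]
    have sq : ∀ c₁ c₂ x y : ℝ, m ≤ c₂ → c₂ ≤ c₁ → 0 ≤ x * y →
        m ^ 2 * (x ^ 2 + y ^ 2) ≤ (c₁ * x + c₂ * y) ^ 2 := fun c₁ c₂ x y h1 h2 h3 => by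
      have h4 : m ^ 2 * x ^ 2 ≤ c₁ ^ 2 * x ^ 2 :=
        mul_le_mul_of_nonneg_right (pow_le_pow_left₀ hm (h1.trans h2) 2) (sq_nonneg x)
      have h5 : m ^ 2 * y ^ 2 ≤ c₂ ^ 2 * y ^ 2 :=
        mul_le_mul_of_nonneg_right (pow_le_pow_left₀ hm h1 2) (sq_nonneg y)
      have h6 : 0 ≤ c₁ * c₂ * (x * y) :=
        mul_nonneg (mul_nonneg (hm.trans (h1.trans h2)) (hm.trans h1)) h3
      nlinarith
    have h3 : 0 ≤ m ^ 2 * (v.re ^ 2 + v.im ^ 2) := by positivity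
    rcases le_total 0 (v.re * v.im) with h0 | h0
    · have := sq a₁ a₂ v.re v.im ha ha' h0
      rw [← hA] at this
      nlinarith
    · have := sq b₁ b₂ v.re (-v.im) hb hb' (by linarith)
      rw [show b₁ * v.re + b₂ * -v.im = B by rw [hB]; ring] at this
      nlinarith
  · have hx := abs_re_le_norm v
    have hy := abs_im_le_norm v
    have hn := norm_nonneg v
    have h1 : |a₁ * v.re| ≤ a₁ * ‖v‖ := by
      rw [abs_mul, abs_of_nonneg (by linarith)]; exact mul_le_mul_of_nonneg_left hx (by linarith)
    have h2 : |a₂ * v.im| ≤ a₁ * ‖v‖ := by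
      rw [abs_mul, abs_of_nonneg (by linarith)]; exact mul_le_mul ha' hy (abs_nonneg _)
          (by linarith)
    have h3 : |b₁ * v.re| ≤ b₁ * ‖v‖ := by
      rw [abs_mul, abs_of_nonneg (by linarith)]; exact mul_le_mul_of_nonneg_left hx (by linarith)
    have h4 : |b₂ * v.im| ≤ b₁ * ‖v‖ := by
      rw [abs_mul, abs_of_nonneg (by linarith)]; exact mul_le_mul hb' hy (abs_nonneg _)
          (by linarith)
    rw [abs_le] at h1 h2 h3 h4
    refine (norm_le_abs_re_add_abs_im _).trans ?_
    simp only
    have h5 : |(a₁ * v.re + a₂ * v.im + (b₁ * v.re - b₂ * v.im)) / 2| ≤ (a₁ + b₁) * ‖v‖ :=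
      abs_le.2 ⟨by linarith, by linarith⟩
    have h6 : |a₁ * v.re + a₂ * v.im - (b₁ * v.re - b₂ * v.im)| ≤ 2 * (a₁ + b₁) * ‖v‖ :=
      abs_le.2 ⟨by linarith, by linarith⟩
    linarith

/-- Local distortion of the Beurling–Ahlfors map inside the strip. -/
theorem eventually_distortion {z : ℂ} (hy : 0 < z.im) (hy' : z.im ≤ 2 * Real.pi) {m : ℝ}
    (hm0 : 0 < m) (hm : m ≤ η (z.re + z.im) - η (z.re + z.im / 3))
    (hm' : m ≤ η (z.re - z.im / 3) - η (z.re - z.im)) :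
    ∀ᶠ w in 𝓝 z, |w.im| ≤ 2 * Real.pi →
      m / (6 * z.im) * ‖w - z‖ ≤ ‖beurlingAhlfors η w - beurlingAhlfors η z‖ ∧
      ‖beurlingAhlfors η w - beurlingAhlfors η z‖ ≤
        4 * (η (z.re + z.im) - η (z.re - z.im)) / z.im * ‖w - z‖ := by
  set x := z.re with hx
  set y := z.im with hyy
  have e : ∀ w : ℂ, |w.im| ≤ 2 * Real.pi → beurlingAhlfors η w =
      (((segMean η w.re w.im + segMean η w.re (-w.im)) / 2 : ℝ) : ℂ) +
      ((segMean η w.re w.im - segMean η w.re (-w.im) : ℝ) : ℂ) * I := fun w hw => by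
    have h1 : clamp w.im = w.im := clamp_of_abs_le hw
    have h2 : clamp (-w.im) = -w.im := clamp_of_abs_le (by rwa [abs_neg])
    rw [← mk_eq_add_mul_I]
    simp [beurlingAhlfors, clampMean, h1, h2]
  have hA := h.hasFDerivAt_segMean (z := z) hy.ne'
  have hB := h.hasFDerivAt_segMean_neg (z := z) hy.ne'
  rw [← hx, ← hyy] at hA hB
  have h1 := ofRealCLM.hasFDerivAt.comp z ((hA.add hB).mul_const (2:ℝ)⁻¹)
  have h2 := (ofRealCLM.hasFDerivAt.comp z (hA.sub hB)).mul_const I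
  have h3 := (h1.add h2).isLittleO
  have hzz : |z.im| ≤ 2 * Real.pi := by rw [abs_of_pos hy]; exact hy'
  have hε : 0 < m / (30 * y) := by positivity
  have hn := h.neg_comp_neg.segMean_le (x := -x) hy
  rw [segMean_neg_comp_neg] at hn
  have hn' := h.neg_comp_neg.le_segMean (x := -x) hy
  rw [segMean_neg_comp_neg] at hn'
  simp only [neg_neg, neg_add] at hn hn'
  simp only [← sub_eq_add_neg] at hn hn'
  have hp := h.segMean_le (x := x) hy
  have hp' := h.le_segMean (x := x) hy
  filter_upwards [h3.bound hε] with w hw hwim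
  have hlin := norm_linear_bounds (a₁ := η (x + y) - η x) (a₂ := η (x + y) - segMean η x y)
    (b₁ := η x - η (x - y)) (b₂ := segMean η x (-y) - η (x - y)) (m := m / 3) (by positivity)
    (by linarith) (by linarith) (by linarith) (by linarith) (w - z)
  rw [e w hwim, e z hzz]
  simp only [Pi.add_apply, Function.comp_apply, ofRealCLM_apply, Pi.sub_apply,
    ← hx, ← hyy, ← div_eq_mul_inv] at hw
  set D := (((segMean η w.re w.im + segMean η w.re (-w.im)) / 2 : ℝ) : ℂ) +
      ((segMean η w.re w.im - segMean η w.re (-w.im) : ℝ) : ℂ) * I -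
      ((((segMean η x y + segMean η x (-y)) / 2 : ℝ) : ℂ) +
      ((segMean η x y - segMean η x (-y) : ℝ) : ℂ) * I) with hD
  set T : ℂ := ⟨((η (x + y) - η x) * (w - z).re + (η (x + y) - segMean η x y) * (w - z).im +
    ((η x - η (x - y)) * (w - z).re - (segMean η x (-y) - η (x - y)) * (w - z).im)) / 2,
    (η (x + y) - η x) * (w - z).re + (η (x + y) - segMean η x y) * (w - z).im -
    ((η x - η (x - y)) * (w - z).re - (segMean η x (-y) - η (x - y)) * (w - z).im)⟩ with hT
  have hw' : ‖D - (y⁻¹ : ℝ) * T‖ ≤ m / (30 * y) * ‖w - z‖ := by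
    convert hw using 2
    congr 1
    rw [hT, mk_eq_add_mul_I]
    simp [div_eq_mul_inv]
    ring
  have hny : ‖((y⁻¹ : ℝ) : ℂ) * T‖ = ‖T‖ / y := by
    rw [norm_mul, norm_real, Real.norm_of_nonneg (by positivity), inv_mul_eq_div]
  have h5 := norm_sub_norm_le (((y⁻¹ : ℝ) : ℂ) * T) D
  have h6 := norm_sub_norm_le D (((y⁻¹ : ℝ) : ℂ) * T)
  rw [norm_sub_rev (((y⁻¹ : ℝ) : ℂ) * T) D, hny] at h5
  rw [hny] at h6
  have h7 : m / (6 * y) * ‖w - z‖ + m / (30 * y) * ‖w - z‖ ≤ ‖T‖ / y := by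
    rw [le_div_iff₀ hy]
    have e5 : (m / (6 * y) * ‖w - z‖ + m / (30 * y) * ‖w - z‖) * y = (1 / 5) * m * ‖w - z‖ := by
      field_simp
      ring
    rw [e5]
    refine le_trans ?_ hlin.1
    exact mul_le_mul_of_nonneg_right (by linarith) (norm_nonneg _)
  have h8 : ‖T‖ / y ≤ 3 * (η (x + y) - η (x - y)) / y * ‖w - z‖ := by
    have e6 : η (x + y) - η x + (η x - η (x - y)) = η (x + y) - η (x - y) := by ring
    rw [← mul_div_right_comm, ← e6]
    gcongr
    exact hlin.2
  have h9 : m / (30 * y) * ‖w - z‖ ≤ (η (x + y) - η (x - y)) / y * ‖w - z‖ := by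
    gcongr ?_ * _
    rw [div_le_div_iff₀ (by positivity) hy]
    have : m ≤ η (x + y) - η (x - y) := by
      linarith [h.mono.monotone (show x - y ≤ x + y / 3 by linarith)]
    nlinarith
  constructor
  · linarith
  · have e4 : 4 * (η (x + y) - η (x - y)) / y * ‖w - z‖ =
      3 * (η (x + y) - η (x - y)) / y * ‖w - z‖ + (η (x + y) - η (x - y)) / y * ‖w - z‖ := by ring
    linarith

end CircleLift

/-- A lift of a conformal map to the upper half-plane, together with its boundary
correspondence. -/
structure HalfPlaneMap (f : ℂ → ℂ) (η : ℝ → ℝ) (Θ : ℂ → ℂ) : Prop where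
  lift : CircleLift η
  cont : ContinuousOn Θ {z | 0 ≤ z.im}
  diff : DifferentiableOn ℂ Θ {z | 0 < z.im}
  inj : ∀ z w : ℂ, 0 ≤ z.im → 0 ≤ w.im → |z.re - w.re| < 2 * Real.pi → Θ z = Θ w → z = w
  notMem : ∀ z : ℂ, 0 < z.im → Θ z ∉ f '' sphere 0 1
  boundary : ∀ x : ℝ, Θ x = f (exp (η x * I))

namespace HalfPlaneMap

variable {f : ℂ → ℂ} {η : ℝ → ℝ} {Θ : ℂ → ℂ} (h : HalfPlaneMap f η Θ)

include h

theorem apply_mem (x : ℝ) : Θ x ∈ f '' sphere 0 1 :=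
  h.boundary x ▸ mem_image_of_mem f (exp_mul_I_mem_sphere _)

theorem hasDerivAt {z : ℂ} (hz : 0 < z.im) : HasDerivAt Θ (deriv Θ z) z :=
  (h.diff.differentiableAt ((isOpen_lt continuous_const continuous_im).mem_nhds hz)).hasDerivAt

theorem deriv_bound {z q : ℂ} {r : ℝ} (hr : 0 < r) (hrz : r ≤ z.im) (hrπ : r ≤ Real.pi)
    (hq : q ∈ f '' sphere 0 1) : r * ‖deriv Θ z‖ ≤ 7 * ‖Θ z - q‖ := by
  have him : ∀ w ∈ ball (0:ℂ) 1, 0 < (z + r * w).im := fun w hw => by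
    have h1 := abs_le.1 (abs_im_le_norm w)
    rw [mem_ball_zero_iff] at hw
    simp only [add_im, mul_im, ofReal_re, ofReal_im, zero_mul, add_zero]
    nlinarith
  have hd : ∀ w ∈ ball (0:ℂ) 1, HasDerivAt (fun w => Θ (z + r * w)) (deriv Θ (z + r * w) * r) w :=
    fun w hw => by
      have h2 : HasDerivAt (fun w : ℂ => z + r * w) (r : ℂ) w := by
        simpa using ((hasDerivAt_id w).const_mul (r:ℂ)).const_add z
      exact (h.hasDerivAt (him w hw)).comp w h2
  have hk : DifferentiableOn ℂ (fun w => Θ (z + r * w)) (ball 0 1) := fun w hw =>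
    (hd w hw).differentiableAt.differentiableWithinAt
  have h0 : (0:ℂ) ∈ ball (0:ℂ) 1 := mem_ball_self one_pos
  have hi : InjOn (fun w => Θ (z + r * w)) (ball 0 1) := fun a ha b hb hab => by
    have h1 := h.inj _ _ (him a ha).le (him b hb).le ?_ hab
    · have hr0 : (r:ℂ) ≠ 0 := by exact_mod_cast hr.ne'
      exact mul_left_cancel₀ hr0 (add_left_cancel h1)
    · have h2 : (z + r * a).re - (z + r * b).re = r * (a - b).re := by simp; ring
      rw [h2, abs_mul, abs_of_pos hr]
      have h3 := abs_re_le_norm (a - b)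
      rw [mem_ball_zero_iff] at ha hb
      have h4 := norm_sub_le a b
      nlinarith
  have h3 := koebe_distortion (q := q) hk hi (fun ⟨w, hw, e⟩ => h.notMem _ (him w hw)
    (by have e' : Θ (z + r * w) = q := e
        rwa [e'])) h0
  rw [(hd 0 h0).deriv] at h3
  simp only [mul_zero, add_zero, norm_zero, norm_mul, norm_real, Real.norm_of_nonneg hr.le] at h3
  linarith

theorem harnack {q : ℂ} (hq : q ∈ f '' sphere 0 1) {κ y : ℝ} (hy : 0 < y)
    (hκ : ∀ z : ℂ, z.im = y → y * ‖deriv Θ z‖ ≤ κ * ‖Θ z - q‖) (x x' : ℝ) :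
    ‖Θ (x + y * I) - q‖ ≤ Real.exp (κ * |x - x'| / y) * ‖Θ (x' + y * I) - q‖ := by
  have hne : ∀ t : ℝ, Θ (t + y * I) - q ≠ 0 := fun t e =>
    h.notMem (t + y * I) (by simpa) (sub_eq_zero.1 e ▸ hq)
  have hder : ∀ t : ℝ, HasDerivAt (fun t : ℝ => Θ (t + y * I) - q) (deriv Θ (t + y * I)) t :=
    fun t => by
      have h2 : HasDerivAt (fun t : ℝ => (t + y * I : ℂ)) 1 t :=
        (ofRealCLM.hasDerivAt (x := t)).add_const (y * I : ℂ) |>.congr_deriv (by simp)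
      have h3 : HasDerivAt Θ (deriv Θ (t + y * I)) ((t:ℂ) + y * I) :=
        h.hasDerivAt (by simpa)
      have := (h3.comp t h2).sub_const q
      simpa using this
  choose d hd hd' using fun t => hasDerivAt_log_norm (hder t) (hne t)
  have hb : ∀ t, ‖d t‖ ≤ κ / y := fun t => by
    refine (hd' t).trans ?_
    rw [div_le_div_iff₀ (norm_pos_iff.2 (hne t)) hy, mul_comm]
    exact hκ _ (by simp)
  have h4 := Convex.norm_image_sub_le_of_norm_hasDerivWithin_le
    (fun t _ => (hd t).hasDerivWithinAt) (fun t _ => hb t) convex_univ (mem_univ x') (mem_univ x)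
  rw [Real.norm_eq_abs, Real.norm_eq_abs] at h4
  have h5 := (le_abs_self _).trans h4
  have h6 : Real.log ‖Θ (x + y * I) - q‖ ≤
      κ * |x - x'| / y + Real.log ‖Θ (x' + y * I) - q‖ := by
    rw [mul_div_right_comm]; linarith
  have h7 := Real.exp_le_exp.2 h6
  rwa [Real.exp_add, Real.exp_log (norm_pos_iff.2 (hne _)),
    Real.exp_log (norm_pos_iff.2 (hne _))] at h7

theorem rectangle_bound {x₁ x₂ a ρ R : ℝ} (hx : x₁ < x₂) (hx' : x₂ - x₁ ≤ 2 * Real.pi) (ha : 0 < a)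
    (hρ : 0 < ρ) (q : ℂ)
    (hcross : ∀ x ∈ Ioo x₁ x₂, ∃ s ∈ Icc 0 a, ∃ t ∈ Icc 0 a, ‖Θ (x + s * I) - q‖ ≤ ρ ∧
      R ≤ ‖Θ (x + t * I) - q‖) : R ≤ ρ * Real.exp (2 * Real.pi * a / (x₂ - x₁)) := by
  rcases le_or_gt R ρ with hR | hR
  · refine hR.trans (le_mul_of_one_le_right hρ.le (Real.one_le_exp ?_))
    have := Real.pi_pos
    have : 0 < x₂ - x₁ := by linarith
    positivity
  have hI : ∀ z ∈ Ioo x₁ x₂ ×ℂ Icc 0 a, 0 ≤ z.im := fun z hz => (mem_reProdIm.1 hz).2.1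
  have h1 := rectangle_estimate (Ψ := Θ) hx ha hρ hR (h.cont.mono hI)
    (h.diff.mono fun z hz => (mem_reProdIm.1 hz).2.1) (fun z hz w hw e =>
      h.inj z w (mem_reProdIm.1 hz).2.1.le (mem_reProdIm.1 hw).2.1.le (by
        have hz' := (mem_reProdIm.1 hz).1
        have hw' := (mem_reProdIm.1 hw).1
        rw [abs_lt]; constructor <;> linarith [hz'.1, hz'.2, hw'.1, hw'.2]) e) q hcross
  have h2 : Real.log (R / ρ) ≤ 2 * Real.pi * a / (x₂ - x₁) := by
    rw [le_div_iff₀ (by linarith)]; linarith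
  have h3 := Real.exp_le_exp.2 h2
  rw [Real.exp_log (div_pos (hρ.trans hR) hρ), div_le_iff₀ hρ] at h3
  linarith

theorem boundary_le {L : ℝ} (hL : 0 ≤ L) (hf : ∀ a ∈ sphere (0:ℂ) 1, ∀ b ∈ sphere (0:ℂ) 1,
    ‖f a - f b‖ ≤ L * ‖a - b‖) (s t : ℝ) : ‖Θ s - Θ t‖ ≤ L * |η s - η t| := by
  rw [h.boundary, h.boundary]
  exact (hf _ (exp_mul_I_mem_sphere _) _ (exp_mul_I_mem_sphere _)).trans
    (mul_le_mul_of_nonneg_left (norm_exp_mul_I_sub_le _ _) hL)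

theorem deriv_le {L : ℝ} (hL : 0 < L) (hf : ∀ a ∈ sphere (0:ℂ) 1, ∀ b ∈ sphere (0:ℂ) 1,
    ‖f a - f b‖ ≤ L * ‖a - b‖) {κ : ℝ} (hκ0 : 0 ≤ κ) {z : ℂ} (hz : 0 < z.im)
    (hz' : z.im ≤ 2 * Real.pi)
    (hκ : ∀ w : ℂ, w.im = z.im → ∀ q ∈ f '' sphere 0 1, z.im * ‖deriv Θ w‖ ≤ κ * ‖Θ w - q‖)
    {x₁ x₂ x₃ : ℝ} (hx : x₂ - x₁ = 2 / 3 * z.im) (h3 : x₃ ∈ Icc x₁ x₂) (hx₁ : z.re - z.im ≤ x₁)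
    (hx₂ : x₂ ≤ z.re + z.im) :
    z.im * ‖deriv Θ z‖ ≤ κ * Real.exp (κ + 3 * Real.pi) * (L * (η x₂ - η x₁)) := by
  set y := z.im with hy
  have hπ := Real.pi_pos
  have hxx : x₁ < x₂ := by linarith
  have hη := h.lift.mono hxx
  have hρ : 0 < L * (η x₂ - η x₁) := mul_pos hL (by linarith)
  have hze : (z.re : ℂ) + y * I = z := re_add_im z
  have key := h.rectangle_bound (a := y) (ρ := L * (η x₂ - η x₁))
    (R := Real.exp (-κ) * ‖Θ z - Θ x₃‖) hxx (by linarith) hz hρ (Θ x₃) fun x hx => by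
      refine ⟨0, ⟨le_rfl, hz.le⟩, y, ⟨hz.le, le_rfl⟩, ?_, ?_⟩
      · simp only [ofReal_zero, zero_mul, add_zero]
        refine (h.boundary_le hL.le hf x x₃).trans (mul_le_mul_of_nonneg_left ?_ hL.le)
        have i1 := h.lift.mono.monotone hx.1.le
        have i2 := h.lift.mono.monotone hx.2.le
        have i3 := h.lift.mono.monotone h3.1
        have i4 := h.lift.mono.monotone h3.2
        rw [abs_le]; constructor <;> linarith
      · have h5 := h.harnack (h.apply_mem x₃) hz (fun w hw => hκ w hw _ (h.apply_mem x₃)) z.re x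
        rw [hze] at h5
        have h6 : κ * |z.re - x| / y ≤ κ := by
          rw [div_le_iff₀ hz]
          refine mul_le_mul_of_nonneg_left ?_ hκ0
          rw [abs_le]; constructor <;> linarith [hx.1, hx.2]
        rw [Real.exp_neg, inv_mul_le_iff₀ (Real.exp_pos κ)]
        exact h5.trans (mul_le_mul_of_nonneg_right (Real.exp_le_exp.2 h6) (norm_nonneg _))
  rw [hx, show 2 * Real.pi * y / (2 / 3 * y) = 3 * Real.pi by field_simp] at key
  rw [Real.exp_neg, inv_mul_le_iff₀ (Real.exp_pos κ)] at key
  refine (hκ z rfl _ (h.apply_mem x₃)).trans ?_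
  rw [mul_assoc, Real.exp_add]
  refine mul_le_mul_of_nonneg_left (key.trans (le_of_eq ?_)) hκ0
  ring

theorem exists_near {x₁ x₂ a ρ : ℝ} (hx : x₁ < x₂) (hx' : x₂ - x₁ ≤ 2 * Real.pi) (ha : 0 < a)
    (hρ : 0 < ρ) (q : ℂ) (hq : ∀ x ∈ Ioo x₁ x₂, ‖Θ (x + a * I) - q‖ ≤ ρ) :
    ∃ x ∈ Ioo x₁ x₂, ‖Θ (x : ℝ) - q‖ ≤ 2 * (ρ * Real.exp (2 * Real.pi * a / (x₂ - x₁))) := by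
  by_contra! hcon
  have := h.rectangle_bound (R := 2 * (ρ * Real.exp (2 * Real.pi * a / (x₂ - x₁)))) hx hx' ha hρ q
    fun x hxx => ⟨a, ⟨ha.le, le_rfl⟩, 0, ⟨le_rfl, ha.le⟩, hq x hxx, by
      simpa using (hcon x hxx).le⟩
  have h2 : 0 < ρ * Real.exp (2 * Real.pi * a / (x₂ - x₁)) := by positivity
  linarith

theorem min_arc_le {ℓ : ℝ} (hℓ : 0 ≤ ℓ) (hf : ∀ a ∈ sphere (0:ℂ) 1, ∀ b ∈ sphere (0:ℂ) 1,
    ℓ * ‖a - b‖ ≤ ‖f a - f b‖) {x₀ h₁ h₂ a ρ : ℝ} (h1 : 0 < h₁) (h12 : h₁ < h₂)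
    (h2 : h₂ ≤ Real.pi) (ha : 0 < a) (hρ : 0 < ρ) (q : ℂ)
    (hq : ∀ x, |x - x₀| ≤ h₂ → ‖Θ (x + a * I) - q‖ ≤ ρ) :
    ℓ * (2 / Real.pi * min (η (x₀ + h₁) - η (x₀ - h₁))
      (2 * Real.pi - (η (x₀ + h₂) - η (x₀ - h₂)))) ≤
      4 * (ρ * Real.exp (2 * Real.pi * a / (h₂ - h₁))) := by
  have hπ := Real.pi_pos
  obtain ⟨s, hs, hs'⟩ := h.exists_near (x₁ := x₀ + h₁) (x₂ := x₀ + h₂) (by linarith) (by linarith)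
    ha hρ q fun x hx => hq x (by rw [abs_le]; constructor <;> linarith [hx.1, hx.2])
  obtain ⟨t, ht, ht'⟩ := h.exists_near (x₁ := x₀ - h₂) (x₂ := x₀ - h₁) (by linarith) (by linarith)
    ha hρ q fun x hx => hq x (by rw [abs_le]; constructor <;> linarith [hx.1, hx.2])
  rw [show x₀ + h₂ - (x₀ + h₁) = h₂ - h₁ by ring] at hs'
  rw [show x₀ - h₁ - (x₀ - h₂) = h₂ - h₁ by ring] at ht'
  have e1 := h.lift.mono.monotone hs.1.le
  have e2 := h.lift.mono.monotone hs.2.le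
  have e3 := h.lift.mono.monotone ht.1.le
  have e4 := h.lift.mono.monotone ht.2.le
  have e5 := h.lift.mono.monotone (show t ≤ s by linarith [hs.1, ht.2])
  have e6 := h.lift.mono.monotone (show s ≤ t + 2 * Real.pi by linarith [hs.2, ht.1])
  rw [h.lift.period] at e6
  have h3 : ‖Θ s - Θ t‖ ≤ 4 * (ρ * Real.exp (2 * Real.pi * a / (h₂ - h₁))) := by
    have := norm_sub_le_norm_sub_add_norm_sub (Θ s) q (Θ t)
    rw [norm_sub_rev q] at this
    linarith
  refine le_trans ?_ h3
  rw [h.boundary, h.boundary]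
  refine le_trans (mul_le_mul_of_nonneg_left ?_ hℓ) (hf _ (exp_mul_I_mem_sphere _) _
    (exp_mul_I_mem_sphere _))
  have hpos : 0 ≤ 2 / Real.pi := by positivity
  rcases le_total (η s - η t) Real.pi with hc | hc
  · have h4 := le_norm_exp_mul_I_sub (s := η s) (t := η t) (abs_le.2 ⟨by linarith, hc⟩)
    refine le_trans (mul_le_mul_of_nonneg_left ?_ hpos) h4
    refine (min_le_left _ _).trans ((le_abs_self _).trans' (by linarith))
  · have h4 := le_norm_exp_mul_I_sub (s := η s - 2 * Real.pi) (t := η t)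
      (abs_le.2 ⟨by linarith, by linarith⟩)
    have h5 : exp (((η s - 2 * Real.pi : ℝ) : ℂ) * I) = exp (η s * I) := by
      push_cast
      rw [sub_mul, exp_sub, exp_two_pi_mul_I, div_one]
    rw [h5] at h4
    refine le_trans (mul_le_mul_of_nonneg_left ?_ hpos) h4
    refine (min_le_right _ _).trans ((neg_le_abs _).trans' (by linarith))

end HalfPlaneMap

theorem eventually_norm_sub_of_hasDerivAt {g : ℂ → ℂ} {d z : ℂ} (hg : HasDerivAt g d z)
    (hd : d ≠ 0) : ∀ᶠ w in 𝓝 z, ‖d‖ / 2 * ‖w - z‖ ≤ ‖g w - g z‖ ∧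
      ‖g w - g z‖ ≤ 2 * ‖d‖ * ‖w - z‖ := by
  have hε : 0 < ‖d‖ / 2 := by have := norm_pos_iff.2 hd; positivity
  filter_upwards [hg.isLittleO.bound hε] with w hw
  have h1 := norm_sub_norm_le (g w - g z) ((w - z) • d)
  have h2 := norm_sub_norm_le ((w - z) • d) (g w - g z)
  rw [norm_sub_rev ((w - z) • d)] at h2
  rw [norm_smul] at h1 h2
  have h3 : 0 ≤ ‖d‖ * ‖w - z‖ := by positivity
  constructor <;> linarith

theorem eventually_norm_exp_sub {K : ℂ → ℂ} (hK : Continuous K) (z : ℂ) :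
    ∀ᶠ w in 𝓝 z, ‖exp (K z * I)‖ / 2 * ‖K w - K z‖ ≤ ‖exp (K w * I) - exp (K z * I)‖ ∧
      ‖exp (K w * I) - exp (K z * I)‖ ≤ 2 * ‖exp (K z * I)‖ * ‖K w - K z‖ := by
  have h1 : HasDerivAt (fun u : ℂ => exp (u * I)) (exp (K z * I) * I) (K z) := by
    simpa using ((hasDerivAt_id (K z)).mul_const I).cexp
  have h2 := hK.continuousAt.eventually (eventually_norm_sub_of_hasDerivAt h1
    (mul_ne_zero (exp_ne_zero _) I_ne_zero))
  simpa using h2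

/-- Local distortion of the Beurling–Ahlfors map in the closed strip of height `2π`. -/
theorem CircleLift.eventually_norm_sub {η : ℝ → ℝ} (h : CircleLift η) {z : ℂ} (hy : 0 < z.im)
    (hy' : z.im ≤ 2 * Real.pi) {m : ℝ} (hm0 : 0 < m) (hm : m ≤ η (z.re + z.im) - η
        (z.re + z.im / 3))
    (hm' : m ≤ η (z.re - z.im / 3) - η (z.re - z.im)) :
    ∀ᶠ w in 𝓝 z, m / (6 * z.im) * ‖w - z‖ ≤ ‖beurlingAhlfors η w - beurlingAhlfors η z‖ ∧
      ‖beurlingAhlfors η w - beurlingAhlfors η z‖ ≤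
        4 * (η (z.re + z.im) - η (z.re - z.im)) / z.im * ‖w - z‖ := by
  have hπ := Real.pi_pos
  have h1 := h.eventually_distortion hy hy' hm0 hm hm'
  have hpos : ∀ᶠ w : ℂ in 𝓝 z, 0 < w.im := continuous_im.continuousAt.eventually_const_lt hy
  rcases hy'.lt_or_eq with hlt | heq
  · have hlt' : ∀ᶠ w : ℂ in 𝓝 z, w.im < 2 * Real.pi :=
      continuous_im.continuousAt.eventually_lt_const hlt
    filter_upwards [h1, hpos, hlt'] with w hw h2 h3
    exact hw (abs_le.2 ⟨by linarith, h3.le⟩)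
  · obtain ⟨c, hc⟩ := h.exists_translation
    filter_upwards [h1, hpos] with w hw h2
    rcases le_total w.im (2 * Real.pi) with h3 | h3
    · exact hw (abs_le.2 ⟨by linarith, h3⟩)
    · rw [hc w (by rwa [abs_of_pos h2]), hc z (by rw [heq, abs_of_pos (by positivity)]),
        add_sub_add_right_eq_sub, heq]
      have p1 := h.period z.re
      have p2 := h.period (z.re - 2 * Real.pi)
      rw [sub_add_cancel] at p2
      rw [heq] at hm
      have hm2 : η z.re ≤ η (z.re + 2 * Real.pi / 3) := h.mono.monotone (by linarith)
      constructor
      · refine (mul_le_mul_of_nonneg_right ?_ (norm_nonneg _)).trans (one_mul _).le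
        rw [div_le_one (by positivity)]
        linarith
      · refine (one_mul _).ge.trans (mul_le_mul_of_nonneg_right ?_ (norm_nonneg _))
        rw [one_le_div (by positivity)]
        linarith

namespace HalfPlaneMap

variable {f : ℂ → ℂ} {η : ℝ → ℝ} {Θ : ℂ → ℂ} (h : HalfPlaneMap f η Θ)

include h

theorem deriv_ne_zero {z : ℂ} (hz : 0 < z.im) : deriv Θ z ≠ 0 := by
  have hπ := Real.pi_pos
  have ho : IsOpen ({w : ℂ | 0 < w.im} ∩ ball z Real.pi) :=
    (isOpen_lt continuous_const continuous_im).inter isOpen_ball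
  refine deriv_ne_zero_of_injOn ho (h.diff.mono inter_subset_left) (fun a ha b hb e => ?_)
    ⟨hz, mem_ball_self hπ⟩
  refine h.inj a b (le_of_lt ha.1) (le_of_lt hb.1) ?_ e
  have h1 := abs_re_le_norm (a - b)
  rw [sub_re] at h1
  have h2 := dist_triangle_right a b z
  rw [dist_eq] at h2
  have h3 := mem_ball.1 ha.2
  have h4 := mem_ball.1 hb.2
  linarith

theorem eventually_le {K : ℂ → ℂ} (hK : Continuous K)
    (hKG : ∀ z w, ‖K w - K z‖ = ‖beurlingAhlfors η w - beurlingAhlfors η z‖) {z : ℂ}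
    (hz : 0 < z.im) (hz' : z.im ≤ 2 * Real.pi) {A : ℝ} (hA : 0 < A)
    (h1 : z.im * ‖deriv Θ z‖ ≤ A * (η (z.re + z.im) - η (z.re + z.im / 3)))
    (h2 : z.im * ‖deriv Θ z‖ ≤ A * (η (z.re - z.im / 3) - η (z.re - z.im))) :
    ∀ᶠ w in 𝓝 z, ‖Θ w - Θ z‖ ≤
      24 * A / ‖exp (K z * I)‖ * ‖exp (K w * I) - exp (K z * I)‖ := by
  have hd := norm_pos_iff.2 (h.deriv_ne_zero hz)
  have hm0 : 0 < z.im * ‖deriv Θ z‖ / A := by positivity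
  filter_upwards [eventually_norm_sub_of_hasDerivAt (h.hasDerivAt hz) (h.deriv_ne_zero hz),
    eventually_norm_exp_sub hK z, h.lift.eventually_norm_sub hz hz' hm0
      (by rwa [div_le_iff₀' hA]) (by rwa [div_le_iff₀' hA])] with w hw1 hw2 hw3
  rw [← hKG] at hw3
  have he : 0 < ‖exp (K z * I)‖ := norm_pos_iff.2 (exp_ne_zero _)
  have e1 : z.im * ‖deriv Θ z‖ / A / (6 * z.im) * ‖w - z‖ = ‖deriv Θ z‖ * ‖w - z‖ / (6 * A) := by
    field_simp
  rw [e1, div_le_iff₀ (by positivity)] at hw3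
  rw [div_mul_eq_mul_div, le_div_iff₀ he]
  have h5 := mul_le_mul_of_nonneg_left hw2.1 (by positivity : 0 ≤ 24 * A)
  have h6 := mul_le_mul_of_nonneg_right (hw1.2.trans (by linarith [hw3.1] :
    _ ≤ 12 * A * ‖K w - K z‖)) he.le
  linarith

theorem eventually_ge {K : ℂ → ℂ} (hK : Continuous K)
    (hKG : ∀ z w, ‖K w - K z‖ = ‖beurlingAhlfors η w - beurlingAhlfors η z‖) {z : ℂ}
    (hz : 0 < z.im) (hz' : z.im ≤ 2 * Real.pi) {B : ℝ} (hB : 0 ≤ B)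
    (h1 : η (z.re + z.im) - η (z.re - z.im) ≤ B * (z.im * ‖deriv Θ z‖)) :
    ∀ᶠ w in 𝓝 z, ‖exp (K w * I) - exp (K z * I)‖ ≤
      16 * B * ‖exp (K z * I)‖ * ‖Θ w - Θ z‖ := by
  have m1 := h.lift.mono (show z.re + z.im / 3 < z.re + z.im by linarith)
  have m2 := h.lift.mono (show z.re - z.im < z.re - z.im / 3 by linarith)
  filter_upwards [eventually_norm_sub_of_hasDerivAt (h.hasDerivAt hz) (h.deriv_ne_zero hz),
    eventually_norm_exp_sub hK z, h.lift.eventually_norm_sub hz hz'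
      (lt_min (sub_pos.2 m1) (sub_pos.2 m2)) (min_le_left _ _) (min_le_right _ _)]
    with w hw1 hw2 hw3
  rw [← hKG] at hw3
  have he : 0 < ‖exp (K z * I)‖ := norm_pos_iff.2 (exp_ne_zero _)
  have h4 : 4 * (η (z.re + z.im) - η (z.re - z.im)) / z.im ≤ 4 * B * ‖deriv Θ z‖ := by
    rw [div_le_iff₀ hz]; linarith
  have h5 : ‖K w - K z‖ ≤ 8 * B * ‖Θ w - Θ z‖ := by
    refine hw3.2.trans ((mul_le_mul_of_nonneg_right h4 (norm_nonneg _)).trans ?_)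
    have := mul_le_mul_of_nonneg_left hw1.1 (by positivity : 0 ≤ 8 * B)
    linarith
  have h6 := mul_le_mul_of_nonneg_left h5 (by positivity : 0 ≤ 2 * ‖exp (K z * I)‖)
  linarith [hw2.2]

end HalfPlaneMap

namespace CircleLift

variable {η : ℝ → ℝ} (h : CircleLift η)

include h

theorem beurlingAhlfors_int_period (z : ℂ) (n : ℤ) :
    beurlingAhlfors η (z + n * (2 * Real.pi)) = beurlingAhlfors η z + n * (2 * Real.pi) := by
  have hp : Function.Periodic (fun z => beurlingAhlfors η z - z) (2 * Real.pi : ℂ) := fun z => by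
    simp only [h.beurlingAhlfors_period]; ring
  have := hp.int_mul n z
  linear_combination this

/-- Passing to the quotient by `z ↦ exp (i z)`, the inverse of the Beurling–Ahlfors map becomes an
injective self-map of the plane. -/
theorem exists_descent : ∃ H : ℂ → ℂ, Continuous H ∧ Function.Injective H ∧ H 0 = 0 ∧
    (∀ z, H (exp (beurlingAhlfors η z * I)) = exp (z * I)) ∧
    (∀ ζ, ‖ζ‖ ≤ 1 → ‖H ζ‖ ≤ 1) ∧ (∀ ζ, ‖ζ‖ < 1 → ‖H ζ‖ < 1) ∧
    ∃ u : ℂ, ‖u‖ = 1 ∧ ∀ ζ, ‖ζ‖ ≤ Real.exp (-(2 * Real.pi)) → H ζ = u * ζ := by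
  obtain ⟨G, hG⟩ := h.exists_homeomorph
  have hinj := h.injective_beurlingAhlfors
  have hsurj : ∀ ζ : ℂ, ζ ≠ 0 → ∃ z, exp (beurlingAhlfors η z * I) = ζ := fun ζ hζ => by
    refine ⟨G.symm (-I * log ζ), ?_⟩
    rw [← hG, G.apply_symm_apply, show -I * log ζ * I = log ζ by
      linear_combination -log ζ * I_mul_I, exp_log hζ]
  classical
  let H : ℂ → ℂ := fun ζ => if ζ = 0 then 0 else exp (G.symm (-I * log ζ) * I)
  have hH0 : H 0 = 0 := if_pos rfl
  have key : ∀ z w, exp (beurlingAhlfors η z * I) = exp (beurlingAhlfors η w * I) →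
      exp (z * I) = exp (w * I) := fun z w e => by
    obtain ⟨n, hn⟩ := exp_eq_exp_iff_exists_int.1 e
    have h1 : beurlingAhlfors η z = beurlingAhlfors η (w + n * (2 * Real.pi)) := by
      rw [h.beurlingAhlfors_int_period]
      refine mul_right_cancel₀ I_ne_zero ?_
      rw [hn]; ring
    rw [hinj h1, exp_eq_exp_iff_exists_int]
    exact ⟨n, by ring⟩
  have hHe : ∀ z, H (exp (beurlingAhlfors η z * I)) = exp (z * I) := fun z => by
    have : H (exp (beurlingAhlfors η z * I)) =
      exp (G.symm (-I * log (exp (beurlingAhlfors η z * I))) * I) := if_neg (exp_ne_zero _)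
    rw [this]
    apply key
    rw [← hG, G.apply_symm_apply, show ∀ u : ℂ, -I * u * I = u from fun u => by
      linear_combination -u * I_mul_I, exp_log (exp_ne_zero _)]
  obtain ⟨c, hc⟩ := h.exists_translation
  have hnear : ∀ ζ, ‖ζ‖ ≤ Real.exp (-(2 * Real.pi)) → H ζ = exp ((-c : ℝ) * I) * ζ := by
    intro ζ hζ
    rcases eq_or_ne ζ 0 with rfl | h0
    · rw [hH0, mul_zero]
    have h1 : 2 * Real.pi ≤ (-I * log ζ - c).im := by
      have : (-I * log ζ - c).im = -Real.log ‖ζ‖ := by simp [log_re]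
      rw [this]
      have := Real.log_le_log (norm_pos_iff.2 h0) hζ
      rw [Real.log_exp] at this
      linarith
    have h2 := hc _ (h1.trans (le_abs_self _))
    have h3 := hHe (-I * log ζ - c)
    rw [h2, sub_add_cancel, show -I * log ζ * I = log ζ by
      linear_combination -log ζ * I_mul_I, exp_log h0] at h3
    rw [h3, show (-I * log ζ - c) * I = (-c : ℝ) * I + log ζ by
      push_cast; linear_combination -log ζ * I_mul_I, exp_add, exp_log h0]
  have hn : ∀ z : ℂ, ‖exp (z * I)‖ = Real.exp (-z.im) := norm_exp_mul_I
  have hcont : Continuous H := by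
    refine continuous_iff_continuousAt.2 fun ζ => ?_
    rcases eq_or_ne ζ 0 with rfl | h0
    · have : H =ᶠ[𝓝 0] fun ζ => exp ((-c : ℝ) * I) * ζ := by
        filter_upwards [closedBall_mem_nhds (0:ℂ) (Real.exp_pos (-(2 * Real.pi)))] with ζ hζ
        exact hnear ζ (by simpa using hζ)
      exact (continuous_const.mul continuous_id).continuousAt.congr this.symm
    · obtain ⟨z, rfl⟩ := hsurj ζ h0
      have ho : IsOpenMap fun z => exp (beurlingAhlfors η z * I) := by
        have := isOpenMap_exp_mul_I.comp G.isOpenMap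
        simpa [Function.comp_def, hG] using this
      have h4 : Tendsto (H ∘ fun z => exp (beurlingAhlfors η z * I)) (𝓝 z) (𝓝 (exp (z * I))) := by
        have : (H ∘ fun z => exp (beurlingAhlfors η z * I)) = fun z => exp (z * I) := funext hHe
        rw [this]
        exact Continuous.continuousAt (by fun_prop)
      rw [ContinuousAt, hHe]
      exact (tendsto_map'_iff.2 h4).mono_left (ho.nhds_le z)
  refine ⟨H, hcont, ?_, hH0, hHe, ?_, ?_, exp ((-c : ℝ) * I), norm_exp_ofReal_mul_I _, hnear⟩
  · intro a b hab
    rcases eq_or_ne a 0 with rfl | ha <;> rcases eq_or_ne b 0 with rfl | hb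
    · rfl
    · obtain ⟨z, rfl⟩ := hsurj b hb
      rw [hH0, hHe] at hab
      exact absurd hab.symm (exp_ne_zero _)
    · obtain ⟨z, rfl⟩ := hsurj a ha
      rw [hH0, hHe] at hab
      exact absurd hab (exp_ne_zero _)
    · obtain ⟨z, rfl⟩ := hsurj a ha
      obtain ⟨w, rfl⟩ := hsurj b hb
      rw [hHe, hHe] at hab
      obtain ⟨n, hn⟩ := exp_eq_exp_iff_exists_int.1 hab
      have h1 : z = w + n * (2 * Real.pi) := by
        refine mul_right_cancel₀ I_ne_zero ?_
        rw [hn]; ring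
      rw [h1, h.beurlingAhlfors_int_period, exp_eq_exp_iff_exists_int]
      exact ⟨n, by ring⟩
  · intro ζ hζ
    rcases eq_or_ne ζ 0 with rfl | h0
    · simp [hH0]
    · obtain ⟨z, rfl⟩ := hsurj ζ h0
      rw [hHe, hn, Real.exp_le_one_iff, neg_nonpos]
      rw [hn, Real.exp_le_one_iff, neg_nonpos] at hζ
      by_contra! hcon
      exact absurd (h.beurlingAhlfors_im_neg hcon) hζ.not_gt
  · intro ζ hζ
    rcases eq_or_ne ζ 0 with rfl | h0
    · simp [hH0]
    · obtain ⟨z, rfl⟩ := hsurj ζ h0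
      rw [hHe, hn, Real.exp_lt_one_iff, neg_lt_zero]
      rw [hn, Real.exp_lt_one_iff, neg_lt_zero] at hζ
      by_contra! hcon
      rcases hcon.lt_or_eq with h1 | h1
      · exact absurd (h.beurlingAhlfors_im_neg h1) hζ.le.not_gt
      · have : z = (z.re : ℂ) := by apply Complex.ext <;> simp [h1]
        rw [this, beurlingAhlfors_ofReal] at hζ
        simp at hζ

end CircleLift

theorem exp_mul_I_eq_iff {s t : ℝ} : exp (s * I) = exp (t * I) ↔ ∃ n : ℤ, s = t + n *
    (2 * Real.pi) := by
  rw [exp_eq_exp_iff_exists_int]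
  refine exists_congr fun n => ⟨fun h => ?_, fun h => by rw [h]; push_cast; ring⟩
  have : (s : ℂ) * I = ((t + n * (2 * Real.pi) : ℝ) : ℂ) * I := by rw [h]; push_cast; ring
  exact_mod_cast mul_right_cancel₀ I_ne_zero this

theorem circleLift_of_strictMono {g : ℂ → ℂ} (hi : InjOn g (sphere (0:ℂ) 1)) {θ : ℝ → ℝ}
    (hθ : Continuous θ) (hm : StrictMono θ) (he : ∀ x : ℝ, g (exp (x * I)) = exp (θ x * I))
    {c : ℝ} (hc : ∀ x, θ (x + 2 * Real.pi) = θ x + c) : CircleLift θ := by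
  have hπ := Real.pi_pos
  refine ⟨hθ, hm, fun x => ?_⟩
  rw [hc]
  have h1 : exp ((θ 0 + c : ℝ) * I) = exp (θ 0 * I) := by
    rw [← hc, ← he, ← he]
    congr 1
    exact exp_mul_I_eq_iff.2 ⟨1, by simp⟩
  obtain ⟨n, hn⟩ := exp_mul_I_eq_iff.1 h1
  have hcn : c = n * (2 * Real.pi) := by linarith
  have hcpos : 0 < c := by
    have := hm (show (0:ℝ) < 0 + 2 * Real.pi by linarith)
    rw [hc] at this; linarith
  have hn1 : 1 ≤ n := by
    rw [hcn] at hcpos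
    have : (0:ℝ) < n := pos_of_mul_pos_left hcpos (by positivity)
    exact_mod_cast this
  rcases hn1.lt_or_eq with h2 | h2
  · exfalso
    have h3 : 2 * Real.pi < c := by
      rw [hcn]
      have : (2:ℝ) ≤ n := by exact_mod_cast h2
      nlinarith
    obtain ⟨x, hx, hxe⟩ := intermediate_value_Icc (show (0:ℝ) ≤ 0 + 2 * Real.pi by linarith)
      hθ.continuousOn (show θ 0 + 2 * Real.pi ∈ Icc (θ 0) (θ (0 + 2 * Real.pi)) by
        rw [hc]; constructor <;> linarith)
    have h4 : g (exp (x * I)) = g (exp ((0:ℝ) * I)) := by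
      rw [he, he, hxe]
      exact exp_mul_I_eq_iff.2 ⟨1, by simp⟩
    have hx0 : 0 < x := hm.lt_iff_lt.1 (by rw [hxe]; linarith)
    have hx1 : x < 0 + 2 * Real.pi := hm.lt_iff_lt.1 (by rw [hxe, hc]; linarith)
    have h5 := exp_mul_I_injOn 0 ⟨hx0.le, hx1⟩ ⟨le_rfl, by linarith⟩
      (hi (exp_mul_I_mem_sphere _) (exp_mul_I_mem_sphere _) h4)
    linarith
  · rw [hcn, ← h2]; simp

/-- Injective self-maps of the circle lift to increasing or decreasing homeomorphisms of the
line. -/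
theorem exists_circleLift {g : ℂ → ℂ} (hg : ContinuousOn g (sphere (0:ℂ) 1))
    (hi : InjOn g (sphere (0:ℂ) 1)) (hs : MapsTo g (sphere (0:ℂ) 1) (sphere (0:ℂ) 1)) :
    ∃ η : ℝ → ℝ, CircleLift η ∧ ((∀ x : ℝ, g (exp (x * I)) = exp (η x * I)) ∨
      ∀ x : ℝ, g (exp (x * I)) = (starRingEnd ℂ) (exp (η x * I))) := by
  have hπ := Real.pi_pos
  have hcont : Continuous fun z : ℂ => g (exp (z.re * I)) :=
    hg.comp_continuous (by fun_prop) fun z => exp_mul_I_mem_sphere _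
  have hnorm : ∀ x : ℝ, ‖g (exp (x * I))‖ = 1 := fun x => by
    simpa using hs (exp_mul_I_mem_sphere x)
  obtain ⟨k, hk, hke⟩ := HasLogOn.of_starConvex (S := univ) (starConvex_univ 0) (mem_univ 0)
    hcont.continuousOn fun z _ e => by have := hnorm z.re; rw [e] at this; simp at this
  rw [continuousOn_univ] at hk
  have hke' : ∀ x : ℝ, exp (k x) = g (exp (x * I)) := fun x => by simpa using hke x (mem_univ _)
  set θ : ℝ → ℝ := fun x => (k x).im with hθdef
  have hθ : Continuous θ := continuous_im.comp (hk.comp continuous_ofReal)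
  have hkθ : ∀ x : ℝ, k x = θ x * I := fun x => by
    have h1 := hnorm x
    rw [← hke', norm_exp, Real.exp_eq_one_iff] at h1
    apply Complex.ext <;> simp [h1, hθdef]
  have he : ∀ x : ℝ, g (exp (x * I)) = exp (θ x * I) := fun x => by rw [← hke', hkθ]
  have hper : ∀ x : ℝ, exp (((x + 2 * Real.pi : ℝ) : ℂ) * I) = exp (x * I) := fun x =>
    exp_mul_I_eq_iff.2 ⟨1, by simp⟩
  set c := θ (0 + 2 * Real.pi) - θ 0 with hcdef
  have hc : ∀ x, θ (x + 2 * Real.pi) = θ x + c := fun x => by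
    have := sub_eq_sub_of_exp_eq (isPreconnected_univ (α := ℝ))
      (g₁ := fun x : ℝ => ((θ (x + 2 * Real.pi) : ℝ) : ℂ) * I) (g₂ := fun x : ℝ => (θ x : ℂ) * I)
      (by fun_prop) (by fun_prop) (fun x _ => by rw [← he, ← he, hper]) (mem_univ x) (mem_univ 0)
    simp only [← sub_mul] at this
    have := mul_right_cancel₀ I_ne_zero this
    have : θ (x + 2 * Real.pi) - θ x = θ (0 + 2 * Real.pi) - θ 0 := by exact_mod_cast this
    linarith
  have hIco : InjOn θ (Ico 0 (0 + 2 * Real.pi)) := fun s hs t ht e =>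
    exp_mul_I_injOn 0 hs ht (hi (exp_mul_I_mem_sphere _) (exp_mul_I_mem_sphere _)
      (by rw [he, he, e]))
  have hc0 : c ≠ 0 := fun h0 => by
    have h2 : θ (2 * Real.pi) = θ 0 := by have := hc 0; rwa [h0, add_zero, zero_add] at this
    have hne : θ 0 ≠ θ Real.pi := fun e => hπ.ne (hIco ⟨le_rfl, by linarith⟩
      ⟨hπ.le, by linarith⟩ e)
    have hm : ∀ u v : ℝ, (u + v) / 2 ∈ uIcc u v := fun u v => by
      rcases le_total u v with h | h
      · rw [uIcc_of_le h]; constructor <;> linarith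
      · rw [uIcc_of_ge h]; constructor <;> linarith
    obtain ⟨x, hx, hxe⟩ := intermediate_value_uIcc (a := 0) (b := Real.pi) hθ.continuousOn
      (hm (θ 0) (θ Real.pi))
    obtain ⟨y, hy, hye⟩ := intermediate_value_uIcc (a := 2 * Real.pi) (b := Real.pi)
      hθ.continuousOn (hm (θ (2 * Real.pi)) (θ Real.pi))
    rw [h2] at hye
    rw [uIcc_of_le hπ.le] at hx
    rw [uIcc_of_ge (by linarith)] at hy
    have hy2 : y ≠ 2 * Real.pi := by
      rintro rfl
      rw [h2] at hye; exact hne (by linarith)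
    have := hIco ⟨hx.1, by linarith [hx.2]⟩ ⟨by linarith [hy.1],
      by linarith [lt_of_le_of_ne hy.2 hy2]⟩ (hxe.trans hye.symm)
    have hxπ : x = Real.pi := le_antisymm hx.2 (by rw [this]; exact hy.1)
    rw [hxπ] at hxe
    exact hne (by linarith)
  have hcn : ∀ (n : ℤ) (x : ℝ), θ (x + n * (2 * Real.pi)) = θ x + n * c := fun n x => by
    have hp : Function.Periodic (fun x => θ x - x * (c / (2 * Real.pi))) (2 * Real.pi) :=
        fun x => by
      simp only [hc]; field_simp; ring
    have := hp.int_mul n x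
    field_simp at this
    have h2 : 2 * Real.pi * (θ (x + n * (2 * Real.pi)) - (θ x + n * c)) = 0 := by
      rw [← mul_assoc (n:ℝ)] at *
      linarith
    have := (mul_eq_zero.1 h2).resolve_left (by positivity)
    linarith
  have hinj : Function.Injective θ := fun s t e => by
    obtain ⟨n, hn⟩ := exp_mul_I_eq_iff.1 (hi (exp_mul_I_mem_sphere s) (exp_mul_I_mem_sphere t)
      (by rw [he, he, e]))
    rw [hn, hcn] at e
    have h3 : (n:ℝ) * c = 0 := by linarith
    rw [hn, (mul_eq_zero.1 h3).resolve_right hc0, zero_mul, add_zero]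
  rcases hθ.strictMono_of_inj hinj with hmono | hanti
  · exact ⟨θ, circleLift_of_strictMono hi hθ hmono he hc, Or.inl he⟩
  · have he' : ∀ x : ℝ, (starRingEnd ℂ) (g (exp (x * I))) = exp (((-θ x : ℝ) : ℂ) * I) :=
      fun x => by
      rw [he, ← exp_conj]; simp
    refine ⟨fun x => -θ x, circleLift_of_strictMono (g := fun z => (starRingEnd ℂ) (g z))
      (fun a ha b hb e => hi ha hb ((starRingEnd ℂ).injective e)) hθ.neg
      (fun a b hab => neg_lt_neg (hanti hab)) he' (c := -c) (fun x => by rw [hc]; ring),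
      Or.inr fun x => ?_⟩
    rw [← he', conj_conj]

theorem CircleLift.not_hasLogOn {η : ℝ → ℝ} (h : CircleLift η) {g : ℂ → ℂ}
    (he : ∀ x : ℝ, g (exp (x * I)) = exp (η x * I)) : ¬ HasLogOn (sphere (0:ℂ) 1) g := by
  rintro ⟨k, hk, hke⟩
  have hπ := Real.pi_pos
  have hη := h.cont
  have := sub_eq_sub_of_exp_eq (isPreconnected_univ (α := ℝ))
      (g₁ := fun x : ℝ => k (exp (x * I))) (g₂ := fun x : ℝ => (η x : ℂ) * I)
      (hk.comp_continuous (by fun_prop) exp_mul_I_mem_sphere).continuousOn (by fun_prop)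
      (fun x _ => by rw [hke _ (exp_mul_I_mem_sphere _), he]) (mem_univ (0 + 2 * Real.pi))
      (mem_univ 0)
  have hper : exp (((0 + 2 * Real.pi : ℝ) : ℂ) * I) = exp ((0:ℝ) * I) :=
    exp_mul_I_eq_iff.2 ⟨1, by simp⟩
  simp only [hper] at this
  have h2 := mul_right_cancel₀ I_ne_zero (sub_right_injective this)
  have h3 : η (0 + 2 * Real.pi) = η 0 := by exact_mod_cast h2
  rw [h.period] at h3
  linarith

theorem not_hasLogOn_sphere_of_injOn {g : ℂ → ℂ} (hg : ContinuousOn g (sphere (0:ℂ) 1))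
    (hi : InjOn g (sphere (0:ℂ) 1)) (hs : MapsTo g (sphere (0:ℂ) 1) (sphere (0:ℂ) 1)) :
    ¬ HasLogOn (sphere (0:ℂ) 1) g := by
  obtain ⟨η, h, he | he⟩ := exists_circleLift hg hi hs
  · exact h.not_hasLogOn he
  · rintro ⟨k, hk, hke⟩
    refine h.not_hasLogOn (g := fun z => (starRingEnd ℂ) (g z)) (fun x => by simp only [he,
        conj_conj])
      ⟨fun z => (starRingEnd ℂ) (k z), continuous_conj.comp_continuousOn hk, fun z hz => ?_⟩
    rw [exp_conj, hke z hz]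

theorem norm_diskMap_le_one {a z : ℂ} (hz : ‖z‖ = 1) : ‖diskMap a z‖ ≤ 1 := by
  have h1 : ‖a - z‖ = ‖1 - (starRingEnd ℂ) a * z‖ := by
    have h2 : a - z = -(starRingEnd ℂ) (1 - (starRingEnd ℂ) a * z) * z := by
      have : (starRingEnd ℂ) z * z = 1 := by rw [conj_mul', hz]; norm_num
      simp only [map_sub, map_one, map_mul, conj_conj]
      linear_combination -a * this
    rw [h2, norm_mul, norm_neg, norm_conj, hz, mul_one]
  rw [diskMap, norm_div, h1]
  exact div_self_le_one _

theorem diskMap_mem_sphere {a z : ℂ} (ha : a ∈ ball (0:ℂ) 1) (hz : z ∈ sphere (0:ℂ) 1) :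
    diskMap a z ∈ sphere (0:ℂ) 1 := by
  have hz1 : ‖z‖ = 1 := by simpa using hz
  rw [mem_sphere_zero_iff_norm]
  refine le_antisymm (norm_diskMap_le_one hz1) (not_lt.1 fun hlt => ?_)
  have h0 := diskMap_denom_ne_zero ha (sphere_subset_closedBall hz)
  have h1 := normSq_one_sub_conj_mul a z
  rw [diskMap, norm_div, div_lt_one (norm_pos_iff.2 h0)] at hlt
  rw [hz1] at h1
  nlinarith [norm_nonneg (a - z)]

theorem one_sub_conj_mul_ne_zero {a z : ℂ} (hz : ‖z‖ = 1) (h : z ≠ a) :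
    1 - (starRingEnd ℂ) a * z ≠ 0 := fun e => by
  have hzz : (starRingEnd ℂ) z * z = 1 := by rw [conj_mul', hz]; norm_num
  have hz0 : z ≠ 0 := by rintro rfl; simp at hz
  have h1 : (starRingEnd ℂ) a = (starRingEnd ℂ) z :=
    mul_right_cancel₀ hz0 (by linear_combination -e - hzz)
  exact h ((starRingEnd ℂ).injective h1).symm

theorem diskMap_of_norm_eq_one {a z : ℂ} (ha : ‖a‖ = 1) (hz : ‖z‖ = 1) (h : z ≠ a) :
    diskMap a z = a := by
  rw [diskMap, div_eq_iff (one_sub_conj_mul_ne_zero hz h)]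
  have : a * (starRingEnd ℂ) a = 1 := by rw [mul_conj', ha]; norm_num
  linear_combination z * this

theorem ae_exp_mul_I_ne (a : ℂ) : ∀ᵐ t : ℝ, t ∈ uIoc (0:ℝ) (2 * Real.pi) → exp (t * I) ≠ a := by
  have hsub : {t : ℝ | t ∈ Ioc 0 (2 * Real.pi) ∧ exp (t * I) = a}.Subsingleton := by
    rintro s ⟨hs, hse⟩ t ⟨ht, hte⟩
    have h1 : exp ((s:ℝ) * I) = exp ((t:ℝ) * I) := hse.trans hte.symm
    have h2 := exp_mul_I_inj h1 (by
      simp only [ofReal_re]; rw [abs_lt]; constructor <;> linarith [hs.1, hs.2, ht.1, ht.2])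
    exact_mod_cast h2
  have h0 : volume {t : ℝ | t ∈ Ioc 0 (2 * Real.pi) ∧ exp (t * I) = a} = 0 :=
    hsub.measure_zero volume
  filter_upwards [compl_mem_ae_iff.2 h0] with t ht hm he
  rw [uIoc_of_le (by have := Real.pi_pos; positivity)] at hm
  exact ht ⟨hm, he⟩

/-- A circle homeomorphism can be precomposed with a disk automorphism to have mean zero. -/
theorem exists_mean_zero {g : ℂ → ℂ} (hg : ContinuousOn g (sphere (0:ℂ) 1))
    (hi : InjOn g (sphere (0:ℂ) 1)) (hs : MapsTo g (sphere (0:ℂ) 1) (sphere (0:ℂ) 1)) :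
    ∃ a ∈ ball (0:ℂ) 1, ∫ t in (0:ℝ)..(2 * Real.pi), g (diskMap a (exp (t * I))) = 0 := by
  have hπ := Real.pi_pos
  obtain ⟨G, hG⟩ := ContinuousMap.exists_restrict_eq (isClosed_sphere (x := (0:ℂ)) (ε := 1))
    (⟨(sphere (0:ℂ) 1).domRestrict g, hg.domRestrict⟩ : C(sphere (0:ℂ) 1, ℂ))
  have hGg : ∀ z ∈ sphere (0:ℂ) 1, G z = g z := fun z hz => congrArg (fun k => k ⟨z, hz⟩) hG
  obtain ⟨B, hB⟩ := (isCompact_closedBall (0:ℂ) 1).exists_bound_of_continuousOn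
    G.continuous.continuousOn
  have hn : ∀ t : ℝ, ‖exp (t * I)‖ = 1 := norm_exp_ofReal_mul_I
  set M : ℂ → ℂ := fun a => ∫ t in (0:ℝ)..(2 * Real.pi), G (diskMap a (exp (t * I))) with hM
  have hMc : ContinuousOn M (closedBall 0 1) := fun a _ => by
    refine intervalIntegral.continuousWithinAt_of_dominated_interval (bound := fun _ => B)
      ?_ ?_ (by simp) ?_
    · refine Eventually.of_forall fun b => (Measurable.aestronglyMeasurable ?_)
      refine G.continuous.measurable.comp ?_
      unfold diskMap
      fun_prop
    · refine Eventually.of_forall fun b => Eventually.of_forall fun t _ => hB _ ?_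
      rw [mem_closedBall_zero_iff]
      exact norm_diskMap_le_one (hn t)
    · filter_upwards [ae_exp_mul_I_ne a] with t ht hm
      have h1 := one_sub_conj_mul_ne_zero (hn t) (ht hm)
      refine ContinuousAt.continuousWithinAt ?_
      refine G.continuous.continuousAt.comp ?_
      unfold diskMap
      refine ContinuousAt.div (by fun_prop) ?_ h1
      exact continuousAt_const.sub (continuous_conj.continuousAt.mul continuousAt_const)
  have hMs : ∀ a ∈ sphere (0:ℂ) 1, M a = (2 * Real.pi : ℝ) * g a := fun a ha => by
    have ha1 : ‖a‖ = 1 := by simpa using ha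
    have : M a = ∫ t in (0:ℝ)..(2 * Real.pi), G a := by
      refine intervalIntegral.integral_congr_ae ?_
      filter_upwards [ae_exp_mul_I_ne a] with t ht hm
      rw [diskMap_of_norm_eq_one ha1 (hn t) (ht hm)]
    rw [this, intervalIntegral.integral_const, hGg a ha, sub_zero, real_smul]
  have hMb : ∀ a ∈ ball (0:ℂ) 1, M a = ∫ t in (0:ℝ)..(2 * Real.pi), g (diskMap a (exp (t * I))) :=
    fun a ha => by
      exact intervalIntegral.integral_congr fun t _ => hGg _
        (diskMap_mem_sphere ha (by simp [hn]))
  by_contra! hcon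
  have hne : ∀ a ∈ closedBall (0:ℂ) 1, M a ≠ 0 := fun a ha => by
    rcases (mem_closedBall_zero_iff.1 ha).lt_or_eq with h1 | h1
    · rw [hMb a (by simpa using h1)]; exact hcon a (by simpa using h1)
    · have ha' : a ∈ sphere (0:ℂ) 1 := by simpa using h1
      rw [hMs a ha']
      refine mul_ne_zero (by exact_mod_cast (by positivity)) fun e => ?_
      have := hs ha'
      rw [e] at this; simp at this
  have hlog := HasLogOn.of_starConvex ((convex_closedBall (0:ℂ) 1).starConvex
    (mem_closedBall_self zero_le_one)) (mem_closedBall_self zero_le_one) hMc hne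
  refine not_hasLogOn_sphere_of_injOn hg hi hs ?_
  have hconst : HasLogOn (sphere (0:ℂ) 1) fun _ : ℂ => (((2 * Real.pi : ℝ) : ℂ))⁻¹ :=
    ⟨fun _ => log (((2 * Real.pi : ℝ) : ℂ))⁻¹, continuousOn_const, fun _ _ => exp_log
      (inv_ne_zero (by exact_mod_cast (by positivity)))⟩
  refine (hconst.mul (hlog.mono sphere_subset_closedBall)).congr fun a ha => ?_
  have h2 : (((2 * Real.pi : ℝ) : ℂ)) ≠ 0 := by exact_mod_cast (by positivity)
  simp only
  rw [hMs a ha, inv_mul_cancel_left₀ h2]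

theorem CircleLift.arc_ge {η : ℝ → ℝ} (h : CircleLift η)
    (h0 : ∫ t in (0:ℝ)..(2 * Real.pi), exp (η t * I) = 0) {a b : ℝ}
    (hab : b = a + 4 / 3 * Real.pi) : 2 / 3 * Real.pi ≤ η b - η a := by
  have hπ := Real.pi_pos
  have hη := h.cont
  by_contra! hlt
  set c := (η a + η b) / 2 with hc
  have hperiod : Function.Periodic (fun t : ℝ => exp (η t * I)) (2 * Real.pi) := fun t => by
    simp only [h.period]
    exact exp_mul_I_eq_iff.2 ⟨1, by simp⟩
  have h1 : ∫ t in a..(a + 2 * Real.pi), exp (η t * I) = 0 := by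
    rw [hperiod.intervalIntegral_add_eq a 0, zero_add, h0]
  have hi : ∀ u v, IntervalIntegrable (fun t : ℝ => Real.cos (η t - c)) volume u v := fun u v =>
    Continuous.intervalIntegrable (by fun_prop) _ _
  have h2 : ∫ t in a..(a + 2 * Real.pi), Real.cos (η t - c) = 0 := by
    have h3 : ∫ t in a..(a + 2 * Real.pi), exp (-c * I) * exp (η t * I) = 0 := by
      rw [intervalIntegral.integral_const_mul, h1, mul_zero]
    have h4 := congrArg re h3
    rw [← reCLM_apply, ← ContinuousLinearMap.intervalIntegral_comp_comm _
      (Continuous.intervalIntegrable (by fun_prop) _ _)] at h4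
    rw [← zero_re, ← h4]
    refine intervalIntegral.integral_congr fun t _ => ?_
    rw [reCLM_apply, ← Complex.exp_add, ← add_mul, neg_add_eq_sub, ← ofReal_sub,
      exp_ofReal_mul_I_re]
  have hτ0 : 0 ≤ η b - η a := sub_nonneg.2 (h.mono.monotone (by rw [hab]; linarith))
  have hcos : 1 / 2 < Real.cos ((η b - η a) / 2) := by
    rw [← Real.cos_pi_div_three]
    exact Real.cos_lt_cos_of_nonneg_of_le_pi (by linarith) (by linarith) (by linarith)
  rw [← intervalIntegral.integral_add_adjacent_intervals (hi a b) (hi b (a + 2 * Real.pi))] at h2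
  have h5 : ∫ t in a..b, Real.cos ((η b - η a) / 2) ≤ ∫ t in a..b, Real.cos (η t - c) :=
    intervalIntegral.integral_mono_on (by rw [hab]; linarith) (by simp) (hi _ _) fun t ht => by
      have e1 := h.mono.monotone ht.1
      have e2 := h.mono.monotone ht.2
      rw [← Real.cos_abs (η t - c)]
      refine Real.cos_le_cos_of_nonneg_of_le_pi (abs_nonneg _) (by linarith) ?_
      rw [abs_le]; constructor <;> linarith
  have h6 : ∫ t in b..(a + 2 * Real.pi), (-1:ℝ) ≤ ∫ t in b..(a + 2 * Real.pi), Real.cos (η t - c) :=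
    intervalIntegral.integral_mono_on (by rw [hab]; linarith) (by simp) (hi _ _) fun t ht =>
      Real.neg_one_le_cos _
  rw [intervalIntegral.integral_const, smul_eq_mul] at h5 h6
  rw [hab] at h5 h6 h2
  rw [← hab] at h2
  have : (4 / 3 * Real.pi) * (1 / 2) < (a + 4 / 3 * Real.pi - a) *
      Real.cos ((η (a + 4 / 3 * Real.pi) - η a) / 2) := by
    rw [← hab, hab, add_sub_cancel_left, ← hab]
    exact mul_lt_mul_of_pos_left hcos (by positivity)
  rw [← hab] at this h5 h6
  linarith

/-- A conformal map of the disk onto a domain bounded by the curve `f '' sphere 0 1`, extended to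
the closed disk, whose boundary values are parametrized through the circle lift `η`. -/
structure BoundaryMap (f : ℂ → ℂ) (η : ℝ → ℝ) (Φ : ℂ → ℂ) : Prop where
  lift : CircleLift η
  cont : ContinuousOn Φ (closedBall 0 1)
  diff : DifferentiableOn ℂ Φ (ball 0 1)
  inj : InjOn Φ (closedBall 0 1)
  notMem : ∀ w ∈ ball (0:ℂ) 1, Φ w ∉ f '' sphere 0 1
  boundary : ∀ x : ℝ, Φ (exp (x * I)) = f (exp (η x * I))

theorem BoundaryMap.halfPlaneMap {f Φ : ℂ → ℂ} {η : ℝ → ℝ} (h : BoundaryMap f η Φ) :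
    HalfPlaneMap f η (fun z => Φ (exp (z * I))) where
  lift := h.lift
  cont := h.cont.comp (by fun_prop) fun z hz => exp_mul_I_mem_closedBall hz
  diff := h.diff.comp (by fun_prop) fun z hz => exp_mul_I_mem_ball hz
  inj z w hz hw hzw e :=
    exp_mul_I_inj (h.inj (exp_mul_I_mem_closedBall hz) (exp_mul_I_mem_closedBall hw) e) hzw
  notMem z hz := h.notMem _ (exp_mul_I_mem_ball hz)
  boundary := h.boundary

theorem conj_mem_sphere {z : ℂ} (hz : z ∈ sphere (0:ℂ) 1) : (starRingEnd ℂ) z ∈ sphere (0:ℂ) 1 := by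
  rwa [mem_sphere_zero_iff_norm, norm_conj, ← mem_sphere_zero_iff_norm]

theorem image_conj_sphere (f : ℂ → ℂ) :
    (fun z => f ((starRingEnd ℂ) z)) '' sphere (0:ℂ) 1 = f '' sphere (0:ℂ) 1 := by
  ext w
  constructor
  · rintro ⟨z, hz, rfl⟩
    exact ⟨_, conj_mem_sphere hz, rfl⟩
  · rintro ⟨z, hz, rfl⟩
    exact ⟨_, conj_mem_sphere hz, by simp⟩

theorem image_diskMap_ball {a : ℂ} (ha : a ∈ ball (0:ℂ) 1) : diskMap a '' ball 0 1 = ball 0 1 := by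
  refine Subset.antisymm (by rintro _ ⟨z, hz, rfl⟩; exact diskMap_mem_ball ha hz) fun z hz => ?_
  exact ⟨_, diskMap_mem_ball ha hz, diskMap_diskMap ha (ball_subset_closedBall hz)⟩

theorem diskMap_mem_closedBall {a z : ℂ} (ha : a ∈ ball (0:ℂ) 1) (hz : z ∈ closedBall (0:ℂ) 1) :
    diskMap a z ∈ closedBall (0:ℂ) 1 := by
  rw [mem_closedBall_zero_iff] at hz
  rcases hz.lt_or_eq with h | h
  · exact ball_subset_closedBall (diskMap_mem_ball ha (by rwa [mem_ball_zero_iff]))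
  · exact sphere_subset_closedBall (diskMap_mem_sphere ha (by rwa [mem_sphere_zero_iff_norm]))

theorem exists_boundaryMap_comp {f Φ : ℂ → ℂ} (hf : ContinuousOn f (sphere (0:ℂ) 1))
    (hi : InjOn f (sphere (0:ℂ) 1)) {p : ℂ} (h : JordanMap f p Φ)
    (hc : ContinuousOn Φ (closedBall 0 1)) (hΦi : InjOn Φ (closedBall 0 1))
    (hs : Φ '' sphere 0 1 = f '' sphere (0:ℂ) 1) {a : ℂ} (ha : a ∈ ball (0:ℂ) 1) :
    ∃ f' : ℂ → ℂ, (f' = f ∨ f' = fun z => f ((starRingEnd ℂ) z)) ∧ ∃ η : ℝ → ℝ,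
      BoundaryMap f' η (fun z => Φ (diskMap a z)) ∧
      (∫ t in (0:ℝ)..(2 * Real.pi), Function.invFunOn f (sphere 0 1) (Φ (diskMap a (exp (t * I)))) =
          0 →
        ∫ t in (0:ℝ)..(2 * Real.pi), exp (η t * I) = 0) := by
  have hsub := sphere_subset_closedBall (x := (0:ℂ)) (ε := 1)
  have hmem : ∀ z ∈ sphere (0:ℂ) 1, Φ (diskMap a z) ∈ f '' sphere (0:ℂ) 1 := fun z hz => by
    rw [← hs]; exact mem_image_of_mem _ (diskMap_mem_sphere ha hz)
  have hdc : ContinuousOn (diskMap a) (closedBall 0 1) := fun z hz =>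
    (hasDerivAt_diskMap ha hz).continuousAt.continuousWithinAt
  have hcc : ContinuousOn (fun z => Φ (diskMap a z)) (closedBall 0 1) :=
    hc.comp hdc fun z hz => diskMap_mem_closedBall ha hz
  have hii : InjOn (fun z => Φ (diskMap a z)) (closedBall 0 1) := fun z hz w hw e =>
    diskMap_injOn ha hz hw (hΦi (diskMap_mem_closedBall ha hz) (diskMap_mem_closedBall ha hw) e)
  have hgf : ∀ z ∈ sphere (0:ℂ) 1,
      f (Function.invFunOn f (sphere 0 1) (Φ (diskMap a z))) = Φ (diskMap a z) := fun z hz =>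
    Function.invFunOn_eq (hmem z hz)
  have hdd : DifferentiableOn ℂ (fun z => Φ (diskMap a z)) (ball 0 1) := fun z hz =>
    ((h.diff.differentiableAt (isOpen_ball.mem_nhds (diskMap_mem_ball ha hz))).comp z
      (hasDerivAt_diskMap ha (ball_subset_closedBall hz)).differentiableAt).differentiableWithinAt
  obtain ⟨η, hη, he | he⟩ := exists_circleLift
    (g := fun z => Function.invFunOn f (sphere 0 1) (Φ (diskMap a z)))
    ((continuousOn_invFunOn (isCompact_sphere 0 1) hf hi).comp (hcc.mono hsub) hmem)
    (fun z hz w hw e => hii (hsub hz) (hsub hw) (by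
      have e' : Function.invFunOn f (sphere 0 1) (Φ (diskMap a z)) =
        Function.invFunOn f (sphere 0 1) (Φ (diskMap a w)) := e
      show Φ (diskMap a z) = Φ (diskMap a w)
      rw [← hgf z hz, ← hgf w hw, e']))
    (fun z hz => Function.invFunOn_mem (hmem z hz))
  · refine ⟨f, Or.inl rfl, η, ⟨hη, hcc, hdd, hii,
      fun w hw => h.notMem_curve (diskMap_mem_ball ha hw), fun x => ?_⟩, fun h0 => ?_⟩
    · rw [← he, hgf _ (exp_mul_I_mem_sphere x)]
    · simpa only [← he] using h0
  · refine ⟨fun z => f ((starRingEnd ℂ) z), Or.inr rfl, η, ⟨hη, hcc, hdd, hii, fun w hw => ?_,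
      fun x => ?_⟩, fun h0 => ?_⟩
    · rw [image_conj_sphere]
      exact h.notMem_curve (diskMap_mem_ball ha hw)
    · rw [← he, hgf _ (exp_mul_I_mem_sphere x)]
    · simp only [he] at h0
      rw [intervalIntegral.intervalIntegral_conj] at h0
      simpa using h0

theorem exists_boundaryMap {f : ℂ → ℂ} (hf : ContinuousOn f (sphere (0:ℂ) 1))
    (hi : InjOn f (sphere (0:ℂ) 1)) {p : ℂ} (hp : p ∉ f '' sphere (0:ℂ) 1)
    (hb : Bornology.IsBounded (connectedComponentIn (f '' sphere (0:ℂ) 1)ᶜ p)) :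
    ∃ f' : ℂ → ℂ, (f' = f ∨ f' = fun z => f ((starRingEnd ℂ) z)) ∧ ∃ (η : ℝ → ℝ) (Φ : ℂ → ℂ),
      BoundaryMap f' η Φ ∧ Φ '' ball 0 1 = connectedComponentIn (f '' sphere (0:ℂ) 1)ᶜ p ∧
      Φ 0 = p := by
  obtain ⟨Φ, h, hc, hΦi, hs⟩ := exists_closed_riemann_map hf hi hp hb
  have h0 : (0:ℂ) ∈ ball (0:ℂ) 1 := mem_ball_self one_pos
  obtain ⟨f', hf', η, hB, -⟩ := exists_boundaryMap_comp hf hi h hc hΦi hs h0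
  refine ⟨f', hf', η, _, hB, ?_, by simp [h.zero]⟩
  rw [← h.image, ← image_image Φ (diskMap 0), image_diskMap_ball h0]

theorem exists_boundaryMap_mean_zero {f : ℂ → ℂ} (hf : ContinuousOn f (sphere (0:ℂ) 1))
    (hi : InjOn f (sphere (0:ℂ) 1)) {p : ℂ} (hp : p ∉ f '' sphere (0:ℂ) 1)
    (hb : Bornology.IsBounded (connectedComponentIn (f '' sphere (0:ℂ) 1)ᶜ p)) :
    ∃ f' : ℂ → ℂ, (f' = f ∨ f' = fun z => f ((starRingEnd ℂ) z)) ∧ ∃ (η : ℝ → ℝ) (Φ : ℂ → ℂ),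
      BoundaryMap f' η Φ ∧ Φ '' ball 0 1 = connectedComponentIn (f '' sphere (0:ℂ) 1)ᶜ p ∧
      ∫ t in (0:ℝ)..(2 * Real.pi), exp (η t * I) = 0 := by
  obtain ⟨Φ, h, hc, hΦi, hs⟩ := exists_closed_riemann_map hf hi hp hb
  have hsub := sphere_subset_closedBall (x := (0:ℂ)) (ε := 1)
  have hmem : ∀ z ∈ sphere (0:ℂ) 1, Φ z ∈ f '' sphere (0:ℂ) 1 := fun z hz => by
    rw [← hs]; exact mem_image_of_mem _ hz
  have hgf : ∀ z ∈ sphere (0:ℂ) 1, f (Function.invFunOn f (sphere 0 1) (Φ z)) = Φ z := fun z hz =>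
    Function.invFunOn_eq (hmem z hz)
  obtain ⟨a, ha, ha0⟩ := exists_mean_zero
    (g := fun z => Function.invFunOn f (sphere 0 1) (Φ z))
    ((continuousOn_invFunOn (isCompact_sphere 0 1) hf hi).comp (hc.mono hsub) hmem)
    (fun z hz w hw e => hΦi (hsub hz) (hsub hw) (by
      have e' : Function.invFunOn f (sphere 0 1) (Φ z) =
        Function.invFunOn f (sphere 0 1) (Φ w) := e
      rw [← hgf z hz, ← hgf w hw, e']))
    (fun z hz => Function.invFunOn_mem (hmem z hz))
  obtain ⟨f', hf', η, hB, h0⟩ := exists_boundaryMap_comp hf hi h hc hΦi hs ha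
  refine ⟨f', hf', η, _, hB, ?_, h0 ha0⟩
  rw [← h.image, ← image_image Φ (diskMap a), image_diskMap_ball ha]

theorem exp_seven_le : Real.exp 7 ≤ 1097 := by
  rw [show (7:ℝ) = (7:ℕ) * 1 by norm_num, Real.exp_nat_mul]
  calc Real.exp 1 ^ 7 ≤ 2.7182818286 ^ 7 := by gcongr; exact Real.exp_one_lt_d9.le
    _ ≤ 1097 := by norm_num

theorem exp_four_le : Real.exp 4 ≤ 55 := by
  rw [show (4:ℝ) = (4:ℕ) * 1 by norm_num, Real.exp_nat_mul]
  calc Real.exp 1 ^ 4 ≤ 2.7182818286 ^ 4 := by gcongr; exact Real.exp_one_lt_d9.le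
    _ ≤ 55 := by norm_num

theorem exp_natCast_le (n : ℕ) : Real.exp n ≤ 3 ^ n := by
  rw [← mul_one (n : ℝ), Real.exp_nat_mul]
  gcongr
  exact Real.exp_one_lt_three.le

theorem exp_two_pi_le : Real.exp (2 * Real.pi) ≤ 1097 :=
  (Real.exp_le_exp.2 (by linarith [Real.pi_lt_d2])).trans exp_seven_le

theorem le_exp_neg_two_pi : 1 / 1097 ≤ Real.exp (-(2 * Real.pi)) := by
  rw [Real.exp_neg, ← one_div]
  exact one_div_le_one_div_of_le (Real.exp_pos _) exp_two_pi_le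

theorem exp_neg_le_two_thirds {y : ℝ} (hy : 1 / 2 ≤ y) : Real.exp (-y) ≤ 2 / 3 := by
  have h1 := Real.add_one_le_exp (1 / 2 : ℝ)
  refine (Real.exp_le_exp.2 (by linarith : -y ≤ -(1 / 2))).trans ?_
  rw [Real.exp_neg, inv_le_comm₀ (Real.exp_pos _) (by norm_num)]
  linarith

theorem exp_neg_le_three_quarters : Real.exp (-0.3) ≤ 3 / 4 := by
  have h1 := Real.quadratic_le_exp_of_nonneg (x := 0.3) (by norm_num)
  rw [Real.exp_neg, inv_le_comm₀ (Real.exp_pos _) (by norm_num)]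
  linarith

/-- `y * exp (-y) ≤ (1 - exp (-2 * y)) / 2`. -/
theorem two_mul_exp_neg_le {y : ℝ} (hy : 0 ≤ y) :
    2 * (y * Real.exp (-y)) ≤ 1 - Real.exp (-y) ^ 2 := by
  have h := Real.self_le_sinh_iff.2 hy
  rw [Real.sinh_eq] at h
  have h2 : Real.exp y * Real.exp (-y) = 1 := by rw [← Real.exp_add]; simp
  nlinarith [Real.exp_pos (-y)]

theorem one_sub_exp_neg_sq_le (y : ℝ) : 1 - Real.exp (-y) ^ 2 ≤ 2 * y := by
  have h := Real.add_one_le_exp (-y + -y)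
  rw [Real.exp_add] at h
  nlinarith

namespace CircleLift

variable {η : ℝ → ℝ} (h : CircleLift η)

include h

theorem exists_arc_ge : ∃ x₀, Real.pi / 3 ≤ η (x₀ + Real.pi / 6) - η (x₀ - Real.pi / 6) := by
  by_contra! hcon
  have hp := h.period (-(Real.pi / 6))
  have h0 := hcon 0
  have h1 := hcon (Real.pi / 3)
  have h2 := hcon (2 * (Real.pi / 3))
  have h3 := hcon (3 * (Real.pi / 3))
  have h4 := hcon (4 * (Real.pi / 3))
  have h5 := hcon (5 * (Real.pi / 3))
  ring_nf at *
  linarith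

theorem arc_le_two_pi {a b : ℝ} (hab : b ≤ a + 2 * Real.pi) : η b - η a ≤ 2 * Real.pi := by
  have := h.mono.monotone hab
  rw [h.period] at this
  linarith

theorem arc_le_four_pi {a b : ℝ} (hab : b ≤ a + 4 * Real.pi) : η b - η a ≤ 4 * Real.pi := by
  have := h.mono.monotone (hab.trans_eq (by ring : _ = a + 2 * Real.pi + 2 * Real.pi))
  rw [h.period, h.period] at this
  linarith

theorem compl_arc_ge (h0 : ∫ t in (0:ℝ)..(2 * Real.pi), exp (η t * I) = 0) {x₀ r : ℝ}
    (hr : r ≤ Real.pi / 3) : 2 / 3 * Real.pi ≤ 2 * Real.pi - (η (x₀ + r) - η (x₀ - r)) := by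
  have h1 := h.arc_ge h0 (a := x₀ + Real.pi / 3) (b := x₀ - Real.pi / 3 + 2 * Real.pi) (by ring)
  rw [h.period] at h1
  have h2 := h.mono.monotone (show x₀ + r ≤ x₀ + Real.pi / 3 by linarith)
  have h3 := h.mono.monotone (show x₀ - Real.pi / 3 ≤ x₀ - r by linarith)
  linarith

end CircleLift

namespace BoundaryMap

variable {f Φ : ℂ → ℂ} {η : ℝ → ℝ} (h : BoundaryMap f η Φ)

include h

theorem injOn_ball : InjOn Φ (ball 0 1) := h.inj.mono ball_subset_closedBall

theorem mem_of_mem_sphere {w : ℂ} (hw : w ∈ sphere (0:ℂ) 1) : Φ w ∈ f '' sphere 0 1 := by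
  obtain ⟨t, -, rfl⟩ := exists_exp_mul_I_eq hw 0
  rw [h.boundary]
  exact mem_image_of_mem _ (exp_mul_I_mem_sphere _)

theorem isOpen_image : IsOpen (Φ '' ball 0 1) :=
  isOpen_image_of_injOn isOpen_ball h.diff h.injOn_ball

theorem subset_image {S : Set ℂ} (hS : IsPreconnected S) (hd : Disjoint S (f '' sphere 0 1))
    {w : ℂ} (hw : w ∈ ball (0:ℂ) 1) (hwS : Φ w ∈ S) : S ⊆ Φ '' ball 0 1 := by
  have hK : IsClosed (Φ '' closedBall 0 1) :=
    ((isCompact_closedBall 0 1).image_of_continuousOn h.cont).isClosed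
  refine hS.subset_left_of_subset_union h.isOpen_image hK.isOpen_compl ?_ (fun x hx => ?_)
    ⟨_, hwS, mem_image_of_mem _ hw⟩
  · exact disjoint_compl_right.mono_left (image_mono ball_subset_closedBall)
  · by_cases hxK : x ∈ Φ '' closedBall 0 1
    · obtain ⟨v, hv, rfl⟩ := hxK
      rw [← ball_union_sphere] at hv
      rcases hv with hv | hv
      · exact Or.inl (mem_image_of_mem _ hv)
      · exact absurd (h.mem_of_mem_sphere hv) (disjoint_left.1 hd hx)
    · exact Or.inr hxK

theorem exists_nearest (hf : ContinuousOn f (sphere (0:ℂ) 1)) {w : ℂ} (hw : w ∈ ball (0:ℂ) 1) :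
    ∃ q ∈ f '' sphere 0 1, (∀ q' ∈ f '' sphere 0 1, ‖Φ w - q‖ ≤ ‖Φ w - q'‖) ∧ 0 < ‖Φ w - q‖ ∧
      ‖Φ w - q‖ ≤ (1 - ‖w‖ ^ 2) * ‖deriv Φ w‖ := by
  have hne : (f '' sphere (0:ℂ) 1).Nonempty := ⟨_, mem_image_of_mem f (exp_mul_I_mem_sphere 0)⟩
  obtain ⟨q, hq, hqd⟩ := (isCompact_curve hf).exists_infDist_eq_dist hne (Φ w)
  rw [dist_eq_norm] at hqd
  have hmin : ∀ q' ∈ f '' sphere 0 1, ‖Φ w - q‖ ≤ ‖Φ w - q'‖ := fun q' hq' => by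
    rw [← hqd, ← dist_eq_norm]; exact infDist_le_dist_of_mem hq'
  have hpos : 0 < ‖Φ w - q‖ := norm_pos_iff.2 fun e => h.notMem w hw (sub_eq_zero.1 e ▸ hq)
  refine ⟨q, hq, hmin, hpos, radius_le_of_ball_subset_image h.diff h.injOn_ball hw hpos
    (h.subset_image (convex_ball _ _).isPreconnected ?_ hw (mem_ball_self hpos))⟩
  refine disjoint_left.2 fun x hx hxΓ => ?_
  have := hmin x hxΓ
  rw [mem_ball, dist_eq_norm, norm_sub_rev] at hx
  linarith

theorem koebe {w q : ℂ} (hw : w ∈ ball (0:ℂ) 1) (hq : q ∈ f '' sphere 0 1) :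
    (1 - ‖w‖ ^ 2) * ‖deriv Φ w‖ ≤ 7 * ‖Φ w - q‖ :=
  koebe_distortion h.diff h.injOn_ball
    (by rintro ⟨v, hv, rfl⟩; exact h.notMem v hv hq) hw

theorem growth {w q : ℂ} (hw : w ∈ ball (0:ℂ) 1) (hq : q ∈ f '' sphere 0 1) {R C : ℝ}
    (hR : 1 + ‖w‖ ≤ R * (1 - ‖w‖)) (hC0 : 0 ≤ C) (hC : R ^ 7 ≤ C ^ 2) :
    ‖Φ w - q‖ ≤ C * ‖Φ 0 - q‖ ∧ ‖Φ 0 - q‖ ≤ C * ‖Φ w - q‖ := by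
  have hq' : q ∉ Φ '' ball 0 1 := by rintro ⟨v, hv, rfl⟩; exact h.notMem v hv hq
  have hmain := abs_log_norm_sub_le h.diff hq' (fun z hz => h.koebe hz hq) hw
  have hpos : ∀ v ∈ ball (0:ℂ) 1, 0 < ‖Φ v - q‖ := fun v hv =>
    norm_pos_iff.2 fun e => hq' ⟨v, hv, sub_eq_zero.1 e⟩
  have h0 := hpos 0 (mem_ball_self one_pos)
  have h1 := hpos w hw
  have hw1 : 0 < 1 - ‖w‖ := sub_pos.2 (mem_ball_zero_iff.1 hw)
  have hr : (1 + ‖w‖) / (1 - ‖w‖) ≤ R := (div_le_iff₀ hw1).2 hR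
  have hr0 : 0 < (1 + ‖w‖) / (1 - ‖w‖) := div_pos (by positivity) hw1
  have hR0 : 0 < R := hr0.trans_le hr
  have hCpos : 0 < C := by
    refine hC0.lt_of_ne fun e => ?_
    rw [← e] at hC
    have : 0 < R ^ 7 := by positivity
    norm_num at hC
    linarith
  have hl : 7 / 2 * Real.log ((1 + ‖w‖) / (1 - ‖w‖)) ≤ Real.log C := by
    have e1 := Real.log_le_log hr0 hr
    have e2 := Real.log_le_log (by positivity) hC
    rw [Real.log_pow, Real.log_pow] at e2
    push_cast at e2
    linarith
  have hl' := abs_le.1 (hmain.trans hl)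
  constructor
  · rw [← Real.log_le_log_iff h1 (by positivity), Real.log_mul hCpos.ne' h0.ne']
    linarith
  · rw [← Real.log_le_log_iff h0 (by positivity), Real.log_mul hCpos.ne' h1.ne']
    linarith

theorem deriv_comp_exp {z : ℂ} (hz : 0 < z.im) :
    deriv (fun z => Φ (exp (z * I))) z = deriv Φ (exp (z * I)) * (exp (z * I) * I) := by
  have h1 := (h.diff.differentiableAt (isOpen_ball.mem_nhds (exp_mul_I_mem_ball hz))).hasDerivAt
  have h2 : HasDerivAt (fun z : ℂ => exp (z * I)) (exp (z * I) * I) z := by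
    simpa using ((hasDerivAt_id z).mul_const I).cexp
  exact (h1.comp z h2).deriv

theorem norm_deriv_comp_exp {z : ℂ} (hz : 0 < z.im) :
    ‖deriv (fun z => Φ (exp (z * I))) z‖ = ‖deriv Φ (exp (z * I))‖ * Real.exp (-z.im) := by
  rw [h.deriv_comp_exp hz, norm_mul, norm_mul, norm_I, mul_one, norm_exp_mul_I]

theorem im_mul_norm_deriv_le {z q : ℂ} (hz : 0 < z.im) (hq : q ∈ f '' sphere 0 1) :
    z.im * ‖deriv (fun z => Φ (exp (z * I))) z‖ ≤ 7 / 2 * ‖Φ (exp (z * I)) - q‖ := by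
  have h1 := h.koebe (exp_mul_I_mem_ball hz) hq
  have h2 := two_mul_exp_neg_le hz.le
  rw [norm_exp_mul_I] at h1
  rw [h.norm_deriv_comp_exp hz]
  nlinarith [norm_nonneg (deriv Φ (exp (z * I)))]

theorem exp_beurlingAhlfors_ge {z : ℂ} (hz : 0 < z.im) (hz' : z.im ≤ 2 * Real.pi) :
    1 / 1097 ≤ ‖exp (beurlingAhlfors η z * I)‖ ∧ ‖exp (beurlingAhlfors η z * I)‖ ≤ 1 := by
  rw [norm_exp_mul_I]
  have h1 := h.lift.beurlingAhlfors_im_le (z := z) (by rwa [abs_of_pos hz])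
  have h2 := h.lift.beurlingAhlfors_im_pos hz
  exact ⟨le_exp_neg_two_pi.trans (Real.exp_le_exp.2 (by linarith)),
    Real.exp_le_one_iff.2 (by linarith)⟩

theorem eventually_le {L : ℝ} (hL : 0 < L) (hf : ∀ a ∈ sphere (0:ℂ) 1, ∀ b ∈ sphere (0:ℂ) 1,
    ‖f a - f b‖ ≤ L * ‖a - b‖) {z : ℂ} (hz : 0 < z.im) (hz' : z.im ≤ 2 * Real.pi) :
    ∀ᶠ w in 𝓝 z, ‖Φ (exp (w * I)) - Φ (exp (z * I))‖ ≤ 10 ^ 14 * L *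
      ‖exp (beurlingAhlfors η w * I) - exp (beurlingAhlfors η z * I)‖ := by
  have hH := h.halfPlaneMap
  have hκ : ∀ w : ℂ, w.im = z.im → ∀ q ∈ f '' sphere 0 1,
      z.im * ‖deriv (fun z => Φ (exp (z * I))) w‖ ≤ 7 / 2 * ‖Φ (exp (w * I)) - q‖ :=
    fun w hw q hq => by
      rw [← hw]; exact h.im_mul_norm_deriv_le (hw ▸ hz) hq
  have hC : 7 / 2 * Real.exp (7 / 2 + 3 * Real.pi) ≤ 10 ^ 7 := by
    have h1 : Real.exp (7 / 2 + 3 * Real.pi) ≤ Real.exp 13 :=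
      Real.exp_le_exp.2 (by linarith [Real.pi_lt_d2])
    have h2 := exp_natCast_le 13
    norm_num at h2
    linarith
  have hb : ∀ x₁ x₂ : ℝ, x₂ - x₁ = 2 / 3 * z.im → z.re - z.im ≤ x₁ → x₂ ≤ z.re + z.im →
      z.im * ‖deriv (fun z => Φ (exp (z * I))) z‖ ≤ 10 ^ 7 * L * (η x₂ - η x₁) :=
    fun x₁ x₂ h1 h2 h3 => by
      have h12 : x₁ ≤ x₂ := by linarith
      have := hH.deriv_le hL hf (by norm_num) hz hz' hκ h1 (left_mem_Icc.2 h12) h2 h3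
      refine this.trans ?_
      rw [mul_assoc (10 ^ 7)]
      gcongr
      exact mul_nonneg hL.le (sub_nonneg.2 (h.lift.mono.monotone h12))
  filter_upwards [hH.eventually_le (K := beurlingAhlfors η) h.lift.continuous_beurlingAhlfors
    (fun _ _ => rfl) hz hz' (A := 10 ^ 7 * L) (by positivity)
    (hb _ _ (by ring) (by linarith) le_rfl) (hb _ _ (by ring) le_rfl (by linarith))] with w hw
  refine hw.trans ?_
  gcongr
  have h3 := (h.exp_beurlingAhlfors_ge hz hz').1
  rw [div_le_iff₀ (by linarith)]
  nlinarith

theorem norm_deriv_le {L : ℝ} (hL : 0 < L) (hf : ∀ a ∈ sphere (0:ℂ) 1, ∀ b ∈ sphere (0:ℂ) 1,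
    ‖f a - f b‖ ≤ L * ‖a - b‖) {w : ℂ} (hw : ‖w‖ ≤ 1 / 2) : ‖deriv Φ w‖ ≤ 20 * L := by
  have hwb : w ∈ ball (0:ℂ) 1 := by rw [mem_ball_zero_iff]; linarith
  have hq : f 1 ∈ f '' sphere 0 1 := mem_image_of_mem _ (by simp)
  have hmax : ‖Φ w - f 1‖ ≤ L * 2 := by
    refine Complex.norm_le_of_forall_mem_frontier_norm_le (f := fun w => Φ w - f 1)
      (U := ball (0:ℂ) 1) isBounded_ball ⟨h.diff.sub_const _, ?_⟩ (fun v hv => ?_)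
      (subset_closure hwb)
    · rw [closure_ball _ one_ne_zero]
      exact h.cont.sub continuousOn_const
    · rw [frontier_ball _ one_ne_zero] at hv
      obtain ⟨b, hb, hbe⟩ := h.mem_of_mem_sphere hv
      have h1 := hf b hb 1 (by simp)
      simp only [← hbe]
      refine h1.trans (mul_le_mul_of_nonneg_left ?_ hL.le)
      refine (norm_sub_le _ _).trans ?_
      rw [mem_sphere_zero_iff_norm.1 hb, norm_one]; norm_num
  have hk := h.koebe hwb hq
  have : ‖w‖ ^ 2 ≤ 1 / 4 := by nlinarith [norm_nonneg w]
  nlinarith [norm_nonneg (deriv Φ w)]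

end BoundaryMap

namespace BoundaryMap

variable {f Φ : ℂ → ℂ} {η : ℝ → ℝ} (h : BoundaryMap f η Φ)

include h

theorem le_norm_sub_center (h0 : ∫ t in (0:ℝ)..(2 * Real.pi), exp (η t * I) = 0) {ℓ : ℝ}
    (hℓ : 0 ≤ ℓ) (hf : ∀ a ∈ sphere (0:ℂ) 1, ∀ b ∈ sphere (0:ℂ) 1, ℓ * ‖a - b‖ ≤ ‖f a - f b‖)
    {q : ℂ} (hq : q ∈ f '' sphere 0 1) : ℓ ≤ 3 * 10 ^ 5 * ‖Φ 0 - q‖ := by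
  have hπ := Real.pi_pos
  obtain ⟨x₀, hx₀⟩ := h.lift.exists_arc_ge
  have hpos : 0 < ‖Φ 0 - q‖ := norm_pos_iff.2 fun e =>
    h.notMem 0 (mem_ball_self one_pos) (sub_eq_zero.1 e ▸ hq)
  have him : ∀ x : ℝ, ((x:ℂ) + (0.3 : ℝ) * I).im = 0.3 := fun x => by simp
  have hmin := h.halfPlaneMap.min_arc_le hℓ hf (x₀ := x₀) (h₁ := Real.pi / 6) (h₂ := Real.pi / 3)
    (a := 0.3) (ρ := 908 * ‖Φ 0 - q‖) (by positivity) (by linarith) (by linarith) (by norm_num)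
    (by positivity) q fun x _ => by
      have hw := exp_mul_I_mem_ball (z := (x:ℂ) + (0.3 : ℝ) * I) (by rw [him]; norm_num)
      refine (h.growth hw hq (R := 7) ?_ (by norm_num) (by norm_num)).1
      rw [norm_exp_mul_I, him]
      linarith [exp_neg_le_three_quarters]
  have hτ := h.lift.compl_arc_ge h0 (x₀ := x₀) (r := Real.pi / 3) le_rfl
  have h1 : Real.pi / 3 ≤ min (η (x₀ + Real.pi / 6) - η (x₀ - Real.pi / 6))
      (2 * Real.pi - (η (x₀ + Real.pi / 3) - η (x₀ - Real.pi / 3))) :=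
    le_min hx₀ (by linarith)
  have h2 : 2 / 3 ≤ 2 / Real.pi * min (η (x₀ + Real.pi / 6) - η (x₀ - Real.pi / 6))
      (2 * Real.pi - (η (x₀ + Real.pi / 3) - η (x₀ - Real.pi / 3))) := by
    refine le_trans (le_of_eq ?_) (mul_le_mul_of_nonneg_left h1 (by positivity))
    field_simp
  have h3 : Real.exp (2 * Real.pi * 0.3 / (Real.pi / 3 - Real.pi / 6)) ≤ 55 := by
    refine (Real.exp_le_exp.2 ?_).trans exp_four_le
    rw [div_le_iff₀ (by linarith)]
    linarith
  have h4 := mul_le_mul_of_nonneg_left h2 hℓ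
  have h5 := mul_le_mul_of_nonneg_left h3 (by positivity : 0 ≤ 908 * ‖Φ 0 - q‖)
  linarith

theorem le_norm_deriv (h0 : ∫ t in (0:ℝ)..(2 * Real.pi), exp (η t * I) = 0)
    (hfc : ContinuousOn f (sphere (0:ℂ) 1)) {ℓ : ℝ}
    (hℓ : 0 ≤ ℓ) (hf : ∀ a ∈ sphere (0:ℂ) 1, ∀ b ∈ sphere (0:ℂ) 1, ℓ * ‖a - b‖ ≤ ‖f a - f b‖)
    {w : ℂ} (hw : ‖w‖ ≤ 2 / 3) : ℓ ≤ 84 * 10 ^ 6 * ‖deriv Φ w‖ := by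
  have hwb : w ∈ ball (0:ℂ) 1 := by rw [mem_ball_zero_iff]; linarith
  obtain ⟨q, hq, -, -, hd⟩ := h.exists_nearest hfc hwb
  have h1 := h.le_norm_sub_center h0 hℓ hf hq
  have h2 := (h.growth hwb hq (R := 5) (C := 280) (by linarith) (by norm_num) (by norm_num)).2
  have h3 : (1 - ‖w‖ ^ 2) * ‖deriv Φ w‖ ≤ ‖deriv Φ w‖ := by
    nlinarith [norm_nonneg (deriv Φ w), sq_nonneg ‖w‖]
  linarith

theorem arc_le_of_near (h0 : ∫ t in (0:ℝ)..(2 * Real.pi), exp (η t * I) = 0)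
    (hfc : ContinuousOn f (sphere (0:ℂ) 1)) {ℓ : ℝ}
    (hℓ : 0 ≤ ℓ) (hf : ∀ a ∈ sphere (0:ℂ) 1, ∀ b ∈ sphere (0:ℂ) 1, ℓ * ‖a - b‖ ≤ ‖f a - f b‖)
    {z : ℂ} (hz : 0 < z.im) (hz' : z.im ≤ Real.pi / 6) :
    ℓ * (η (z.re + z.im) - η (z.re - z.im)) ≤
      10 ^ 9 * (z.im * ‖deriv (fun z => Φ (exp (z * I))) z‖) := by
  have hπ := Real.pi_pos
  have hπ' := Real.pi_lt_d2
  have hw := exp_mul_I_mem_ball hz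
  obtain ⟨q, hq, -, hpos, hd⟩ := h.exists_nearest hfc hw
  have hzz : (z.re : ℂ) + z.im * I = z := re_add_im z
  have hmin := h.halfPlaneMap.min_arc_le hℓ hf (x₀ := z.re) (h₁ := z.im) (h₂ := 2 * z.im)
    (a := z.im) (ρ := Real.exp 7 * ‖Φ (exp (z * I)) - q‖) hz (by linarith) (by linarith) hz
    (by positivity) q fun x hx => by
      have := h.halfPlaneMap.harnack hq hz (κ := 7 / 2) (fun w hw => by
        rw [← hw]; exact h.im_mul_norm_deriv_le (hw ▸ hz) hq) x z.re
      rw [hzz] at this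
      refine this.trans ?_
      gcongr
      rw [div_le_iff₀ hz]
      linarith
  have hτ := h.lift.compl_arc_ge h0 (x₀ := z.re) (r := 2 * z.im) (by linarith)
  have hS := h.lift.arc_le_two_pi (a := z.re - z.im) (b := z.re + z.im) (by linarith)
  have hS0 : 0 ≤ η (z.re + z.im) - η (z.re - z.im) :=
    sub_nonneg.2 (h.lift.mono.monotone (by linarith))
  have h1 : (η (z.re + z.im) - η (z.re - z.im)) / 3 ≤ min (η (z.re + z.im) - η (z.re - z.im))
      (2 * Real.pi - (η (z.re + 2 * z.im) - η (z.re - 2 * z.im))) :=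
    le_min (by linarith) (by linarith)
  have h2 : 1 / 5 * (η (z.re + z.im) - η (z.re - z.im)) ≤ 2 / Real.pi *
      min (η (z.re + z.im) - η (z.re - z.im))
      (2 * Real.pi - (η (z.re + 2 * z.im) - η (z.re - 2 * z.im))) := by
    refine le_trans ?_ (mul_le_mul_of_nonneg_left h1 (by positivity))
    rw [div_mul_div_comm, le_div_iff₀ (by positivity)]
    nlinarith
  have h3 : Real.exp (2 * Real.pi * z.im / (2 * z.im - z.im)) ≤ 1097 := by
    refine le_trans (le_of_eq ?_) exp_two_pi_le
    congr 1
    field_simp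
    ring
  have h4 : Real.exp 7 * ‖Φ (exp (z * I)) - q‖ *
      Real.exp (2 * Real.pi * z.im / (2 * z.im - z.im)) ≤
      1097 * ‖Φ (exp (z * I)) - q‖ * 1097 := by
    gcongr
    exact exp_seven_le
  have h5 := mul_le_mul_of_nonneg_left h2 hℓ
  have h6 : ‖Φ (exp (z * I)) - q‖ ≤
      6 * (z.im * ‖deriv (fun z => Φ (exp (z * I))) z‖) := by
    rw [h.norm_deriv_comp_exp hz]
    have e1 := one_sub_exp_neg_sq_le z.im
    have e2 : 1 / 3 ≤ Real.exp (-z.im) := by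
      rw [Real.exp_neg, ← one_div]
      refine one_div_le_one_div_of_le (Real.exp_pos _) ?_
      exact (Real.exp_le_exp.2 (by linarith)).trans Real.exp_one_lt_three.le
    rw [norm_exp_mul_I] at hd
    calc _ ≤ _ := hd
      _ ≤ 2 * z.im * ‖deriv Φ (exp (z * I))‖ := by gcongr
      _ = 6 * (z.im * (‖deriv Φ (exp (z * I))‖ * (1 / 3))) := by ring
      _ ≤ _ := by gcongr
  have h7 : 0 ≤ z.im * ‖deriv (fun z => Φ (exp (z * I))) z‖ := by positivity
  linarith

theorem arc_le_of_far (h0 : ∫ t in (0:ℝ)..(2 * Real.pi), exp (η t * I) = 0)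
    (hfc : ContinuousOn f (sphere (0:ℂ) 1)) {ℓ : ℝ}
    (hℓ : 0 ≤ ℓ) (hf : ∀ a ∈ sphere (0:ℂ) 1, ∀ b ∈ sphere (0:ℂ) 1, ℓ * ‖a - b‖ ≤ ‖f a - f b‖)
    {z : ℂ} (hz : Real.pi / 6 ≤ z.im) (hz' : z.im ≤ 2 * Real.pi) :
    ℓ * (η (z.re + z.im) - η (z.re - z.im)) ≤
      24 * 10 ^ 11 * (z.im * ‖deriv (fun z => Φ (exp (z * I))) z‖) := by
  have hπ := Real.pi_gt_three
  have hπ' := Real.pi_lt_d2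
  have hS := h.lift.arc_le_four_pi (a := z.re - z.im) (b := z.re + z.im) (by linarith)
  have hd := h.le_norm_deriv h0 hfc hℓ hf (w := exp (z * I))
    (by rw [norm_exp_mul_I]; exact exp_neg_le_two_thirds (by linarith))
  rw [h.norm_deriv_comp_exp (by linarith)]
  have h1 : 1 / 1097 ≤ Real.exp (-z.im) :=
    le_exp_neg_two_pi.trans (Real.exp_le_exp.2 (by linarith))
  calc ℓ * (η (z.re + z.im) - η (z.re - z.im)) ≤ (84 * 10 ^ 6 * ‖deriv Φ (exp (z * I))‖) * 13 :=
        mul_le_mul hd (by linarith) (sub_nonneg.2 (h.lift.mono.monotone (by linarith)))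
          (by positivity)
    _ ≤ 24 * 10 ^ 11 * (1 / 2 * (‖deriv Φ (exp (z * I))‖ * (1 / 1097))) := by
        nlinarith [norm_nonneg (deriv Φ (exp (z * I)))]
    _ ≤ _ := by gcongr <;> linarith

theorem eventually_ge (h0 : ∫ t in (0:ℝ)..(2 * Real.pi), exp (η t * I) = 0)
    (hfc : ContinuousOn f (sphere (0:ℂ) 1)) {ℓ : ℝ}
    (hℓ : 0 < ℓ) (hf : ∀ a ∈ sphere (0:ℂ) 1, ∀ b ∈ sphere (0:ℂ) 1, ℓ * ‖a - b‖ ≤ ‖f a - f b‖)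
    {z : ℂ} (hz : 0 < z.im) (hz' : z.im ≤ 2 * Real.pi) :
    ∀ᶠ w in 𝓝 z, ℓ * ‖exp (beurlingAhlfors η w * I) - exp (beurlingAhlfors η z * I)‖ ≤
      10 ^ 14 * ‖Φ (exp (w * I)) - Φ (exp (z * I))‖ := by
  have hb : ℓ * (η (z.re + z.im) - η (z.re - z.im)) ≤
      24 * 10 ^ 11 * (z.im * ‖deriv (fun z => Φ (exp (z * I))) z‖) := by
    rcases le_total z.im (Real.pi / 6) with hy | hy
    · refine (h.arc_le_of_near h0 hfc hℓ.le hf hz hy).trans ?_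
      gcongr
      norm_num
    · exact h.arc_le_of_far h0 hfc hℓ.le hf hy hz'
  filter_upwards [h.halfPlaneMap.eventually_ge (K := beurlingAhlfors η)
    h.lift.continuous_beurlingAhlfors (fun _ _ => rfl) hz hz' (B := 24 * 10 ^ 11 / ℓ)
    (by positivity) (by rw [div_mul_eq_mul_div, le_div_iff₀ hℓ]; linarith)] with w hw
  have h1 := (h.exp_beurlingAhlfors_ge hz hz').2
  have h2 := mul_le_mul_of_nonneg_left hw hℓ.le
  refine h2.trans ?_
  rw [show ℓ * (16 * (24 * 10 ^ 11 / ℓ) * ‖exp (beurlingAhlfors η z * I)‖ *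
    ‖Φ (exp (w * I)) - Φ (exp (z * I))‖) = (16 * (24 * 10 ^ 11) * ‖exp (beurlingAhlfors η z * I)‖) *
    ‖Φ (exp (w * I)) - Φ (exp (z * I))‖ by field_simp]
  gcongr
  linarith

end BoundaryMap

namespace CircleLift

variable {η : ℝ → ℝ} (h : CircleLift η)

include h

theorem exists_exp_beurlingAhlfors_eq {ζ : ℂ} (hζ : ζ ≠ 0) :
    ∃ z : ℂ, exp (beurlingAhlfors η z * I) = ζ ∧ (‖ζ‖ < 1 → 0 < z.im) ∧ (‖ζ‖ = 1 → z.im = 0) ∧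
      (Real.exp (-(2 * Real.pi)) ≤ ‖ζ‖ → z.im ≤ 2 * Real.pi) := by
  obtain ⟨G, hG⟩ := h.exists_homeomorph
  obtain ⟨v, -, hv, hve⟩ := exists_exp_mul_I_eq_of_ne_zero hζ 0
  obtain ⟨z, rfl⟩ := G.surjective v
  rw [hG] at hv hve
  have hpos := fun (hz : 0 < z.im) => h.beurlingAhlfors_im_pos hz
  have hneg := fun (hz : z.im < 0) => h.beurlingAhlfors_im_neg hz
  have hreal : z.im = 0 → (beurlingAhlfors η z).im = 0 := fun hz => by
    rw [show z = (z.re : ℂ) from Complex.ext rfl (by simp [hz]), beurlingAhlfors_ofReal, ofReal_im]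
  have hζ0 := norm_pos_iff.2 hζ
  refine ⟨z, hve, fun h1 => ?_, fun h1 => ?_, fun h1 => ?_⟩
  · have := Real.log_neg hζ0 h1
    by_contra! hz
    rcases hz.lt_or_eq with hz | hz
    · linarith [hneg hz]
    · linarith [hreal hz]
  · rw [h1, Real.log_one, neg_zero] at hv
    rcases lt_trichotomy z.im 0 with hz | hz | hz
    · linarith [hneg hz]
    · exact hz
    · linarith [hpos hz]
  · have h2 := (Real.le_log_iff_exp_le hζ0).2 h1
    by_contra! hz
    obtain ⟨c, hc⟩ := h.exists_translation
    have h3 := hc z (hz.le.trans (le_abs_self _))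
    rw [h3] at hv
    simp only [add_im, ofReal_im, add_zero] at hv
    linarith

theorem eventually_exp_beurlingAhlfors {P : ℂ → Prop} {z : ℂ}
    (hP : ∀ᶠ w in 𝓝 z, P (exp (beurlingAhlfors η w * I))) :
    ∀ᶠ ζ in 𝓝 (exp (beurlingAhlfors η z * I)), P ζ := by
  obtain ⟨G, hG⟩ := h.exists_homeomorph
  have ho : IsOpenMap fun w => exp (beurlingAhlfors η w * I) := by
    simp only [← hG]
    exact isOpenMap_exp_mul_I.comp G.isOpenMap
  exact ho.nhds_le z hP

end CircleLift

/-- An extension of `f` to a homeomorphism of the closed disk onto the closure of `U`, locally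
bi-Lipschitz at the points of the open disk. -/
structure InnerExtension (f F : ℂ → ℂ) (U : Set ℂ) : Prop where
  cont : ContinuousOn F (closedBall 0 1)
  inj : InjOn F (closedBall 0 1)
  eqOn : EqOn F f (sphere 0 1)
  image : F '' ball 0 1 = U
  upper : ∀ L : ℝ, 0 < L → (∀ a ∈ sphere (0:ℂ) 1, ∀ b ∈ sphere (0:ℂ) 1,
    ‖f a - f b‖ ≤ L * ‖a - b‖) → ∀ ζ₀ ∈ ball (0:ℂ) 1, ∀ᶠ ζ in 𝓝 ζ₀,
      ‖F ζ - F ζ₀‖ ≤ 10 ^ 14 * L * ‖ζ - ζ₀‖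
  lower : ∀ ℓ : ℝ, 0 < ℓ → (∀ a ∈ sphere (0:ℂ) 1, ∀ b ∈ sphere (0:ℂ) 1,
    ℓ * ‖a - b‖ ≤ ‖f a - f b‖) → ∀ ζ₀ ∈ ball (0:ℂ) 1, ∀ᶠ ζ in 𝓝 ζ₀,
      ℓ * ‖ζ - ζ₀‖ ≤ 10 ^ 14 * ‖F ζ - F ζ₀‖

theorem forall_sphere_conj {P : ℂ → ℂ → Prop} (hP : ∀ a ∈ sphere (0:ℂ) 1, ∀ b ∈ sphere (0:ℂ) 1,
    P a b) :
    ∀ a ∈ sphere (0:ℂ) 1, ∀ b ∈ sphere (0:ℂ) 1, P ((starRingEnd ℂ) a) ((starRingEnd ℂ) b) :=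
  fun _ ha _ hb => hP _ (conj_mem_sphere ha) _ (conj_mem_sphere hb)

theorem norm_conj_sub_conj (a b : ℂ) : ‖(starRingEnd ℂ) a - (starRingEnd ℂ) b‖ = ‖a - b‖ := by
  rw [← map_sub, norm_conj]

theorem eventually_conj {P : ℂ → Prop} {ζ : ℂ} (hP : ∀ᶠ w in 𝓝 ((starRingEnd ℂ) ζ), P w) :
    ∀ᶠ w in 𝓝 ζ, P ((starRingEnd ℂ) w) :=
  continuous_conj.continuousAt.eventually hP

theorem InnerExtension.comp_conj {f F : ℂ → ℂ} {U : Set ℂ}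
    (h : InnerExtension (fun z => f ((starRingEnd ℂ) z)) F U) :
    InnerExtension f (fun z => F ((starRingEnd ℂ) z)) U where
  cont := h.cont.comp continuous_conj.continuousOn fun z hz => by simpa using hz
  inj z hz w hw e := (starRingEnd ℂ).injective
    (h.inj (by simpa using hz) (by simpa using hw) e)
  eqOn z hz := by simpa using h.eqOn (conj_mem_sphere hz)
  image := by
    rw [← h.image]
    ext w
    constructor
    · rintro ⟨z, hz, rfl⟩
      exact ⟨_, by simpa using hz, rfl⟩
    · rintro ⟨z, hz, rfl⟩
      exact ⟨(starRingEnd ℂ) z, by simpa using hz, by simp⟩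
  upper L hL hf ζ₀ hζ₀ := by
    filter_upwards [eventually_conj (h.upper L hL (fun a ha b hb => by
      simpa only [norm_conj_sub_conj] using forall_sphere_conj hf a ha b hb)
      ((starRingEnd ℂ) ζ₀) (by simpa using hζ₀))] with ζ hζ
    simpa only [norm_conj_sub_conj] using hζ
  lower ℓ hℓ hf ζ₀ hζ₀ := by
    filter_upwards [eventually_conj (h.lower ℓ hℓ (fun a ha b hb => by
      simpa only [norm_conj_sub_conj] using forall_sphere_conj hf a ha b hb)
      ((starRingEnd ℂ) ζ₀) (by simpa using hζ₀))] with ζ hζ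
    simpa only [norm_conj_sub_conj] using hζ

theorem BoundaryMap.exists_innerExtension {f Φ : ℂ → ℂ} {η : ℝ → ℝ} (h : BoundaryMap f η Φ)
    (h0 : ∫ t in (0:ℝ)..(2 * Real.pi), exp (η t * I) = 0)
    (hfc : ContinuousOn f (sphere (0:ℂ) 1)) : ∃ F, InnerExtension f F (Φ '' ball 0 1) := by
  obtain ⟨H, hHc, hHi, hH0, hHe, hH1, hH2, u, hu, hHu⟩ := h.lift.exists_descent
  have hmaps : MapsTo H (closedBall 0 1) (closedBall 0 1) := fun ζ hζ => by
    rw [mem_closedBall_zero_iff] at hζ ⊢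
    exact hH1 ζ hζ
  have hsmall : ∀ ζ₀ : ℂ, ‖ζ₀‖ < Real.exp (-(2 * Real.pi)) → ‖u * ζ₀‖ ≤ 1 / 2 ∧
      ∃ d ≠ 0, ‖d‖ = ‖deriv Φ (u * ζ₀)‖ ∧ HasDerivAt (fun ζ => Φ (H ζ)) d ζ₀ := fun ζ₀ hζ₀ => by
    have hle : ‖u * ζ₀‖ ≤ 1 / 2 := by
      rw [norm_mul, hu, one_mul]
      have h2 : Real.exp (-(2 * Real.pi)) ≤ Real.exp (-1) :=
        Real.exp_le_exp.2 (by linarith [Real.pi_gt_three])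
      have h3 := Real.exp_neg_one_lt_d9
      linarith
    have hb : u * ζ₀ ∈ ball (0:ℂ) 1 := by rw [mem_ball_zero_iff]; linarith
    have hd := (h.diff.differentiableAt (isOpen_ball.mem_nhds hb)).hasDerivAt
    have hd2 : HasDerivAt (fun ζ => Φ (u * ζ)) (deriv Φ (u * ζ₀) * u) ζ₀ := by
      refine hd.comp ζ₀ ?_
      simpa using (hasDerivAt_id ζ₀).const_mul u
    refine ⟨hle, deriv Φ (u * ζ₀) * u, mul_ne_zero
      (deriv_ne_zero_of_injOn isOpen_ball h.diff h.injOn_ball hb) (norm_pos_iff.1 (hu ▸ one_pos)),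
      by rw [norm_mul, hu, mul_one], hd2.congr_of_eventuallyEq ?_⟩
    filter_upwards [(isOpen_lt continuous_norm continuous_const).mem_nhds hζ₀] with ζ hζ
    rw [hHu ζ (le_of_lt hζ)]
  have hbig : ∀ ζ₀ ∈ ball (0:ℂ) 1, Real.exp (-(2 * Real.pi)) ≤ ‖ζ₀‖ →
      ∃ z : ℂ, 0 < z.im ∧ z.im ≤ 2 * Real.pi ∧ exp (beurlingAhlfors η z * I) = ζ₀ :=
    fun ζ₀ hζ₀ hζ₀' => by
      obtain ⟨z, hz, hz1, -, hz2⟩ := h.lift.exists_exp_beurlingAhlfors_eq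
        (norm_pos_iff.1 ((Real.exp_pos _).trans_le hζ₀'))
      exact ⟨z, hz1 (mem_ball_zero_iff.1 hζ₀), hz2 hζ₀', hz⟩
  refine ⟨fun ζ => Φ (H ζ), h.cont.comp hHc.continuousOn hmaps,
    fun z hz w hw e => hHi (h.inj (hmaps hz) (hmaps hw) e), fun ζ hζ => ?_, ?_,
    fun L hL hf ζ₀ hζ₀ => ?_, fun ℓ hℓ hf ζ₀ hζ₀ => ?_⟩
  · rw [mem_sphere_zero_iff_norm] at hζ
    obtain ⟨z, rfl, -, hz, -⟩ := h.lift.exists_exp_beurlingAhlfors_eq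
      (norm_pos_iff.1 (hζ ▸ one_pos))
    have hz' : z = (z.re : ℂ) := Complex.ext rfl (by simp [hz hζ])
    simp only [hHe]
    rw [hz', CircleLift.beurlingAhlfors_ofReal, h.boundary]
  · ext w
    constructor
    · rintro ⟨ζ, hζ, rfl⟩
      exact ⟨H ζ, mem_ball_zero_iff.2 (hH2 ζ (mem_ball_zero_iff.1 hζ)), rfl⟩
    · rintro ⟨v, hv, rfl⟩
      rcases eq_or_ne v 0 with rfl | hv0
      · exact ⟨0, mem_ball_self one_pos, by simp [hH0]⟩
      · obtain ⟨z, -, hz, rfl⟩ := exists_exp_mul_I_eq_of_ne_zero hv0 0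
        have hz0 : 0 < z.im := by
          rw [hz]
          exact neg_pos.2 (Real.log_neg (norm_pos_iff.2 hv0) (mem_ball_zero_iff.1 hv))
        exact ⟨_, exp_mul_I_mem_ball (h.lift.beurlingAhlfors_im_pos hz0), by simp only [hHe]⟩
  · rcases lt_or_ge ‖ζ₀‖ (Real.exp (-(2 * Real.pi))) with hs | hs
    · obtain ⟨hle, d, hd0, hd, hder⟩ := hsmall ζ₀ hs
      filter_upwards [eventually_norm_sub_of_hasDerivAt hder hd0] with ζ hζ
      refine hζ.2.trans (mul_le_mul_of_nonneg_right ?_ (norm_nonneg _))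
      rw [hd]
      linarith [h.norm_deriv_le hL hf hle]
    · obtain ⟨z, hz, hz', rfl⟩ := hbig ζ₀ hζ₀ hs
      refine h.lift.eventually_exp_beurlingAhlfors ?_
      filter_upwards [h.eventually_le hL hf hz hz'] with w hw
      simpa only [hHe] using hw
  · rcases lt_or_ge ‖ζ₀‖ (Real.exp (-(2 * Real.pi))) with hs | hs
    · obtain ⟨hle, d, hd0, hd, hder⟩ := hsmall ζ₀ hs
      filter_upwards [eventually_norm_sub_of_hasDerivAt hder hd0] with ζ hζ
      have h1 := h.le_norm_deriv h0 hfc hℓ.le hf (w := u * ζ₀) (by linarith)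
      rw [← hd] at h1
      have h2 := mul_le_mul_of_nonneg_right h1 (norm_nonneg (ζ - ζ₀))
      have h3 := hζ.1
      have h4 := norm_nonneg (Φ (H ζ) - Φ (H ζ₀))
      nlinarith
    · obtain ⟨z, hz, hz', rfl⟩ := hbig ζ₀ hζ₀ hs
      refine h.lift.eventually_exp_beurlingAhlfors ?_
      filter_upwards [h.eventually_ge h0 hfc hℓ hf hz hz'] with w hw
      simpa only [hHe] using hw

theorem exists_innerExtension {f : ℂ → ℂ} (hf : ContinuousOn f (sphere (0:ℂ) 1))
    (hi : InjOn f (sphere (0:ℂ) 1)) {p : ℂ} (hp : p ∉ f '' sphere (0:ℂ) 1)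
    (hb : Bornology.IsBounded (connectedComponentIn (f '' sphere (0:ℂ) 1)ᶜ p)) :
    ∃ F, InnerExtension f F (connectedComponentIn (f '' sphere (0:ℂ) 1)ᶜ p) := by
  obtain ⟨f', hf', η, Φ, h, hΦ, h0⟩ := exists_boundaryMap_mean_zero hf hi hp hb
  rw [← hΦ]
  rcases hf' with rfl | rfl
  · exact h.exists_innerExtension h0 hf
  · obtain ⟨F, hF⟩ := h.exists_innerExtension h0
      (hf.comp continuous_conj.continuousOn fun z hz => conj_mem_sphere hz)
    exact ⟨_, hF.comp_conj⟩

/-- A boundary map for the inversion of `f` at the point `p`, sending the center to the image of the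
point at infinity; `D` is the largest distance from `p` to the curve. -/
structure OuterMap (f : ℂ → ℂ) (p : ℂ) (D : ℝ) (η : ℝ → ℝ) (Ψ : ℂ → ℂ) : Prop where
  map : BoundaryMap (fun z => (f z - p)⁻¹) η Ψ
  zero : Ψ 0 = 0
  cont : ContinuousOn f (sphere 0 1)
  notMem : p ∉ f '' sphere 0 1
  attained : ∃ γ ∈ f '' sphere 0 1, ‖γ - p‖ = D
  le : ∀ γ ∈ f '' sphere 0 1, ‖γ - p‖ ≤ D

namespace OuterMap

variable {f Ψ : ℂ → ℂ} {p : ℂ} {D : ℝ} {η : ℝ → ℝ} (h : OuterMap f p D η Ψ)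

include h

theorem sub_ne_zero {γ : ℂ} (hγ : γ ∈ f '' sphere 0 1) : γ - p ≠ 0 := fun e =>
  h.notMem (sub_eq_zero.1 e ▸ hγ)

omit h in
theorem inv_mem {γ : ℂ} (hγ : γ ∈ f '' sphere 0 1) :
    (γ - p)⁻¹ ∈ (fun z => (f z - p)⁻¹) '' sphere 0 1 := by
  obtain ⟨z, hz, rfl⟩ := hγ
  exact ⟨z, hz, rfl⟩

theorem cont_inv : ContinuousOn (fun z => (f z - p)⁻¹) (sphere 0 1) :=
  (h.cont.sub continuousOn_const).inv₀ fun _ hz => h.sub_ne_zero (mem_image_of_mem f hz)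

theorem pos : 0 < D := by
  obtain ⟨γ, hγ, rfl⟩ := h.attained
  exact norm_pos_iff.2 (h.sub_ne_zero hγ)

theorem ne_zero {w : ℂ} (hw : w ∈ closedBall (0:ℂ) 1) (hw0 : w ≠ 0) : Ψ w ≠ 0 := fun e =>
  hw0 (h.map.inj hw (mem_closedBall_self zero_le_one) (e.trans h.zero.symm))

theorem halfPlaneMap : HalfPlaneMap f η (fun z => p + (Ψ (exp (z * I)))⁻¹) where
  lift := h.map.lift
  cont := continuousOn_const.add (h.map.halfPlaneMap.cont.inv₀ fun z hz =>
    h.ne_zero (exp_mul_I_mem_closedBall hz) (Complex.exp_ne_zero _))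
  diff := (differentiableOn_const _).add (h.map.halfPlaneMap.diff.inv fun z hz =>
    h.ne_zero (exp_mul_I_mem_closedBall (le_of_lt hz)) (Complex.exp_ne_zero _))
  inj z w hz hw hzw e := h.map.halfPlaneMap.inj z w hz hw hzw (inv_injective (add_left_cancel e))
  notMem z hz := by
    rintro ⟨a, ha, hae⟩
    refine h.map.halfPlaneMap.notMem z hz ⟨a, ha, ?_⟩
    simp only [hae, add_sub_cancel_left, inv_inv]
  boundary x := by
    rw [h.map.boundary, inv_inv, add_sub_cancel]

theorem norm_deriv {z : ℂ} (hz : 0 < z.im) :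
    ‖deriv (fun z => p + (Ψ (exp (z * I)))⁻¹) z‖ =
      ‖deriv Ψ (exp (z * I))‖ * Real.exp (-z.im) / ‖Ψ (exp (z * I))‖ ^ 2 := by
  have hd := h.map.halfPlaneMap.hasDerivAt hz
  have hne := h.ne_zero (exp_mul_I_mem_closedBall hz.le) (Complex.exp_ne_zero (z * I))
  rw [((hd.fun_inv hne).const_add p).deriv, norm_div, norm_neg, norm_pow,
    h.map.norm_deriv_comp_exp hz]

theorem growth {w γ : ℂ} (hw : ‖w‖ ≤ 2 / 3) (hγ : γ ∈ f '' sphere 0 1) :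
    ‖Ψ w - (γ - p)⁻¹‖ ≤ 280 * ‖γ - p‖⁻¹ ∧ ‖γ - p‖⁻¹ ≤ 280 * ‖Ψ w - (γ - p)⁻¹‖ := by
  have hwb : w ∈ ball (0:ℂ) 1 := by rw [mem_ball_zero_iff]; linarith
  have := h.map.growth hwb (OuterMap.inv_mem hγ) (R := 5) (C := 280) (by linarith) (by norm_num)
    (by norm_num)
  rwa [h.zero, zero_sub, norm_neg, norm_inv] at this

theorem one_le_norm_deriv {w : ℂ} (hw : ‖w‖ ≤ 2 / 3) : 1 ≤ 280 * (D * ‖deriv Ψ w‖) := by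
  have hwb : w ∈ ball (0:ℂ) 1 := by rw [mem_ball_zero_iff]; linarith
  obtain ⟨_, ⟨a, ha, rfl⟩, -, -, hd⟩ := h.map.exists_nearest h.cont_inv hwb
  have hγ := mem_image_of_mem f ha
  have h1 := (h.growth hw hγ).2
  have h2 : D⁻¹ ≤ ‖f a - p‖⁻¹ :=
    inv_anti₀ (norm_pos_iff.2 (h.sub_ne_zero hγ)) (h.le _ hγ)
  have h3 : (1 - ‖w‖ ^ 2) * ‖deriv Ψ w‖ ≤ ‖deriv Ψ w‖ := by
    nlinarith [norm_nonneg (deriv Ψ w), sq_nonneg ‖w‖]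
  have h4 : D⁻¹ ≤ 280 * ‖deriv Ψ w‖ := by linarith
  rw [inv_le_iff_one_le_mul₀ h.pos] at h4
  linarith

theorem norm_deriv_map_le {w : ℂ} (hw : ‖w‖ ≤ 2 / 3) : D * ‖deriv Ψ w‖ ≤ 3528 := by
  have hwb : w ∈ ball (0:ℂ) 1 := by rw [mem_ball_zero_iff]; linarith
  obtain ⟨γ, hγ, hγD⟩ := h.attained
  have h1 := (h.growth hw hγ).1
  have h2 := h.map.koebe hwb (OuterMap.inv_mem hγ)
  rw [hγD] at h1
  have h3 : 5 / 9 * ‖deriv Ψ w‖ ≤ (1 - ‖w‖ ^ 2) * ‖deriv Ψ w‖ := by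
    gcongr
    nlinarith [norm_nonneg w]
  have h4 : ‖deriv Ψ w‖ ≤ 3528 * D⁻¹ := by linarith
  rw [← div_eq_mul_inv, le_div_iff₀ h.pos] at h4
  linarith

theorem norm_map_le {w : ℂ} (hw : ‖w‖ ≤ 2 / 3) : D * ‖Ψ w‖ ≤ 3528 * ‖w‖ := by
  have hsub : closedBall (0:ℂ) (2 / 3) ⊆ ball 0 1 := closedBall_subset_ball (by norm_num)
  have := (convex_closedBall (0:ℂ) (2 / 3)).norm_image_sub_le_of_norm_deriv_le (f := Ψ)
    (C := 3528 / D) (fun x hx => h.map.diff.differentiableAt (isOpen_ball.mem_nhds (hsub hx)))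
    (fun x hx => by
      rw [le_div_iff₀ h.pos, mul_comm]
      exact h.norm_deriv_map_le (by simpa using hx))
    (mem_closedBall_self (by norm_num)) (by simpa using hw)
  rw [h.zero, sub_zero, sub_zero, div_mul_eq_mul_div, le_div_iff₀ h.pos] at this
  linarith

theorem ball_subset_image : ball 0 D⁻¹ ⊆ Ψ '' ball 0 1 := by
  have hD := inv_pos.2 h.pos
  refine h.map.subset_image (convex_ball _ _).isPreconnected (disjoint_left.2 ?_)
    (mem_ball_self one_pos) (by rw [h.zero]; exact mem_ball_self hD)
  rintro _ hx ⟨a, ha, rfl⟩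
  have hγ := mem_image_of_mem f ha
  have h2 : D⁻¹ ≤ ‖f a - p‖⁻¹ :=
    inv_anti₀ (norm_pos_iff.2 (h.sub_ne_zero hγ)) (h.le _ hγ)
  rw [mem_ball_zero_iff, norm_inv] at hx
  linarith

theorem norm_le_norm_map {w : ℂ} (hw : w ∈ ball (0:ℂ) 1) : ‖w‖ ≤ D * ‖Ψ w‖ := by
  have hD := inv_pos.2 h.pos
  rcases lt_or_ge ‖Ψ w‖ D⁻¹ with hs | hs
  · have hi := h.map.injOn_ball
    have hg : DifferentiableOn ℂ (Function.invFunOn Ψ (ball 0 1)) (ball 0 D⁻¹) :=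
      (differentiableOn_invFunOn isOpen_ball h.map.diff hi).mono h.ball_subset_image
    have hg0 : Function.invFunOn Ψ (ball 0 1) 0 = 0 := by
      have := invFunOn_apply hi (mem_ball_self one_pos)
      rwa [h.zero] at this
    have := dist_le_div_mul_dist_of_mapsTo_ball hg (c := 0) (R₂ := 1) (z := Ψ w) (fun v hv => by
      rw [hg0]
      exact ball_subset_closedBall (Function.invFunOn_mem (h.ball_subset_image hv)))
          (by simpa using hs)
    rw [hg0, invFunOn_apply hi hw, dist_zero_right, dist_zero_right] at this
    simpa using this
  · have h1 := mul_le_mul_of_nonneg_left hs h.pos.le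
    rw [mul_inv_cancel₀ h.pos.ne'] at h1
    exact (mem_ball_zero_iff.1 hw).le.trans h1

theorem norm_map_le_of_forall {M : ℝ} (hM : ∀ γ ∈ f '' sphere 0 1, ‖γ - p‖⁻¹ ≤ M) {w : ℂ}
    (hw : w ∈ ball (0:ℂ) 1) : ‖Ψ w‖ ≤ M := by
  refine Complex.norm_le_of_forall_mem_frontier_norm_le (U := ball (0:ℂ) 1) isBounded_ball
    ⟨h.map.diff, by rw [closure_ball _ one_ne_zero]; exact h.map.cont⟩ (fun v hv => ?_)
    (subset_closure hw)
  rw [frontier_ball _ one_ne_zero] at hv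
  obtain ⟨a, ha, hae⟩ := h.map.mem_of_mem_sphere hv
  rw [← hae, norm_inv]
  exact hM _ (mem_image_of_mem f ha)

theorem norm_add_inv_sub {w γ : ℂ} (hw : w ∈ closedBall (0:ℂ) 1) (hw0 : w ≠ 0)
    (hγ : γ ∈ f '' sphere 0 1) :
    ‖p + (Ψ w)⁻¹ - γ‖ = ‖Ψ w - (γ - p)⁻¹‖ * ‖Ψ w‖⁻¹ * ‖γ - p‖ := by
  have h1 := h.ne_zero hw hw0
  have h2 := h.sub_ne_zero hγ
  rw [← norm_inv, ← norm_mul, ← norm_mul, ← norm_neg]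
  congr 1
  field_simp
  ring

/-- The distance from a point outside the curve to the curve is controlled by the conformal
radius. -/
theorem exists_near_curve {z : ℂ} (hz : 0 < z.im) (hz' : z.im ≤ 1) :
    ∃ γ ∈ f '' sphere 0 1, 0 < ‖p + (Ψ (exp (z * I)))⁻¹ - γ‖ ∧ ‖p + (Ψ (exp (z * I)))⁻¹ - γ‖ ≤
      18 * (z.im * ‖deriv (fun z => p + (Ψ (exp (z * I)))⁻¹) z‖) := by
  have hne : (f '' sphere (0:ℂ) 1).Nonempty := ⟨_, mem_image_of_mem f (exp_mul_I_mem_sphere 0)⟩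
  have hw := exp_mul_I_mem_ball hz
  have hwc := ball_subset_closedBall hw
  have hw0 := Complex.exp_ne_zero (z * I)
  set w := exp (z * I) with hwdef
  obtain ⟨γ, hγ, hγd⟩ := (isCompact_curve h.cont).exists_infDist_eq_dist hne (p + (Ψ w)⁻¹)
  obtain ⟨γ₂, hγ₂, hγd₂⟩ := (isCompact_curve h.cont).exists_infDist_eq_dist hne p
  have hmin : ∀ γ' ∈ f '' sphere 0 1, ‖p + (Ψ w)⁻¹ - γ‖ ≤ ‖p + (Ψ w)⁻¹ - γ'‖ := fun γ' hγ' => by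
    rw [← dist_eq_norm, ← dist_eq_norm, ← hγd]; exact infDist_le_dist_of_mem hγ'
  have hmin₂ : ∀ γ' ∈ f '' sphere 0 1, ‖γ₂ - p‖ ≤ ‖γ' - p‖ := fun γ' hγ' => by
    rw [norm_sub_rev, norm_sub_rev γ', ← dist_eq_norm, ← dist_eq_norm, ← hγd₂]
    exact infDist_le_dist_of_mem hγ'
  have hpos₂ := norm_pos_iff.2 (h.sub_ne_zero hγ₂)
  have hΨ := norm_pos_iff.2 (h.ne_zero hwc hw0)
  have hV : ‖γ₂ - p‖ ≤ ‖Ψ w‖⁻¹ := by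
    rw [← inv_le_inv₀ (inv_pos.2 hΨ) hpos₂, inv_inv]
    exact h.norm_map_le_of_forall (fun γ' hγ' => inv_anti₀ hpos₂ (hmin₂ γ' hγ')) hw
  have hd0 : ‖p + (Ψ w)⁻¹ - γ‖ ≤ 2 * ‖Ψ w‖⁻¹ := by
    refine (hmin γ₂ hγ₂).trans ?_
    rw [show p + (Ψ w)⁻¹ - γ₂ = (Ψ w)⁻¹ - (γ₂ - p) by ring]
    refine (norm_sub_le _ _).trans ?_
    rw [norm_inv]
    linarith
  refine ⟨γ, hγ, norm_pos_iff.2 fun e => h.halfPlaneMap.notMem z hz (by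
    rw [← hwdef, sub_eq_zero.1 e]; exact hγ), ?_⟩
  obtain ⟨_, ⟨a, ha, rfl⟩, -, -, hd⟩ := h.map.exists_nearest h.cont_inv hw
  have hγ₃ := mem_image_of_mem f ha
  have e1 := h.norm_add_inv_sub hwc hw0 hγ₃
  have e2 := hmin _ hγ₃
  have e3 := norm_pos_iff.2 (h.sub_ne_zero hγ₃)
  have e4 : ‖f a - p‖ ≤ ‖p + (Ψ w)⁻¹ - f a‖ + ‖Ψ w‖⁻¹ := by
    rw [show f a - p = (Ψ w)⁻¹ - (p + (Ψ w)⁻¹ - f a) by ring, ← norm_inv]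
    linarith [norm_sub_le (Ψ w)⁻¹ (p + (Ψ w)⁻¹ - f a)]
  have e5 : ‖p + (Ψ w)⁻¹ - γ‖ ≤ 3 * (‖Ψ w - (f a - p)⁻¹‖ * ‖Ψ w‖⁻¹ ^ 2) := by
    set V := ‖Ψ w‖⁻¹ with hVdef
    have hVp : 0 < V := inv_pos.2 hΨ
    set s := ‖Ψ w - (f a - p)⁻¹‖
    rcases le_total ‖f a - p‖ (3 * V) with hc | hc
    · calc _ ≤ _ := e2
        _ = s * V * ‖f a - p‖ := e1
        _ ≤ s * V * (3 * V) := by gcongr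
        _ = _ := by ring
    · have e6 : 2 / 3 * ‖f a - p‖ ≤ s * V * ‖f a - p‖ := by rw [← e1]; linarith
      have e7 : 2 / 3 ≤ s * V := le_of_mul_le_mul_right e6 e3
      nlinarith
  refine e5.trans ?_
  have e6 : ‖Ψ w - (f a - p)⁻¹‖ ≤ 2 * z.im * ‖deriv Ψ w‖ := by
    refine hd.trans ?_
    gcongr
    rw [hwdef, norm_exp_mul_I]
    exact one_sub_exp_neg_sq_le _
  have e7 : 1 / 3 ≤ Real.exp (-z.im) := by
    rw [Real.exp_neg, ← one_div]
    refine one_div_le_one_div_of_le (Real.exp_pos _) ?_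
    exact (Real.exp_le_exp.2 hz').trans Real.exp_one_lt_three.le
  rw [h.norm_deriv hz, ← hwdef]
  calc 3 * (‖Ψ w - (f a - p)⁻¹‖ * ‖Ψ w‖⁻¹ ^ 2)
      ≤ 3 * (2 * z.im * ‖deriv Ψ w‖ * ‖Ψ w‖⁻¹ ^ 2) := by gcongr
    _ = 18 * (z.im * (‖deriv Ψ w‖ * (1 / 3) / ‖Ψ w‖ ^ 2)) := by
        rw [inv_pow, ← div_eq_mul_inv]; ring
    _ ≤ _ := by gcongr

end OuterMap

theorem exp_conj_mul_I (z : ℂ) :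
    exp ((starRingEnd ℂ) z * I) = ((starRingEnd ℂ) (exp (z * I)))⁻¹ := by
  rw [← exp_conj, map_mul, conj_I, mul_neg, exp_neg, inv_inv]

namespace OuterMap

variable {f Ψ : ℂ → ℂ} {p : ℂ} {D : ℝ} {η : ℝ → ℝ} (h : OuterMap f p D η Ψ)

include h

theorem le_radius {ℓ : ℝ}
    (hf : ∀ a ∈ sphere (0:ℂ) 1, ∀ b ∈ sphere (0:ℂ) 1, ℓ * ‖a - b‖ ≤ ‖f a - f b‖) : ℓ ≤ D := by
  have h1 : (1:ℂ) ∈ sphere (0:ℂ) 1 := by simp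
  have h2 : (-1:ℂ) ∈ sphere (0:ℂ) 1 := by simp
  have h3 := hf 1 h1 (-1) h2
  rw [show ‖(1:ℂ) - -1‖ = 2 by norm_num] at h3
  have h4 := h.le _ (mem_image_of_mem f h1)
  have h5 := h.le _ (mem_image_of_mem f h2)
  have h6 := norm_sub_le (f 1 - p) (f (-1) - p)
  rw [sub_sub_sub_cancel_right] at h6
  linarith

theorem radius_le_norm_deriv {w : ℂ} (hw : ‖w‖ ≤ 2 / 3) (hw0 : w ≠ 0) :
    D ≤ 35 * 10 ^ 8 * (‖deriv Ψ w‖ * ‖w‖ ^ 2 / ‖Ψ w‖ ^ 2) := by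
  have hwb : w ∈ ball (0:ℂ) 1 := by rw [mem_ball_zero_iff]; linarith
  have hΨ := norm_pos_iff.2 (h.ne_zero (ball_subset_closedBall hwb) hw0)
  have hD := h.pos
  have h1 := h.one_le_norm_deriv hw
  have h2 := h.norm_map_le hw
  have h3 : (D * ‖Ψ w‖) ^ 2 ≤ (3528 * ‖w‖) ^ 2 := by gcongr
  rw [← mul_div_assoc, le_div_iff₀ (by positivity)]
  have h4 : D * ‖Ψ w‖ ^ 2 ≤ 280 * (D * ‖deriv Ψ w‖) * (D * ‖Ψ w‖ ^ 2) :=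
    le_mul_of_one_le_left (by positivity) h1
  have h5 := mul_le_mul_of_nonneg_left h3 (by positivity : 0 ≤ 280 * ‖deriv Ψ w‖)
  have h6 : 0 ≤ ‖deriv Ψ w‖ * ‖w‖ ^ 2 := by positivity
  linarith

theorem norm_deriv_le_radius {w : ℂ} (hw : ‖w‖ ≤ 2 / 3) (hw0 : w ≠ 0) :
    ‖deriv Ψ w‖ * ‖w‖ ^ 2 / ‖Ψ w‖ ^ 2 ≤ 3528 * D := by
  have hwb : w ∈ ball (0:ℂ) 1 := by rw [mem_ball_zero_iff]; linarith
  have hΨ := norm_pos_iff.2 (h.ne_zero (ball_subset_closedBall hwb) hw0)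
  have hD := h.pos
  have h1 := h.norm_deriv_map_le hw
  have h2 := h.norm_le_norm_map hwb
  rw [div_le_iff₀ (by positivity)]
  calc ‖deriv Ψ w‖ * ‖w‖ ^ 2 ≤ ‖deriv Ψ w‖ * (D * ‖Ψ w‖) ^ 2 := by gcongr
    _ = D * ‖deriv Ψ w‖ * (D * ‖Ψ w‖ ^ 2) := by ring
    _ ≤ 3528 * (D * ‖Ψ w‖ ^ 2) := by gcongr
    _ = _ := by ring

theorem radius_le_compl_arc {L : ℝ} (hL : 0 < L)
    (hf : ∀ a ∈ sphere (0:ℂ) 1, ∀ b ∈ sphere (0:ℂ) 1, ‖f a - f b‖ ≤ L * ‖a - b‖) {x₀ r : ℝ}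
    (hr : 0 ≤ r) (hr' : r ≤ Real.pi / 3) :
    D ≤ 3 * 10 ^ 6 * (L * (2 * Real.pi - (η (x₀ + r) - η (x₀ - r)))) := by
  have hπ := Real.pi_pos
  have hD := h.pos
  have hx : x₀ + r < x₀ - r + 2 * Real.pi := by linarith
  have hτ := sub_pos.2 (h.map.lift.mono hx)
  have hp := h.map.lift.period (x₀ - r)
  have him : ∀ x : ℝ, ((x:ℂ) + (1 / 2 : ℝ) * I).im = 1 / 2 := fun x => by simp
  have hγ := h.halfPlaneMap.apply_mem (x₀ + r)
  have hrec := h.halfPlaneMap.rectangle_bound (x₁ := x₀ + r) (x₂ := x₀ - r + 2 * Real.pi)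
    (a := 1 / 2) (ρ := L * (η (x₀ - r + 2 * Real.pi) - η (x₀ + r))) (R := D / 987840) hx
    (by linarith) (by norm_num) (by positivity) _ fun x hxx =>
      ⟨0, ⟨le_rfl, by norm_num⟩, 1 / 2, ⟨by norm_num, le_rfl⟩, by
        have := h.halfPlaneMap.boundary_le hL.le hf x (x₀ + r)
        rw [ofReal_zero, zero_mul, add_zero]
        refine this.trans (mul_le_mul_of_nonneg_left ?_ hL.le)
        rw [abs_of_pos (sub_pos.2 (h.map.lift.mono hxx.1))]
        exact sub_le_sub_right (h.map.lift.mono hxx.2).le _, by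
        have hwb := exp_mul_I_mem_ball (z := (x:ℂ) + (1 / 2 : ℝ) * I) (by rw [him]; norm_num)
        have hw0 := Complex.exp_ne_zero (((x:ℂ) + (1 / 2 : ℝ) * I) * I)
        have hw : ‖exp (((x:ℂ) + (1 / 2 : ℝ) * I) * I)‖ ≤ 2 / 3 := by
          rw [norm_exp_mul_I, him]
          exact exp_neg_le_two_thirds le_rfl
        have e0 := h.norm_add_inv_sub (ball_subset_closedBall hwb) hw0 hγ
        have e1 := (h.growth hw hγ).2
        have e2 := h.norm_map_le hw
        have e3 := norm_pos_iff.2 (h.ne_zero (ball_subset_closedBall hwb) hw0)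
        have e4 := norm_pos_iff.2 (h.sub_ne_zero hγ)
        refine le_trans ?_ e0.ge
        rw [inv_le_iff_one_le_mul₀ e4] at e1
        have e5 : D * ‖Ψ (exp (((x:ℂ) + (1 / 2 : ℝ) * I) * I))‖ ≤ 3528 := by linarith
        rw [← le_div_iff₀ e3, div_eq_mul_inv] at e5
        have e6 := mul_le_mul_of_nonneg_left e1 (inv_pos.2 e3).le
        nlinarith⟩
  have h3 : Real.exp (2 * Real.pi * (1 / 2) / (x₀ - r + 2 * Real.pi - (x₀ + r))) ≤ 3 := by
    refine le_trans (Real.exp_le_exp.2 ?_) Real.exp_one_lt_three.le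
    rw [div_le_iff₀ (by linarith)]
    linarith
  have h4 := hrec.trans (mul_le_mul_of_nonneg_left h3 (by positivity))
  rw [hp] at h4 hτ
  have h5 : 0 < L * (η (x₀ - r) + 2 * Real.pi - η (x₀ + r)) := by positivity
  rw [show 2 * Real.pi - (η (x₀ + r) - η (x₀ - r)) = η (x₀ - r) + 2 * Real.pi - η (x₀ + r) by ring]
  linarith

theorem min_arc_le {ℓ : ℝ} (hℓ : 0 ≤ ℓ)
    (hf : ∀ a ∈ sphere (0:ℂ) 1, ∀ b ∈ sphere (0:ℂ) 1, ℓ * ‖a - b‖ ≤ ‖f a - f b‖)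
    {z : ℂ} (hz : 0 < z.im) (hz' : z.im ≤ Real.pi / 6) :
    ℓ * min (η (z.re + z.im) - η (z.re - z.im))
      (2 * Real.pi - (η (z.re + 2 * z.im) - η (z.re - 2 * z.im))) ≤
      16 * 10 ^ 10 * (z.im * ‖deriv (fun z => p + (Ψ (exp (z * I)))⁻¹) z‖) := by
  have hπ := Real.pi_pos
  have hπ' := Real.pi_lt_d2
  obtain ⟨q, hq, hpos, hd⟩ := h.exists_near_curve hz (by linarith)
  have hzz : (z.re : ℂ) + z.im * I = z := re_add_im z
  set m := min (η (z.re + z.im) - η (z.re - z.im))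
      (2 * Real.pi - (η (z.re + 2 * z.im) - η (z.re - 2 * z.im))) with hm
  have hm0 : 0 ≤ m := le_min (sub_nonneg.2 (h.map.lift.mono.monotone (by linarith)))
    (sub_nonneg.2 (h.map.lift.arc_le_two_pi (by linarith)))
  have hmin := h.halfPlaneMap.min_arc_le hℓ hf (x₀ := z.re) (h₁ := z.im) (h₂ := 2 * z.im)
    (a := z.im) (ρ := Real.exp 14 * ‖p + (Ψ (exp (z * I)))⁻¹ - q‖) hz (by linarith) (by linarith) hz
    (by positivity) q fun x hx => by
      have := h.halfPlaneMap.harnack hq hz (κ := 7) (fun w hw =>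
        h.halfPlaneMap.deriv_bound hz hw.ge (by linarith) hq) x z.re
      rw [hzz] at this
      refine this.trans ?_
      gcongr
      rw [div_le_iff₀ hz]
      linarith
  have h2 : 3 / 5 * m ≤ 2 / Real.pi * m := by
    refine mul_le_mul_of_nonneg_right ?_ hm0
    rw [div_le_div_iff₀ (by norm_num) hπ]
    linarith
  have h3 : Real.exp (2 * Real.pi * z.im / (2 * z.im - z.im)) ≤ 1097 := by
    refine le_trans (le_of_eq ?_) exp_two_pi_le
    congr 1
    field_simp
    ring
  have h0 : Real.exp 14 ≤ 1097 * 1097 := by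
    rw [show (14:ℝ) = 7 + 7 by norm_num, Real.exp_add]
    gcongr <;> exact exp_seven_le
  have h4 : Real.exp 14 * ‖p + (Ψ (exp (z * I)))⁻¹ - q‖ *
      Real.exp (2 * Real.pi * z.im / (2 * z.im - z.im)) ≤
      1097 * 1097 * ‖p + (Ψ (exp (z * I)))⁻¹ - q‖ * 1097 := by
    gcongr
  have h5 := mul_le_mul_of_nonneg_left h2 hℓ
  have h7 : 0 ≤ z.im * ‖deriv (fun z => p + (Ψ (exp (z * I)))⁻¹) z‖ := by positivity
  linarith

theorem arc_le_of_near {ℓ L : ℝ} (hℓ : 0 ≤ ℓ) (hL : 0 < L) (hℓL : ℓ ≤ L)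
    (hf : ∀ a ∈ sphere (0:ℂ) 1, ∀ b ∈ sphere (0:ℂ) 1, ℓ * ‖a - b‖ ≤ ‖f a - f b‖)
    (hf' : ∀ a ∈ sphere (0:ℂ) 1, ∀ b ∈ sphere (0:ℂ) 1, ‖f a - f b‖ ≤ L * ‖a - b‖)
    {z : ℂ} (hz : 0 < z.im) (hz' : z.im ≤ Real.pi / 6) :
    ℓ ^ 2 * (η (z.re + z.im) - η (z.re - z.im)) ≤
      4 * 10 ^ 18 * L * (z.im * ‖deriv (fun z => p + (Ψ (exp (z * I)))⁻¹) z‖) := by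
  have hπ := Real.pi_lt_d2
  have hmin := h.min_arc_le hℓ hf hz hz'
  have hD := h.le_radius hf
  have hτ := h.radius_le_compl_arc hL hf' (x₀ := z.re) (r := 2 * z.im) (by linarith) (by linarith)
  have hS := h.map.lift.arc_le_two_pi (a := z.re - z.im) (b := z.re + z.im) (by linarith)
  have hS0 := sub_nonneg.2 (h.map.lift.mono.monotone (show z.re - z.im ≤ z.re + z.im by linarith))
  set S := η (z.re + z.im) - η (z.re - z.im)
  set τ := 2 * Real.pi - (η (z.re + 2 * z.im) - η (z.re - 2 * z.im)) with hτdef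
  have hτ0 : 0 ≤ τ := sub_nonneg.2 (h.map.lift.arc_le_two_pi (by linarith))
  have key : ℓ * S ≤ 21 * 10 ^ 6 * (L * min S τ) := by
    rcases le_total S τ with hc | hc
    · rw [min_eq_left hc]
      have := mul_le_mul_of_nonneg_right hℓL hS0
      have : 0 ≤ L * S := by positivity
      linarith
    · rw [min_eq_right hc]
      calc ℓ * S ≤ 3 * 10 ^ 6 * (L * τ) * 7 := by
            refine mul_le_mul (hD.trans hτ) (by linarith) hS0 (by positivity)
        _ = _ := by ring
  have h1 := mul_le_mul_of_nonneg_left key hℓ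
  have h2 := mul_le_mul_of_nonneg_left hmin hL.le
  have h3 : 0 ≤ L * (z.im * ‖deriv (fun z => p + (Ψ (exp (z * I)))⁻¹) z‖) := by positivity
  linarith

theorem arc_le_of_far {ℓ L : ℝ} (hℓ : 0 ≤ ℓ) (hℓL : ℓ ≤ L)
    (hf : ∀ a ∈ sphere (0:ℂ) 1, ∀ b ∈ sphere (0:ℂ) 1, ℓ * ‖a - b‖ ≤ ‖f a - f b‖)
    {z : ℂ} (hz : Real.pi / 6 ≤ z.im) (hz' : z.im ≤ 2 * Real.pi) :
    ℓ ^ 2 * (η (z.re + z.im) - η (z.re - z.im)) ≤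
      4 * 10 ^ 18 * L * (z.im * ‖deriv (fun z => p + (Ψ (exp (z * I)))⁻¹) z‖) := by
  have hπ := Real.pi_gt_three
  have hπ' := Real.pi_lt_d2
  have hz0 : 0 < z.im := by linarith
  have hS := h.map.lift.arc_le_four_pi (a := z.re - z.im) (b := z.re + z.im) (by linarith)
  have hS0 := sub_nonneg.2 (h.map.lift.mono.monotone (show z.re - z.im ≤ z.re + z.im by linarith))
  have hw : ‖exp (z * I)‖ ≤ 2 / 3 := by
    rw [norm_exp_mul_I]; exact exp_neg_le_two_thirds (by linarith)
  have hd := h.radius_le_norm_deriv hw (Complex.exp_ne_zero _)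
  have hD := h.le_radius hf
  have h1 : ‖deriv Ψ (exp (z * I))‖ * ‖exp (z * I)‖ ^ 2 / ‖Ψ (exp (z * I))‖ ^ 2 ≤
      ‖deriv (fun z => p + (Ψ (exp (z * I)))⁻¹) z‖ := by
    rw [h.norm_deriv hz0, ← norm_exp_mul_I]
    gcongr
    nlinarith [norm_nonneg (exp (z * I))]
  set d := ‖deriv (fun z => p + (Ψ (exp (z * I)))⁻¹) z‖ with hdef
  have hd0 : 0 ≤ d := norm_nonneg _
  have h2 : ℓ ≤ 7 * 10 ^ 9 * (z.im * d) := by nlinarith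
  calc ℓ ^ 2 * (η (z.re + z.im) - η (z.re - z.im)) =
        ℓ * ℓ * (η (z.re + z.im) - η (z.re - z.im)) := by ring
    _ ≤ L * (7 * 10 ^ 9 * (z.im * d)) * 13 :=
        mul_le_mul (mul_le_mul hℓL h2 hℓ (hℓ.trans hℓL)) (by linarith) hS0
          (mul_nonneg (hℓ.trans hℓL) (by positivity))
    _ ≤ _ := by
      have : 0 ≤ L * (z.im * d) := mul_nonneg (hℓ.trans hℓL) (by positivity)
      linarith

theorem exp_conj_beurlingAhlfors_ge {z : ℂ} (hz : 0 < z.im) (hz' : z.im ≤ 2 * Real.pi) :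
    1 ≤ ‖exp ((starRingEnd ℂ) (beurlingAhlfors η z) * I)‖ ∧
      ‖exp ((starRingEnd ℂ) (beurlingAhlfors η z) * I)‖ ≤ 1097 := by
  rw [norm_exp_mul_I, conj_im, neg_neg]
  exact ⟨Real.one_le_exp (h.map.lift.beurlingAhlfors_im_pos hz).le,
    (Real.exp_le_exp.2 ((h.map.lift.beurlingAhlfors_im_le (abs_le.2 ⟨by linarith, hz'⟩)))).trans
      exp_two_pi_le⟩

theorem eventually_le {L : ℝ} (hL : 0 < L) (hf : ∀ a ∈ sphere (0:ℂ) 1, ∀ b ∈ sphere (0:ℂ) 1,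
    ‖f a - f b‖ ≤ L * ‖a - b‖) {z : ℂ} (hz : 0 < z.im) (hz' : z.im ≤ 2 * Real.pi) :
    ∀ᶠ w in 𝓝 z, ‖(p + (Ψ (exp (w * I)))⁻¹) - (p + (Ψ (exp (z * I)))⁻¹)‖ ≤ 10 ^ 14 * L *
      ‖exp ((starRingEnd ℂ) (beurlingAhlfors η w) * I) -
        exp ((starRingEnd ℂ) (beurlingAhlfors η z) * I)‖ := by
  have hH := h.halfPlaneMap
  have hκ : ∀ w : ℂ, w.im = z.im → ∀ q ∈ f '' sphere 0 1,
      z.im * ‖deriv (fun z => p + (Ψ (exp (z * I)))⁻¹) w‖ ≤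
        14 * ‖(p + (Ψ (exp (w * I)))⁻¹) - q‖ :=
    fun w hw q hq => by
      have := hH.deriv_bound (z := w) (r := z.im / 2) (by linarith) (by linarith) (by linarith) hq
      linarith
  have hC : 14 * Real.exp (14 + 3 * Real.pi) ≤ 4 * 10 ^ 12 := by
    have h1 : Real.exp (14 + 3 * Real.pi) ≤ Real.exp 24 :=
      Real.exp_le_exp.2 (by linarith [Real.pi_lt_d2])
    have h2 := exp_natCast_le 24
    norm_num at h2
    linarith
  have hb : ∀ x₁ x₂ : ℝ, x₂ - x₁ = 2 / 3 * z.im → z.re - z.im ≤ x₁ → x₂ ≤ z.re + z.im →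
      z.im * ‖deriv (fun z => p + (Ψ (exp (z * I)))⁻¹) z‖ ≤ 4 * 10 ^ 12 * L * (η x₂ - η x₁) :=
    fun x₁ x₂ h1 h2 h3 => by
      have h12 : x₁ ≤ x₂ := by linarith
      have := hH.deriv_le hL hf (by norm_num) hz hz' hκ h1 (left_mem_Icc.2 h12) h2 h3
      refine this.trans ?_
      rw [mul_assoc (4 * 10 ^ 12)]
      gcongr
      exact mul_nonneg hL.le (sub_nonneg.2 (h.map.lift.mono.monotone h12))
  filter_upwards [hH.eventually_le (K := fun z => (starRingEnd ℂ) (beurlingAhlfors η z))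
    (continuous_conj.comp h.map.lift.continuous_beurlingAhlfors)
    (fun _ _ => norm_conj_sub_conj _ _) hz hz' (A := 4 * 10 ^ 12 * L) (by positivity)
    (hb _ _ (by ring) (by linarith) le_rfl) (hb _ _ (by ring) le_rfl (by linarith))] with w hw
  refine hw.trans ?_
  gcongr
  have h3 := (h.exp_conj_beurlingAhlfors_ge hz hz').1
  rw [div_le_iff₀ (by linarith)]
  nlinarith

theorem eventually_ge {ℓ L : ℝ} (hℓ : 0 < ℓ) (hL : 0 < L) (hℓL : ℓ ≤ L)
    (hf : ∀ a ∈ sphere (0:ℂ) 1, ∀ b ∈ sphere (0:ℂ) 1, ℓ * ‖a - b‖ ≤ ‖f a - f b‖)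
    (hf' : ∀ a ∈ sphere (0:ℂ) 1, ∀ b ∈ sphere (0:ℂ) 1, ‖f a - f b‖ ≤ L * ‖a - b‖)
    {z : ℂ} (hz : 0 < z.im) (hz' : z.im ≤ 2 * Real.pi) :
    ∀ᶠ w in 𝓝 z, ℓ ^ 2 * ‖exp ((starRingEnd ℂ) (beurlingAhlfors η w) * I) -
        exp ((starRingEnd ℂ) (beurlingAhlfors η z) * I)‖ ≤
      10 ^ 25 * L * ‖(p + (Ψ (exp (w * I)))⁻¹) - (p + (Ψ (exp (z * I)))⁻¹)‖ := by
  have hb : ℓ ^ 2 * (η (z.re + z.im) - η (z.re - z.im)) ≤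
      4 * 10 ^ 18 * L * (z.im * ‖deriv (fun z => p + (Ψ (exp (z * I)))⁻¹) z‖) := by
    rcases le_total z.im (Real.pi / 6) with hy | hy
    · exact h.arc_le_of_near hℓ.le hL hℓL hf hf' hz hy
    · exact h.arc_le_of_far hℓ.le hℓL hf hy hz'
  filter_upwards [h.halfPlaneMap.eventually_ge
    (K := fun z => (starRingEnd ℂ) (beurlingAhlfors η z))
    (continuous_conj.comp h.map.lift.continuous_beurlingAhlfors)
    (fun _ _ => norm_conj_sub_conj _ _) hz hz' (B := 4 * 10 ^ 18 * L / ℓ ^ 2)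
    (by positivity) (by rw [div_mul_eq_mul_div, le_div_iff₀ (by positivity)]; linarith)] with w hw
  have h1 := (h.exp_conj_beurlingAhlfors_ge hz hz').2
  have h2 := mul_le_mul_of_nonneg_left hw (sq_nonneg ℓ)
  refine h2.trans ?_
  set s := ‖exp ((starRingEnd ℂ) (beurlingAhlfors η z) * I)‖
  set d := ‖(p + (Ψ (exp (w * I)))⁻¹) - (p + (Ψ (exp (z * I)))⁻¹)‖
  rw [show ℓ ^ 2 * (16 * (4 * 10 ^ 18 * L / ℓ ^ 2) * s * d) = (64 * 10 ^ 18 * s) * (L * d) by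
    field_simp; ring, mul_assoc (10 ^ 25)]
  gcongr
  linarith

end OuterMap

/-- An extension of a circle embedding to the exterior of the unit disk. -/
structure OuterExtension (f F : ℂ → ℂ) : Prop where
  cont : ContinuousOn F {ζ | 1 ≤ ‖ζ‖}
  inj : InjOn F {ζ | 1 ≤ ‖ζ‖}
  eqOn : EqOn F f (sphere 0 1)
  notMem : ∀ ζ : ℂ, 1 < ‖ζ‖ → F ζ ∉ f '' sphere 0 1
  tendsto : Tendsto F (cocompact ℂ) (cocompact ℂ)
  upper : ∀ L : ℝ, 0 < L → (∀ a ∈ sphere (0:ℂ) 1, ∀ b ∈ sphere (0:ℂ) 1,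
    ‖f a - f b‖ ≤ L * ‖a - b‖) → ∀ ζ₀ : ℂ, 1 < ‖ζ₀‖ → ∀ᶠ ζ in 𝓝 ζ₀,
      ‖F ζ - F ζ₀‖ ≤ 10 ^ 28 * L * ‖ζ - ζ₀‖
  lower : ∀ ℓ L : ℝ, 0 < ℓ → 0 < L → (∀ a ∈ sphere (0:ℂ) 1, ∀ b ∈ sphere (0:ℂ) 1,
    ℓ * ‖a - b‖ ≤ ‖f a - f b‖) → (∀ a ∈ sphere (0:ℂ) 1, ∀ b ∈ sphere (0:ℂ) 1,
    ‖f a - f b‖ ≤ L * ‖a - b‖) → ∀ ζ₀ : ℂ, 1 < ‖ζ₀‖ → ∀ᶠ ζ in 𝓝 ζ₀,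
      ℓ ^ 2 * ‖ζ - ζ₀‖ ≤ 10 ^ 25 * L * ‖F ζ - F ζ₀‖

theorem tendsto_conj_cocompact : Tendsto (starRingEnd ℂ) (cocompact ℂ) (cocompact ℂ) := by
  rw [← Metric.cobounded_eq_cocompact, ← tendsto_norm_atTop_iff_cobounded]
  simpa using tendsto_norm_cobounded_atTop (E := ℂ)

theorem OuterExtension.comp_conj {f F : ℂ → ℂ}
    (h : OuterExtension (fun z => f ((starRingEnd ℂ) z)) F) :
    OuterExtension f (fun z => F ((starRingEnd ℂ) z)) where
  cont := h.cont.comp continuous_conj.continuousOn fun z hz => by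
    simpa only [mem_ofPred_eq, norm_conj] using hz
  inj z hz w hw e := (starRingEnd ℂ).injective
    (h.inj (by simpa only [mem_ofPred_eq, norm_conj] using hz)
      (by simpa only [mem_ofPred_eq, norm_conj] using hw) e)
  eqOn z hz := by simpa using h.eqOn (conj_mem_sphere hz)
  notMem ζ hζ := by
    rw [← image_conj_sphere f]
    exact h.notMem _ (by simpa using hζ)
  tendsto := h.tendsto.comp tendsto_conj_cocompact
  upper L hL hf ζ₀ hζ₀ := by
    filter_upwards [eventually_conj (h.upper L hL (fun a ha b hb => by
      simpa only [norm_conj_sub_conj] using forall_sphere_conj hf a ha b hb)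
      ((starRingEnd ℂ) ζ₀) (by simpa using hζ₀))] with ζ hζ
    simpa only [norm_conj_sub_conj] using hζ
  lower ℓ L hℓ hL hf hf' ζ₀ hζ₀ := by
    filter_upwards [eventually_conj (h.lower ℓ L hℓ hL (fun a ha b hb => by
      simpa only [norm_conj_sub_conj] using forall_sphere_conj hf a ha b hb) (fun a ha b hb => by
      simpa only [norm_conj_sub_conj] using forall_sphere_conj hf' a ha b hb)
      ((starRingEnd ℂ) ζ₀) (by simpa using hζ₀))] with ζ hζ
    simpa only [norm_conj_sub_conj] using hζ

theorem lower_le_upper {f : ℂ → ℂ} {ℓ L : ℝ}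
    (hf : ∀ a ∈ sphere (0:ℂ) 1, ∀ b ∈ sphere (0:ℂ) 1, ℓ * ‖a - b‖ ≤ ‖f a - f b‖)
    (hf' : ∀ a ∈ sphere (0:ℂ) 1, ∀ b ∈ sphere (0:ℂ) 1, ‖f a - f b‖ ≤ L * ‖a - b‖) : ℓ ≤ L := by
  have h := (hf 1 (by simp) (-1) (by simp)).trans (hf' 1 (by simp) (-1) (by simp))
  exact le_of_mul_le_mul_right h (by norm_num)

theorem OuterMap.exists_outerExtension {f Ψ : ℂ → ℂ} {p : ℂ} {D : ℝ} {η : ℝ → ℝ}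
    (h : OuterMap f p D η Ψ) (hD : ∀ L : ℝ, 0 < L → (∀ a ∈ sphere (0:ℂ) 1,
      ∀ b ∈ sphere (0:ℂ) 1, ‖f a - f b‖ ≤ L * ‖a - b‖) → D ≤ 2 * L) :
    ∃ F, OuterExtension f F := by
  obtain ⟨H, hHc, hHi, hH0, hHe, hH1, hH2, u, hu, hHu⟩ := h.map.lift.exists_descent
  have hmaps : MapsTo H (closedBall 0 1) (closedBall 0 1) := fun ζ hζ => by
    rw [mem_closedBall_zero_iff] at hζ ⊢
    exact hH1 ζ hζ
  obtain ⟨σ, hσ⟩ : ∃ σ : ℂ → ℂ, ∀ ζ, σ ζ = ((starRingEnd ℂ) ζ)⁻¹ := ⟨_, fun _ => rfl⟩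
  have hσσ : ∀ ζ, σ (σ ζ) = ζ := fun ζ => by rw [hσ, hσ, map_inv₀, conj_conj, inv_inv]
  have hσn : ∀ ζ, ‖σ ζ‖ = ‖ζ‖⁻¹ := fun ζ => by rw [hσ, norm_inv, norm_conj]
  have hσ0 : ∀ ζ, ζ ≠ 0 → σ ζ ≠ 0 := fun ζ hζ => by rw [hσ]; simpa using hζ
  have hσb : ∀ ζ : ℂ, 1 ≤ ‖ζ‖ → σ ζ ∈ closedBall (0:ℂ) 1 := fun ζ hζ => by
    rw [mem_closedBall_zero_iff, hσn]; exact inv_le_one_of_one_le₀ hζ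
  have hσc : ∀ ζ, ζ ≠ 0 → ContinuousAt σ ζ := fun ζ hζ => by
    rw [show σ = fun ζ => ((starRingEnd ℂ) ζ)⁻¹ from funext hσ]
    exact continuous_conj.continuousAt.inv₀ (by simpa using hζ)
  have hne0 : ∀ ζ : ℂ, 1 ≤ ‖ζ‖ → ζ ≠ 0 := fun ζ hζ => norm_pos_iff.1 (one_pos.trans_le hζ)
  have hHne : ∀ ζ, ζ ≠ 0 → H ζ ≠ 0 := fun ζ hζ e => hζ (hHi (e.trans hH0.symm))
  have hΨne : ∀ ζ : ℂ, 1 ≤ ‖ζ‖ → Ψ (H (σ ζ)) ≠ 0 := fun ζ hζ =>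
    h.ne_zero (hmaps (hσb ζ hζ)) (hHne _ (hσ0 _ (hne0 ζ hζ)))
  have hX : ∀ z, σ (exp (beurlingAhlfors η z * I)) =
      exp ((starRingEnd ℂ) (beurlingAhlfors η z) * I) := fun z => by rw [hσ, exp_conj_mul_I]
  have hev : ∀ {P : ℂ → Prop} {z : ℂ}, (∀ᶠ w in 𝓝 z, P (σ (exp (beurlingAhlfors η w * I)))) →
      ∀ᶠ ζ in 𝓝 (σ (exp (beurlingAhlfors η z * I))), P ζ := fun {P z} hP => by
    have h1 := h.map.lift.eventually_exp_beurlingAhlfors (P := fun ζ => P (σ ζ)) hP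
    have h2 := (hσc _ (hσ0 _ (Complex.exp_ne_zero (beurlingAhlfors η z * I)))).eventually
      (hσσ (exp (beurlingAhlfors η z * I)) ▸ h1)
    simpa only [hσσ] using h2
  have hnear : ∀ ζ₀ : ℂ, 1 < ‖ζ₀‖ → ‖ζ₀‖ ≤ Real.exp (2 * Real.pi) →
      ∃ z : ℂ, 0 < z.im ∧ z.im ≤ 2 * Real.pi ∧ σ (exp (beurlingAhlfors η z * I)) = ζ₀ :=
    fun ζ₀ hζ₀ hζ₀' => by
      obtain ⟨z, hz, hz1, -, hz2⟩ := h.map.lift.exists_exp_beurlingAhlfors_eq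
        (hσ0 _ (hne0 _ hζ₀.le))
      refine ⟨z, hz1 ?_, hz2 ?_, by rw [hz, hσσ]⟩
      · rw [hσn]; exact inv_lt_one_of_one_lt₀ hζ₀
      · rw [hσn, Real.exp_neg]; exact inv_anti₀ (by linarith) hζ₀'
  have hfar : ∀ ζ₀ : ℂ, Real.exp (2 * Real.pi) < ‖ζ₀‖ → ∃ (g : ℂ → ℂ) (d : ℂ), d ≠ 0 ∧
      D ≤ 35 * 10 ^ 8 * ‖d‖ ∧ ‖d‖ ≤ 3528 * D ∧ HasDerivAt g d ((starRingEnd ℂ) ζ₀) ∧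
      ∀ᶠ ζ in 𝓝 ζ₀, p + (Ψ (H (σ ζ)))⁻¹ = g ((starRingEnd ℂ) ζ) := fun ζ₀ hζ₀ => by
    have hζ0 : ζ₀ ≠ 0 := norm_pos_iff.1 ((Real.exp_pos _).trans hζ₀)
    have hc0 : (starRingEnd ℂ) ζ₀ ≠ 0 := by simpa using hζ0
    have hu0 : u ≠ 0 := norm_pos_iff.1 (hu ▸ one_pos)
    set ω := u * ((starRingEnd ℂ) ζ₀)⁻¹ with hω
    have hω0 : ω ≠ 0 := mul_ne_zero hu0 (inv_ne_zero hc0)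
    have hωn : ‖ω‖ = ‖ζ₀‖⁻¹ := by rw [hω, norm_mul, hu, one_mul, norm_inv, norm_conj]
    have hle : ‖ω‖ ≤ 2 / 3 := by
      rw [hωn, inv_le_comm₀ (norm_pos_iff.2 hζ0) (by norm_num)]
      have := Real.add_one_le_exp (2 * Real.pi)
      linarith [Real.pi_gt_three]
    have hb : ω ∈ ball (0:ℂ) 1 := by rw [mem_ball_zero_iff]; linarith
    have hd := (h.map.diff.differentiableAt (isOpen_ball.mem_nhds hb)).hasDerivAt
    have hΨ0 := h.ne_zero (ball_subset_closedBall hb) hω0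
    have hin : HasDerivAt (fun ξ : ℂ => u * ξ⁻¹) (u * -(((starRingEnd ℂ) ζ₀) ^ 2)⁻¹)
      ((starRingEnd ℂ) ζ₀) := (hasDerivAt_inv hc0).const_mul u
    have hg := ((hd.comp ((starRingEnd ℂ) ζ₀) hin).fun_inv hΨ0).const_add p
    have hdn : ‖-(deriv Ψ ω * (u * -(((starRingEnd ℂ) ζ₀) ^ 2)⁻¹)) / Ψ ω ^ 2‖ =
        ‖deriv Ψ ω‖ * ‖ω‖ ^ 2 / ‖Ψ ω‖ ^ 2 := by
      rw [hωn]; simp [hu]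
    refine ⟨_, _, ?_, ?_, ?_, hg, ?_⟩
    · exact div_ne_zero (neg_ne_zero.2 (mul_ne_zero
        (deriv_ne_zero_of_injOn isOpen_ball h.map.diff h.map.injOn_ball hb)
        (mul_ne_zero hu0 (neg_ne_zero.2 (inv_ne_zero (pow_ne_zero 2 hc0)))))) (pow_ne_zero 2 hΨ0)
    · exact (h.radius_le_norm_deriv hle hω0).trans_eq (congrArg _ hdn.symm)
    · exact hdn.trans_le (h.norm_deriv_le_radius hle hω0)
    · filter_upwards [(isOpen_lt continuous_const continuous_norm).mem_nhds hζ₀] with ζ hζ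
      rw [hHu (σ ζ) (by
        rw [hσn, Real.exp_neg]; exact inv_anti₀ (Real.exp_pos _) (le_of_lt hζ)), hσ]
      rfl
  refine ⟨fun ζ => p + (Ψ (H (σ ζ)))⁻¹, ?_, fun z hz w hw e => ?_, fun ζ hζ => ?_,
    fun ζ hζ => ?_, ?_, fun L hL hf ζ₀ hζ₀ => ?_, fun ℓ L hℓ hL hf hf' ζ₀ hζ₀ => ?_⟩
  · refine continuousOn_const.add (ContinuousOn.inv₀ ?_ hΨne)
    exact (h.map.cont.comp hHc.continuousOn hmaps).comp
      (fun ζ hζ => (hσc ζ (hne0 ζ hζ)).continuousWithinAt) hσb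
  · have e1 := hHi (h.map.inj (hmaps (hσb _ hz)) (hmaps (hσb _ hw))
      (inv_injective (add_left_cancel e)))
    rw [← hσσ z, e1, hσσ]
  · rw [mem_sphere_zero_iff_norm] at hζ
    obtain ⟨z, hz, -, hz0, -⟩ := h.map.lift.exists_exp_beurlingAhlfors_eq (hσ0 _ (hne0 _ hζ.ge))
    have hz' : z = (z.re : ℂ) := Complex.ext rfl (by simp [hz0 (by rw [hσn, hζ, inv_one])])
    have hσζ : σ ζ = ζ := by
      rw [hσ]
      refine inv_eq_of_mul_eq_one_left ?_
      rw [mul_conj, normSq_eq_norm_sq, hζ]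
      simp
    have h1 : p + (Ψ (exp (z.re * I)))⁻¹ = f (exp (η z.re * I)) := h.halfPlaneMap.boundary z.re
    rw [← CircleLift.beurlingAhlfors_ofReal, ← hz', hz, hσζ] at h1
    simpa only [← hz, hHe] using h1
  · have hw := hΨne ζ hζ.le
    have hb : H (σ ζ) ∈ ball (0:ℂ) 1 :=
      mem_ball_zero_iff.2 (hH2 _ (by rw [hσn]; exact inv_lt_one_of_one_lt₀ hζ))
    obtain ⟨z, -, hz, hze⟩ :=
      exists_exp_mul_I_eq_of_ne_zero (hHne _ (hσ0 _ (hne0 ζ hζ.le))) 0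
    have hz0 : 0 < z.im := by
      rw [hz]
      exact neg_pos.2 (Real.log_neg (norm_pos_iff.2 (hHne _ (hσ0 _ (hne0 ζ hζ.le))))
        (mem_ball_zero_iff.1 hb))
    have := h.halfPlaneMap.notMem z hz0
    rwa [hze] at this
  · have h1 : Tendsto σ (Bornology.cobounded ℂ) (𝓝[≠] 0) := by
      rw [show σ = fun ζ => ((starRingEnd ℂ) ζ)⁻¹ from funext hσ]
      refine tendsto_inv₀_cobounded'.comp ?_
      rw [Metric.cobounded_eq_cocompact]
      exact tendsto_conj_cocompact
    have h2 : Tendsto (fun v => Ψ (H v)) (𝓝[≠] 0) (𝓝[≠] 0) := by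
      refine tendsto_nhdsWithin_iff.2 ⟨?_, ?_⟩
      · have hc : ContinuousAt (fun v => Ψ (H v)) 0 := by
          refine ContinuousAt.comp (g := Ψ) ?_ hHc.continuousAt
          rw [hH0]
          exact h.map.cont.continuousAt (closedBall_mem_nhds 0 one_pos)
        have := hc.tendsto
        rw [hH0, h.zero] at this
        exact this.mono_left nhdsWithin_le_nhds
      · filter_upwards [self_mem_nhdsWithin,
          mem_nhdsWithin_of_mem_nhds (closedBall_mem_nhds (0:ℂ) one_pos)] with v hv hv'
        exact h.ne_zero (hmaps hv') (hHne v hv)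
    have h3 := tendsto_inv₀_nhdsNE_zero.comp (h2.comp h1)
    rw [← Metric.cobounded_eq_cocompact, ← tendsto_norm_atTop_iff_cobounded]
    rw [← tendsto_norm_atTop_iff_cobounded] at h3
    refine tendsto_atTop_mono (fun ζ => ?_) (tendsto_atTop_add_const_right _ (-‖p‖) h3)
    have := norm_sub_le (p + (Ψ (H (σ ζ)))⁻¹) p
    rw [add_sub_cancel_left] at this
    simpa using this
  · rcases le_or_gt ‖ζ₀‖ (Real.exp (2 * Real.pi)) with hs | hs
    · obtain ⟨z, hz, hz', rfl⟩ := hnear ζ₀ hζ₀ hs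
      refine hev ?_
      filter_upwards [h.eventually_le hL hf hz hz'] with w hw
      simp only [← hX] at hw
      simp only [hσσ, hHe]
      refine hw.trans ?_
      gcongr <;> norm_num
    · obtain ⟨g, d, hd0, -, hd, hg, he⟩ := hfar ζ₀ hs
      filter_upwards [eventually_conj (eventually_norm_sub_of_hasDerivAt hg hd0), he] with ζ hζ hζe
      rw [hζe, he.self_of_nhds]
      refine hζ.2.trans ?_
      rw [norm_conj_sub_conj]
      refine mul_le_mul_of_nonneg_right ?_ (norm_nonneg _)
      linarith [hD L hL hf]
  · have hℓL := lower_le_upper hf hf'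
    rcases le_or_gt ‖ζ₀‖ (Real.exp (2 * Real.pi)) with hs | hs
    · obtain ⟨z, hz, hz', rfl⟩ := hnear ζ₀ hζ₀ hs
      refine hev ?_
      filter_upwards [h.eventually_ge hℓ hL hℓL hf hf' hz hz'] with w hw
      simp only [← hX] at hw
      simpa only [hσσ, hHe] using hw
    · obtain ⟨g, d, hd0, hd, -, hg, he⟩ := hfar ζ₀ hs
      filter_upwards [eventually_conj (eventually_norm_sub_of_hasDerivAt hg hd0), he] with ζ hζ hζe
      rw [hζe, he.self_of_nhds]
      have h1 := hζ.1
      rw [norm_conj_sub_conj] at h1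
      have h2 := h.le_radius hf
      set N := ‖g ((starRingEnd ℂ) ζ) - g ((starRingEnd ℂ) ζ₀)‖
      calc ℓ ^ 2 * ‖ζ - ζ₀‖ = ℓ * (ℓ * ‖ζ - ζ₀‖) := by ring
        _ ≤ L * (35 * 10 ^ 8 * ‖d‖ * ‖ζ - ζ₀‖) := by gcongr; linarith
        _ = 70 * 10 ^ 8 * L * (‖d‖ / 2 * ‖ζ - ζ₀‖) := by ring
        _ ≤ 70 * 10 ^ 8 * L * N := by gcongr
        _ ≤ _ := by gcongr; norm_num

theorem norm_sub_le_of_mem_bounded_component {f : ℂ → ℂ} (hf : ContinuousOn f (sphere (0:ℂ) 1))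
    (hi : InjOn f (sphere (0:ℂ) 1)) {p : ℂ} (hp : p ∉ f '' sphere (0:ℂ) 1)
    (hb : Bornology.IsBounded (connectedComponentIn (f '' sphere (0:ℂ) 1)ᶜ p)) {L : ℝ}
    (hL : 0 < L) (hfL : ∀ a ∈ sphere (0:ℂ) 1, ∀ b ∈ sphere (0:ℂ) 1, ‖f a - f b‖ ≤ L * ‖a - b‖)
    {γ : ℂ} (hγ : γ ∈ f '' sphere 0 1) : ‖γ - p‖ ≤ 2 * L := by
  rw [norm_sub_rev]
  refine Complex.norm_le_of_forall_mem_frontier_norm_le (f := fun w => w - γ) hb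
    ⟨by fun_prop, by fun_prop⟩ (fun v hv => ?_) (subset_closure (mem_connectedComponentIn hp))
  rw [frontier_bounded_component hf hi hp hb] at hv
  obtain ⟨a, ha, rfl⟩ := hγ
  obtain ⟨b, hb, rfl⟩ := hv
  refine (hfL b hb a ha).trans ?_
  rw [mul_comm]
  refine mul_le_mul_of_nonneg_right ((norm_sub_le _ _).trans ?_) hL.le
  rw [mem_sphere_zero_iff_norm.1 ha, mem_sphere_zero_iff_norm.1 hb]
  norm_num

theorem hasLogOn_id_of_not_isBounded {K : Set ℂ} (hK : IsCompact K)
    (h : ¬ Bornology.IsBounded (connectedComponentIn Kᶜ 0)) : HasLogOn K fun z => z := by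
  obtain ⟨R, hR, hKR⟩ := hK.isBounded.subset_closedBall_lt 0 0
  obtain ⟨v, hv, hvR⟩ : ∃ v ∈ connectedComponentIn Kᶜ 0, R < ‖v‖ := by
    by_contra! hcon
    exact h (isBounded_closedBall.subset fun v hv => mem_closedBall_zero_iff.2 (hcon v hv))
  have h0 : (0:ℂ) ∈ Kᶜ := by
    by_contra hn
    rw [connectedComponentIn_eq_empty hn] at hv
    exact hv
  have hne : ∀ z ∈ closedBall (0:ℂ) R, z - v ≠ 0 := fun z hz e => by
    rw [sub_eq_zero.1 e, mem_closedBall_zero_iff] at hz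
    linarith
  have h1 : HasLogOn K fun z => z - v := (HasLogOn.of_starConvex
    ((convex_closedBall (0:ℂ) R).starConvex (mem_closedBall_self hR.le))
    (mem_closedBall_self hR.le) (by fun_prop) hne).mono hKR
  refine (h1.mul (hasLogOn_of_mem_component hK.isClosed hv).inv).congr fun z hz => ?_
  have h2 := hne z (hKR hz)
  simp only [sub_zero, inv_div]
  field_simp

theorem isBounded_component_inv {f : ℂ → ℂ} (hf : ContinuousOn f (sphere (0:ℂ) 1))
    (hi : InjOn f (sphere (0:ℂ) 1)) {p : ℂ} (hp : p ∉ f '' sphere (0:ℂ) 1)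
    (hb : Bornology.IsBounded (connectedComponentIn (f '' sphere (0:ℂ) 1)ᶜ p)) :
    Bornology.IsBounded
      (connectedComponentIn ((fun z => (f z - p)⁻¹) '' sphere (0:ℂ) 1)ᶜ 0) := by
  by_contra hcon
  have hinv : ContinuousOn (fun z => (f z - p)⁻¹) (sphere (0:ℂ) 1) :=
    (hf.sub continuousOn_const).inv₀ fun z hz e => hp ⟨z, hz, sub_eq_zero.1 e⟩
  obtain ⟨g, hg, he⟩ := hasLogOn_id_of_not_isBounded (isCompact_curve hinv) hcon
  have h1 : HasLogOn (sphere (0:ℂ) 1) fun z => (f z - p)⁻¹ :=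
    ⟨fun z => g (f z - p)⁻¹, hg.comp hinv (mapsTo_image _ _),
      fun z hz => he _ (mem_image_of_mem _ hz)⟩
  have h2 : HasLogOn (sphere (0:ℂ) 1) fun z => f z - p := by simpa using h1.inv
  obtain ⟨G, hG, hGe⟩ := h2.image (isCompact_sphere 0 1) hf hi (h := fun w => w - p)
  have hcl := (isCompact_curve hf).isClosed
  refine borsuk_obstruction hcl hb (frontier_bounded_component hf hi hp hb).subset
    (v := p) ?_ (h₀ := fun _ => 1) continuous_const (fun _ _ => one_ne_zero) hG
    (fun z hz => by rw [hGe z hz, one_mul])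
  rw [hcl.isOpen_compl.connectedComponentIn.interior_eq]
  exact mem_connectedComponentIn hp

theorem exists_outerMap {f : ℂ → ℂ} (hf : ContinuousOn f (sphere (0:ℂ) 1)) {p : ℂ}
    (hp : p ∉ f '' sphere (0:ℂ) 1) {η : ℝ → ℝ} {Ψ : ℂ → ℂ}
    (h : BoundaryMap (fun z => (f z - p)⁻¹) η Ψ) (h0 : Ψ 0 = 0) :
    ∃ D, OuterMap f p D η Ψ ∧ ∃ γ ∈ f '' sphere 0 1, ‖γ - p‖ = D := by
  have hne : (f '' sphere (0:ℂ) 1).Nonempty := ⟨_, mem_image_of_mem f (exp_mul_I_mem_sphere 0)⟩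
  obtain ⟨γ, hγ, hγm⟩ := (isCompact_curve hf).exists_isMaxOn hne
    (f := fun γ => ‖γ - p‖) (by fun_prop)
  exact ⟨_, ⟨h, h0, hf, hp, ⟨γ, hγ, rfl⟩, fun γ' hγ' => hγm hγ'⟩, γ, hγ, rfl⟩

theorem exists_outerExtension {f : ℂ → ℂ} (hf : ContinuousOn f (sphere (0:ℂ) 1))
    (hi : InjOn f (sphere (0:ℂ) 1)) {p : ℂ} (hp : p ∉ f '' sphere (0:ℂ) 1)
    (hb : Bornology.IsBounded (connectedComponentIn (f '' sphere (0:ℂ) 1)ᶜ p)) :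
    ∃ F, OuterExtension f F := by
  have hne : ∀ z ∈ sphere (0:ℂ) 1, f z - p ≠ 0 := fun z hz e => hp ⟨z, hz, sub_eq_zero.1 e⟩
  obtain ⟨f', hf', η, Ψ, h, -, h0⟩ := exists_boundaryMap (f := fun z => (f z - p)⁻¹)
    ((hf.sub continuousOn_const).inv₀ hne)
    (fun z hz w hw e => hi hz hw (sub_left_injective (inv_injective e)))
    (p := 0) (by rintro ⟨z, hz, e⟩; exact hne z hz (inv_eq_zero.1 e))
    (isBounded_component_inv hf hi hp hb)
  rcases hf' with rfl | rfl
  · obtain ⟨D, hO, γ, hγ, hD⟩ := exists_outerMap hf hp h h0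
    refine hO.exists_outerExtension fun L hL hfL => ?_
    rw [← hD]
    exact norm_sub_le_of_mem_bounded_component hf hi hp hb hL hfL hγ
  · obtain ⟨D, hO, γ, hγ, hD⟩ := exists_outerMap (f := fun z => f ((starRingEnd ℂ) z))
      (hf.comp continuous_conj.continuousOn fun z hz => conj_mem_sphere hz)
      (by rwa [image_conj_sphere]) h h0
    rw [image_conj_sphere] at hγ
    obtain ⟨F, hF⟩ := hO.exists_outerExtension fun L hL hfL => by
      rw [← hD]
      refine norm_sub_le_of_mem_bounded_component hf hi hp hb hL (fun a ha b hb => ?_) hγ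
      simpa [norm_conj_sub_conj] using hfL _ (conj_mem_sphere ha) _ (conj_mem_sphere hb)
    exact ⟨_, hF.comp_conj⟩

theorem hasLogOn_sphere_of_notMem_range {F : ℂ → ℂ} (hc : Continuous F)
    (hi : Function.Injective F) (hp : Tendsto F (cocompact ℂ) (cocompact ℂ)) {q : ℂ}
    (hq : ¬ ∃ z, F z = q) : HasLogOn (sphere (0:ℂ) 1) fun z => F z - F 0 := by
  have hne : ∀ z, F z - q ≠ 0 := fun z e => hq ⟨z, sub_eq_zero.1 e⟩
  set k : ℂ → ℂ := fun v => (F ((starRingEnd ℂ) v)⁻¹ - q)⁻¹ - (F 0 - q)⁻¹ with hk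
  set K : ℂ → ℂ := Function.update k 0 (-(F 0 - q)⁻¹) with hK
  have hK0 : ∀ v, v ≠ 0 → K v = k v := fun v hv => Function.update_of_ne hv _ _
  have hKc : Continuous K := by
    refine continuous_iff_continuousAt.2 fun v => ?_
    rcases eq_or_ne v 0 with rfl | hv
    · refine continuousAt_update_same.2 ?_
      have h1 : Tendsto (fun v : ℂ => ((starRingEnd ℂ) v)⁻¹) (𝓝[≠] 0) (cocompact ℂ) := by
        have : Tendsto (fun v : ℂ => (starRingEnd ℂ) v⁻¹) (𝓝[≠] 0) (cocompact ℂ) := by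
          refine tendsto_conj_cocompact.comp ?_
          rw [← Metric.cobounded_eq_cocompact]
          exact tendsto_inv₀_nhdsNE_zero
        exact this.congr fun v => map_inv₀ _ _
      have h2 : Tendsto (fun w : ℂ => w - q) (cocompact ℂ) (cocompact ℂ) :=
        (Homeomorph.subRight q).isClosedEmbedding.tendsto_cocompact
      have h3 : Tendsto (fun w : ℂ => w⁻¹) (cocompact ℂ) (𝓝 0) := by
        rw [← Metric.cobounded_eq_cocompact]
        exact tendsto_inv₀_cobounded
      have := (h3.comp (h2.comp (hp.comp h1))).sub_const (F 0 - q)⁻¹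
      rwa [zero_sub] at this
    · refine (continuousAt_update_of_ne hv).2 (ContinuousAt.sub (ContinuousAt.inv₀ ?_ (hne _))
        continuousAt_const)
      refine (hc.continuousAt.comp ?_).sub continuousAt_const
      exact continuous_conj.continuousAt.inv₀ (by simpa using hv)
  have hKne : ∀ v, K v ≠ 0 := fun v => by
    rcases eq_or_ne v 0 with rfl | hv
    · rw [hK, Function.update_self]
      exact neg_ne_zero.2 (inv_ne_zero (hne 0))
    · rw [hK0 v hv]
      intro e
      have := hi (sub_left_injective (inv_injective (sub_eq_zero.1 e)))
      exact hv (by simpa using this)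
  have h1 : HasLogOn (sphere (0:ℂ) 1) K := (HasLogOn.of_starConvex (starConvex_univ 0)
    (mem_univ 0) hKc.continuousOn fun v _ => hKne v).mono (subset_univ _)
  have h2 : HasLogOn (sphere (0:ℂ) 1) fun z => F z - q := (HasLogOn.of_starConvex
    (starConvex_univ 0) (mem_univ 0) (by fun_prop) fun v _ => hne v).mono (subset_univ _)
  have h3 : HasLogOn (sphere (0:ℂ) 1) fun _ => -(F 0 - q) := (HasLogOn.of_starConvex
    (starConvex_univ 0) (mem_univ 0) (by fun_prop) fun v _ => neg_ne_zero.2 (hne 0)).mono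
    (subset_univ _)
  refine ((h1.mul h2).mul h3).congr fun z hz => ?_
  have hz1 := mem_sphere_zero_iff_norm.1 hz
  have hz0 : z ≠ 0 := by
    rintro rfl
    simp at hz1
  have hz2 : ((starRingEnd ℂ) z)⁻¹ = z := by
    rw [← inv_eq_conj hz1, inv_inv]
  simp only [hK0 z hz0, hk, hz2]
  have h4 := hne z
  have h5 := hne 0
  field_simp
  ring

/-- The interior and exterior extensions glue to a homeomorphism of the plane. -/
theorem exists_homeomorph_of_extensions {f F₀ F₁ : ℂ → ℂ} {U : Set ℂ} (h₀ : InnerExtension f F₀ U)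
    (h₁ : OuterExtension f F₁) (hU : Bornology.IsBounded U)
    (hUc : ∃ p, U = connectedComponentIn (f '' sphere (0:ℂ) 1)ᶜ p) :
    ∃ F : ℂ ≃ₜ ℂ, EqOn F F₀ (closedBall 0 1) ∧ EqOn F F₁ {ζ | 1 ≤ ‖ζ‖} := by
  classical
  obtain ⟨p, hUp⟩ := hUc
  set F : ℂ → ℂ := fun ζ => if ‖ζ‖ ≤ 1 then F₀ ζ else F₁ ζ with hF
  have hF0 : EqOn F F₀ (closedBall 0 1) := fun ζ hζ => if_pos (mem_closedBall_zero_iff.1 hζ)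
  have hF1 : EqOn F F₁ {ζ | 1 ≤ ‖ζ‖} := fun ζ hζ => by
    rcases (show 1 ≤ ‖ζ‖ from hζ).eq_or_lt with h | h
    · rw [hF0 (mem_closedBall_zero_iff.2 h.ge)]
      have hs := mem_sphere_zero_iff_norm.2 h.symm
      rw [h₀.eqOn hs, h₁.eqOn hs]
    · exact if_neg (not_le.2 h)
  have hcov : closedBall (0:ℂ) 1 ∪ {ζ | 1 ≤ ‖ζ‖} = univ := eq_univ_of_forall fun ζ => by
    rw [mem_union, mem_closedBall_zero_iff]
    exact le_total _ _
  have hcont : Continuous F := by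
    rw [← continuousOn_univ, ← hcov]
    exact (h₀.cont.congr hF0).union_of_isClosed (h₁.cont.congr hF1) isClosed_closedBall
      (isClosed_le continuous_const continuous_norm)
  have hprop : Tendsto F (cocompact ℂ) (cocompact ℂ) := by
    refine h₁.tendsto.congr' ?_
    filter_upwards [tendsto_norm_cocompact_atTop (E := ℂ) (eventually_ge_atTop 1)] with ζ hζ
    exact (hF1 hζ).symm
  have hout : ∀ ζ : ℂ, 1 < ‖ζ‖ → F₁ ζ ∉ U := fun ζ hζ hmem => by
    have hsub : F₁ '' (closedBall (0:ℂ) 1)ᶜ ⊆ U := by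
      rw [hUp] at hmem ⊢
      rw [connectedComponentIn_eq hmem]
      refine IsPreconnected.subset_connectedComponentIn ?_ ⟨ζ, by simpa using hζ, rfl⟩ ?_
      · exact (isPreconnected_compl_closedBall one_pos).image _ (h₁.cont.mono fun v hv => by
          have : 1 < ‖v‖ := by simpa using hv
          exact this.le)
      · rintro _ ⟨v, hv, rfl⟩
        exact h₁.notMem v (by simpa using hv)
    have h2 : ∀ᶠ v in cocompact ℂ, F₁ v ∈ (closure (F₁ '' (closedBall (0:ℂ) 1)ᶜ))ᶜ :=
      h₁.tendsto (hU.subset hsub).isCompact_closure.compl_mem_cocompact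
    have h3 : ∀ᶠ v : ℂ in cocompact ℂ, 1 < ‖v‖ :=
      tendsto_norm_cocompact_atTop (E := ℂ) (eventually_gt_atTop 1)
    obtain ⟨v, hv1, hv2⟩ := (h2.and h3).exists
    exact hv1 (subset_closure ⟨v, by simpa using hv2, rfl⟩)
  have hmix : ∀ z w : ℂ, ‖z‖ ≤ 1 → 1 < ‖w‖ → F z ≠ F w := fun z w hz hw e => by
    rw [hF0 (mem_closedBall_zero_iff.2 hz), hF1 (show 1 ≤ ‖w‖ from hw.le)] at e
    rcases hz.lt_or_eq with h | h
    · refine hout w hw ?_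
      rw [← e, ← h₀.image]
      exact ⟨z, mem_ball_zero_iff.2 h, rfl⟩
    · have hs := mem_sphere_zero_iff_norm.2 h
      exact h₁.notMem w hw ⟨z, hs, by rw [← e, h₀.eqOn hs]⟩
  have hinj : Function.Injective F := fun z w e => by
    rcases le_or_gt ‖z‖ 1 with hz | hz <;> rcases le_or_gt ‖w‖ 1 with hw | hw
    · have hz' := mem_closedBall_zero_iff.2 hz
      have hw' := mem_closedBall_zero_iff.2 hw
      rw [hF0 hz', hF0 hw'] at e
      exact h₀.inj hz' hw' e
    · exact (hmix z w hz hw e).elim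
    · exact (hmix w z hw hz e.symm).elim
    · rw [hF1 (show 1 ≤ ‖z‖ from hz.le), hF1 (show 1 ≤ ‖w‖ from hw.le)] at e
      exact h₁.inj hz.le hw.le e
  have hsurj : Function.Surjective F := fun q => by
    by_contra hq
    have hfF : EqOn f F (sphere 0 1) := fun z hz => by
      rw [hF0 (sphere_subset_closedBall hz), h₀.eqOn hz]
    have hf : ContinuousOn f (sphere (0:ℂ) 1) := hcont.continuousOn.congr hfF
    have hi : InjOn f (sphere (0:ℂ) 1) := (hinj.injOn).congr hfF.symm
    have hm : F 0 ∈ U := by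
      rw [hF0 (mem_closedBall_self zero_le_one), ← h₀.image]
      exact mem_image_of_mem _ (mem_ball_self one_pos)
    have h2 := ((hasLogOn_sphere_of_notMem_range hcont hinj hprop hq).congr (h' :=
        fun z => f z - F 0)
      fun z hz => by simp only [hfF hz]).image (isCompact_sphere 0 1) hf hi (h := fun w => w - F 0)
    obtain ⟨G, hG, hGe⟩ := h2
    have hcl := (isCompact_curve hf).isClosed
    refine borsuk_obstruction hcl hU ?_
      (v := F 0) ?_ (h₀ := fun _ => 1) continuous_const (fun _ _ => one_ne_zero) hG
      (fun z hz => by rw [hGe z hz, one_mul])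
    · rw [hUp]
      exact frontier_connectedComponentIn_subset hcl p
    · rwa [hUp, hcl.isOpen_compl.connectedComponentIn.interior_eq, ← hUp]
  obtain ⟨e, he⟩ := exists_homeomorph_of_bijective hcont ⟨hinj, hsurj⟩ hprop
  exact ⟨e, fun z hz => (he z).trans (hF0 hz), fun z hz => (he z).trans (hF1 hz)⟩

theorem norm_sub_le_of_eventually_right {φ : ℝ → ℂ} (hφ : Continuous φ) {C a b : ℝ} (hab : a ≤ b)
    (h : ∀ t ∈ Ico a b, ∀ᶠ s in 𝓝[>] t, ‖φ s - φ t‖ ≤ C * (s - t)) :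
    ‖φ b - φ a‖ ≤ C * (b - a) := by
  have hS : Icc a b ⊆ {t | ‖φ t - φ a‖ ≤ C * (t - a)} := by
    refine IsClosed.Icc_subset_of_forall_mem_nhdsWithin ?_ (by simp) fun x hx => ?_
    · exact (isClosed_le (by fun_prop) (by fun_prop)).inter isClosed_Icc
    · filter_upwards [h x hx.2] with s hs
      have h1 : ‖φ x - φ a‖ ≤ C * (x - a) := hx.1
      have h2 : ‖φ s - φ a‖ ≤ ‖φ s - φ x‖ + ‖φ x - φ a‖ := norm_sub_le_norm_sub_add_norm_sub _ _ _
      show ‖φ s - φ a‖ ≤ C * (s - a)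
      linarith
  exact hS (right_mem_Icc.2 hab)

theorem norm_sub_le_of_lineMap_notMem {h : ℂ → ℂ} (hc : Continuous h) {K V : Set ℂ}
    (hfr : frontier V ⊆ K) {C : ℝ} (hloc : ∀ u ∈ V, u ∉ K → ∀ᶠ v in 𝓝 u, ‖h v - h u‖ ≤ C * ‖v - u‖)
    {x y : ℂ} (hx : x ∈ V) {b : ℝ} (hb : 0 ≤ b)
    (hn : ∀ t ∈ Ico 0 b, AffineMap.lineMap x y t ∉ K) :
    ‖h (AffineMap.lineMap x y b) - h x‖ ≤ C * (b * ‖y - x‖) := by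
  have hl : Continuous fun t : ℝ => (AffineMap.lineMap x y t : ℂ) := AffineMap.lineMap_continuous
  have hV : ∀ t ∈ Ico 0 b, (AffineMap.lineMap x y t : ℂ) ∈ V := fun t ht => by
    have hcase : ∀ s ∈ Ico 0 b, (AffineMap.lineMap x y s : ℂ) ∉ frontier V := fun s hs hsf =>
      hn s hs (hfr hsf)
    have hm : (0:ℝ) ∈ Ico 0 b := ⟨le_rfl, ht.1.trans_lt ht.2⟩
    have h0 : (AffineMap.lineMap x y (0:ℝ) : ℂ) = x := AffineMap.lineMap_apply_zero x y
    have hpre := (isPreconnected_Ico (a := (0:ℝ)) (b := b)).image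
      (fun t : ℝ => (AffineMap.lineMap x y t : ℂ)) hl.continuousOn
    have hsub := hpre.subset_left_of_subset_union (u := interior V) (v := (closure V)ᶜ)
      isOpen_interior isClosed_closure.isOpen_compl
      (disjoint_compl_right.mono_left (interior_subset.trans subset_closure)) (by
        rintro _ ⟨s, hs, rfl⟩
        by_contra hcon
        rw [mem_union, not_or, mem_compl_iff, not_not] at hcon
        exact hcase s hs ((mem_sdiff _).2 ⟨hcon.2, hcon.1⟩))
      ⟨x, mem_inter ((mem_image _ _ _).2 ⟨0, hm, h0⟩) (by
        by_contra hcon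
        refine hcase 0 hm ?_
        rw [h0]
        exact (mem_sdiff _).2 ⟨subset_closure hx, hcon⟩)⟩
    exact interior_subset (hsub ⟨t, ht, rfl⟩)
  have := norm_sub_le_of_eventually_right (hc.comp hl) (C := C * ‖y - x‖) hb fun t ht => by
    filter_upwards [nhdsWithin_le_nhds (hl.continuousAt.eventually (hloc _ (hV t ht) (hn t ht))),
      self_mem_nhdsWithin] with s hs hst
    refine hs.trans_eq ?_
    have : (AffineMap.lineMap x y s - AffineMap.lineMap x y t : ℂ) = ((s - t : ℝ) : ℂ) * (y - x) :=
        by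
      simp only [AffineMap.lineMap_apply_module, real_smul]
      push_cast
      ring
    rw [this, norm_mul, norm_real, Real.norm_of_nonneg (sub_nonneg.2 (le_of_lt hst))]
    ring
  simp only [Function.comp_apply, AffineMap.lineMap_apply_zero, sub_zero] at this
  linarith

theorem exists_first_mem {h : ℂ → ℂ} (hc : Continuous h) {K V : Set ℂ} (hK : IsClosed K)
    (hfr : frontier V ⊆ K) {C : ℝ} (hloc : ∀ u ∈ V, u ∉ K → ∀ᶠ v in 𝓝 u, ‖h v - h u‖ ≤ C * ‖v - u‖)
    {x y : ℂ} (hx : x ∈ V ∪ K) (hm : ∃ t ∈ Icc (0:ℝ) 1, (AffineMap.lineMap x y t : ℂ) ∈ K) :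
    ∃ b, 0 ≤ b ∧ (AffineMap.lineMap x y b : ℂ) ∈ K ∧
      (∀ t ∈ Icc (0:ℝ) 1, (AffineMap.lineMap x y t : ℂ) ∈ K → b ≤ t) ∧
      ‖h (AffineMap.lineMap x y b) - h x‖ ≤ C * (b * ‖y - x‖) := by
  by_cases hxK : x ∈ K
  · exact ⟨0, le_rfl, by simpa using hxK, fun t ht _ => ht.1, by simp⟩
  have hcomp : IsCompact (Icc (0:ℝ) 1 ∩ (fun t : ℝ => (AffineMap.lineMap x y t : ℂ)) ⁻¹' K) :=
    isCompact_Icc.inter_right (hK.preimage AffineMap.lineMap_continuous)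
  obtain ⟨b, hb⟩ := hcomp.exists_isLeast (let ⟨t, ht, htK⟩ := hm; ⟨t, ht, htK⟩)
  refine ⟨b, hb.1.1.1, hb.1.2, fun t ht htK => hb.2 ⟨ht, htK⟩,
    norm_sub_le_of_lineMap_notMem hc hfr hloc (hx.resolve_right hxK) hb.1.1.1 fun t ht htK => ?_⟩
  exact (hb.2 ⟨⟨ht.1, ht.2.le.trans hb.1.1.2⟩, htK⟩).not_gt ht.2

/-- A map that is `C`-Lipschitz on a closed set containing the frontier of `V`, and pointwise
`C`-Lipschitz at the remaining points of `V`, is `C`-Lipschitz. -/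
theorem norm_sub_le_of_pointwise {h : ℂ → ℂ} (hc : Continuous h) {K V : Set ℂ} (hK : IsClosed K)
    (hfr : frontier V ⊆ K) {C : ℝ} (hKC : ∀ u ∈ K, ∀ v ∈ K, ‖h u - h v‖ ≤ C * ‖u - v‖)
    (hloc : ∀ u ∈ V, u ∉ K → ∀ᶠ v in 𝓝 u, ‖h v - h u‖ ≤ C * ‖v - u‖)
    {x y : ℂ} (hx : x ∈ V ∪ K) (hy : y ∈ V ∪ K) : ‖h x - h y‖ ≤ C * ‖x - y‖ := by
  by_cases hm : ∃ t ∈ Icc (0:ℝ) 1, (AffineMap.lineMap x y t : ℂ) ∈ K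
  · obtain ⟨b, hb0, hbK, hbm, hb⟩ := exists_first_mem hc hK hfr hloc hx hm
    obtain ⟨t, ht, htK⟩ := hm
    obtain ⟨c, hc0, hcK, hcm, hc⟩ := exists_first_mem hc hK hfr hloc hy (y := x)
      ⟨1 - t, ⟨by linarith [ht.2], by linarith [ht.1]⟩, by
        rwa [AffineMap.lineMap_apply_one_sub]⟩
    have hc1 : c ≤ 1 := (hcm (1 - t) ⟨by linarith [ht.2], by linarith [ht.1]⟩ (by
        rwa [AffineMap.lineMap_apply_one_sub])).trans (by linarith [ht.1])
    have hbc : b ≤ 1 - c := hbm _ ⟨by linarith, by linarith⟩ (by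
      rwa [AffineMap.lineMap_apply_one_sub])
    have h1 := hKC _ hbK _ hcK
    have h2 : (AffineMap.lineMap x y b - AffineMap.lineMap y x c : ℂ) =
        ((1 - c - b : ℝ) : ℂ) * (x - y) := by
      simp only [AffineMap.lineMap_apply_module, real_smul]
      push_cast
      ring
    rw [h2, norm_mul, norm_real, Real.norm_of_nonneg (by linarith)] at h1
    rw [norm_sub_rev, norm_sub_rev y x] at hb
    have h3 := norm_sub_le_norm_sub_add_norm_sub (h x) (h (AffineMap.lineMap x y b)) (h y)
    have h4 := norm_sub_le_norm_sub_add_norm_sub (h (AffineMap.lineMap x y b))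
      (h (AffineMap.lineMap y x c)) (h y)
    linarith
  · push Not at hm
    have hxV : x ∈ V := hx.resolve_right (by simpa using hm 0 (by simp))
    have := norm_sub_le_of_lineMap_notMem hc hfr hloc hxV (y := y) zero_le_one
      fun t ht => hm t ⟨ht.1, ht.2.le⟩
    rw [AffineMap.lineMap_apply_one, one_mul] at this
    rwa [norm_sub_rev, norm_sub_rev x]

theorem exists_homeomorph_extension {f : ℂ → ℂ} (hf : ContinuousOn f (sphere (0:ℂ) 1))
    (hi : InjOn f (sphere (0:ℂ) 1)) : ∃ F : ℂ ≃ₜ ℂ, EqOn F f (sphere 0 1) ∧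
      (∀ L : ℝ, 0 < L → (∀ a ∈ sphere (0:ℂ) 1, ∀ b ∈ sphere (0:ℂ) 1,
        ‖f a - f b‖ ≤ L * ‖a - b‖) →
        (∀ a ∈ closedBall (0:ℂ) 1, ∀ b ∈ closedBall (0:ℂ) 1,
          ‖F a - F b‖ ≤ 10 ^ 14 * L * ‖a - b‖) ∧
        ∀ a b, ‖F a - F b‖ ≤ 10 ^ 28 * L * ‖a - b‖) ∧
      ∀ ℓ : ℝ, 0 < ℓ → (∀ a ∈ sphere (0:ℂ) 1, ∀ b ∈ sphere (0:ℂ) 1,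
        ℓ * ‖a - b‖ ≤ ‖f a - f b‖) →
        (∀ a ∈ closedBall (0:ℂ) 1, ∀ b ∈ closedBall (0:ℂ) 1,
          ℓ * ‖a - b‖ ≤ 10 ^ 14 * ‖F a - F b‖) ∧
        ∀ L : ℝ, 0 < L → (∀ a ∈ sphere (0:ℂ) 1, ∀ b ∈ sphere (0:ℂ) 1,
          ‖f a - f b‖ ≤ L * ‖a - b‖) → ∀ a b, ℓ ^ 2 * ‖a - b‖ ≤ 10 ^ 25 * L * ‖F a - F b‖ := by
  obtain ⟨p, hp, hb⟩ := exists_bounded_component hf hi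
  obtain ⟨F₀, h₀⟩ := exists_innerExtension hf hi hp hb
  obtain ⟨F₁, h₁⟩ := exists_outerExtension hf hi hp hb
  obtain ⟨F, hF0, hF1⟩ := exists_homeomorph_of_extensions h₀ h₁ hb ⟨p, rfl⟩
  have hFf : EqOn F f (sphere 0 1) := (hF0.mono sphere_subset_closedBall).trans h₀.eqOn
  have hcl : IsClosed (sphere (0:ℂ) 1) := isClosed_sphere
  have hfrb : frontier (ball (0:ℂ) 1) ⊆ sphere 0 1 := (frontier_ball 0 one_ne_zero).subset
  have hbu : ball (0:ℂ) 1 ∪ sphere 0 1 = closedBall 0 1 := ball_union_sphere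
  have hev0 : ∀ u ∈ ball (0:ℂ) 1, F u = F₀ u ∧ ∀ᶠ v in 𝓝 u, F v = F₀ v := fun u hu =>
    ⟨hF0 (ball_subset_closedBall hu), by
      filter_upwards [isOpen_ball.mem_nhds hu] with v hv
      exact hF0 (ball_subset_closedBall hv)⟩
  have hev1 : ∀ u : ℂ, 1 < ‖u‖ → F u = F₁ u ∧ ∀ᶠ v in 𝓝 u, F v = F₁ v := fun u hu =>
    ⟨hF1 hu.le, by
      filter_upwards [continuous_norm.continuousAt.eventually_const_lt hu] with v hv
      exact hF1 hv.le⟩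
  have hcase : ∀ u : ℂ, u ∉ sphere (0:ℂ) 1 → u ∈ ball (0:ℂ) 1 ∨ 1 < ‖u‖ := fun u hu => by
    rw [mem_sphere_zero_iff_norm] at hu
    rw [mem_ball_zero_iff]
    exact lt_or_gt_of_ne hu
  have hinv : ∀ {A : ℝ} {u : ℂ}, (∀ᶠ v in 𝓝 u, ‖v - u‖ ≤ A * ‖F v - F u‖) →
      ∀ᶠ w in 𝓝 (F u), ‖F.symm w - F.symm (F u)‖ ≤ A * ‖w - F u‖ := fun {A u} h => by
    have h1 : Tendsto F.symm (𝓝 (F u)) (𝓝 u) := by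
      simpa using F.symm.continuous.continuousAt (x := F u) |>.tendsto
    filter_upwards [h1.eventually h] with w hw
    simpa using hw
  refine ⟨F, hFf, fun L hL hfL => ?_, fun ℓ hℓ hfℓ => ?_⟩
  · have hK : ∀ u ∈ sphere (0:ℂ) 1, ∀ v ∈ sphere (0:ℂ) 1, ‖F u - F v‖ ≤ L * ‖u - v‖ :=
      fun u hu v hv => by
        rw [hFf hu, hFf hv]
        exact hfL u hu v hv
    have hin : ∀ u ∈ ball (0:ℂ) 1, ∀ᶠ v in 𝓝 u, ‖F v - F u‖ ≤ 10 ^ 14 * L * ‖v - u‖ :=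
      fun u hu => by
        filter_upwards [(hev0 u hu).2, h₀.upper L hL hfL u hu] with v hv hv'
        rwa [hv, (hev0 u hu).1]
    have hmono : ∀ {A B x y : ℝ}, A ≤ B → x ≤ A * L * ‖(y : ℂ)‖ → x ≤ B * L * ‖(y : ℂ)‖ :=
      fun hAB hx => hx.trans (by gcongr)
    constructor
    · intro a ha b hb
      refine norm_sub_le_of_pointwise F.continuous hcl hfrb (fun u hu v hv =>
        (hK u hu v hv).trans ?_) (fun u hu _ => hin u hu) (hbu ▸ ha) (hbu ▸ hb)
      refine mul_le_mul_of_nonneg_right ?_ (norm_nonneg _)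
      linarith
    · intro a b
      refine norm_sub_le_of_pointwise F.continuous hcl (V := univ) (by simp) (fun u hu v hv =>
        (hK u hu v hv).trans ?_) (fun u _ hu => ?_) (by simp) (by simp)
      · refine mul_le_mul_of_nonneg_right ?_ (norm_nonneg _)
        linarith
      rcases hcase u hu with h | h
      · filter_upwards [hin u h] with v hv
        refine hv.trans (mul_le_mul_of_nonneg_right ?_ (norm_nonneg _))
        linarith
      · filter_upwards [(hev1 u h).2, h₁.upper L hL hfL u h] with v hv hv'
        rwa [hv, (hev1 u h).1]
  · have hK : ∀ u ∈ F '' sphere (0:ℂ) 1, ∀ v ∈ F '' sphere (0:ℂ) 1,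
        ‖F.symm u - F.symm v‖ ≤ ℓ⁻¹ * ‖u - v‖ := by
      rintro _ ⟨u, hu, rfl⟩ _ ⟨v, hv, rfl⟩
      rw [F.symm_apply_apply, F.symm_apply_apply, hFf hu, hFf hv, ← div_eq_inv_mul,
        le_div_iff₀' hℓ]
      exact hfℓ u hu v hv
    have hclK : IsClosed (F '' sphere (0:ℂ) 1) := F.isClosedMap _ hcl
    have hin : ∀ u ∈ ball (0:ℂ) 1, ∀ᶠ v in 𝓝 u, ‖v - u‖ ≤ 10 ^ 14 / ℓ * ‖F v - F u‖ :=
      fun u hu => by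
        filter_upwards [(hev0 u hu).2, h₀.lower ℓ hℓ hfℓ u hu] with v hv hv'
        rw [hv, (hev0 u hu).1, div_mul_eq_mul_div, le_div_iff₀' hℓ]
        exact hv'
    constructor
    · intro a ha b hb
      have := norm_sub_le_of_pointwise F.symm.continuous hclK (V := F '' ball 0 1)
        (by rw [← F.image_frontier]; exact image_mono hfrb) (C := 10 ^ 14 / ℓ)
        (fun u hu v hv => (hK u hu v hv).trans ?_) ?_ (x := F a) (y := F b)
        (by rw [← image_union, hbu]; exact mem_image_of_mem _ ha)
        (by rw [← image_union, hbu]; exact mem_image_of_mem _ hb)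
      · rwa [F.symm_apply_apply, F.symm_apply_apply, div_mul_eq_mul_div, le_div_iff₀' hℓ] at this
      · refine mul_le_mul_of_nonneg_right ?_ (norm_nonneg _)
        rw [inv_eq_one_div]
        exact div_le_div_of_nonneg_right (by norm_num) hℓ.le
      · rintro _ ⟨u, hu, rfl⟩ -
        exact hinv (hin u hu)
    · intro L hL hfL a b
      have hℓL := lower_le_upper hfℓ hfL
      have hcmp : ∀ {A : ℝ}, 0 ≤ A → A ≤ 10 ^ 25 → A / ℓ ≤ 10 ^ 25 * L / ℓ ^ 2 :=
          fun {A} hA hA' => by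
        rw [div_le_div_iff₀ hℓ (by positivity)]
        calc A * ℓ ^ 2 ≤ 10 ^ 25 * ℓ ^ 2 := by gcongr
          _ = 10 ^ 25 * ℓ * ℓ := by ring
          _ ≤ 10 ^ 25 * L * ℓ := by gcongr
      have := norm_sub_le_of_pointwise F.symm.continuous hclK (V := univ) (by simp)
        (C := 10 ^ 25 * L / ℓ ^ 2) (fun u hu v hv => (hK u hu v hv).trans ?_) ?_ (x := F a)
        (y := F b) (by simp) (by simp)
      · rwa [F.symm_apply_apply, F.symm_apply_apply, div_mul_eq_mul_div,
          le_div_iff₀' (by positivity)] at this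
      · refine mul_le_mul_of_nonneg_right ?_ (norm_nonneg _)
        rw [inv_eq_one_div]
        exact hcmp zero_le_one (by norm_num)
      · intro w _ hw
        obtain ⟨u, rfl⟩ := F.surjective w
        have hu : u ∉ sphere (0:ℂ) 1 := fun h => hw (mem_image_of_mem _ h)
        refine hinv ?_
        rcases hcase u hu with h | h
        · filter_upwards [hin u h] with v hv
          exact hv.trans (mul_le_mul_of_nonneg_right (hcmp (by norm_num) (by norm_num))
            (norm_nonneg _))
        · filter_upwards [(hev1 u h).2, h₁.lower ℓ L hℓ hL hfℓ hfL u h] with v hv hv'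
          rw [hv, (hev1 u h).1, div_mul_eq_mul_div, le_div_iff₀' (by positivity)]
          exact hv'

theorem ofReal_mul_edist {c : ℝ} (hc : 0 ≤ c) (a b : ℂ) :
    ENNReal.ofReal c * edist a b = ENNReal.ofReal (c * ‖a - b‖) := by
  rw [edist_dist, dist_eq_norm, ENNReal.ofReal_mul hc]

theorem edist_eq_ofReal (a b : ℂ) : edist a b = ENNReal.ofReal ‖a - b‖ := by
  rw [edist_dist, dist_eq_norm]

end CircleEmbedding

/-- **Optimal extension of Lipschitz embeddings in the plane** (Kovalev, Theorem 1.1).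
Suppose `f : 𝕋 → ℂ` is an embedding of the unit circle with
`ℓ·|a−b| ≤ |f a − f b| ≤ L·|a−b|` for all `a b ∈ 𝕋`, where `ℓ ∈ [0,∞)` and `L ∈ (0,∞]`
(encoded as extended nonnegative reals with `ℓ ≠ ∞`, `L ≠ 0`).  Then `f` extends to a
homeomorphism `F : ℂ → ℂ` with
`10⁻¹⁴·ℓ·|a−b| ≤ |F a − F b| ≤ 2·10¹⁴·L·|a−b|` on the closed unit disk, and
`10⁻²⁵·(ℓ²/L)·|a−b| ≤ |F a − F b| ≤ 10²⁸·L·|a−b|` on all of `ℂ`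
(with `ℓ²/L = 0` when `L = ∞`). -/
theorem optimal_biLipschitz_extension_of_circle_embedding
    (f : ℂ → ℂ) (ℓ L : ENNReal) (hℓ : ℓ ≠ ⊤) (hL : L ≠ 0)
    (hf_cont : ContinuousOn f (sphere (0:ℂ) 1))
    (hf_inj : InjOn f (sphere (0:ℂ) 1))
    (hbi : ∀ a ∈ sphere (0:ℂ) 1, ∀ b ∈ sphere (0:ℂ) 1,
      ℓ * edist a b ≤ edist (f a) (f b) ∧ edist (f a) (f b) ≤ L * edist a b) :
    ∃ F : ℂ ≃ₜ ℂ, EqOn F f (sphere (0:ℂ) 1) ∧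
      (∀ a ∈ closedBall (0:ℂ) 1, ∀ b ∈ closedBall (0:ℂ) 1,
        ℓ * edist a b / 10 ^ 14 ≤ edist (F a) (F b) ∧
        edist (F a) (F b) ≤ 2 * 10 ^ 14 * L * edist a b) ∧
      (∀ a b : ℂ,
        ℓ ^ 2 / L * edist a b / 10 ^ 25 ≤ edist (F a) (F b) ∧
        edist (F a) (F b) ≤ 10 ^ 28 * L * edist a b) := by
  obtain ⟨F, hF, hup, hlow⟩ := CircleEmbedding.exists_homeomorph_extension hf_cont hf_inj
  have hpow : ∀ n : ℕ, (10:ENNReal) ^ n = ENNReal.ofReal (10 ^ n) := fun n => by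
    rw [ENNReal.ofReal_pow (by norm_num), ENNReal.ofReal_ofNat]
  have hupL : L ≠ ⊤ → (∀ a ∈ sphere (0:ℂ) 1, ∀ b ∈ sphere (0:ℂ) 1,
      ‖f a - f b‖ ≤ L.toReal * ‖a - b‖) := fun hLt a ha b hb => by
    have h := (hbi a ha b hb).2
    rw [← ENNReal.ofReal_toReal hLt, CircleEmbedding.ofReal_mul_edist ENNReal.toReal_nonneg,
      CircleEmbedding.edist_eq_ofReal] at h
    exact (ENNReal.ofReal_le_ofReal_iff (by positivity)).1 h
  have hlowℓ : ∀ a ∈ sphere (0:ℂ) 1, ∀ b ∈ sphere (0:ℂ) 1,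
      ℓ.toReal * ‖a - b‖ ≤ ‖f a - f b‖ := fun a ha b hb => by
    have h := (hbi a ha b hb).1
    rw [← ENNReal.ofReal_toReal hℓ, CircleEmbedding.ofReal_mul_edist ENNReal.toReal_nonneg,
      CircleEmbedding.edist_eq_ofReal] at h
    exact (ENNReal.ofReal_le_ofReal_iff (by positivity)).1 h
  have hpos : L ≠ ⊤ → 0 < L.toReal := fun hLt => ENNReal.toReal_pos hL hLt
  have hupper : ∀ {c : ENNReal} {a b : ℂ}, c ≠ 0 → (L ≠ ⊤ → edist (F a) (F b) ≤ c * L * edist a b) →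
      edist (F a) (F b) ≤ c * L * edist a b := fun {c a b} hc h => by
    rcases eq_or_ne L ⊤ with hLt | hLt
    · rcases eq_or_ne a b with rfl | hab
      · simp
      · rw [hLt, ENNReal.mul_top hc, ENNReal.top_mul (edist_pos.2 hab).ne']
        exact le_top
    · exact h hLt
  refine ⟨F, hF, fun a ha b hb => ⟨?_, hupper (by simp) fun hLt => ?_⟩,
    fun a b => ⟨?_, hupper (by simp) fun hLt => ?_⟩⟩
  · rcases eq_or_ne ℓ 0 with rfl | hℓ0
    · simp
    refine ENNReal.div_le_of_le_mul ?_
    have h := (hlow _ (ENNReal.toReal_pos hℓ0 hℓ) hlowℓ).1 a ha b hb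
    rw [mul_comm (edist _ _), hpow, CircleEmbedding.ofReal_mul_edist (by positivity),
      ← ENNReal.ofReal_toReal hℓ, CircleEmbedding.ofReal_mul_edist ENNReal.toReal_nonneg]
    exact ENNReal.ofReal_le_ofReal h
  · have h := (hup _ (hpos hLt) (hupL hLt)).1 a ha b hb
    refine le_trans ?_ (mul_le_mul_left (mul_le_mul_left (le_mul_of_one_le_left zero_le
      one_le_two) L) _)
    rw [hpow, ← ENNReal.ofReal_toReal hLt, ← ENNReal.ofReal_mul (by positivity),
      CircleEmbedding.ofReal_mul_edist (by positivity), CircleEmbedding.edist_eq_ofReal]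
    exact ENNReal.ofReal_le_ofReal h
  · rcases eq_or_ne L ⊤ with rfl | hLt
    · simp
    rcases eq_or_ne ℓ 0 with rfl | hℓ0
    · simp
    refine ENNReal.div_le_of_le_mul ?_
    rw [← ENNReal.mul_div_right_comm]
    refine ENNReal.div_le_of_le_mul ?_
    have h := (hlow _ (ENNReal.toReal_pos hℓ0 hℓ) hlowℓ).2 _ (hpos hLt) (hupL hLt) a b
    rw [mul_assoc, mul_comm (edist _ _), hpow, ← ENNReal.ofReal_toReal hℓ,
      ← ENNReal.ofReal_toReal hLt, ← ENNReal.ofReal_mul (by positivity),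
      ← ENNReal.ofReal_pow ENNReal.toReal_nonneg, CircleEmbedding.ofReal_mul_edist (by positivity),
      CircleEmbedding.ofReal_mul_edist (by positivity)]
    exact ENNReal.ofReal_le_ofReal h
  · have h := (hup _ (hpos hLt) (hupL hLt)).2 a b
    rw [hpow, ← ENNReal.ofReal_toReal hLt, ← ENNReal.ofReal_mul (by positivity),
      CircleEmbedding.ofReal_mul_edist (by positivity), CircleEmbedding.edist_eq_ofReal]
    exact ENNReal.ofReal_le_ofReal h
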